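/- C^{2,α} bound for the difference of nearby solutions (part of Proposition 5.1): there exist constants ε₁ ∈ (0,1), α ∈ (0,1) and C > 0 depending only on n such that the following holds. Let u₁, u₂ be classical solutions of the one-phase free boundary problem in the open unit ball B₁ satisfying (x_n − ε₁)⁺ ≤ u₁(x) ≤ u₂(x) ≤ (x_n + ε₁)⁺ for all x ∈ B₁, where x_n is the last coordinate, and set v := u₂ − u₁ and M := sup_{B₁} |v|. Then v is twice continuously differentiable on B_{1/2} ∩ {u₁ > 0} and, for all x, y ∈ B_{1/2} ∩ {u₁ > 0} with x ≠ y: |v(x)| ≤ C·M, ‖Dv(x)‖ ≤ C·M, ‖D²v(x)‖ ≤ C·M, and ‖D²v(x) − D²v(y)‖ ≤ C·M·‖x − y‖^α. -/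

import Mathlib

open MeasureTheory Metric Set Filter ENNReal NNReal

/-- The Euclidean Laplacian: the sum of the second partial derivatives. -/
noncomputable def lap {n : ℕ} (u : EuclideanSpace ℝ (Fin n) → ℝ)
    (x : EuclideanSpace ℝ (Fin n)) : ℝ :=
  ∑ i : Fin n,
    fderiv ℝ (fun y => fderiv ℝ u y (EuclideanSpace.single i 1)) x (EuclideanSpace.single i 1)

/-- A classical solution of the one-phase free boundary problem in the open unit ball:
continuous and nonnegative on `B₁`, harmonic (smooth with vanishing Laplacian) on
`B₁ ∩ {u > 0}`, and the gradient extends continuously to `B₁ ∩ closure {u > 0}` with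
norm `1` on the free boundary `B₁ ∩ ∂{u > 0}`. -/
def OnePhaseSolution {n : ℕ} (u : EuclideanSpace ℝ (Fin n) → ℝ) : Prop :=
  ContinuousOn u (Metric.ball (0 : EuclideanSpace ℝ (Fin n)) 1) ∧
  (∀ x ∈ Metric.ball (0 : EuclideanSpace ℝ (Fin n)) 1, 0 ≤ u x) ∧
  ContDiffOn ℝ (⊤ : ℕ∞) u (Metric.ball (0 : EuclideanSpace ℝ (Fin n)) 1 ∩ {x | 0 < u x}) ∧
  (∀ x ∈ Metric.ball (0 : EuclideanSpace ℝ (Fin n)) 1 ∩ {x | 0 < u x}, lap u x = 0) ∧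
  ∃ G : EuclideanSpace ℝ (Fin n) → EuclideanSpace ℝ (Fin n),
    ContinuousOn G (Metric.ball (0 : EuclideanSpace ℝ (Fin n)) 1 ∩ closure {x | 0 < u x}) ∧
    (∀ x ∈ Metric.ball (0 : EuclideanSpace ℝ (Fin n)) 1 ∩ {x | 0 < u x}, G x = gradient u x) ∧
    (∀ x ∈ Metric.ball (0 : EuclideanSpace ℝ (Fin n)) 1 ∩ frontier {x | 0 < u x}, ‖G x‖ = 1)

set_option linter.unusedSectionVars false
set_option linter.unusedSimpArgs false
set_option linter.unusedVariables false
set_option linter.style.longLine false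

namespace OP
open scoped RealInnerProductSpace Topology
open Module

section M0
variable {E : Type*} [NormedAddCommGroup E] [InnerProductSpace ℝ E] [FiniteDimensional ℝ E]
  [MeasurableSpace E] [BorelSpace E]

/-- bump -/
noncomputable def bump (z : E) : ℝ := expNegInvGlue (1 - ‖z‖ ^ 2)

/-- weight: `∇ bump z = - rho z • z` -/
noncomputable def rho (z : E) : ℝ := 2 * deriv expNegInvGlue (1 - ‖z‖ ^ 2)

lemma bump_contDiff : ContDiff ℝ 3 (bump : E → ℝ) := by
  unfold bump
  exact (expNegInvGlue.contDiff (n := 3)).comp (contDiff_const.sub (contDiff_norm_sq ℝ))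

lemma rho_contDiff : ContDiff ℝ 3 (rho : E → ℝ) := by
  unfold rho
  have h : ContDiff ℝ 3 (deriv expNegInvGlue) := by
    have := (contDiff_succ_iff_deriv (n := 3) (f := expNegInvGlue) (𝕜 := ℝ)).1
      expNegInvGlue.contDiff
    exact this.2.2
  exact contDiff_const.mul (h.comp (contDiff_const.sub (contDiff_norm_sq ℝ)))

lemma rho_nonneg (z : E) : 0 ≤ rho z := by
  unfold rho
  have : 0 ≤ deriv expNegInvGlue (1 - ‖z‖ ^ 2) := expNegInvGlue.monotone.deriv_nonneg
  positivity

lemma glue_deriv_nonpos {t : ℝ} (ht : t ≤ 0) : deriv expNegInvGlue t = 0 := by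
  have h1 : IsLocalMin expNegInvGlue t := by
    filter_upwards with s
    rw [expNegInvGlue.zero_of_nonpos ht]
    exact expNegInvGlue.nonneg s
  exact h1.deriv_eq_zero

lemma rho_zero {z : E} (hz : 1 ≤ ‖z‖) : rho z = 0 := by
  unfold rho
  rw [glue_deriv_nonpos (by nlinarith), mul_zero]

lemma bump_zero {z : E} (hz : 1 ≤ ‖z‖) : bump z = 0 :=
  expNegInvGlue.zero_of_nonpos (by nlinarith)

lemma hasGradientAt_bump [CompleteSpace E] (z : E) : HasGradientAt bump (-(rho z) • z) z := by
  have h1 : HasFDerivAt (fun z : E => 1 - ‖z‖ ^ 2) (-(2 • (innerSL ℝ z))) z := by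
    have := (hasStrictFDerivAt_norm_sq z).hasFDerivAt
    simpa using this.const_sub 1
  have h2 : HasDerivAt expNegInvGlue (deriv expNegInvGlue (1 - ‖z‖ ^ 2)) (1 - ‖z‖ ^ 2) :=
    ((expNegInvGlue.contDiff (n := 1)).differentiable (by norm_num)).differentiableAt.hasDerivAt
  have h3 := h2.comp_hasFDerivAt z h1
  rw [hasGradientAt_iff_hasFDerivAt]
  refine h3.congr_fderiv ?_
  ext y
  simp [rho]
  ring

lemma bump_support : Function.support (bump : E → ℝ) ⊆ closedBall 0 1 := by
  intro z hz
  by_contra h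
  simp only [mem_closedBall, dist_zero_right, not_le] at h
  exact hz (bump_zero h.le)

lemma rho_support : Function.support (rho : E → ℝ) ⊆ closedBall 0 1 := by
  intro z hz
  by_contra h
  simp only [mem_closedBall, dist_zero_right, not_le] at h
  exact hz (rho_zero h.le)

lemma rho_compact : HasCompactSupport (rho : E → ℝ) :=
  HasCompactSupport.of_support_subset_isCompact (isCompact_closedBall 0 1) rho_support

lemma bump_compact : HasCompactSupport (bump : E → ℝ) :=
  HasCompactSupport.of_support_subset_isCompact (isCompact_closedBall 0 1) bump_support

lemma rho_cont : Continuous (rho : E → ℝ) := rho_contDiff.continuous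

lemma rho_int : Integrable (rho : E → ℝ) := rho_cont.integrable_of_hasCompactSupport rho_compact

variable (E) in
/-- total mass -/
noncomputable def c0 : ℝ := ∫ z : E, rho z

lemma c0_pos [Nontrivial E] : 0 < c0 E := by
  unfold c0
  obtain ⟨t, ht, htd⟩ : ∃ t ∈ Ioo (0 : ℝ) 1, deriv expNegInvGlue t =
      (expNegInvGlue 1 - expNegInvGlue 0) / (1 - 0) :=
    exists_deriv_eq_slope _ zero_lt_one
      (expNegInvGlue.contDiff (n := 1)).continuous.continuousOn
      ((expNegInvGlue.contDiff (n := 1)).differentiable (by norm_num)).differentiableOn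
  obtain ⟨z, hz⟩ := exists_norm_eq E (Real.sqrt_nonneg (1 - t))
  have hpos : rho z ≠ 0 := by
    unfold rho
    rw [hz, Real.sq_sqrt (by linarith [ht.2]), _root_.sub_sub_cancel, htd, expNegInvGlue.zero_of_nonpos le_rfl]
    have := expNegInvGlue.pos_of_pos (x := 1) one_pos
    simp; try exact this.ne'
  exact rho_cont.integral_pos_of_hasCompactSupport_nonneg_nonzero rho_compact rho_nonneg hpos

/-- averaged function -/
noncomputable def avg (V : E → ℝ) (t : ℝ) (x : E) : ℝ := ∫ z, V (x + t • z) * rho z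

lemma avg_int {V : E → ℝ} (hV : Continuous V) (t : ℝ) (x : E) :
    Integrable (fun z => V (x + t • z) * rho z) := by
  refine Continuous.integrable_of_hasCompactSupport ?_ rho_compact.mul_left
  exact (hV.comp (by fun_prop)).mul rho_cont

lemma avg_zero (V : E → ℝ) (x : E) : avg V 0 x = c0 E * V x := by
  simp [avg, c0, integral_const_mul, mul_comm]

lemma hasDerivAt_avg {V : E → ℝ} {K : ℝ≥0} (hV : LipschitzWith K V) (x : E) {t : ℝ} (ht : t ≠ 0) :
    HasDerivAt (fun t => avg V t x) (∫ z, fderiv ℝ V (x + t • z) z * rho z) t := by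
  unfold avg
  refine (hasDerivAt_integral_of_dominated_loc_of_lip (s := univ)
    (bound := fun z => K * ‖z‖ * rho z) univ_mem ?_ (avg_int hV.continuous t x) ?_ ?_ ?_ ?_).2
  · exact Eventually.of_forall fun s => (avg_int hV.continuous s x).aestronglyMeasurable
  · apply Measurable.aestronglyMeasurable
    refine Measurable.mul ?_ rho_cont.measurable
    have h1 : Measurable (fun z => fderiv ℝ V (x + t • z)) :=
      (measurable_fderiv ℝ V).comp (by fun_prop)
    exact (ContinuousLinearMap.measurable_apply₂ (𝕜 := ℝ) (E := E) (F := ℝ)).comp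
      (h1.prodMk measurable_id)
  · refine Eventually.of_forall fun z => LipschitzOnWith.of_dist_le_mul fun s _ s' _ => ?_
    rw [Real.coe_nnabs, abs_of_nonneg (by have := rho_nonneg z; positivity), Real.dist_eq, ← sub_mul, abs_mul,
      abs_of_nonneg (rho_nonneg z), mul_right_comm]
    gcongr
    · exact rho_nonneg z
    have := hV.dist_le_mul (x + s • z) (x + s' • z)
    rw [Real.dist_eq, dist_add_left, dist_eq_norm, ← sub_smul, norm_smul] at this
    rw [Real.dist_eq]
    calc _ ≤ _ := this
      _ = _ := by rw [Real.norm_eq_abs]; ring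
  · refine Continuous.integrable_of_hasCompactSupport ?_ rho_compact.mul_left
    exact (by fun_prop : Continuous fun z : E => (K:ℝ) * ‖z‖).mul rho_cont
  · have h1 : ∀ᵐ y, DifferentiableAt ℝ V y := hV.ae_differentiableAt
    have h2 : ∀ᵐ z, DifferentiableAt ℝ V (x + t • z) := by
      have hq : Measure.QuasiMeasurePreserving (fun z : E => x + t • z) volume volume := by
        refine ⟨by fun_prop, ?_⟩
        have : (fun z : E => x + t • z) = (fun y => x + y) ∘ (fun z => t • z) := rfl
        rw [this, ← Measure.map_map (by fun_prop) (by fun_prop), Measure.map_addHaar_smul _ ht,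
          Measure.map_smul, map_add_left_eq_self]
        exact Measure.smul_absolutelyContinuous
      exact hq.ae h1
    filter_upwards [h2] with z hz
    have h3 : HasDerivAt (fun s : ℝ => x + s • z) z t := by
      simpa using ((hasDerivAt_id t).smul_const z).const_add x
    exact (hz.hasFDerivAt.comp_hasDerivAt t h3).mul_const _

lemma avg_bound {V : E → ℝ} {K : ℝ≥0} (hV : LipschitzWith K V) (x : E) {s T β : ℝ} (hs : 0 ≤ s)
    (hT : s ≤ T) (hb : ∀ t ∈ Ioo s T, |∫ z, fderiv ℝ V (x + t • z) z * rho z| ≤ β) :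
    |avg V T x - avg V s x| ≤ β * (T - s) := by
  have hc : Continuous (fun t => avg V t x) := by
    unfold avg
    have hKi : Integrable (fun z : E => K * ‖z‖ * rho z) := by
      refine Continuous.integrable_of_hasCompactSupport ?_ rho_compact.mul_left
      exact (by fun_prop : Continuous fun z : E => (K:ℝ) * ‖z‖).mul rho_cont
    rw [continuous_iff_continuousAt]
    intro t0
    refine continuousAt_of_dominated (bound := fun z => |V (x + t0 • z) * rho z| + K * ‖z‖ * rho z)
      (Eventually.of_forall fun s => (avg_int hV.continuous s x).aestronglyMeasurable) ?_
      ((avg_int hV.continuous t0 x).abs.add hKi) ?_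
    · filter_upwards [Metric.ball_mem_nhds t0 one_pos] with t ht
      refine Eventually.of_forall fun z => ?_
      have h1 := hV.dist_le_mul (x + t • z) (x + t0 • z)
      rw [Real.dist_eq, dist_add_left, dist_eq_norm, ← sub_smul, norm_smul] at h1
      rw [mem_ball, dist_eq_norm] at ht
      have h2 : |V (x + t • z)| ≤ |V (x + t0 • z)| + K * ‖z‖ := by
        have h4 : (K:ℝ) * (‖t - t0‖ * ‖z‖) ≤ K * ‖z‖ := by
          gcongr
          exact mul_le_of_le_one_left (norm_nonneg _) ht.le
        have := abs_sub_abs_le_abs_sub (V (x + t • z)) (V (x + t0 • z))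
        linarith
      rw [Real.norm_eq_abs, abs_mul, abs_mul, abs_of_nonneg (rho_nonneg z), ← add_mul]
      exact mul_le_mul_of_nonneg_right h2 (rho_nonneg z)
    · refine Eventually.of_forall fun z => ContinuousAt.mul ?_ continuousAt_const
      exact (hV.continuous.comp (by fun_prop : Continuous fun t : ℝ => x + t • z)).continuousAt
  rcases hT.eq_or_lt with rfl | hT'
  · simp
  obtain ⟨c, hc1, hc2⟩ := exists_hasDerivAt_eq_slope (fun t => avg V t x) _ hT' hc.continuousOn
    (fun t ht => hasDerivAt_avg hV x (by linarith [ht.1]))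
  have := hb c hc1
  rw [hc2, abs_div, abs_of_pos (sub_pos.2 hT'), div_le_iff₀ (sub_pos.2 hT')] at this
  exact this

end M0
end OP

namespace OP
open scoped RealInnerProductSpace Topology
open Module

section M0b
variable {E : Type*} [NormedAddCommGroup E] [InnerProductSpace ℝ E] [FiniteDimensional ℝ E]
  [MeasurableSpace E] [BorelSpace E]

variable (E) in
lemma rho_taylor : ∃ C : ℝ, 0 < C ∧ (∀ w k : E, |rho (w - k) - rho w| ≤ C * ‖k‖) ∧
    (∀ w k : E, |rho (w - k) - rho w + fderiv ℝ rho w k| ≤ C * ‖k‖ ^ 2) ∧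
    (∀ w : E, ‖fderiv ℝ rho w‖ ≤ C) := by
  have h1 : ContDiff ℝ 1 (rho : E → ℝ) := rho_contDiff.of_le (by norm_num)
  obtain ⟨C1, hC1⟩ := h1.lipschitzWith_of_hasCompactSupport rho_compact (by norm_num)
  have h2 : ContDiff ℝ 1 (fderiv ℝ (rho : E → ℝ)) := rho_contDiff.fderiv_right (by norm_num)
  have h2c : HasCompactSupport (fderiv ℝ (fderiv ℝ (rho : E → ℝ))) :=
    (rho_compact.fderiv (𝕜 := ℝ)).fderiv (𝕜 := ℝ)
  obtain ⟨C2', hC2'⟩ := (h2.continuous_fderiv (by norm_num)).bounded_above_of_compact_support h2c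
  obtain ⟨C2, hC2⟩ : ∃ C2 : ℝ≥0, LipschitzWith C2 (fderiv ℝ (rho : E → ℝ)) :=
    ⟨C2'.toNNReal, lipschitzWith_of_nnnorm_fderiv_le (𝕜 := ℝ) (h2.differentiable (by norm_num))
      fun x => by
        rw [← NNReal.coe_le_coe]
        exact (hC2' x).trans (Real.le_coe_toNNReal _)⟩
  have hd : ∀ w : E, DifferentiableAt ℝ (rho : E → ℝ) w := fun w =>
    (rho_contDiff.differentiable (by norm_num)).differentiableAt
  refine ⟨C1 + C2 + 1, by positivity, fun w k => ?_, fun w k => ?_, fun w => ?_⟩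
  · have := hC1.dist_le_mul (w - k) w
    rw [Real.dist_eq, dist_eq_norm] at this
    have e : w - k - w = -k := by abel
    rw [e, norm_neg] at this
    refine this.trans ?_
    gcongr
    have : (0:ℝ) ≤ C2 := C2.2
    linarith
  · have key := (convex_closedBall (0:E) ‖k‖).norm_image_sub_le_of_norm_hasFDerivWithin_le
      (f := fun k => rho (w - k) + fderiv ℝ rho w k)
      (f' := fun k => -(fderiv ℝ rho (w - k)) + fderiv ℝ rho w) (C := C2 * ‖k‖) (x := 0) (y := k)
      (fun y hy => by
        have ha : HasFDerivAt (fun k : E => w - k) (-(ContinuousLinearMap.id ℝ E)) y :=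
          (hasFDerivAt_id y).const_sub w
        have hb := ((hd (w - y)).hasFDerivAt.comp y ha).add (fderiv ℝ rho w).hasFDerivAt
        refine (hb.congr_fderiv ?_).hasFDerivWithinAt
        ext z; simp)
      (fun y hy => by
        have := hC2.dist_le_mul w (w - y)
        rw [dist_eq_norm, dist_eq_norm] at this
        rw [neg_add_eq_sub]
        refine this.trans ?_
        rw [_root_.sub_sub_cancel]
        have := mem_closedBall_zero_iff.1 hy
        gcongr)
      (mem_closedBall_self (norm_nonneg _)) (by simp)
    simp only [sub_zero, map_zero, add_zero, Real.norm_eq_abs] at key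
    have e : rho (w - k) - rho w + fderiv ℝ rho w k = rho (w - k) + fderiv ℝ rho w k - rho w := by ring
    rw [e]
    refine key.trans ?_
    have : (0:ℝ) ≤ C1 := C1.2
    nlinarith [sq_nonneg ‖k‖]
  · have := norm_fderiv_le_of_lipschitz ℝ hC1 (x₀ := w)
    have : (0:ℝ) ≤ C2 := C2.2
    linarith

lemma avg_shift (V : E → ℝ) {t : ℝ} (ht : 0 < t) (x h : E) :
    avg V t (x + h) = ∫ w, V (x + t • w) * rho (w - t⁻¹ • h) := by
  unfold avg
  rw [← integral_sub_right_eq_self (fun z => V (x + h + t • z) * rho z) (t⁻¹ • h)]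
  congr 1
  ext w
  congr 2
  rw [smul_sub, smul_smul, mul_inv_cancel₀ ht.ne', one_smul]
  abel

variable (E) in
/-- regularity of averages -/
lemma avg_reg : ∃ C : ℝ, 0 < C ∧ ∀ (V : E → ℝ) (t m : ℝ) (x : E), Continuous V → 0 < t →
    (∀ y ∈ closedBall x (2 * t), |V y| ≤ m) →
    (|avg V t x| ≤ C * m) ∧
    (∀ h : E, ‖h‖ ≤ t → |avg V t (x + h) - avg V t x| ≤ C * m * (‖h‖ / t)) ∧
    ∃ b : E, ‖b‖ ≤ C * m / t ∧
      ∀ h : E, ‖h‖ ≤ t → |avg V t (x + h) - avg V t x - ⟪b, h⟫| ≤ C * m * (‖h‖ / t) ^ 2 := by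
  obtain ⟨C, hC, h1, h2, h3⟩ := rho_taylor E
  set v := (volume (closedBall (0:E) 2)).toReal with hv
  have hv0 : 0 ≤ v := ENNReal.toReal_nonneg
  have hvfin : volume (closedBall (0:E) 2) ≠ ⊤ := measure_closedBall_lt_top.ne
  refine ⟨C * (v + 1) + (c0 E + 1), ?_, ?_⟩
  · have : 0 ≤ c0 E := integral_nonneg rho_nonneg
    positivity
  intro V t m x hV ht hm
  have hc00 : 0 ≤ c0 E := integral_nonneg rho_nonneg
  have hm0 : 0 ≤ m := (abs_nonneg _).trans (hm x (mem_closedBall_self (by positivity)))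
  -- integral bound
  have key : ∀ (f : E → ℝ) (B : ℝ), 0 ≤ B → (∀ w, |f w| ≤ B) → (∀ w, 2 < ‖w‖ → f w = 0) →
      |∫ w, V (x + t • w) * f w| ≤ m * B * v := by
    intro f B hB hf hf0
    have : ∫ w, V (x + t • w) * f w = ∫ w in closedBall (0:E) 2, V (x + t • w) * f w := by
      rw [setIntegral_eq_integral_of_forall_compl_eq_zero]
      intro w hw
      rw [hf0 w (by simpa using hw), mul_zero]
    rw [this, ← Real.norm_eq_abs]
    have := norm_setIntegral_le_of_norm_le_const (μ := volume) (s := closedBall (0:E) 2)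
      (f := fun w => V (x + t • w) * f w) (C := m * B) measure_closedBall_lt_top (fun w hw => by
        rw [norm_mul]
        gcongr
        · refine hm _ ?_
          rw [mem_closedBall, dist_eq_norm, add_sub_cancel_left, norm_smul, Real.norm_of_nonneg ht.le,
            mul_comm]
          gcongr
          simpa using hw
        · exact hf w)
    exact this
  have hsh : ∀ h : E, ‖h‖ ≤ t → ‖t⁻¹ • h‖ = ‖h‖ / t ∧ ‖t⁻¹ • h‖ ≤ 1 := by
    intro h hh
    have : ‖t⁻¹ • h‖ = ‖h‖ / t := by
      rw [norm_smul, norm_inv, Real.norm_of_nonneg ht.le]; ring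
    exact ⟨this, by rw [this, div_le_one ht]; exact hh⟩
  have hz : ∀ w k : E, ‖k‖ ≤ 1 → 2 < ‖w‖ → rho (w - k) = 0 := by
    intro w k hk hw
    refine rho_zero ?_
    have := norm_sub_norm_le w k
    linarith
  have hz' : ∀ w : E, 2 < ‖w‖ → fderiv ℝ rho w = 0 := by
    intro w hw
    have : (rho : E → ℝ) =ᶠ[𝓝 w] fun _ => 0 := by
      filter_upwards [(isOpen_lt continuous_const continuous_norm).mem_nhds hw] with y hy
      exact rho_zero (by linarith [show (2:ℝ) < ‖y‖ from hy])
    rw [this.fderiv_eq]; simp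
  have hitg : ∀ k : E, Integrable (fun w => V (x + t • w) * rho (w - k)) := by
    intro k
    refine Continuous.integrable_of_hasCompactSupport ?_ ?_
    · exact (hV.comp (by fun_prop)).mul (rho_cont.comp (by fun_prop))
    · exact HasCompactSupport.mul_left (rho_compact.comp_homeomorph (Homeomorph.subRight k))
  have hint0 : Integrable (fun w => V (x + t • w) * rho w) := avg_int hV t x
  have hcd : Continuous (fderiv ℝ (rho : E → ℝ)) := rho_contDiff.continuous_fderiv (by norm_num)
  have hintd : ∀ k : E, Integrable (fun w => V (x + t • w) * fderiv ℝ rho w k) := by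
    intro k
    refine Continuous.integrable_of_hasCompactSupport ?_ ?_
    · exact (hV.comp (by fun_prop)).mul (hcd.clm_apply continuous_const)
    · refine HasCompactSupport.mul_left (f := fun w => V (x + t • w)) ?_
      exact HasCompactSupport.comp_left (g := fun L : E →L[ℝ] ℝ => L k)
        (rho_compact.fderiv (𝕜 := ℝ)) (by simp)
  refine ⟨?_, fun h hh => ?_, ?_⟩
  · have : |avg V t x| ≤ m * c0 E := by
      unfold avg c0
      rw [← integral_const_mul, ← Real.norm_eq_abs]
      refine norm_integral_le_of_norm_le (rho_int.const_mul m) (Eventually.of_forall fun z => ?_)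
      rw [norm_mul, Real.norm_of_nonneg (rho_nonneg z)]
      by_cases hz : 1 ≤ ‖z‖
      · simp [rho_zero hz]
      · refine mul_le_mul_of_nonneg_right (hm _ ?_) (rho_nonneg z)
        rw [mem_closedBall, dist_eq_norm, add_sub_cancel_left, norm_smul, Real.norm_of_nonneg ht.le]
        nlinarith
    refine this.trans ?_
    rw [mul_comm]
    gcongr
    nlinarith [mul_nonneg hC.le hv0]
  · obtain ⟨e1, e2⟩ := hsh h hh
    rw [avg_shift V ht]
    unfold avg
    rw [← integral_sub (hitg _) hint0]
    have := key (fun w => rho (w - t⁻¹ • h) - rho w) (C * (‖h‖ / t)) (by positivity)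
      (fun w => by rw [← e1]; exact h1 w _)
      (fun w hw => by rw [hz w _ e2 hw, rho_zero (by linarith), sub_zero])
    simp only [mul_sub] at this
    refine this.trans ?_
    have h5 : m * (C * (‖h‖ / t)) * v = C * v * m * (‖h‖ / t) := by ring
    rw [h5]
    gcongr
    nlinarith
  · have hdm : Integrable (fun w => V (x + t • w) • fderiv ℝ rho w) := by
      have hc1 : Continuous fun w => V (x + t • w) := hV.comp (by fun_prop)
      have hc2 : Continuous fun w => V (x + t • w) • fderiv ℝ rho w := hc1.smul hcd
      have hc3 : HasCompactSupport (fun w => V (x + t • w) • fderiv ℝ rho w) := by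
        have := rho_compact.fderiv (𝕜 := ℝ) (E := E)
        refine this.mono ?_
        intro w hw hw'
        apply hw
        show V (x + t • w) • fderiv ℝ rho w = 0
        rw [hw', smul_zero]
      exact hc2.integrable_of_hasCompactSupport hc3
    set L : E →L[ℝ] ℝ := ∫ w, V (x + t • w) • fderiv ℝ rho w with hL
    have hLa : ∀ k, L k = ∫ w, V (x + t • w) * fderiv ℝ rho w k := by
      intro k
      rw [hL, ContinuousLinearMap.integral_apply hdm]
      rfl
    set b : E := -(t⁻¹ • (InnerProductSpace.toDual ℝ E).symm L) with hb
    have hbi : ∀ h, ⟪b, h⟫ = -L (t⁻¹ • h) := by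
      intro h
      rw [hb, inner_neg_left, real_inner_smul_left, InnerProductSpace.toDual_symm_apply, map_smul]
      rfl
    refine ⟨b, ?_, fun h hh => ?_⟩
    · have hLn : ‖L‖ ≤ m * C * v := by
        refine ContinuousLinearMap.opNorm_le_bound _ (by positivity) fun k => ?_
        rw [hLa, Real.norm_eq_abs]
        have := key (fun w => fderiv ℝ rho w k) (C * ‖k‖) (by positivity)
          (fun w => ((fderiv ℝ rho w).le_opNorm k).trans (by gcongr; exact h3 w))
          (fun w hw => by rw [hz' w hw]; rfl)
        linarith
      rw [hb, norm_neg, norm_smul, LinearIsometryEquiv.norm_map, norm_inv, Real.norm_of_nonneg ht.le,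
        inv_mul_eq_div]
      gcongr
      refine hLn.trans ?_
      have : m * C * v = (C * v) * m := by ring
      rw [this]
      gcongr
      nlinarith
    · obtain ⟨e1, e2⟩ := hsh h hh
      rw [hbi, hLa, avg_shift V ht]
      unfold avg
      have hI : Integrable fun w => V (x + t • w) * rho (w - t⁻¹ • h) - V (x + t • w) * rho w :=
        (hitg _).sub hint0
      rw [sub_neg_eq_add, ← integral_sub (hitg _) hint0, ← integral_add hI (hintd _)]
      have := key (fun w => rho (w - t⁻¹ • h) - rho w + fderiv ℝ rho w (t⁻¹ • h))
        (C * (‖h‖ / t) ^ 2) (by positivity) (fun w => by rw [← e1]; exact h2 w _)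
        (fun w hw => by rw [hz w _ e2 hw, rho_zero (by linarith), hz' w hw]; simp)
      simp only [mul_add, mul_sub] at this
      refine this.trans ?_
      have h5 : m * (C * (‖h‖ / t) ^ 2) * v = C * v * m * (‖h‖ / t) ^ 2 := by ring
      rw [h5]
      gcongr
      nlinarith

/-- divergence theorem for compactly supported C¹ fields -/
lemma integral_div_eq_zero {Z : E → E} (hZ : ContDiff ℝ 1 Z) (hc : HasCompactSupport Z) :
    ∫ y, LinearMap.trace ℝ E (fderiv ℝ Z y : E →ₗ[ℝ] E) = 0 := by
  set b := stdOrthonormalBasis ℝ E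
  have hd : ∀ y, DifferentiableAt ℝ Z y := fun y => (hZ.differentiable (by norm_num)).differentiableAt
  have hcd : Continuous (fderiv ℝ Z) := hZ.continuous_fderiv (by norm_num)
  have h1 : ∀ y, LinearMap.trace ℝ E (fderiv ℝ Z y : E →ₗ[ℝ] E) =
      ∑ i, fderiv ℝ (fun y => ⟪b i, Z y⟫) y (b i) := by
    intro y
    rw [LinearMap.trace_eq_sum_inner _ b]
    refine Finset.sum_congr rfl fun i _ => ?_
    have := ((innerSL ℝ (b i)).hasFDerivAt.comp y (hd y).hasFDerivAt).fderiv
    have h2 : (fun y => ⟪b i, Z y⟫) = (innerSL ℝ (b i)) ∘ Z := rfl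
    rw [h2, this]
    simp
  have h3 : ∀ i, ContDiff ℝ 1 (fun y => ⟪b i, Z y⟫) := fun i => contDiff_const.inner ℝ hZ
  have hcs : ∀ i, HasCompactSupport (fun y => ⟪b i, Z y⟫) := fun i =>
    hc.comp_left (g := fun z => ⟪b i, z⟫) (by simp)
  have hcs' : ∀ i, HasCompactSupport (fun y => fderiv ℝ (fun y => ⟪b i, Z y⟫) y (b i)) := fun i =>
    ((hcs i).fderiv (𝕜 := ℝ)).comp_left (g := fun L : E →L[ℝ] ℝ => L (b i)) (by simp)
  have hco : ∀ i, Continuous (fun y => fderiv ℝ (fun y => ⟪b i, Z y⟫) y (b i)) := fun i =>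
    ((h3 i).continuous_fderiv (by norm_num)).clm_apply continuous_const
  have hin : ∀ i, Integrable (fun y => fderiv ℝ (fun y => ⟪b i, Z y⟫) y (b i)) := fun i =>
    (hco i).integrable_of_hasCompactSupport (hcs' i)
  simp_rw [h1]
  rw [integral_finsetSum _ (fun i _ => hin i)]
  refine Finset.sum_eq_zero fun i _ => ?_
  have := integral_mul_fderiv_eq_neg_fderiv_mul_of_integrable (μ := (volume : Measure E)) (𝕜 := ℝ)
    (f := fun _ => 1) (g := fun y => ⟪b i, Z y⟫) (v := b i) (by simp) (by simpa using hin i)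
    (by simpa using (h3 i).continuous.integrable_of_hasCompactSupport (hcs i))
    (fun _ _ => differentiableAt_const _)
    (fun y _ => ((h3 i).differentiable (by norm_num)).differentiableAt)
  simpa using this

end M0b
end OP

namespace OP
open scoped RealInnerProductSpace Topology
open Module

section M0c
variable {E : Type*} [NormedAddCommGroup E] [InnerProductSpace ℝ E] [FiniteDimensional ℝ E]
  [MeasurableSpace E] [BorelSpace E]

/-- trace of a continuous linear endomorphism -/
noncomputable def tr (B : E →L[ℝ] E) : ℝ := LinearMap.trace ℝ E (B : E →ₗ[ℝ] E)

lemma tr_add (A B : E →L[ℝ] E) : tr (A + B) = tr A + tr B := by simp [tr]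
lemma tr_smul (c : ℝ) (B : E →L[ℝ] E) : tr (c • B) = c * tr B := by simp [tr]
lemma tr_sub (A B : E →L[ℝ] E) : tr (A - B) = tr A - tr B := by simp [tr]
lemma tr_neg (B : E →L[ℝ] E) : tr (-B) = - tr B := by simp [tr]
lemma tr_zero : tr (0 : E →L[ℝ] E) = 0 := by simp [tr]
lemma tr_id : tr (ContinuousLinearMap.id ℝ E) = finrank ℝ E := by
  simp [tr]
lemma tr_smulRight (f : E →L[ℝ] ℝ) (a : E) : tr (f.smulRight a) = f a := by
  have : ((f.smulRight a : E →L[ℝ] E) : E →ₗ[ℝ] E) = (f : E →ₗ[ℝ] ℝ).smulRight a := rfl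
  rw [tr, this, LinearMap.trace_smulRight]; rfl
lemma tr_eq_sum {ι : Type*} [Fintype ι] (b : OrthonormalBasis ι ℝ E) (B : E →L[ℝ] E) :
    tr B = ∑ i, ⟪b i, B (b i)⟫ := LinearMap.trace_eq_sum_inner _ b

/-- the trace as a continuous linear map -/
noncomputable def trL (E : Type*) [NormedAddCommGroup E] [InnerProductSpace ℝ E] [FiniteDimensional ℝ E] :
    (E →L[ℝ] E) →L[ℝ] ℝ :=
  LinearMap.toContinuousLinearMap
    ({ toFun := fun B => LinearMap.trace ℝ E (B : E →ₗ[ℝ] E)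
       map_add' := by intro a b; simp
       map_smul' := by intro a b; simp } : (E →L[ℝ] E) →ₗ[ℝ] ℝ)

lemma trL_apply (B : E →L[ℝ] E) : trL E B = tr B := rfl

/-- h is twice differentiable at x with gradient field g and hessian B -/
def D2 (h : E → ℝ) (g : E → E) (B : E →L[ℝ] E) (x : E) : Prop :=
  (∀ᶠ y in 𝓝 x, HasGradientAt h (g y) y) ∧ HasFDerivAt g B x

lemma hasGradientAt_iff {h : E → ℝ} {a x : E} :
    HasGradientAt h a x ↔ HasFDerivAt h (innerSL ℝ a) x := Iff.rfl

lemma D2.add {h h' : E → ℝ} {g g' : E → E} {B B' : E →L[ℝ] E} {x : E} (H : D2 h g B x)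
    (H' : D2 h' g' B' x) : D2 (fun y => h y + h' y) (fun y => g y + g' y) (B + B') x := by
  refine ⟨?_, H.2.add H'.2⟩
  filter_upwards [H.1, H'.1] with y h1 h2
  rw [hasGradientAt_iff] at *
  rw [map_add]
  exact h1.add h2

lemma D2.const_mul {h : E → ℝ} {g : E → E} {B : E →L[ℝ] E} {x : E} (c : ℝ) (H : D2 h g B x) :
    D2 (fun y => c * h y) (fun y => c • g y) (c • B) x := by
  refine ⟨?_, H.2.const_smul c⟩
  filter_upwards [H.1] with y h1
  rw [hasGradientAt_iff] at *
  rw [map_smul]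
  exact h1.const_mul c

lemma D2.neg {h : E → ℝ} {g : E → E} {B : E →L[ℝ] E} {x : E} (H : D2 h g B x) :
    D2 (fun y => - h y) (fun y => - g y) (-B) x := by
  have := H.const_mul (-1)
  simpa using this

lemma D2.sub {h h' : E → ℝ} {g g' : E → E} {B B' : E →L[ℝ] E} {x : E} (H : D2 h g B x)
    (H' : D2 h' g' B' x) : D2 (fun y => h y - h' y) (fun y => g y - g' y) (B - B') x := by
  have := H.add H'.neg
  simpa [sub_eq_add_neg] using this

lemma D2_inner (e : E) (c : ℝ) (x : E) : D2 (fun y => ⟪e, y⟫ + c) (fun _ => e) 0 x := by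
  refine ⟨Eventually.of_forall fun y => ?_, hasFDerivAt_const _ _⟩
  rw [hasGradientAt_iff]
  exact ((innerSL ℝ e).hasFDerivAt).add_const c

lemma D2.comp_affine {h : E → ℝ} {g : E → E} {B : E →L[ℝ] E} {x0 : E} {s : ℝ} {z : E}
    (H : D2 h g B (x0 + s • z)) :
    D2 (fun z => h (x0 + s • z)) (fun z => s • g (x0 + s • z)) ((s * s) • B) z := by
  have ha : ∀ z : E, HasFDerivAt (fun z : E => x0 + s • z) (s • ContinuousLinearMap.id ℝ E) z :=
    fun z => ((hasFDerivAt_id z).const_smul s).const_add x0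
  refine ⟨?_, ?_⟩
  · have := (ha z).continuousAt.tendsto.eventually H.1
    filter_upwards [this] with y hy
    rw [hasGradientAt_iff] at *
    refine (hy.comp y (ha y)).congr_fderiv ?_
    ext w; simp
  · refine ((H.2.comp z (ha z)).const_smul s).congr_fderiv ?_
    ext w; simp [mul_smul]

/-- second derivative test -/
lemma D2.min_tr {h : E → ℝ} {g : E → E} {B : E →L[ℝ] E} {x : E} (H : D2 h g B x)
    (hm : IsLocalMin h x) : g x = 0 ∧ 0 ≤ tr B := by
  have hg : g x = 0 := by
    have h1 := hm.hasFDerivAt_eq_zero (hasGradientAt_iff.1 H.1.self_of_nhds)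
    have : innerSL ℝ (g x) (g x) = 0 := by rw [h1]; rfl
    simpa using this
  refine ⟨hg, ?_⟩
  rw [tr_eq_sum (stdOrthonormalBasis ℝ E)]
  refine Finset.sum_nonneg fun i _ => ?_
  set v := stdOrthonormalBasis ℝ E i
  by_contra hneg
  push Not at hneg
  -- one dimensional
  set f : ℝ → ℝ := fun t => h (x + t • v)
  have hl : ∀ t : ℝ, HasDerivAt (fun t : ℝ => x + t • v) v t := fun t => by
    simpa using ((hasDerivAt_id t).smul_const v).const_add x
  have hc : Tendsto (fun t : ℝ => x + t • v) (𝓝 0) (𝓝 x) := by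
    have := (hl 0).continuousAt.tendsto
    simpa using this
  have hd : ∀ᶠ t in 𝓝 (0:ℝ), HasDerivAt f ⟪g (x + t • v), v⟫ t := by
    filter_upwards [hc.eventually H.1] with t ht
    have := (hasGradientAt_iff.1 ht).comp_hasDerivAt t (hl t)
    rw [innerSL_apply_apply] at this
    exact this
  have hd2 : HasDerivAt (fun t : ℝ => ⟪g (x + t • v), v⟫) ⟪B v, v⟫ 0 := by
    have h0 : HasFDerivAt g B (x + (0:ℝ) • v) := by simpa using H.2
    have := h0.comp_hasDerivAt (0:ℝ) (hl 0)
    simpa using this.inner ℝ (hasDerivAt_const (0:ℝ) v)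
  have hneg' : ⟪B v, v⟫ < 0 := by rw [real_inner_comm]; exact hneg
  have hderiv : deriv f =ᶠ[𝓝 0] fun t => ⟪g (x + t • v), v⟫ := hd.mono fun t ht => ht.deriv
  have hdd : deriv (deriv f) 0 < 0 := by
    rw [hderiv.deriv_eq, hd2.deriv]; exact hneg'
  have hd0 : deriv f 0 = 0 := by
    rw [hderiv.self_of_nhds]; simp [hg]
  have hmax := isLocalMax_of_deriv_deriv_neg hdd hd0 hd.self_of_nhds.continuousAt
  have hmin : IsLocalMin f 0 := by
    have := hc.eventually hm
    filter_upwards [this] with t ht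
    simpa [f] using ht
  have hconst : f =ᶠ[𝓝 0] fun _ => f 0 := by
    filter_upwards [hmax, hmin] with t h1 h2
    exact le_antisymm h1 h2
  have hz : deriv f =ᶠ[𝓝 0] fun _ => 0 := by
    filter_upwards [hconst.eventuallyEq_nhds] with t ht
    rw [ht.deriv_eq]; simp
  rw [hz.deriv_eq] at hdd
  simp at hdd

lemma tr_fderiv_smul {φ : E → ℝ} {Y : E → E} {a z : E} {L : E →L[ℝ] E} (hφ : HasGradientAt φ a z)
    (hY : HasFDerivAt Y L z) : tr (fderiv ℝ (fun z => φ z • Y z) z) = ⟪a, Y z⟫ + φ z * tr L := by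
  have := ((hasGradientAt_iff.1 hφ).smul hY).fderiv
  have e : (fun z => φ z • Y z) = φ • Y := rfl
  rw [e, this, tr_add, tr_smul, tr_smulRight]
  simp [add_comm]

/-- weak form of div Y = 0 -/
lemma weak_div {U : Set E} (hU : IsOpen U) {Y : E → E} (hY : ∀ x ∈ U, ContDiffAt ℝ 1 Y x)
    (hdiv : ∀ x ∈ U, tr (fderiv ℝ Y x) = 0) {φ : E → ℝ} {g : E → E} (hφ : ContDiff ℝ 1 φ)
    (hg : ∀ z, HasGradientAt φ (g z) z) (hc : HasCompactSupport φ) (hs : tsupport φ ⊆ U) :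
    ∫ z, ⟪g z, Y z⟫ = 0 := by
  have hZ : ContDiff ℝ 1 (fun z => φ z • Y z) := by
    rw [contDiff_iff_contDiffAt]
    intro z
    by_cases hz : z ∈ tsupport φ
    · exact hφ.contDiffAt.smul (hY z (hs hz))
    · have : (fun z => φ z • Y z) =ᶠ[𝓝 z] fun _ => 0 := by
        filter_upwards [(isClosed_tsupport φ).isOpen_compl.mem_nhds hz] with y hy
        rw [image_eq_zero_of_notMem_tsupport hy, zero_smul]
      exact contDiffAt_const.congr_of_eventuallyEq this
  have hcs : HasCompactSupport (fun z => φ z • Y z) := by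
    refine hc.mono ?_
    intro z hz hz'
    exact hz (by show φ z • Y z = 0; rw [hz', zero_smul])
  rw [← integral_div_eq_zero hZ hcs]
  congr 1
  ext z
  change _ = tr _
  by_cases hz : z ∈ U
  · have hd := ((hY z hz).differentiableAt (by norm_num)).hasFDerivAt
    rw [tr_fderiv_smul (hg z) hd, hdiv z hz, mul_zero, add_zero]
  · have hz' : z ∉ tsupport φ := fun h => hz (hs h)
    have e1 : φ =ᶠ[𝓝 z] fun _ => 0 := by
      filter_upwards [(isClosed_tsupport φ).isOpen_compl.mem_nhds hz'] with y hy
      exact image_eq_zero_of_notMem_tsupport hy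
    have e2 : (fun z => φ z • Y z) =ᶠ[𝓝 z] fun _ => 0 := by
      filter_upwards [e1] with y hy
      rw [hy, zero_smul]
    have hg0 : g z = 0 := by
      have := (hg z).unique ((hasGradientAt_const z (0:ℝ)).congr_of_eventuallyEq e1)
      simpa using this
    rw [hg0, inner_zero_left, e2.fderiv_eq]
    simp [tr]

lemma two_le_top : (2 : WithTop ℕ∞) ≤ ((⊤ : ℕ∞) : WithTop ℕ∞) :=
  WithTop.coe_le_coe.2 (le_top : (2:ℕ∞) ≤ ⊤)

/-- smooth harmonic functions with gradient field g -/
def Harm (h : E → ℝ) (g : E → E) (U : Set E) : Prop :=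
  ∀ x ∈ U, ContDiffAt ℝ (⊤ : ℕ∞) h x ∧ ∃ B, D2 h g B x ∧ tr B = 0

lemma Harm.mono {h : E → ℝ} {g : E → E} {U V : Set E} (H : Harm h g U) (hVU : V ⊆ U) : Harm h g V :=
  fun x hx => H x (hVU hx)

lemma Harm.grad {h : E → ℝ} {g : E → E} {U : Set E} (H : Harm h g U) {x : E} (hx : x ∈ U) :
    HasGradientAt h (g x) x := by
  obtain ⟨_, B, hB, _⟩ := H x hx
  exact hB.1.self_of_nhds

lemma Harm.tr_eq {h : E → ℝ} {g : E → E} {U : Set E} (H : Harm h g U) {x : E} (hx : x ∈ U) :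
    tr (fderiv ℝ g x) = 0 := by
  obtain ⟨_, B, hB, h0⟩ := H x hx
  rw [hB.2.fderiv, h0]

lemma contDiffAt_gradient {h : E → ℝ} {g : E → E} {x : E} (hh : ContDiffAt ℝ (⊤ : ℕ∞) h x)
    (hg : ∀ᶠ y in 𝓝 x, HasGradientAt h (g y) y) : ContDiffAt ℝ (⊤ : ℕ∞) g x := by
  have h1 : ContDiffAt ℝ (⊤ : ℕ∞) (fderiv ℝ h) x := hh.fderiv_right (by simp)
  have h2 : ContDiffAt ℝ (⊤ : ℕ∞) (fun y => (InnerProductSpace.toDual ℝ E).symm (fderiv ℝ h y)) x :=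
    ((InnerProductSpace.toDual ℝ E).symm.toContinuousLinearEquiv.contDiff.contDiffAt).comp x h1
  refine h2.congr_of_eventuallyEq ?_
  filter_upwards [hg] with y hy
  rw [(hasGradientAt_iff.1 hy).fderiv]
  exact ((InnerProductSpace.toDual ℝ E).symm_apply_apply (g y)).symm

lemma Harm.smooth {h : E → ℝ} {g : E → E} {U : Set E} (H : Harm h g U) {x : E} (hx : x ∈ U) :
    ContDiffAt ℝ (⊤ : ℕ∞) g x := by
  obtain ⟨h1, B, hB, h0⟩ := H x hx
  exact contDiffAt_gradient h1 hB.1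

lemma Harm.add {h h' : E → ℝ} {g g' : E → E} {U : Set E} (H : Harm h g U) (H' : Harm h' g' U) :
    Harm (fun y => h y + h' y) (fun y => g y + g' y) U := by
  intro x hx
  obtain ⟨h1, B, hB, h0⟩ := H x hx
  obtain ⟨h1', B', hB', h0'⟩ := H' x hx
  exact ⟨h1.add h1', _, hB.add hB', by rw [tr_add, h0, h0', add_zero]⟩

lemma Harm.const_mul {h : E → ℝ} {g : E → E} {U : Set E} (c : ℝ) (H : Harm h g U) :
    Harm (fun y => c * h y) (fun y => c • g y) U := by
  intro x hx
  obtain ⟨h1, B, hB, h0⟩ := H x hx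
  exact ⟨contDiffAt_const.mul h1, _, hB.const_mul c, by rw [tr_smul, h0, mul_zero]⟩

lemma Harm_affine (e : E) (c : ℝ) (U : Set E) : Harm (fun y => ⟪e, y⟫ + c) (fun _ => e) U :=
  fun x _ => ⟨(contDiffAt_const.inner ℝ contDiffAt_id).add contDiffAt_const, 0, D2_inner e c x, tr_zero⟩

lemma Harm.sub_affine {h : E → ℝ} {g : E → E} {U : Set E} (H : Harm h g U) (e : E) (c : ℝ) :
    Harm (fun y => h y - (⟪e, y⟫ + c)) (fun y => g y - e) U := by
  have := H.add ((Harm_affine e c U).const_mul (-1))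
  simpa [sub_eq_add_neg] using this

/-- mean value property -/
lemma Harm.mv {h : E → ℝ} {g : E → E} {U : Set E} (hU : IsOpen U) (H : Harm h g U) {x : E} {t : ℝ}
    (ht : 0 < t) (hs : closedBall x t ⊆ U) {V : E → ℝ} {K : ℝ≥0} (hV : LipschitzWith K V)
    (hVh : EqOn V h (closedBall x t)) : avg V t x = c0 E * h x := by
  have := avg_bound (β := 0) hV (le_refl (0:ℝ)) ht.le (x := x) (fun s hs' => ?_)
  · rw [zero_mul, avg_zero, hVh (mem_closedBall_self ht.le)] at this
    have := abs_nonpos_iff.1 this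
    linarith
  · obtain ⟨hs0, hst⟩ := hs'
    have hmem : ∀ z : E, ‖z‖ ≤ 1 → x + s • z ∈ ball x t := by
      intro z hz
      rw [mem_ball, dist_eq_norm, add_sub_cancel_left, norm_smul, Real.norm_of_nonneg hs0.le]
      nlinarith [norm_nonneg z]
    have ha : Continuous fun z : E => x + s • z := by fun_prop
    have hw := weak_div (U := (fun z : E => x + s • z) ⁻¹' U) (hU.preimage ha)
      (Y := fun z => g (x + s • z)) (φ := bump) (g := fun z => -(rho z) • z)
      (fun z hz => by
        have h1 := (H.smooth hz).of_le (m := 1) (by norm_cast)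
        exact h1.comp z (by fun_prop))
      (fun z hz => by
        obtain ⟨_, B, hB, h0⟩ := H _ hz
        have hl : HasFDerivAt (fun z : E => x + s • z) (s • ContinuousLinearMap.id ℝ E) z :=
          ((hasFDerivAt_id z).const_smul s).const_add x
        have := (hB.2.comp z hl).fderiv
        have e : (fun z => g (x + s • z)) = g ∘ (fun z : E => x + s • z) := rfl
        rw [e, this, ContinuousLinearMap.comp_smul, ContinuousLinearMap.comp_id, tr_smul, h0, mul_zero])
      (bump_contDiff.of_le (by norm_num)) (fun z => hasGradientAt_bump z) bump_compact
      (by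
        refine (closure_minimal bump_support isClosed_closedBall).trans ?_
        intro z hz
        exact hs (ball_subset_closedBall (hmem z (by simpa using hz))))
    have e : ∫ z, fderiv ℝ V (x + s • z) z * rho z = - ∫ z, ⟪-(rho z) • z, g (x + s • z)⟫ := by
      rw [← integral_neg]
      congr 1
      ext z
      by_cases hz : 1 ≤ ‖z‖
      · simp [rho_zero hz]
      · have hm := hmem z (by linarith)
        have e1 : V =ᶠ[𝓝 (x + s • z)] h := by
          filter_upwards [isOpen_ball.mem_nhds hm] with y hy
          exact hVh (ball_subset_closedBall hy)
        rw [e1.fderiv_eq, (hasGradientAt_iff.1 (H.grad (hs (ball_subset_closedBall hm)))).fderiv,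
          innerSL_apply_apply, neg_smul, inner_neg_left, real_inner_smul_left, real_inner_comm]
        ring
    rw [e, hw]; simp

lemma Harm.lip_ext {h : E → ℝ} {g : E → E} {U : Set E} (H : Harm h g U) {x : E} {t : ℝ}
    (hs : closedBall x t ⊆ U) : ∃ (K : ℝ≥0) (V : E → ℝ), LipschitzWith K V ∧ EqOn V h (closedBall x t) := by
  have hc : ContDiffOn ℝ 1 h (closedBall x t) := fun y hy =>
    ((H y (hs hy)).1.of_le (by norm_cast)).contDiffWithinAt
  obtain ⟨K, hK⟩ := hc.exists_lipschitzOnWith (by norm_num) (convex_closedBall x t) (isCompact_closedBall x t)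
  obtain ⟨V, hV, hVh⟩ := hK.extend_real
  exact ⟨K, V, hV, hVh.symm⟩

variable (E) in
/-- interior estimates for harmonic functions -/
lemma harm_est0 [Nontrivial E] : ∃ C : ℝ, 1 ≤ C ∧ ∀ (h : E → ℝ) (g : E → E) (x0 : E) (r m : ℝ), 0 < r →
    Harm h g (ball x0 r) → (∀ y ∈ ball x0 r, |h y| ≤ m) →
    (∀ x ∈ ball x0 r, |h x - h x0| ≤ C * m * (‖x - x0‖ / r)) ∧ ‖g x0‖ ≤ C * m / r ∧
    (∀ x ∈ ball x0 r, |h x - h x0 - ⟪g x0, x - x0⟫| ≤ C * m * (‖x - x0‖ / r) ^ 2) := by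
  obtain ⟨C, hC, hreg⟩ := avg_reg E
  have hc0 := c0_pos (E := E)
  set A := C / c0 E with hA
  have hA0 : 0 < A := by positivity
  refine ⟨100 * A + 100, by linarith, ?_⟩
  intro h g x0 r m hr H hm
  have hm0 : 0 ≤ m := (abs_nonneg _).trans (hm x0 (mem_ball_self hr))
  set t := r / 4 with ht
  have ht0 : 0 < t := by positivity
  have hsub : closedBall x0 (2 * t) ⊆ ball x0 r := closedBall_subset_ball (by rw [ht]; linarith)
  obtain ⟨K, V, hV, hVh⟩ := H.lip_ext hsub
  obtain ⟨h1, h2, b, h3, h4⟩ := hreg V t m x0 hV.continuous ht0 (fun y hy => by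
    rw [hVh hy]; exact hm y (hsub hy))
  have hmv : ∀ k : E, ‖k‖ ≤ t → avg V t (x0 + k) = c0 E * h (x0 + k) := by
    intro k hk
    have hs : closedBall (x0 + k) t ⊆ closedBall x0 (2 * t) := by
      refine closedBall_subset_closedBall' ?_
      rw [dist_eq_norm, add_sub_cancel_left]; linarith
    exact H.mv isOpen_ball ht0 (hs.trans hsub) hV (fun y hy => hVh (hs hy))
  have hmv0 : avg V t x0 = c0 E * h x0 := by simpa using hmv 0 (by simpa using ht0.le)
  -- near bounds
  have n1 : ∀ k : E, ‖k‖ ≤ t → |h (x0 + k) - h x0| ≤ A * m * (‖k‖ / t) := by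
    intro k hk
    have := h2 k hk
    rw [hmv k hk, hmv0, ← mul_sub, abs_mul, abs_of_pos hc0] at this
    have e : A * m * (‖k‖ / t) = (C * m * (‖k‖ / t)) / c0 E := by rw [hA]; ring
    rw [e, le_div_iff₀ hc0]; linarith
  have n2 : ∀ k : E, ‖k‖ ≤ t → |h (x0 + k) - h x0 - ⟪(c0 E)⁻¹ • b, k⟫| ≤ A * m * (‖k‖ / t) ^ 2 := by
    intro k hk
    have := h4 k hk
    have e2 : c0 E * h (x0 + k) - c0 E * h x0 - ⟪b, k⟫ = c0 E * (h (x0 + k) - h x0 - ⟪(c0 E)⁻¹ • b, k⟫) := by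
      rw [real_inner_smul_left]; field_simp
    rw [hmv k hk, hmv0, e2, abs_mul, abs_of_pos hc0] at this
    have e : A * m * (‖k‖ / t) ^ 2 = (C * m * (‖k‖ / t) ^ 2) / c0 E := by rw [hA]; ring
    rw [e, le_div_iff₀ hc0]; linarith
  have hgb : g x0 = (c0 E)⁻¹ • b := by
    have h5 : HasGradientAt h ((c0 E)⁻¹ • b) x0 := by
      rw [hasGradientAt_iff, hasFDerivAt_iff_isLittleO_nhds_zero]
      have : (fun k : E => h (x0 + k) - h x0 - innerSL ℝ ((c0 E)⁻¹ • b) k) =O[𝓝 0] fun k : E => ‖k‖ ^ 2 := by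
        refine Asymptotics.IsBigO.of_bound (A * m / t ^ 2) ?_
        filter_upwards [closedBall_mem_nhds (0:E) ht0] with k hk
        rw [innerSL_apply_apply, Real.norm_eq_abs]
        refine (n2 k (by simpa using hk)).trans (le_of_eq ?_)
        rw [norm_pow, norm_norm]; ring
      refine this.trans_isLittleO ?_
      exact Asymptotics.isLittleO_norm_pow_id (by norm_num)
    exact (H.grad (mem_ball_self hr)).unique h5
  have hgn : ‖g x0‖ ≤ A * m / t := by
    rw [hgb, norm_smul, norm_inv, Real.norm_of_nonneg hc0.le]
    have e : A * m / t = (c0 E)⁻¹ * (C * m / t) := by rw [hA]; ring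
    rw [e]; gcongr
  have hdec : ∀ x ∈ ball x0 r, ∃ k, x = x0 + k ∧ ‖x - x0‖ = ‖k‖ := fun x _ =>
    ⟨x - x0, by abel, rfl⟩
  have hgn' : A * m / t = 4 * A * m / r := by rw [ht]; field_simp
  refine ⟨fun x hx => ?_, ?_, fun x hx => ?_⟩
  · by_cases hk : ‖x - x0‖ ≤ t
    · have := n1 _ hk
      rw [add_sub_cancel] at this
      refine this.trans ?_
      have e : A * m * (‖x - x0‖ / t) = (4 * A) * m * (‖x - x0‖ / r) := by rw [ht]; field_simp
      rw [e]; gcongr; linarith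
    · push Not at hk
      have h6 : 1 / 4 ≤ ‖x - x0‖ / r := by rw [le_div_iff₀ hr]; linarith
      have h7 : |h x - h x0| ≤ 2 * m := by
        have := abs_sub (h x) (h x0)
        linarith [hm x hx, hm x0 (mem_ball_self hr)]
      have h8 : (8:ℝ) * m * (1/4) ≤ (100 * A + 100) * m * (‖x - x0‖ / r) := by
        gcongr; linarith
      linarith
  · refine hgn.trans ?_
    rw [hgn']; gcongr; linarith
  · by_cases hk : ‖x - x0‖ ≤ t
    · have := n2 _ hk
      rw [add_sub_cancel, ← hgb] at this
      refine this.trans ?_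
      have e : A * m * (‖x - x0‖ / t) ^ 2 = (16 * A) * m * (‖x - x0‖ / r) ^ 2 := by rw [ht]; field_simp; norm_num
      rw [e]; gcongr; linarith
    · push Not at hk
      have h6 : 1 / 4 ≤ ‖x - x0‖ / r := by rw [le_div_iff₀ hr]; linarith
      have h7 : |h x - h x0| ≤ 2 * m := by
        have := abs_sub (h x) (h x0)
        linarith [hm x hx, hm x0 (mem_ball_self hr)]
      have h9 : |⟪g x0, x - x0⟫| ≤ 4 * A * m := by
        refine (abs_real_inner_le_norm _ _).trans ?_
        have h10 : ‖x - x0‖ ≤ r := by rw [← dist_eq_norm]; exact (mem_ball.1 hx).le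
        calc ‖g x0‖ * ‖x - x0‖ ≤ (4 * A * m / r) * r := by
              rw [hgn'] at hgn; gcongr
          _ = 4 * A * m := by field_simp
      have h8 : (64 * A + 32:ℝ) * m * (1/4) ^ 2 ≤ (100 * A + 100) * m * (‖x - x0‖ / r) ^ 2 := by
        gcongr <;> linarith
      have := abs_sub (h x - h x0) ⟪g x0, x - x0⟫
      linarith

/-- directional derivatives of harmonic functions are harmonic -/
lemma Harm.dir {h : E → ℝ} {g : E → E} {U : Set E} (hU : IsOpen U) (H : Harm h g U) (a : E) :
    Harm (fun x => ⟪g x, a⟫) (fun x => fderiv ℝ g x a) U := by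
  intro x hx
  have hg := H.smooth hx
  have hgr : ∀ y ∈ U, HasGradientAt (fun x => ⟪g x, a⟫) (fderiv ℝ g y a) y := by
    intro y hy
    rw [hasGradientAt_iff]
    have h1 := ((H.smooth hy).differentiableAt (by simp)).hasFDerivAt
    have h2 := (h1.inner ℝ (hasFDerivAt_const a y))
    refine h2.congr_fderiv ?_
    ext w
    simp only [innerSL_apply_apply]
    have hs := (H y hy).1.isSymmSndFDerivAt (by simpa using two_le_top)
    have hfd : fderiv ℝ h =ᶠ[𝓝 y] fun y => innerSL ℝ (g y) := by
      filter_upwards [hU.mem_nhds hy] with z hz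
      exact (hasGradientAt_iff.1 (H.grad hz)).fderiv
    have hs' := hs w a
    have h3 : fderiv ℝ (fderiv ℝ h) y = (innerSL ℝ).comp (fderiv ℝ g y) := by
      rw [hfd.fderiv_eq]
      exact ((innerSL ℝ).hasFDerivAt.comp y h1).fderiv
    rw [h3] at hs'
    simpa using hs'
  have hk : ContDiffAt ℝ (⊤ : ℕ∞) (fderiv ℝ g) x := hg.fderiv_right (by simp)
  have hkd := (hk.differentiableAt (by simp)).hasFDerivAt
  refine ⟨hg.inner ℝ contDiffAt_const, fderiv ℝ (fderiv ℝ g) x a, ⟨?_, ?_⟩, ?_⟩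
  · filter_upwards [hU.mem_nhds hx] with y hy using hgr y hy
  · have h1 := hkd.clm_apply (hasFDerivAt_const a x)
    refine h1.congr_fderiv ?_
    ext w
    have hs := hg.isSymmSndFDerivAt (by simpa using two_le_top) w a
    simp [hs]
  · have h1 := (trL E).hasFDerivAt.comp x hkd
    have h2 : (trL E) ∘ (fderiv ℝ g) =ᶠ[𝓝 x] fun _ => 0 := by
      filter_upwards [hU.mem_nhds hx] with y hy
      exact H.tr_eq hy
    have h3 := h1.unique ((hasFDerivAt_const (0:ℝ) x).congr_of_eventuallyEq h2)
    have h4 := congrArg (fun L : E →L[ℝ] ℝ => L a) h3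
    simpa [trL_apply] using h4

variable (E) in
/-- interior gradient estimates for harmonic functions -/
lemma harm_est [Nontrivial E] : ∃ C : ℝ, 1 ≤ C ∧ ∀ (h : E → ℝ) (g : E → E) (x0 : E) (r m : ℝ), 0 < r →
    Harm h g (ball x0 r) → (∀ y ∈ ball x0 r, |h y| ≤ m) →
    (∀ x ∈ ball x0 r, |h x - h x0| ≤ C * m * (‖x - x0‖ / r)) ∧ ‖g x0‖ ≤ C * m / r ∧
    (∀ x ∈ ball x0 r, |h x - h x0 - ⟪g x0, x - x0⟫| ≤ C * m * (‖x - x0‖ / r) ^ 2) ∧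
    (∀ x ∈ ball x0 (r / 2), ‖g x - g x0‖ ≤ C * m / r * (‖x - x0‖ / r)) ∧
    ‖fderiv ℝ g x0‖ ≤ C * m / r ^ 2 := by
  obtain ⟨C, hC, H0⟩ := harm_est0 E
  refine ⟨4 * C ^ 2, by nlinarith, ?_⟩
  intro h g x0 r m hr H hm
  have hm0 : 0 ≤ m := (abs_nonneg _).trans (hm x0 (mem_ball_self hr))
  obtain ⟨h1, h2, h3⟩ := H0 h g x0 r m hr H hm
  have hCC : C ≤ 4 * C ^ 2 := by nlinarith
  have hgb : ∀ y ∈ ball x0 (r / 2), ‖g y‖ ≤ 2 * C * m / r := by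
    intro y hy
    have hs : ball y (r / 2) ⊆ ball x0 r := ball_subset_ball' (by linarith [mem_ball.1 hy])
    obtain ⟨_, h5, _⟩ := H0 h g y (r / 2) m (by positivity) (H.mono hs) (fun z hz => hm z (hs hz))
    refine h5.trans (le_of_eq ?_); field_simp
  have hs : ball x0 (r / 2) ⊆ ball x0 r := ball_subset_ball (by linarith)
  have hdir : ∀ a : E, _ := fun a => H0 (fun x => ⟪g x, a⟫) _ x0 (r / 2) (2 * C * m / r * ‖a‖) (by positivity)
    ((H.mono hs).dir isOpen_ball a) (fun y hy => (abs_real_inner_le_norm _ _).trans (by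
      have := hgb y hy; gcongr))
  have hlip : ∀ x ∈ ball x0 (r / 2), ‖g x - g x0‖ ≤ 4 * C ^ 2 * m / r * (‖x - x0‖ / r) := by
    intro x hx
    have h6 := (hdir (g x - g x0)).1 x hx
    rw [← inner_sub_left, real_inner_self_eq_norm_sq, abs_of_nonneg (by positivity)] at h6
    rcases eq_or_lt_of_le (norm_nonneg (g x - g x0)) with h0 | h0
    · rw [← h0]; positivity
    · have e : C * (2 * C * m / r * ‖g x - g x0‖) * (‖x - x0‖ / (r / 2)) =
        (4 * C ^ 2 * m / r * (‖x - x0‖ / r)) * ‖g x - g x0‖ := by field_simp; ring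
      rw [e, sq] at h6
      exact le_of_mul_le_mul_right h6 h0
  refine ⟨fun x hx => (h1 x hx).trans (by gcongr), h2.trans (by gcongr), fun x hx => (h3 x hx).trans (by gcongr), hlip, ?_⟩
  have hd := ((H.smooth (mem_ball_self hr)).differentiableAt (by simp)).hasFDerivAt
  refine hd.le_of_lip' (by positivity) ?_
  filter_upwards [ball_mem_nhds x0 (half_pos hr)] with x hx
  refine (hlip x hx).trans (le_of_eq ?_)
  field_simp

end M0c
end OP

namespace OP
open scoped RealInnerProductSpace Topology
open Module

section
variable {E : Type*} [NormedAddCommGroup E] [InnerProductSpace ℝ E] [FiniteDimensional ℝ E]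
  [MeasurableSpace E] [BorelSpace E]

variable (E) in
/-- affine functions -/
noncomputable def PS : Submodule ℝ (E → ℝ) :=
  Submodule.span ℝ {1} ⊔ Submodule.span ℝ (range fun i => fun x : E => ⟪stdOrthonormalBasis ℝ E i, x⟫)

/-- directional derivative -/
noncomputable def dd (a : E) (p : E → ℝ) : E → ℝ := fun x => fderiv ℝ p x a

/-- Laplacian of a function -/
noncomputable def Lap (p : E → ℝ) : E → ℝ :=
  ∑ i, dd (stdOrthonormalBasis ℝ E i) (dd (stdOrthonormalBasis ℝ E i) p)

lemma PS_one : (1 : E → ℝ) ∈ PS E := Submodule.mem_sup_left (Submodule.subset_span rfl)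

lemma PS_basis (i) : (fun x : E => ⟪stdOrthonormalBasis ℝ E i, x⟫) ∈ PS E :=
  Submodule.mem_sup_right (Submodule.subset_span ⟨i, rfl⟩)

lemma PS_fg : (PS E).FG :=
  (Submodule.fg_span (Set.finite_singleton _)).sup (Submodule.fg_span (Set.finite_range _))

lemma PS_form {s : E → ℝ} (hs : s ∈ PS E) : ∃ (a : E) (c : ℝ), s = fun x => ⟪a, x⟫ + c := by
  rw [PS, ← Submodule.span_union] at hs
  induction hs using Submodule.span_induction with
  | mem x hx =>
    rcases hx with hx | ⟨i, rfl⟩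
    · exact ⟨0, 1, by rw [hx]; ext; simp⟩
    · exact ⟨stdOrthonormalBasis ℝ E i, 0, by simp⟩
  | zero => exact ⟨0, 0, by ext; simp⟩
  | add x y _ _ hx hy =>
    obtain ⟨a, c, rfl⟩ := hx
    obtain ⟨a', c', rfl⟩ := hy
    exact ⟨a + a', c + c', by ext z; simp [inner_add_left]; ring⟩
  | smul r x _ hx =>
    obtain ⟨a, c, rfl⟩ := hx
    exact ⟨r • a, r * c, by ext z; simp [real_inner_smul_left]; ring⟩

lemma PP_an : ∀ (m : ℕ) (p : E → ℝ), p ∈ (PS E) ^ m → ContDiff ℝ ω p := by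
  intro m
  induction m with
  | zero =>
    intro p hp
    rw [pow_zero, Submodule.mem_one] at hp
    obtain ⟨c, rfl⟩ := hp
    exact contDiff_const
  | succ m ih =>
    intro p hp
    rw [pow_succ'] at hp
    refine Submodule.mul_induction_on hp (fun s hs q hq => ?_) (fun x y hx hy => hx.add hy)
    obtain ⟨a, c, rfl⟩ := PS_form hs
    exact ((contDiff_const.inner ℝ contDiff_id).add contDiff_const).mul (ih q hq)

lemma PP_smooth {m : ℕ} {p : E → ℝ} (hp : p ∈ (PS E) ^ m) : ContDiff ℝ (⊤ : ℕ∞) p :=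
  (PP_an m p hp).of_le le_top

lemma PP_mono {m k : ℕ} (h : m ≤ k) : (PS E) ^ m ≤ (PS E) ^ k :=
  pow_le_pow_right₀ (Submodule.one_le.2 PS_one) h

lemma PP_dd0 (a : E) {p : E → ℝ} (hp : p ∈ (PS E) ^ 0) : dd a p = 0 := by
  rw [pow_zero, Submodule.mem_one] at hp
  obtain ⟨c, rfl⟩ := hp
  ext x
  have : (algebraMap ℝ (E → ℝ)) c = fun _ => c := rfl
  simp [dd, this]

lemma PP_dd (a : E) : ∀ (m : ℕ) (p : E → ℝ), p ∈ (PS E) ^ (m + 1) → dd a p ∈ (PS E) ^ m := by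
  intro m
  induction m with
  | zero =>
    intro p hp
    rw [zero_add, pow_one] at hp
    obtain ⟨b, c, rfl⟩ := PS_form hp
    rw [pow_zero, Submodule.mem_one]
    refine ⟨⟪b, a⟫, ?_⟩
    ext x
    have h := ((innerSL ℝ b).hasFDerivAt (x := x)).add_const c
    have h' : HasFDerivAt (fun x => ⟪b, x⟫ + c) (innerSL ℝ b) x := h
    simp [dd, h'.fderiv]
  | succ m ih =>
    intro p hp
    rw [pow_succ'] at hp
    have : dd a p ∈ (PS E) ^ (m + 1) ∧ Differentiable ℝ p := by
      refine Submodule.mul_induction_on hp (fun s hs q hq => ?_) (fun x y hx hy => ?_)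
      · have hqd : Differentiable ℝ q := (PP_smooth hq).differentiable (by simp)
        have hsd : Differentiable ℝ s := (PP_smooth (m := 1) (by simpa using hs)).differentiable (by simp)
        refine ⟨?_, hsd.mul hqd⟩
        have e : dd a (s * q) = s * dd a q + dd a s * q := by
          ext x
          simp [dd, fderiv_mul (hsd x) (hqd x)]
          ring
        rw [e]
        refine Submodule.add_mem _ ?_ ?_
        · rw [pow_succ']
          exact Submodule.mul_mem_mul hs (ih q hq)
        · obtain ⟨b, c, rfl⟩ := PS_form hs
          have : dd a (fun x => ⟪b, x⟫ + c) = fun _ => ⟪b, a⟫ := by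
            ext x
            have h := ((innerSL ℝ b).hasFDerivAt (x := x)).add_const c
            have h' : HasFDerivAt (fun x => ⟪b, x⟫ + c) (innerSL ℝ b) x := h
            simp [dd, h'.fderiv]
          rw [this]
          exact Submodule.smul_mem _ ⟪b, a⟫ hq
      · refine ⟨?_, hx.2.add hy.2⟩
        have e : dd a (x + y) = dd a x + dd a y := by
          ext z
          simp [dd, fderiv_add (hx.2 z) (hy.2 z)]
        rw [e]
        exact Submodule.add_mem _ hx.1 hy.1
    exact this.1

lemma dd_smooth {p : E → ℝ} (hp : ContDiff ℝ (⊤ : ℕ∞) p) (a : E) : ContDiff ℝ (⊤ : ℕ∞) (dd a p) :=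
  (hp.fderiv_right (by simp)).clm_apply contDiff_const

lemma dd_add {p q : E → ℝ} (hp : ContDiff ℝ (⊤ : ℕ∞) p) (hq : ContDiff ℝ (⊤ : ℕ∞) q) (a : E) :
    dd a (p + q) = dd a p + dd a q := by
  ext z
  simp [dd, fderiv_add (hp.differentiable (by simp) z) (hq.differentiable (by simp) z)]

lemma dd_smul {p : E → ℝ} (hp : ContDiff ℝ (⊤ : ℕ∞) p) (c : ℝ) (a : E) :
    dd a (c • p) = c • dd a p := by
  ext z
  simp [dd, fderiv_const_smul (hp.differentiable (by simp) z)]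

lemma Lap_add {p q : E → ℝ} (hp : ContDiff ℝ (⊤ : ℕ∞) p) (hq : ContDiff ℝ (⊤ : ℕ∞) q) :
    Lap (p + q) = Lap p + Lap q := by
  simp only [Lap, ← Finset.sum_add_distrib]
  refine Finset.sum_congr rfl fun i _ => ?_
  rw [dd_add hp hq, dd_add (dd_smooth hp _) (dd_smooth hq _)]

lemma Lap_smul {p : E → ℝ} (hp : ContDiff ℝ (⊤ : ℕ∞) p) (c : ℝ) : Lap (c • p) = c • Lap p := by
  simp only [Lap, Finset.smul_sum]
  refine Finset.sum_congr rfl fun i _ => ?_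
  rw [dd_smul hp, dd_smul (dd_smooth hp _)]

lemma Lap_mem {m : ℕ} {p : E → ℝ} (hp : p ∈ (PS E) ^ (m + 2)) : Lap p ∈ (PS E) ^ m :=
  Submodule.sum_mem _ fun i _ => PP_dd _ _ _ (PP_dd _ _ _ hp)

lemma D2_smooth {p : E → ℝ} (hp : ContDiff ℝ (⊤ : ℕ∞) p) (x : E) :
    ∃ B, D2 p (gradient p) B x ∧ tr B = Lap p x := by
  have hg : ∀ y, HasGradientAt p (gradient p y) y := fun y =>
    (hp.differentiable (by simp) y).hasGradientAt
  have hs : ContDiffAt ℝ (⊤ : ℕ∞) (gradient p) x :=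
    contDiffAt_gradient hp.contDiffAt (Eventually.of_forall hg)
  have hd := (hs.differentiableAt (by simp)).hasFDerivAt
  refine ⟨_, ⟨Eventually.of_forall hg, hd⟩, ?_⟩
  rw [tr_eq_sum (stdOrthonormalBasis ℝ E), Lap, Finset.sum_apply]
  refine Finset.sum_congr rfl fun i _ => ?_
  set v := stdOrthonormalBasis ℝ E i
  have e : dd v p = fun y => ⟪v, gradient p y⟫ := by
    ext y
    rw [dd, (hasGradientAt_iff.1 (hg y)).fderiv, innerSL_apply_apply, real_inner_comm]
  have h1 := (innerSL ℝ v).hasFDerivAt.comp x hd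
  have h2 : HasFDerivAt (fun y => ⟪v, gradient p y⟫) _ x := h1
  rw [dd, e, h2.fderiv]
  simp

/-- weak maximum principle -/
lemma max_pr [Nontrivial E] {w : E → ℝ} (hw : ContDiff ℝ (⊤ : ℕ∞) w) (hL : Lap w = 0)
    (hs : ∀ x, ‖x‖ = 1 → w x ≤ 0) {x : E} (hx : ‖x‖ ≤ 1) : w x ≤ 0 := by
  refine le_of_forall_pos_le_add fun δ hδ => ?_
  set q : E → ℝ := fun y => w y + δ * ‖y‖ ^ 2 with hq
  have hqc : Continuous q := by have := hw.continuous; fun_prop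
  obtain ⟨z, hz, hmax⟩ := (isCompact_closedBall (0:E) 1).exists_isMaxOn ⟨0, by simp⟩ hqc.continuousOn
  have h1 : q x ≤ q z := hmax (by simpa using hx)
  have hz' : ‖z‖ ≤ 1 := by simpa using hz
  rcases hz'.lt_or_eq with hlt | heq
  · exfalso
    obtain ⟨B, hB, htr⟩ := D2_smooth hw z
    have hsq : D2 (fun y : E => ‖y‖ ^ 2) (fun y => (2:ℝ) • y) ((2:ℝ) • ContinuousLinearMap.id ℝ E) z := by
      refine ⟨Eventually.of_forall fun y => ?_, (hasFDerivAt_id z).const_smul 2⟩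
      rw [hasGradientAt_iff]
      have := (hasStrictFDerivAt_norm_sq y).hasFDerivAt
      refine this.congr_fderiv ?_
      ext w; simp
    have hD := (hB.add (hsq.const_mul δ)).neg
    have hmin : IsLocalMin (fun y => -(w y + δ * ‖y‖ ^ 2)) z := by
      filter_upwards [isOpen_ball.mem_nhds (show z ∈ ball (0:E) 1 by simpa using hlt)] with y hy
      exact neg_le_neg (hmax (ball_subset_closedBall hy))
    have := (hD.min_tr hmin).2
    rw [tr_neg, tr_add, tr_smul, tr_smul, tr_id, htr, hL] at this
    have hn : (0:ℝ) < finrank ℝ E := by exact_mod_cast finrank_pos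
    simp at this
    nlinarith
  · have h2 := hs z heq
    simp only [hq, heq] at h1
    nlinarith [sq_nonneg ‖x‖]

lemma one_sub_mem : (fun x : E => 1 - ‖x‖ ^ 2) ∈ (PS E) ^ 2 := by
  have e : (fun x : E => 1 - ‖x‖ ^ 2) = 1 * 1 - ∑ i, (fun x : E => ⟪stdOrthonormalBasis ℝ E i, x⟫) *
      (fun x : E => ⟪stdOrthonormalBasis ℝ E i, x⟫) := by
    ext x
    simp only [Pi.sub_apply, Pi.mul_apply, Pi.one_apply, Finset.sum_apply, mul_one]
    congr 1
    rw [← (stdOrthonormalBasis ℝ E).sum_sq_norm_inner_right x]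
    refine Finset.sum_congr rfl fun i _ => ?_
    rw [Real.norm_eq_abs, sq_abs]; ring
  rw [e, sq]
  exact Submodule.sub_mem _ (Submodule.mul_mem_mul PS_one PS_one)
    (Submodule.sum_mem _ fun i _ => Submodule.mul_mem_mul (PS_basis i) (PS_basis i))

/-- solve the Poisson equation with zero boundary data for polynomials -/
lemma poisson_poly [Nontrivial E] (m : ℕ) {f : E → ℝ} (hf : f ∈ (PS E) ^ m) :
    ∃ q ∈ (PS E) ^ m, Lap ((fun x : E => 1 - ‖x‖ ^ 2) * q) = f := by
  set P := (PS E) ^ m with hP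
  have : FiniteDimensional ℝ P := Module.Finite.iff_fg.2 (PS_fg.pow m)
  have hmem : ∀ q : P, (fun x : E => 1 - ‖x‖ ^ 2) * (q : E → ℝ) ∈ (PS E) ^ (m + 2) := fun q => by
    rw [add_comm, pow_add]
    exact Submodule.mul_mem_mul one_sub_mem q.2
  let T : P →ₗ[ℝ] P :=
    { toFun := fun q => ⟨Lap ((fun x : E => 1 - ‖x‖ ^ 2) * (q : E → ℝ)), Lap_mem (hmem q)⟩
      map_add' := fun q q' => by
        ext1
        simp only [Submodule.coe_add, mul_add]
        rw [Lap_add (PP_smooth (hmem q)) (PP_smooth (hmem q'))]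
      map_smul' := fun c q => by
        ext1
        simp only [Submodule.coe_smul, mul_smul_comm, RingHom.id_apply]
        rw [Lap_smul (PP_smooth (hmem q))] }
  have hinj : Function.Injective T := by
    rw [injective_iff_map_eq_zero]
    intro q hq
    have h0 : Lap ((fun x : E => 1 - ‖x‖ ^ 2) * (q : E → ℝ)) = 0 := congrArg Subtype.val hq
    set w := (fun x : E => 1 - ‖x‖ ^ 2) * (q : E → ℝ) with hw
    have hws := PP_smooth (hmem q)
    have hb : ∀ x : E, ‖x‖ = 1 → w x = 0 := fun x hx => by simp [hw, hx]
    have h1 : ∀ x : E, ‖x‖ ≤ 1 → w x = 0 := by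
      intro x hx
      refine le_antisymm (max_pr hws h0 (fun y hy => (hb y hy).le) hx) ?_
      have := max_pr (w := (-1 : ℝ) • w) (hws.const_smul (-1 : ℝ)) (by rw [Lap_smul hws, h0, smul_zero])
        (fun y hy => by simp [hb y hy]) hx
      simpa using this
    have h2 : (q : E → ℝ) =ᶠ[𝓝 0] fun _ => 0 := by
      filter_upwards [ball_mem_nhds (0:E) one_pos] with x hx
      have hx' : ‖x‖ < 1 := by simpa using hx
      have := h1 x hx'.le
      simp only [hw, Pi.mul_apply, mul_eq_zero] at this
      rcases this with h | h
      · nlinarith [norm_nonneg x]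
      · exact h
    have hqa : AnalyticOnNhd ℝ (q : E → ℝ) univ := fun x _ => ((PP_an m q q.2).contDiffAt (x := x)).analyticAt
    have h3 := hqa.eq_of_eventuallyEq (g := fun _ => 0) analyticOnNhd_const h2
    ext1
    exact h3
  obtain ⟨q, hq⟩ := (LinearMap.injective_iff_surjective.1 hinj) ⟨f, hf⟩
  exact ⟨q, q.2, congrArg Subtype.val hq⟩

/-- approximate solution of the Dirichlet problem in the unit ball -/
lemma dirichlet [Nontrivial E] {f : E → ℝ} (hf : Continuous f) {η : ℝ} (hη : 0 < η) :
    ∃ h : E → ℝ, ContDiff ℝ (⊤ : ℕ∞) h ∧ Harm h (gradient h) univ ∧ ∀ x, ‖x‖ = 1 → |h x - f x| ≤ η := by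
  let A : Subalgebra ℝ C(E, ℝ) :=
    { carrier := {c | ∃ m, (c : E → ℝ) ∈ (PS E) ^ m}
      mul_mem' := by
        rintro a b ⟨m, hm⟩ ⟨k, hk⟩
        exact ⟨m + k, by rw [pow_add]; exact Submodule.mul_mem_mul hm hk⟩
      add_mem' := by
        rintro a b ⟨m, hm⟩ ⟨k, hk⟩
        exact ⟨max m k, Submodule.add_mem _ (PP_mono (le_max_left _ _) hm) (PP_mono (le_max_right _ _) hk)⟩
      algebraMap_mem' := fun r => ⟨0, by
        rw [pow_zero, Submodule.mem_one]
        exact ⟨r, rfl⟩⟩ }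
  have hA : A.SeparatesPoints := by
    intro x y hxy
    by_contra hcon
    push Not at hcon
    apply hxy
    refine (stdOrthonormalBasis ℝ E).repr.injective ?_
    ext i
    rw [OrthonormalBasis.repr_apply_apply, OrthonormalBasis.repr_apply_apply]
    have hcont : Continuous fun x : E => ⟪stdOrthonormalBasis ℝ E i, x⟫ := continuous_const.inner continuous_id
    have hmem : (⟨fun x : E => ⟪stdOrthonormalBasis ℝ E i, x⟫, hcont⟩ : C(E, ℝ)) ∈ A :=
      ⟨1, by rw [pow_one]; exact PS_basis i⟩
    exact hcon _ ⟨_, hmem, rfl⟩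
  obtain ⟨p, ⟨m, hp⟩, hpf⟩ := ContinuousMap.exists_mem_subalgebra_near_continuous_of_isCompact_of_separatesPoints
    hA ⟨f, hf⟩ (isCompact_sphere (0:E) 1) hη
  have hp2 : (p : E → ℝ) ∈ (PS E) ^ (m + 2) := PP_mono (by omega) hp
  obtain ⟨q, hq, hqL⟩ := poisson_poly m (Lap_mem hp2)
  have hw : (fun x : E => 1 - ‖x‖ ^ 2) * q ∈ (PS E) ^ (m + 2) := by
    rw [add_comm, pow_add]
    exact Submodule.mul_mem_mul one_sub_mem hq
  set w := (fun x : E => 1 - ‖x‖ ^ 2) * q with hwdef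
  have hw1 : ContDiff ℝ (⊤ : ℕ∞) ((-1 : ℝ) • w) := (PP_smooth hw).const_smul (-1 : ℝ)
  have hsm : ContDiff ℝ (⊤ : ℕ∞) ((p : E → ℝ) + (-1 : ℝ) • w) :=
    (PP_smooth hp).add hw1
  refine ⟨(p : E → ℝ) + (-1 : ℝ) • w, hsm, fun x _ => ⟨hsm.contDiffAt, ?_⟩, fun x hx => ?_⟩
  · obtain ⟨B, hB, ht⟩ := D2_smooth hsm x
    refine ⟨B, hB, ?_⟩
    rw [ht, Lap_add (PP_smooth hp) hw1, Lap_smul (PP_smooth hw), hqL]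
    simp
  · have := hpf x (by simpa using hx)
    simp only [Pi.add_apply, Pi.smul_apply, hwdef, Pi.mul_apply, hx]
    simpa using this.le

end
end OP

namespace OP
open scoped RealInnerProductSpace Topology
open Module

section
variable {E : Type*} [NormedAddCommGroup E] [InnerProductSpace ℝ E] [FiniteDimensional ℝ E]
  [MeasurableSpace E] [BorelSpace E]

/-- one-dimensional ray lemma -/
lemma ray {f : ℝ → ℝ} {T c : ℝ} (hf : ContinuousOn f (Icc 0 T)) (h0 : 0 < f 0)
    (hd : ∀ t ∈ Ico 0 T, 0 < f t → ∃ d, c ≤ d ∧ HasDerivAt f d t) {s : ℝ} (hs : s ∈ Icc 0 T)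
    (hpos : 0 < f 0 + c * s) : f 0 + c * s ≤ f s := by
  have key : ∀ δ > 0, 0 < f 0 + (c - δ) * s → f 0 + (c - δ) * s ≤ f s := by
    intro δ hδ hp
    have hfs : ContinuousOn f (Icc 0 s) := hf.mono (Icc_subset_Icc_right hs.2)
    have hcl : IsClosed ({t | f 0 + (c - δ) * t ≤ f t} ∩ Icc 0 s) := by
      have : {t | f 0 + (c - δ) * t ≤ f t} ∩ Icc 0 s = Icc 0 s ∩ {t | f 0 + (c - δ) * t ≤ f t} := inter_comm _ _
      rw [this]
      exact isClosed_Icc.isClosed_le (by fun_prop) hfs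
    have := hcl.Icc_subset_of_forall_exists_gt (a := 0) (b := s) (by simp) ?_
    · exact this ⟨hs.1, le_rfl⟩
    · rintro x ⟨hx, hx0, hxs⟩ y hy
      have hlx : 0 < f 0 + (c - δ) * x := by
        rcases le_total 0 (c - δ) with h | h
        · have := mul_nonneg h hx0; linarith
        · nlinarith
      have hx' : f 0 + (c - δ) * x ≤ f x := hx
      obtain ⟨d, hcd, hder⟩ := hd x ⟨hx0, hxs.trans_le hs.2⟩ (hlx.trans_le hx')
      have h1 : ∀ᶠ z in 𝓝[>] x, c - δ < slope f x z := by
        have h2 := hder.tendsto_slope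
        have h3 : Tendsto (slope f x) (𝓝[>] x) (𝓝 d) := h2.mono_left (nhdsWithin_mono _ (fun z hz => ne_of_gt hz))
        exact h3.eventually_const_lt (by linarith)
      have h4 : ∀ᶠ z in 𝓝[>] x, z ∈ Ioc x y := Ioc_mem_nhdsGT hy
      obtain ⟨z, hz1, hz2⟩ := (h1.and h4).exists
      refine ⟨z, ?_, hz2⟩
      rw [slope_def_field, lt_div_iff₀ (sub_pos.2 hz2.1)] at hz1
      show f 0 + (c - δ) * z ≤ f z
      nlinarith
  have hlim : Tendsto (fun δ : ℝ => f 0 + (c - δ) * s) (𝓝[>] 0) (𝓝 (f 0 + c * s)) := by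
    have : Continuous fun δ : ℝ => f 0 + (c - δ) * s := by fun_prop
    have := (this.tendsto 0).mono_left (nhdsWithin_le_nhds (s := Ioi 0))
    simpa using this
  refine le_of_tendsto hlim ?_
  filter_upwards [hlim.eventually_const_lt hpos, self_mem_nhdsWithin] with δ h1 h2
  exact key δ h2 h1

/-- one-phase solutions on an open set, with gradient field G -/
structure Sol (u : E → ℝ) (G : E → E) (U : Set E) : Prop where
  op : IsOpen U
  cont : ∀ x ∈ U, ContinuousAt u x
  nonneg : ∀ x ∈ U, 0 ≤ u x
  harm : Harm u G (U ∩ {x | 0 < u x})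
  gcont : ∀ x ∈ U, x ∈ closure {x | 0 < u x} → ContinuousWithinAt G (closure {x | 0 < u x}) x
  norm1 : ∀ x ∈ U, x ∈ closure {x | 0 < u x} → u x = 0 → ‖G x‖ = 1

variable {u : E → ℝ} {G : E → E} {U : Set E}

lemma Sol.mono {V : Set E} (S : Sol u G U) (hV : IsOpen V) (hVU : V ⊆ U) : Sol u G V :=
  ⟨hV, fun x hx => S.cont x (hVU hx), fun x hx => S.nonneg x (hVU hx),
    S.harm.mono (inter_subset_inter_left _ hVU), fun x hx => S.gcont x (hVU hx), fun x hx => S.norm1 x (hVU hx)⟩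

lemma Sol.grad (S : Sol u G U) {x : E} (hx : x ∈ U) (hp : 0 < u x) : HasGradientAt u (G x) x :=
  S.harm.grad ⟨hx, hp⟩

lemma Sol.deriv_line (S : Sol u G U) {x v : E} {t : ℝ} (hx : x + t • v ∈ U) (hp : 0 < u (x + t • v)) :
    HasDerivAt (fun t : ℝ => u (x + t • v)) ⟪G (x + t • v), v⟫ t := by
  have hl : HasDerivAt (fun t : ℝ => x + t • v) v t := by
    simpa using ((hasDerivAt_id t).smul_const v).const_add x
  have := (hasGradientAt_iff.1 (S.grad hx hp)).comp_hasDerivAt t hl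
  rw [innerSL_apply_apply] at this
  exact this

lemma Sol.cont_line (S : Sol u G U) {x v : E} {s : Set ℝ} (hx : ∀ t ∈ s, x + t • v ∈ U) :
    ContinuousOn (fun t : ℝ => u (x + t • v)) s := by
  intro t ht
  have h1 : ContinuousAt (fun t : ℝ => x + t • v) t := by fun_prop
  exact (ContinuousAt.comp (f := fun t : ℝ => x + t • v) (S.cont _ (hx t ht)) h1).continuousWithinAt

/-- growth at free boundary points -/
lemma Sol.growth (S : Sol u G U) {x0 : E} (hx : x0 ∈ U) (hcl : x0 ∈ closure {x | 0 < u x}) (h0 : u x0 = 0)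
    {η : ℝ} (hη : 0 < η) : ∀ᶠ x in 𝓝 x0, u x ≤ (1 + η) * ‖x - x0‖ := by
  have h1 : ∀ᶠ x in 𝓝[closure {x | 0 < u x}] x0, ‖G x‖ < 1 + η := by
    have := (S.gcont x0 hx hcl).norm.tendsto
    rw [S.norm1 x0 hx hcl h0] at this
    exact this.eventually_lt_const (by linarith)
  rw [eventually_nhdsWithin_iff] at h1
  obtain ⟨r, hr, hb⟩ := Metric.eventually_nhds_iff_ball.1 (h1.and (S.op.mem_nhds hx))
  filter_upwards [ball_mem_nhds x0 hr] with x hxr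
  by_contra hcon
  push Not at hcon
  have hseg : ∀ t ∈ Icc (0:ℝ) 1, x + t • (x0 - x) ∈ ball x0 r := by
    intro t ht
    have := (convex_ball x0 r).add_smul_sub_mem hxr (mem_ball_self hr) ht
    exact this
  have hp : 0 < u x := lt_of_le_of_lt (by positivity) hcon
  have := ray (f := fun t : ℝ => u (x + t • (x0 - x))) (T := 1) (c := -((1 + η) * ‖x - x0‖))
    (S.cont_line fun t ht => (hb _ (hseg t ht)).2) (by simpa using hp)
    (fun t ht hpt => ⟨_, ?_, S.deriv_line (hb _ (hseg t ⟨ht.1, ht.2.le⟩)).2 hpt⟩) (s := 1) (by simp)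
    (by simp; linarith)
  · simp at this
    linarith
  · have h2 := (hb _ (hseg t ⟨ht.1, ht.2.le⟩)).1 (subset_closure hpt)
    have h3 := neg_le_of_abs_le (abs_real_inner_le_norm (G (x + t • (x0 - x))) (x0 - x))
    have h4 : ‖G (x + t • (x0 - x))‖ * ‖x0 - x‖ ≤ (1 + η) * ‖x - x0‖ := by
      rw [norm_sub_rev x0 x]; gcongr
    linarith

/-- nondegeneracy at free boundary points -/
lemma Sol.nondeg (S : Sol u G U) {x0 : E} (hx : x0 ∈ U) (hcl : x0 ∈ closure {x | 0 < u x}) (h0 : u x0 = 0)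
    {η : ℝ} (hη : 0 < η) (hη1 : η < 1) : ∀ᶠ s in 𝓝[>] (0:ℝ), (1 - η) * s ≤ u (x0 + s • G x0) := by
  set ν := G x0 with hν
  have hn : ‖ν‖ = 1 := S.norm1 x0 hx hcl h0
  have h1 : ∀ᶠ x in 𝓝[closure {x | 0 < u x}] x0, 1 - η < ⟪G x, ν⟫ := by
    have h := S.gcont x0 hx hcl
    have := (h.inner (𝕜 := ℝ) (continuousWithinAt_const (b := ν))).tendsto
    rw [← hν, real_inner_self_eq_norm_sq, hn] at this
    exact this.eventually_const_lt (by linarith)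
  rw [eventually_nhdsWithin_iff] at h1
  obtain ⟨r, hr, hb⟩ := Metric.eventually_nhds_iff_ball.1 (h1.and (S.op.mem_nhds hx))
  have h2 : ∀ᶠ s in 𝓝[>] (0:ℝ), s ∈ Ioo 0 (r / 2) := Ioo_mem_nhdsGT (by positivity)
  filter_upwards [h2] with s hs
  have hms : x0 + s • ν ∈ U := by
    refine (hb _ ?_).2
    rw [mem_ball, dist_eq_norm, add_sub_cancel_left, norm_smul, hn, Real.norm_of_nonneg hs.1.le]
    linarith [hs.2]
  -- approximate
  have hne : (𝓝[{x | 0 < u x}] x0).NeBot := mem_closure_iff_nhdsWithin_neBot.1 hcl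
  have hlim : Tendsto (fun x1 => u (x1 + s • ν)) (𝓝[{x | 0 < u x}] x0) (𝓝 (u (x0 + s • ν))) := by
    have hc : ContinuousAt (fun x1 : E => x1 + s • ν) x0 := by fun_prop
    exact (ContinuousAt.comp (f := fun x1 : E => x1 + s • ν) (S.cont _ hms) hc).tendsto.mono_left nhdsWithin_le_nhds
  refine ge_of_tendsto hlim ?_
  have hb2 : ∀ᶠ x1 in 𝓝[{x | 0 < u x}] x0, x1 ∈ ball x0 (r / 2) :=
    nhdsWithin_le_nhds (ball_mem_nhds x0 (by positivity))
  filter_upwards [hb2, self_mem_nhdsWithin] with x1 hx1 hp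
  have hseg : ∀ t ∈ Icc (0:ℝ) s, x1 + t • ν ∈ ball x0 r := by
    intro t ht
    rw [mem_ball, dist_eq_norm] at *
    have e : x1 + t • ν - x0 = (x1 - x0) + t • ν := by abel
    have h5 := norm_add_le (x1 - x0) (t • ν)
    rw [norm_smul, hn, Real.norm_of_nonneg ht.1] at h5
    rw [e]
    linarith [ht.2, hs.2]
  have hp' : 0 < u x1 := hp
  have := ray (f := fun t : ℝ => u (x1 + t • ν)) (T := s) (c := 1 - η)
    (S.cont_line fun t ht => (hb _ (hseg t ht)).2) (by simpa using hp)
    (fun t ht hpt => ⟨_, ((hb _ (hseg t ⟨ht.1, ht.2.le⟩)).1 (subset_closure hpt)).le,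
      S.deriv_line (hb _ (hseg t ⟨ht.1, ht.2.le⟩)).2 hpt⟩) (s := s) ⟨hs.1.le, le_rfl⟩
    (by have := hs.1; simp; nlinarith)
  simp at this
  linarith

lemma grad_slope {v : E → ℝ} {a x0 : E} (hv : HasGradientAt v a x0) (d : E) :
    Tendsto (fun s : ℝ => s⁻¹ * (v (x0 + s • d) - v x0)) (𝓝[>] 0) (𝓝 ⟪a, d⟫) := by
  have hl : HasDerivAt (fun t : ℝ => x0 + t • d) d 0 := by
    simpa using ((hasDerivAt_id (0:ℝ)).smul_const d).const_add x0
  have hv' : HasFDerivAt v (innerSL ℝ a) (x0 + (0:ℝ) • d) := by simpa using hasGradientAt_iff.1 hv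
  have h := hv'.comp_hasDerivAt (0:ℝ) hl
  have := h.tendsto_slope_zero_right
  simpa using this

lemma Sol.touch_below (S : Sol u G U) {x0 : E} (hx : x0 ∈ U) (hcl : x0 ∈ closure {x | 0 < u x}) (h0 : u x0 = 0)
    {v : E → ℝ} {a : E} (hv : HasGradientAt v a x0) (ht : ∀ᶠ x in 𝓝 x0, v x - v x0 ≤ u x) : ‖a‖ ≤ 1 := by
  by_contra hcon
  push Not at hcon
  have h1 := grad_slope hv a
  have hlim : Tendsto (fun s : ℝ => x0 + s • a) (𝓝[>] 0) (𝓝 x0) := by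
    have : Continuous fun s : ℝ => x0 + s • a := by fun_prop
    have := (this.tendsto 0).mono_left (nhdsWithin_le_nhds (s := Ioi 0))
    simpa using this
  have hb : ∀ η > 0, ⟪a, a⟫ ≤ (1 + η) * ‖a‖ := by
    intro η hη
    refine le_of_tendsto h1 ?_
    filter_upwards [hlim.eventually ht, hlim.eventually (S.growth hx hcl h0 hη), self_mem_nhdsWithin] with s h2 h3 h4
    have h4' : (0:ℝ) < s := h4
    rw [add_sub_cancel_left, norm_smul, Real.norm_of_nonneg h4'.le] at h3
    rw [inv_mul_le_iff₀ h4']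
    linarith
  have := hb ((‖a‖ - 1) / 2) (by linarith)
  rw [real_inner_self_eq_norm_sq] at this
  nlinarith

lemma Sol.touch_above (S : Sol u G U) {x0 : E} (hx : x0 ∈ U) (hcl : x0 ∈ closure {x | 0 < u x}) (h0 : u x0 = 0)
    {v : E → ℝ} {a : E} (hv : HasGradientAt v a x0) (ht : ∀ᶠ x in 𝓝 x0, 0 < u x → u x ≤ v x - v x0) :
    1 ≤ ⟪a, G x0⟫ := by
  have h1 := grad_slope hv (G x0)
  have hlim : Tendsto (fun s : ℝ => x0 + s • G x0) (𝓝[>] 0) (𝓝 x0) := by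
    have : Continuous fun s : ℝ => x0 + s • G x0 := by fun_prop
    have := (this.tendsto 0).mono_left (nhdsWithin_le_nhds (s := Ioi 0))
    simpa using this
  refine le_of_forall_pos_lt_add fun η hη => ?_
  set η' := min (η / 2) (1 / 2) with hη'
  have hp : 0 < η' := by positivity
  have hlt : η' < 1 := (min_le_right _ _).trans_lt (by norm_num)
  have : 1 - η' ≤ ⟪a, G x0⟫ := by
    refine ge_of_tendsto h1 ?_
    filter_upwards [hlim.eventually ht, S.nondeg hx hcl h0 hp hlt, self_mem_nhdsWithin] with s h2 h3 h4
    have h4' : (0:ℝ) < s := h4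
    rw [le_inv_mul_iff₀ h4']
    have := h2 (lt_of_lt_of_le (by nlinarith) h3)
    linarith
  have := min_le_left (η / 2) (1 / 2)
  linarith

/-- comparison from below -/
lemma Sol.comp_below (S : Sol u G U) {K : Set E} (hK : IsCompact K) (hKU : K ⊆ U) {v : E → ℝ} {g : E → E}
    (hvc : ContinuousOn v K) (hv : ∀ x ∈ interior K, ∃ B, D2 v g B x ∧ 0 < tr B)
    (hfb : ∀ x ∈ interior K, x ∈ closure {x | 0 < u x} → u x = 0 → v x ≤ 0 ∨ 1 < ‖g x‖)
    (hbd : ∀ x ∈ K, x ∉ interior K → v x ≤ u x) : ∀ x ∈ K, v x ≤ u x := by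
  intro x hx
  have hc : ContinuousOn (fun y => u y - v y) K := ContinuousOn.sub
    (fun y hy => (S.cont y (hKU hy)).continuousWithinAt) hvc
  obtain ⟨z, hz, hmin⟩ := hK.exists_isMinOn ⟨x, hx⟩ hc
  by_contra hcon
  push Not at hcon
  have hzx : u z - v z ≤ u x - v x := hmin hx
  have hzneg : u z < v z := by linarith
  have hzi : z ∈ interior K := by
    by_contra h
    have := hbd z hz h
    linarith
  obtain ⟨B, hB, htr⟩ := hv z hzi
  have hloc : ∀ᶠ y in 𝓝 z, u z - v z ≤ u y - v y := by
    filter_upwards [mem_interior_iff_mem_nhds.1 hzi] with y hy using hmin hy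
  rcases (S.nonneg z (hKU hz)).lt_or_eq with hp | h0
  · obtain ⟨_, B', hB', h0'⟩ := S.harm z ⟨hKU hz, hp⟩
    have := ((hB'.sub hB).min_tr hloc).2
    rw [tr_sub] at this
    linarith
  · by_cases hcl : z ∈ closure {x | 0 < u x}
    · rcases hfb z hzi hcl h0.symm with h | h
      · linarith
      · have := S.touch_below (hKU hz) hcl h0.symm hB.1.self_of_nhds (by
          filter_upwards [hloc] with y hy
          linarith)
        linarith
    · have hloc2 : IsLocalMin (fun y => - v y) z := by
        filter_upwards [hloc, isClosed_closure.isOpen_compl.mem_nhds hcl,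
          S.op.mem_nhds (hKU hz)] with y hy hy2 hy3
        have : u y = 0 := by
          by_contra hne
          exact hy2 (subset_closure (lt_of_le_of_ne (S.nonneg y hy3) (Ne.symm hne)))
        linarith
      have := (hB.neg.min_tr hloc2).2
      rw [tr_neg] at this
      linarith

/-- comparison from above -/
lemma Sol.comp_above (S : Sol u G U) {K : Set E} (hK : IsCompact K) (hKU : K ⊆ U) {v : E → ℝ} {g : E → E}
    (hvc : ContinuousOn v K) (hv : ∀ x ∈ interior K, ∃ B, D2 v g B x ∧ tr B < 0)
    (hfb : ∀ x ∈ interior K, x ∈ closure {x | 0 < u x} → u x = 0 → ‖g x‖ < 1)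
    (hbd : ∀ x ∈ K, x ∉ interior K → x ∈ closure {x | 0 < u x} → u x ≤ v x) :
    ∀ x ∈ K, x ∈ closure {x | 0 < u x} → u x ≤ v x := by
  intro x hx hxcl
  have hc : ContinuousOn (fun y => u y - v y) K := ContinuousOn.sub
    (fun y hy => (S.cont y (hKU hy)).continuousWithinAt) hvc
  obtain ⟨z, ⟨hz, hcl⟩, hmax⟩ := (hK.inter_right isClosed_closure).exists_isMaxOn ⟨x, hx, hxcl⟩
    (hc.mono inter_subset_left)
  by_contra hcon
  push Not at hcon
  have hzx : u x - v x ≤ u z - v z := hmax ⟨hx, hxcl⟩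
  have hzneg : v z < u z := by linarith
  have hzi : z ∈ interior K := by
    by_contra h
    have := hbd z hz h hcl
    linarith
  obtain ⟨B, hB, htr⟩ := hv z hzi
  have hloc : ∀ᶠ y in 𝓝 z, 0 < u y → u y - v y ≤ u z - v z := by
    filter_upwards [mem_interior_iff_mem_nhds.1 hzi] with y hy hp
    exact hmax ⟨hy, subset_closure hp⟩
  rcases (S.nonneg z (hKU hz)).lt_or_eq with hp | h0
  · obtain ⟨_, B', hB', h0'⟩ := S.harm z ⟨hKU hz, hp⟩
    have hl : IsLocalMin (fun y => v y - u y) z := by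
      filter_upwards [hloc, (S.cont z (hKU hz)).eventually_const_lt hp] with y hy hy2
      have := hy hy2
      linarith
    have := ((hB.sub hB').min_tr hl).2
    rw [tr_sub] at this
    linarith
  · have h1 := S.touch_above (hKU hz) hcl h0.symm hB.1.self_of_nhds (by
      filter_upwards [hloc] with y hy hp
      have := hy hp
      linarith)
    have h2 := hfb z hzi hcl h0.symm
    have h3 := real_inner_le_norm (g z) (G z)
    rw [S.norm1 z (hKU hz) hcl h0.symm] at h3
    linarith

end
end OP

namespace OP
open scoped RealInnerProductSpace Topology
open Module

section
variable {E : Type*} [NormedAddCommGroup E] [InnerProductSpace ℝ E] [FiniteDimensional ℝ E]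
  [MeasurableSpace E] [BorelSpace E]

variable {u : E → ℝ} {G : E → E} {U : Set E}

/-- Gaussian barrier -/
lemma D2_gauss (α : ℝ) (c x : E) :
    ∃ B : E →L[ℝ] E, D2 (fun y => Real.exp (-α * ‖y - c‖ ^ 2)) (fun y => (-2 * α * Real.exp (-α * ‖y - c‖ ^ 2)) • (y - c)) B x ∧
      tr B = Real.exp (-α * ‖x - c‖ ^ 2) * (4 * α ^ 2 * ‖x - c‖ ^ 2 - 2 * α * finrank ℝ E) := by
  have h1 : ∀ y : E, HasFDerivAt (fun y : E => ‖y - c‖ ^ 2) ((2:ℝ) • innerSL ℝ (y - c)) y := by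
    intro y
    have := (hasStrictFDerivAt_norm_sq (y - c)).hasFDerivAt.comp y ((hasFDerivAt_id y).sub_const c)
    refine this.congr_fderiv ?_
    ext w; simp
  have h2 : ∀ y : E, HasFDerivAt (fun y : E => Real.exp (-α * ‖y - c‖ ^ 2))
      (innerSL ℝ ((-2 * α * Real.exp (-α * ‖y - c‖ ^ 2)) • (y - c))) y := by
    intro y
    refine ((h1 y).const_mul (-α)).exp.congr_fderiv ?_
    ext w; simp [inner_smul_left]; ring
  have h3 := ((h2 x).const_mul (-2 * α)).smul ((hasFDerivAt_id x).sub_const c)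
  refine ⟨_, ⟨Eventually.of_forall fun y => h2 y, h3⟩, ?_⟩
  rw [tr_add, tr_smul, tr_smulRight, tr_id]
  simp only [_root_.smul_apply, innerSL_apply_apply, inner_smul_left, real_inner_self_eq_norm_sq]
  simp
  ring

lemma Sol.le_cl (S : Sol u G U) {v : E → ℝ} (hv : Continuous v) (h : ∀ x ∈ U, u x ≤ max (v x) 0) {x : E} (hx : x ∈ U)
    (hcl : x ∈ closure {x | 0 < u x}) : u x ≤ v x := by
  have hne : (𝓝[{x | 0 < u x}] x).NeBot := mem_closure_iff_nhdsWithin_neBot.1 hcl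
  refine le_of_tendsto_of_tendsto ((S.cont x hx).tendsto.mono_left nhdsWithin_le_nhds)
    ((hv.tendsto x).mono_left (nhdsWithin_le_nhds (s := {x | 0 < u x}))) ?_
  filter_upwards [self_mem_nhdsWithin, nhdsWithin_le_nhds (S.op.mem_nhds hx)] with y hy hyU
  have := h y hyU
  rcases le_max_iff.1 this with h | h
  · exact h
  · exact absurd hy (not_lt.2 h)

set_option maxHeartbeats 1600000
variable (E) in
/-- partial Harnack inequality (De Silva) -/
lemma DS1 [Nontrivial E] : ∃ c ∈ Ioo (0:ℝ) (1/2), ∃ ε0 > 0, ∀ (u : E → ℝ) (G : E → E) (e : E) (a b : ℝ),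
    ‖e‖ = 1 → Sol u G (ball 0 1) → |a| ≤ 1 / 10 → a ≤ b → b - a ≤ ε0 →
    (∀ x ∈ ball (0:E) 1, max (⟪e, x⟫ + a) 0 ≤ u x ∧ u x ≤ max (⟪e, x⟫ + b) 0) →
    ∃ a' b', a ≤ a' ∧ b' ≤ b ∧ a' ≤ b' ∧ b' - a' = (1 - c) * (b - a) ∧
    (∀ x ∈ ball (0:E) (1/20), max (⟪e, x⟫ + a') 0 ≤ u x ∧ u x ≤ max (⟪e, x⟫ + b') 0) := by
  obtain ⟨C, hC, hest⟩ := harm_est E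
  set n : ℝ := ((finrank ℝ E : ℕ) : ℝ) with hn
  have hn0 : 0 < n := by rw [hn]; exact_mod_cast finrank_pos
  set ρ := 1 / (40 * C) with hρ
  have hρ0 : 0 < ρ := by positivity
  have hρ1 : ρ ≤ 1 / 40 := by
    rw [hρ]; gcongr; linarith
  set α := n / ρ ^ 2 with hα
  have hα0 : 0 < α := by positivity
  have hαρ : α * ρ ^ 2 = n := by rw [hα]; field_simp
  set w0 := Real.exp (-α * (1/4) ^ 2) - Real.exp (-α * (3/4) ^ 2) with hw0
  have hw0p : 0 < w0 := sub_pos.2 (Real.exp_lt_exp.2 (by nlinarith))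
  have hw01 : w0 < 1 := by
    have h1 : Real.exp (-α * (1/4) ^ 2) ≤ 1 := Real.exp_le_one_iff.2 (by nlinarith)
    have := Real.exp_pos (-α * (3/4) ^ 2)
    linarith
  refine ⟨w0 / 4, ⟨by linarith, by linarith⟩, 1 / (2 * α), by positivity, ?_⟩
  intro u G e a b he S ha hab hδ hfl
  set δ := b - a with hδd
  have hδ0 : 0 ≤ δ := by linarith
  obtain ⟨ha1, ha2⟩ := abs_le.1 ha
  set xb : E := (1/5 : ℝ) • e with hxb
  have hxbn : ‖xb‖ = 1 / 5 := by rw [hxb, norm_smul, he]; norm_num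
  have hexb : ⟪e, xb⟫ = 1 / 5 := by
    rw [hxb, inner_smul_right, real_inner_self_eq_norm_sq, he]; norm_num
  have hin : ∀ x : E, ⟪e, x⟫ = 1 / 5 + ⟪e, x - xb⟫ := fun x => by rw [inner_sub_right, hexb]; ring
  have hein : ∀ y : E, |⟪e, y⟫| ≤ ‖y‖ := fun y => by
    have := abs_real_inner_le_norm e y
    rwa [he, one_mul] at this
  have hsub : ∀ x : E, ‖x - xb‖ ≤ 3 / 4 → x ∈ ball (0:E) 1 := by
    intro x hx
    rw [mem_ball_zero_iff]
    have := norm_add_le (x - xb) xb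
    rw [sub_add_cancel] at this
    linarith
  have hpos : ∀ x ∈ ball xb (1/10), 0 < ⟪e, x⟫ + a := by
    intro x hx
    rw [mem_ball, dist_eq_norm] at hx
    have := abs_le.1 (hein (x - xb))
    rw [hin x]; linarith
  have hball : ball xb (1/10) ⊆ ball 0 1 ∩ {x | 0 < u x} := by
    intro x hx
    have h1 : x ∈ ball (0:E) 1 := hsub x (by rw [mem_ball, dist_eq_norm] at hx; linarith)
    exact ⟨h1, (hpos x hx).trans_le ((le_max_left _ _).trans (hfl x h1).1)⟩
  have hh0 : ∀ x ∈ ball xb (1/10), 0 ≤ u x - (⟪e, x⟫ + a) ∧ u x - (⟪e, x⟫ + a) ≤ δ := by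
    intro x hx
    have h1 := hfl x (hball hx).1
    have h2 := (le_max_left _ _).trans h1.1
    rw [max_eq_left (by linarith [hpos x hx] : (0:ℝ) ≤ ⟪e, x⟫ + b)] at h1
    exact ⟨by linarith, by linarith [h1.2]⟩
  have hH := (hest _ _ xb (1/10) δ (by norm_num) ((S.harm.mono hball).sub_affine e a) (fun y hy => by
    rw [abs_of_nonneg (hh0 y hy).1]; exact (hh0 y hy).2)).1
  have hcore : ∀ x, ‖x - xb‖ ≤ ρ → |(u x - (⟪e, x⟫ + a)) - (u xb - (⟪e, xb⟫ + a))| ≤ δ / 4 := by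
    intro x hx
    have h1 := hH x (by rw [mem_ball, dist_eq_norm]; linarith)
    refine h1.trans ?_
    have : C * δ * (‖x - xb‖ / (1/10)) ≤ C * δ * (ρ / (1 / 10)) := by gcongr
    refine this.trans (le_of_eq ?_)
    rw [hρ]; field_simp; ring
  set K : Set E := closedBall xb (3/4) \ ball xb ρ with hK
  have hKc : IsCompact K := (isCompact_closedBall xb (3/4)).diff isOpen_ball
  have hKm : ∀ x ∈ K, ρ ≤ ‖x - xb‖ ∧ ‖x - xb‖ ≤ 3 / 4 := by
    rintro x ⟨h1, h2⟩
    rw [mem_closedBall, dist_eq_norm] at h1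
    rw [mem_ball, dist_eq_norm, not_lt] at h2
    exact ⟨h2, h1⟩
  have hKU : K ⊆ ball (0:E) 1 := fun x hx => hsub x (hKm x hx).2
  have hKi : ∀ x ∈ K, x ∉ interior K → ‖x - xb‖ = ρ ∨ ‖x - xb‖ = 3 / 4 := by
    intro x hx hxi
    by_contra hcon
    push Not at hcon
    obtain ⟨h1, h2⟩ := hKm x hx
    have h3 := lt_of_le_of_ne h1 (Ne.symm hcon.1)
    have h4 := lt_of_le_of_ne h2 hcon.2
    apply hxi
    rw [mem_interior]
    refine ⟨ball xb (3/4) \ closedBall xb ρ, ?_, isOpen_ball.sdiff isClosed_closedBall, ?_⟩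
    · exact sdiff_subset_sdiff ball_subset_closedBall ball_subset_closedBall
    · refine ⟨by rw [mem_ball, dist_eq_norm]; exact h4, by rw [mem_closedBall, dist_eq_norm]; linarith⟩
  set w : E → ℝ := fun y => Real.exp (-α * ‖y - xb‖ ^ 2) with hw
  set k1 := Real.exp (-α * (3/4) ^ 2) with hk1
  have hk10 : 0 < k1 := Real.exp_pos _
  have hwpos : ∀ y, 0 < w y := fun y => Real.exp_pos _
  have hw1 : ∀ y, w y ≤ 1 := fun y => Real.exp_le_one_iff.2 (by nlinarith [sq_nonneg ‖y - xb‖])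
  have hwc : Continuous w := by rw [hw]; fun_prop
  have hwD : ∀ x ∈ K, ∃ B : E →L[ℝ] E, D2 w (fun y => (-2 * α * w y) • (y - xb)) B x ∧ 0 < tr B := by
    intro x hx
    obtain ⟨B, hB, ht⟩ := D2_gauss α xb x
    refine ⟨B, hB, ?_⟩
    rw [ht]
    refine mul_pos (Real.exp_pos _) ?_
    have h1 := (hKm x hx).1
    have h2 : n ≤ α * ‖x - xb‖ ^ 2 := by
      rw [← hαρ]; gcongr
    rw [← hn]
    nlinarith
  have hball20 : ∀ x ∈ ball (0:E) (1/20), ‖x - xb‖ ≤ 1 / 4 := by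
    intro x hx
    have := norm_sub_le x xb
    rw [mem_ball_zero_iff] at hx
    linarith
  have hw14 : ∀ x ∈ ball (0:E) (1/20), w0 ≤ w x - k1 := by
    intro x hx
    have := hball20 x hx
    have h2 : Real.exp (-α * (1/4) ^ 2) ≤ w x := by
      refine Real.exp_le_exp.2 ?_
      have : ‖x - xb‖ ^ 2 ≤ (1/4) ^ 2 := by gcongr
      nlinarith
    rw [hw0]; linarith
  have hFB : ∀ x ∈ K, u x = 0 → ⟪e, x - xb⟫ ≤ -(1/10) := by
    intro x hx h0
    have h1 := (le_max_left _ _).trans (hfl x (hKU hx)).1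
    rw [hin x, h0] at h1
    linarith
  have hK34 : ∀ x, ‖x - xb‖ = 3 / 4 → w x = k1 := fun x hx => by simp only [hw, hx, hk1]
  have hdich : ∀ x ∈ ball (0:E) (1/20), ‖x - xb‖ ≤ ρ ∨ x ∈ K := by
    intro x hx
    rcases le_total ‖x - xb‖ ρ with h | h
    · exact Or.inl h
    · refine Or.inr ⟨?_, ?_⟩
      · rw [mem_closedBall, dist_eq_norm]; linarith [hball20 x hx]
      · rw [mem_ball, dist_eq_norm]; linarith
  have hb20 : ∀ x ∈ ball (0:E) (1/20), x ∈ ball (0:E) 1 := fun x hx => ball_subset_ball (by norm_num) hx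
  have hgn : ∀ (s : ℝ) (x : E), ‖e + s • (x - xb)‖ ^ 2 = 1 + 2 * s * ⟪e, x - xb⟫ + s ^ 2 * ‖x - xb‖ ^ 2 := by
    intro s x
    rw [norm_add_sq_real, he, inner_smul_right, norm_smul, mul_pow, Real.norm_eq_abs, sq_abs]
    ring
  rcases le_total (δ / 2) (u xb - (⟪e, xb⟫ + a)) with hcase | hcase
  · -- raise from below
    refine ⟨a + δ / 4 * w0, b, by linarith [mul_nonneg hδ0 hw0p.le], le_rfl, by linarith [mul_le_mul_of_nonneg_left hw01.le hδ0], by rw [hδd]; ring, ?_⟩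
    have hdeep : ∀ x, ‖x - xb‖ ≤ ρ → ⟪e, x⟫ + a + δ / 4 ≤ u x := by
      intro x hx
      have := abs_le.1 (hcore x hx)
      linarith
    rcases hδ0.eq_or_lt with hz | hδp
    · intro x hx
      rw [← hz]
      have := hfl x (hb20 x hx)
      simpa using this
    have hcmp := S.comp_below hKc hKU (v := fun y => (⟪e, y⟫ + (a - δ / 4 * k1)) + δ / 4 * w y)
      (g := fun y => e + (δ / 4) • ((-2 * α * w y) • (y - xb)))
      (by have : Continuous fun y : E => ⟪e, y⟫ := continuous_const.inner continuous_id
          fun_prop)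
      (fun x hx => by
        obtain ⟨B, hB, ht⟩ := hwD x (interior_subset hx)
        refine ⟨_, (D2_inner e _ x).add (hB.const_mul (δ / 4)), ?_⟩
        rw [tr_add, tr_zero, tr_smul]
        positivity)
      (fun x hx hcl h0 => by
        right
        have h1 := hFB x (interior_subset hx) h0
        rw [smul_smul]
        have h2 := hgn (δ / 4 * (-2 * α * w x)) x
        have h3 : 0 < δ / 4 * (2 * α * w x) := by have := hwpos x; positivity
        have h4 : 1 < ‖e + (δ / 4 * (-2 * α * w x)) • (x - xb)‖ ^ 2 := by
          rw [h2]
          have := mul_nonneg (sq_nonneg (δ / 4 * (-2 * α * w x))) (sq_nonneg ‖x - xb‖)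
          have h9 := mul_le_mul_of_nonneg_left h1 h3.le
          linarith
        exact (one_lt_sq_iff₀ (norm_nonneg _)).1 h4)
      (fun x hx hxi => by
        rcases hKi x hx hxi with h | h
        · have := hdeep x h.le
          have h8 := mul_le_mul_of_nonneg_left (hw1 x) hδp.le
          have h9 := mul_pos hδp hk10
          linarith
        · rw [hK34 x h]
          have := (le_max_left _ _).trans (hfl x (hKU hx)).1
          linarith)
    intro x hx
    refine ⟨max_le ?_ (S.nonneg x (hb20 x hx)), (hfl x (hb20 x hx)).2⟩
    rcases hdich x hx with h | h
    · have := hdeep x h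
      have h8 := mul_lt_mul_of_pos_left hw01 hδp
      linarith
    · have h1 := hcmp x h
      have h2 := mul_le_mul_of_nonneg_left (hw14 x hx) hδp.le
      linarith
  · refine ⟨a, b - δ / 4 * w0, le_rfl, by linarith [mul_nonneg hδ0 hw0p.le], by linarith [mul_le_mul_of_nonneg_left hw01.le hδ0], by rw [hδd]; ring, ?_⟩
    have hdeep : ∀ x, ‖x - xb‖ ≤ ρ → u x ≤ ⟪e, x⟫ + b - δ / 4 := by
      intro x hx
      have := abs_le.1 (hcore x hx)
      linarith
    rcases hδ0.eq_or_lt with hz | hδp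
    · intro x hx
      rw [← hz]
      have := hfl x (hb20 x hx)
      simpa using this
    have hδα : δ * α ≤ 1 / 2 := by
      rw [le_div_iff₀ (by positivity)] at hδ
      linarith
    have hcle : Continuous fun y : E => ⟪e, y⟫ := continuous_const.inner continuous_id
    have hcmp := S.comp_above hKc hKU (v := fun y => (⟪e, y⟫ + (b + δ / 4 * k1)) + (-(δ / 4)) * w y)
      (g := fun y => e + (-(δ / 4)) • ((-2 * α * w y) • (y - xb)))
      (by fun_prop)
      (fun x hx => by
        obtain ⟨B, hB, ht⟩ := hwD x (interior_subset hx)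
        refine ⟨_, (D2_inner e _ x).add (hB.const_mul (-(δ / 4))), ?_⟩
        rw [tr_add, tr_zero, tr_smul]
        have := mul_pos hδp ht
        linarith)
      (fun x hx hcl h0 => by
        have h1 := hFB x (interior_subset hx) h0
        have h5 := (hKm x (interior_subset hx)).2
        rw [smul_smul]
        set s := -(δ / 4) * (-2 * α * w x) with hs
        have h2 := hgn s x
        have hwx := hwpos x
        have h3 : 0 < s := by
          have : s = δ / 4 * (2 * α * w x) := by rw [hs]; ring
          rw [this]; positivity
        have h6 : s ≤ 1 / 4 := by
          have : s = (δ * α) * w x / 2 := by rw [hs]; ring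
          rw [this]
          have := mul_le_mul_of_nonneg_left (hw1 x) (mul_pos hδp hα0).le
          linarith
        have h7 : ‖x - xb‖ ^ 2 ≤ (3/4) ^ 2 := by gcongr
        have h4 : ‖e + s • (x - xb)‖ ^ 2 < 1 := by
          rw [h2]
          have h8 : s ^ 2 * ‖x - xb‖ ^ 2 ≤ s ^ 2 * (3/4) ^ 2 := by gcongr
          have h9 : s * ⟪e, x - xb⟫ ≤ s * (-(1/10)) := by gcongr
          have h10 : s ^ 2 ≤ s * (1/4) := by rw [sq]; gcongr
          linarith
        exact (sq_lt_one_iff₀ (norm_nonneg _)).1 h4)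
      (fun x hx hxi hcl => by
        rcases hKi x hx hxi with h | h
        · have := hdeep x h.le
          have h8 := mul_le_mul_of_nonneg_left (hw1 x) hδp.le
          have h9 := mul_pos hδp hk10
          linarith
        · rw [hK34 x h]
          have := S.le_cl (v := fun y => ⟪e, y⟫ + b) (by fun_prop) (fun y hy => (hfl y hy).2) (hKU hx) hcl
          linarith)
    intro x hx
    refine ⟨(hfl x (hb20 x hx)).1, ?_⟩
    rcases le_or_gt (u x) 0 with h0 | h0
    · exact le_max_of_le_right h0
    refine le_max_of_le_left ?_
    rcases hdich x hx with h | h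
    · have := hdeep x h
      have h8 := mul_lt_mul_of_pos_left hw01 hδp
      linarith
    · have h1 := hcmp x h (subset_closure h0)
      have h2 := mul_le_mul_of_nonneg_left (hw14 x hx) hδp.le
      linarith

end
end OP

namespace OP
open scoped RealInnerProductSpace Topology
open Module

section
variable {E : Type*} [NormedAddCommGroup E] [InnerProductSpace ℝ E] [FiniteDimensional ℝ E]
  [MeasurableSpace E] [BorelSpace E]

variable {u : E → ℝ} {G : E → E} {U : Set E}

lemma scale_cl (u : E → ℝ) {r : ℝ} (hr : 0 < r) (x0 z : E) :
    z ∈ closure {z | 0 < r⁻¹ * u (x0 + r • z)} ↔ x0 + r • z ∈ closure {x | 0 < u x} := by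
  let H : E ≃ₜ E := (Homeomorph.smulOfNeZero r hr.ne').trans (Homeomorph.addLeft x0)
  have h1 : {z | 0 < r⁻¹ * u (x0 + r • z)} = H ⁻¹' {x | 0 < u x} := by
    ext z
    have : H z = x0 + r • z := rfl
    simp only [mem_setOf_eq, mem_preimage, this]
    exact ⟨fun h => pos_of_mul_pos_right h (by positivity), fun h => by positivity⟩
  rw [h1, ← H.preimage_closure]
  rfl

lemma Sol.scale (S : Sol u G U) {r : ℝ} (hr : 0 < r) (x0 : E) :
    Sol (fun z => r⁻¹ * u (x0 + r • z)) (fun z => G (x0 + r • z)) ((fun z => x0 + r • z) ⁻¹' U) := by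
  have hc : Continuous fun z : E => x0 + r • z := by fun_prop
  refine ⟨S.op.preimage hc, ?_, ?_, ?_, ?_, ?_⟩
  · intro x hx
    exact ((S.cont _ hx).comp (f := fun z : E => x0 + r • z) hc.continuousAt).const_mul r⁻¹
  · intro x hx
    have := S.nonneg _ hx
    positivity
  · rintro x ⟨hx, hp⟩
    have hp' : 0 < u (x0 + r • x) := pos_of_mul_pos_right hp (by positivity)
    obtain ⟨h1, B, hB, ht⟩ := S.harm _ ⟨hx, hp'⟩
    refine ⟨?_, (r⁻¹) • ((r * r) • B), ?_, by rw [tr_smul, tr_smul, ht]; simp⟩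
    · exact contDiffAt_const.mul (ContDiffAt.comp x h1 (f := fun z : E => x0 + r • z) (by fun_prop))
    · have := hB.comp_affine.const_mul r⁻¹
      simp only [smul_smul, inv_mul_cancel₀ hr.ne', one_smul] at this ⊢
      exact this
  · intro x hx hcl
    rw [scale_cl u hr] at hcl
    refine (S.gcont _ hx hcl).comp (f := fun z : E => x0 + r • z) hc.continuousAt.continuousWithinAt ?_
    intro z hz
    exact (scale_cl u hr x0 z).1 hz
  · intro x hx hcl h0
    rw [scale_cl u hr] at hcl
    exact S.norm1 _ hx hcl (by
      rcases mul_eq_zero.1 h0 with h | h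
      · exact absurd h (by positivity)
      · exact h)

lemma scale_sub {r : ℝ} (hr : 0 < r) (x0 : E) (s : ℝ) : ball (0:E) (s / r) ⊆ (fun z => x0 + r • z) ⁻¹' (ball x0 s) := by
  intro z hz
  rw [mem_ball_zero_iff, lt_div_iff₀ hr] at hz
  rw [mem_preimage, mem_ball, dist_eq_norm, add_sub_cancel_left, norm_smul, Real.norm_of_nonneg hr.le]
  linarith

lemma Sol.scale1 {x0 : E} {r : ℝ} (S : Sol u G (ball x0 r)) (hr : 0 < r) :
    Sol (fun z => r⁻¹ * u (x0 + r • z)) (fun z => G (x0 + r • z)) (ball 0 1) :=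
  (S.scale hr x0).mono isOpen_ball (by have := scale_sub hr x0 r; rwa [div_self hr.ne'] at this)

/-- two-sided flatness -/
def Flat (u : E → ℝ) (e : E) (a b : ℝ) (x0 : E) (r : ℝ) : Prop :=
  ∀ x ∈ ball x0 r, max (⟪e, x⟫ + a) 0 ≤ u x ∧ u x ≤ max (⟪e, x⟫ + b) 0

lemma Flat.scale {e x0 : E} {a b r s : ℝ} (hs : 0 < s) (h : Flat u e a b x0 r) :
    Flat (fun z => s⁻¹ * u (x0 + s • z)) e (s⁻¹ * (⟪e, x0⟫ + a)) (s⁻¹ * (⟪e, x0⟫ + b)) 0 (r / s) := by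
  intro z hz
  have h1 := h _ (scale_sub hs x0 r hz)
  have key : ∀ a, max (⟪e, z⟫ + s⁻¹ * (⟪e, x0⟫ + a)) 0 = s⁻¹ * max (⟪e, x0 + s • z⟫ + a) 0 := by
    intro a
    rw [mul_max_of_nonneg _ _ (by positivity), mul_zero, inner_add_right, inner_smul_right]
    congr 1
    field_simp; ring
  simp only [key]
  exact ⟨by gcongr; exact h1.1, by gcongr; exact h1.2⟩

lemma Flat.unscale {e x0 : E} {a b r s : ℝ} (hs : 0 < s) (h : Flat (fun z => s⁻¹ * u (x0 + s • z)) e a b 0 r) :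
    Flat u e (s * a - ⟪e, x0⟫) (s * b - ⟪e, x0⟫) x0 (s * r) := by
  intro x hx
  have h1 := h (s⁻¹ • (x - x0)) (by
    rw [mem_ball, dist_eq_norm] at hx
    rw [mem_ball_zero_iff, norm_smul, norm_inv, Real.norm_of_nonneg hs.le, inv_mul_lt_iff₀ hs]
    exact hx)
  have hxx : x0 + s • s⁻¹ • (x - x0) = x := by
    rw [smul_smul, mul_inv_cancel₀ hs.ne', one_smul]; abel
  simp only [hxx] at h1
  have key : ∀ a, max (⟪e, x⟫ + (s * a - ⟪e, x0⟫)) 0 = s * max (⟪e, s⁻¹ • (x - x0)⟫ + a) 0 := by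
    intro a
    rw [mul_max_of_nonneg _ _ (by positivity), mul_zero, inner_smul_right, inner_sub_right]
    congr 1
    field_simp; ring
  rw [key, key]
  have h2 : u x = s * (s⁻¹ * u x) := by field_simp
  rw [h2]
  exact ⟨by gcongr; exact h1.1, by gcongr; exact h1.2⟩

variable (E) in
lemma DS1s [Nontrivial E] : ∃ c ∈ Ioo (0:ℝ) (1/2), ∃ ε0 > 0, ∀ (u : E → ℝ) (G : E → E) (e x0 : E) (r a b : ℝ),
    0 < r → ‖e‖ = 1 → Sol u G (ball x0 r) → |⟪e, x0⟫ + a| ≤ r / 10 → a ≤ b → b - a ≤ ε0 * r →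
    Flat u e a b x0 r →
    ∃ a' b', a ≤ a' ∧ b' ≤ b ∧ a' ≤ b' ∧ b' - a' = (1 - c) * (b - a) ∧ Flat u e a' b' x0 (r / 20) := by
  obtain ⟨c, hc, ε0, hε0, H⟩ := DS1 E
  refine ⟨c, hc, ε0, hε0, ?_⟩
  intro u G e x0 r a b hr he S ha hab hε hf
  have hf1 := hf.scale hr
  rw [div_self hr.ne'] at hf1
  obtain ⟨a', b', h1, h2, h3, h4, h5⟩ := H _ _ e (r⁻¹ * (⟪e, x0⟫ + a)) (r⁻¹ * (⟪e, x0⟫ + b)) he (S.scale1 hr)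
    (by rw [abs_mul, abs_of_pos (by positivity : 0 < r⁻¹), inv_mul_le_iff₀ hr]; linarith) (by gcongr)
    (by rw [← mul_sub, inv_mul_le_iff₀ hr]; linarith) hf1
  have h6 := Flat.unscale hr h5
  refine ⟨_, _, ?_, ?_, ?_, ?_, by rw [show r / 20 = r * (1 / 20) by ring]; exact h6⟩
  · rw [inv_mul_le_iff₀ hr] at h1; linarith
  · rw [le_inv_mul_iff₀ hr] at h2; linarith
  · have := mul_le_mul_of_nonneg_left h3 hr.le; linarith
  · have : r * (b' - a') = (1 - c) * (b - a) := by rw [h4]; field_simp; ring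
    linarith

variable (E) in
lemma DSN [Nontrivial E] : ∃ c ∈ Ioo (0:ℝ) (1/2), ∃ κ > 0, ∀ (N : ℕ) (u : E → ℝ) (G : E → E) (e x0 : E) (r a b : ℝ),
    0 < r → ‖e‖ = 1 → Sol u G (ball x0 r) → a ≤ b → |⟪e, x0⟫ + a| + (b - a) ≤ κ * r / 20 ^ N →
    Flat u e a b x0 r →
    ∃ a' b', a ≤ a' ∧ b' ≤ b ∧ a' ≤ b' ∧ b' - a' = (1 - c) ^ N * (b - a) ∧ Flat u e a' b' x0 (r / 20 ^ N) := by
  obtain ⟨c, hc, ε0, hε0, H⟩ := DS1s E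
  refine ⟨c, hc, min ε0 (1/10), by positivity, ?_⟩
  intro N
  induction N with
  | zero => 
    intro u G e x0 r a b hr he S hab h hf
    exact ⟨a, b, le_rfl, le_rfl, hab, by simp, by simpa using hf⟩
  | succ N ih =>
    intro u G e x0 r a b hr he S hab h hf
    have h20 : min ε0 (1/10) * r / 20 ^ (N+1) ≤ min ε0 (1/10) * r :=
      div_le_self (by positivity) (one_le_pow₀ (by norm_num))
    have ha0 := abs_nonneg (⟪e, x0⟫ + a)
    have hm1 := mul_le_mul_of_nonneg_right (min_le_left ε0 (1/10)) hr.le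
    have hm2 := mul_le_mul_of_nonneg_right (min_le_right ε0 (1/10)) hr.le
    obtain ⟨a1, b1, h1, h2, h3, h4, h5⟩ := H u G e x0 r a b hr he S (by linarith) hab (by linarith) hf
    obtain ⟨a', b', k1, k2, k3, k4, k5⟩ := ih u G e x0 (r / 20) a1 b1 (by positivity) he
      (S.mono isOpen_ball (ball_subset_ball (by linarith))) h3 (by
        have : ⟪e, x0⟫ + a1 = (⟪e, x0⟫ + a) + (a1 - a) := by ring
        have h6 := abs_add_le (⟪e, x0⟫ + a) (a1 - a)
        rw [abs_of_nonneg (by linarith : 0 ≤ a1 - a)] at h6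
        rw [this]
        calc _ ≤ |⟪e, x0⟫ + a| + (b - a) := by linarith
          _ ≤ _ := h
          _ = _ := by rw [pow_succ]; field_simp) h5
    exact ⟨a', b', h1.trans k1, k2.trans h2, k3, by rw [k4, h4, pow_succ]; ring,
      by rw [pow_succ', ← div_div]; exact k5⟩

variable (E) in
lemma OSC [Nontrivial E] (θ : ℝ) (hθ : 0 < θ) : ∃ r1 > 0, ∃ ε0 > 0, ∀ (u : E → ℝ) (G : E → E) (e : E) (ε : ℝ),
    0 < ε → ε ≤ ε0 → ‖e‖ = 1 → Sol u G (ball 0 1) → Flat u e (-ε) ε 0 1 →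
    ∀ y ∈ ball (0:E) (1/2), y ∈ closure {x | 0 < u x} → ∀ x, ‖x - y‖ ≤ r1 →
      u y - ⟪e, y⟫ ≤ u x - ⟪e, x⟫ + θ * ε := by
  obtain ⟨c, hc, κ, hκ, H⟩ := DSN E
  obtain ⟨C, hC, hest⟩ := harm_est E
  obtain ⟨N, hN⟩ := exists_pow_lt_of_lt_one (by positivity : 0 < θ / 2) (by linarith [hc.1] : 1 - c < 1)
  set s := min (κ * (1/4) / 20 ^ N / 2) (1/4) with hs
  have hs0 : 0 < s := by positivity
  have hs1 : s ≤ κ * (1/4) / 20 ^ N / 2 := min_le_left _ _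
  have hs2 : s ≤ 1/4 := min_le_right _ _
  refine ⟨min ((1/4) / 20 ^ N / 2) (min (θ * (s/2) / C) (s / 4)), by positivity, s / 4, by positivity, ?_⟩
  intro u G e ε hε hεs he S hf y hy hcl x hx
  have hx1 := hx.trans (min_le_left _ _)
  have hx2 := hx.trans ((min_le_right _ _).trans (min_le_left _ _))
  have hx3 := hx.trans ((min_le_right _ _).trans (min_le_right _ _))
  rw [mem_ball_zero_iff] at hy
  have hcle : Continuous fun y : E => ⟪e, y⟫ := continuous_const.inner continuous_id
  have hy1 : y ∈ ball (0:E) 1 := by rw [mem_ball_zero_iff]; linarith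
  have hyl : u y ≤ ⟪e, y⟫ + ε := S.le_cl (by fun_prop) (fun z hz => (hf z hz).2) hy1 hcl
  have hy0 := S.nonneg y hy1
  have hbs : ∀ r ≤ 1/4, ball y r ⊆ ball (0:E) 1 := by
    intro r hr z hz
    rw [mem_ball, dist_eq_norm] at hz
    rw [mem_ball_zero_iff]
    have := norm_add_le (z - y) y
    rw [sub_add_cancel] at this
    linarith
  rcases le_or_gt ⟪e, y⟫ s with hys | hys
  · have S1 := S.mono isOpen_ball (hbs (1/4) le_rfl)
    obtain ⟨a', b', h1, h2, h3, h4, h5⟩ := H N u G e y (1/4) (-ε) ε (by norm_num) he S1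
      (by linarith) (by
        have : |⟪e, y⟫ + -ε| ≤ s + ε := by rw [abs_le]; constructor <;> linarith
        linarith) (fun z hz => hf z (hbs _ le_rfl hz))
    have hr : 0 < (1/4 : ℝ) / 20 ^ N := by positivity
    have hr1 : (1/4 : ℝ) / 20 ^ N ≤ 1/4 := div_le_self (by norm_num) (one_le_pow₀ (by norm_num))
    have S2 := S.mono isOpen_ball (hbs _ hr1)
    have hxl := (h5 x (by rw [mem_ball, dist_eq_norm]; linarith)).1
    have hyl := S2.le_cl (v := fun y => ⟪e, y⟫ + b') (by fun_prop) (fun z hz => (h5 z hz).2) (mem_ball_self hr) hcl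
    have := (le_max_left _ _).trans hxl
    have h6 := mul_le_mul_of_nonneg_right hN.le hε.le
    linarith
  · have hb : ∀ z ∈ ball y (s/2), ε < ⟪e, z⟫ := by
      intro z hz
      rw [mem_ball, dist_eq_norm] at hz
      have := abs_real_inner_le_norm e (z - y)
      rw [he, one_mul, inner_sub_right] at this
      have := abs_le.1 this
      linarith
    have hbb := hbs (s/2) (by linarith)
    have h1 := (hest (fun z => u z - (⟪e, z⟫ + 0)) _ y (s/2) ε (by positivity)
      ((S.harm.mono (U := ball 0 1 ∩ {x | 0 < u x}) (fun z hz => ⟨hbb hz, ?_⟩)).sub_affine e 0) ?_).1 x (by rw [mem_ball, dist_eq_norm]; linarith)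
    · have h2 : C * ε * (‖x - y‖ / (s/2)) ≤ θ * ε := by
        rw [le_div_iff₀ (by positivity)] at hx2
        calc C * ε * (‖x - y‖ / (s/2)) = ε / (s / 2) * (‖x - y‖ * C) := by ring
          _ ≤ ε / (s / 2) * (θ * (s/2)) := by gcongr
          _ = _ := by field_simp
      have := abs_le.1 (h1.trans h2)
      linarith
    · have := (le_max_left _ _).trans (hf z (hbb hz)).1
      have := hb z hz
      show 0 < u z
      linarith
    · intro z hz
      have h1 := hf z (hbb hz)
      have := hb z hz
      rw [max_eq_left (by linarith), max_eq_left (by linarith)] at h1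
      rw [abs_le]; constructor <;> linarith

end
end OP

namespace OP
open scoped RealInnerProductSpace Topology
open Module

section
variable {E : Type*} [NormedAddCommGroup E] [InnerProductSpace ℝ E] [FiniteDimensional ℝ E]
  [MeasurableSpace E] [BorelSpace E]

variable {u : E → ℝ} {G : E → E} {U : Set E}

/-- reflection in the hyperplane orthogonal to `e` -/
noncomputable def rf (e : E) : E →L[ℝ] E :=
  ContinuousLinearMap.id ℝ E - (2:ℝ) • (innerSL ℝ e).smulRight e

lemma rf_apply (e x : E) : rf e x = x - (2 * ⟪e, x⟫) • e := by
  simp [rf, smul_smul]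

lemma rf_symm (e x y : E) : ⟪rf e x, y⟫ = ⟪x, rf e y⟫ := by
  simp only [rf_apply, inner_sub_left, inner_sub_right, inner_smul_left, inner_smul_right]
  rw [real_inner_comm x e]
  simp; ring

lemma rf_inner {e : E} (he : ‖e‖ = 1) (x : E) : ⟪e, rf e x⟫ = -⟪e, x⟫ := by
  rw [rf_apply, inner_sub_right, inner_smul_right, real_inner_self_eq_norm_sq, he]; ring

lemma rf_rf {e : E} (he : ‖e‖ = 1) (x : E) : rf e (rf e x) = x := by
  rw [rf_apply e (rf e x), rf_inner he, rf_apply]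
  module

lemma rf_norm {e : E} (he : ‖e‖ = 1) (x : E) : ‖rf e x‖ = ‖x‖ := by
  have : ‖rf e x‖ ^ 2 = ‖x‖ ^ 2 := by
    rw [← real_inner_self_eq_norm_sq, rf_symm, rf_rf he, real_inner_self_eq_norm_sq]
  exact (sq_eq_sq₀ (norm_nonneg _) (norm_nonneg _)).1 this

lemma Harm.comp_rf {h : E → ℝ} {g : E → E} {e : E} (he : ‖e‖ = 1) (H : Harm h g univ) :
    Harm (fun x => h (rf e x)) (fun x => rf e (g (rf e x))) univ := by
  intro x _
  refine ⟨ContDiffAt.comp x (H (rf e x) trivial).1 (rf e).contDiff.contDiffAt, (rf e) ∘L (fderiv ℝ g (rf e x)) ∘L (rf e), ⟨?_, ?_⟩, ?_⟩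
  · refine Eventually.of_forall fun y => ?_
    rw [hasGradientAt_iff]
    refine ((hasGradientAt_iff.1 (H.grad (x := rf e y) trivial)).comp y (rf e).hasFDerivAt).congr_fderiv ?_
    ext w
    simp [rf_symm]
  · have h1 : HasFDerivAt g (fderiv ℝ g (rf e x)) (rf e x) :=
      ((H.smooth (x := rf e x) trivial).differentiableAt (by simp)).hasFDerivAt
    exact (rf e).hasFDerivAt.comp x (h1.comp x (rf e).hasFDerivAt)
  · have h2 := H.tr_eq (x := rf e x) trivial
    have h3 : ((rf e : E →L[ℝ] E) : E →ₗ[ℝ] E) * ((rf e : E →L[ℝ] E) : E →ₗ[ℝ] E) = 1 := by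
      ext x; simp [rf_rf he]
    unfold tr at h2 ⊢
    rw [← h2]
    change LinearMap.trace ℝ E (((rf e : E →L[ℝ] E) : E →ₗ[ℝ] E) * (((fderiv ℝ g (rf e x) : E →L[ℝ] E) : E →ₗ[ℝ] E) * ((rf e : E →L[ℝ] E) : E →ₗ[ℝ] E))) = _
    rw [LinearMap.trace_mul_comm, mul_assoc, h3, mul_one]

lemma Harm_sum {ι : Type*} (t : Finset ι) (w : ι → ℝ) {h : ι → E → ℝ} {g : ι → E → E}
    (H : ∀ i ∈ t, Harm (h i) (g i) U) : Harm (fun x => ∑ i ∈ t, w i * h i x) (fun x => ∑ i ∈ t, w i • g i x) U := by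
  classical
  induction t using Finset.induction_on with
  | empty =>
    have := Harm_affine (0:E) 0 U
    simpa using this
  | insert a t ha ih =>
    have h1 := (H a (Finset.mem_insert_self _ _)).const_mul (w a)
    have h2 := h1.add (ih fun i hi => H i (Finset.mem_insert_of_mem hi))
    simp only [Finset.sum_insert ha]
    exact h2

lemma Harm.max_ball [Nontrivial E] {h : E → ℝ} {g : E → E} (H : Harm h g univ) {m : ℝ}
    (hm : ∀ x, ‖x‖ = 1 → |h x| ≤ m) {x : E} (hx : ‖x‖ ≤ 1) : |h x| ≤ m := by
  have key : ∀ {h : E → ℝ} {g : E → E} (H : Harm h g univ) (hm : ∀ x, ‖x‖ = 1 → h x ≤ m), h x ≤ m := by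
    intro h g H hm
    have H1 := (H.sub_affine 0 m)
    have hs : ContDiff ℝ (⊤ : ℕ∞) (fun y => h y - (⟪(0:E), y⟫ + m)) := contDiff_iff_contDiffAt.2 fun y => (H1 y trivial).1
    have hg : gradient (fun y => h y - (⟪(0:E), y⟫ + m)) = fun y => g y - 0 := funext fun y => (H1.grad (x := y) trivial).gradient
    have := max_pr hs (by
      funext y
      obtain ⟨B, hB, hBt⟩ := D2_smooth hs y
      rw [← hBt, ← hB.2.fderiv, hg]
      exact H1.tr_eq (x := y) trivial) (fun y hy => by simpa using hm y hy) hx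
    simpa using this
  rw [abs_le]
  constructor
  · have := key (H.const_mul (-1)) (fun x hx => by linarith [(abs_le.1 (hm x hx)).1])
    linarith
  · exact key H (fun x hx => (abs_le.1 (hm x hx)).2)

variable (E) in
lemma BAS [Nontrivial E] (r1 θ : ℝ) (hr1 : 0 < r1) (hθ : 0 < θ) : ∃ A > 0, ∀ f : E → ℝ, (∀ x, ‖x‖ = 1 → |f x| ≤ 1) →
    (∀ x y, ‖x‖ = 1 → ‖y‖ = 1 → ‖x - y‖ ≤ r1 → |f x - f y| ≤ θ) →
    ∃ (h : E → ℝ) (g : E → E), Harm h g univ ∧ (∀ x, ‖x‖ = 1 → |h x - f x| ≤ 2 * θ) ∧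
      (∀ x, ‖x‖ ≤ 1 → ‖g x‖ ≤ A) ∧ (∀ x y, ‖x‖ ≤ 1 → ‖y‖ ≤ 1 → ‖g x - g y‖ ≤ A * ‖x - y‖) := by
  obtain ⟨t0, hts, htf, hcov⟩ := (isCompact_sphere (0:E) 1).finite_cover_balls (e := r1 / 2) (by positivity)
  set t := htf.toFinset with ht
  have htm : ∀ c ∈ t, ‖c‖ = 1 := fun c hc => by
    have := hts (htf.mem_toFinset.1 hc); simpa using this
  set φ : E → E → ℝ := fun c x => max 0 (r1 - ‖x - c‖) with hφ
  have hφ0 : ∀ c x, 0 ≤ φ c x := fun c x => le_max_left _ _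
  set D : E → ℝ := fun x => max (∑ c ∈ t, φ c x) (r1 / 2) with hD
  have hD0 : ∀ x, 0 < D x := fun x => lt_max_of_lt_right (by positivity)
  have hD1 : ∀ x, ‖x‖ = 1 → D x = ∑ c ∈ t, φ c x := by
    intro x hx
    apply max_eq_left
    have : x ∈ ⋃ x ∈ t0, ball x (r1 / 2) := hcov (by simpa using hx)
    simp only [mem_iUnion] at this
    obtain ⟨c, hc, hxc⟩ := this
    rw [mem_ball, dist_eq_norm] at hxc
    calc r1 / 2 ≤ φ c x := le_max_of_le_right (by linarith)
      _ ≤ _ := Finset.single_le_sum (f := fun c => φ c x) (fun c _ => hφ0 c x) (htf.mem_toFinset.2 hc)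
  have hψc : ∀ c, Continuous fun x => φ c x / D x := by
    intro c
    refine Continuous.div ?_ ?_ (fun x => (hD0 x).ne')
    · simp only [hφ]; fun_prop
    · simp only [hD, hφ]; fun_prop
  have hη : 0 < θ / (t.card + 1) := by positivity
  choose h hsm hH happ using fun c => dirichlet (hψc c) hη
  have hlip : ∀ c, ∃ K : ℝ≥0, LipschitzOnWith K (gradient (h c)) (closedBall 0 1) := by
    intro c
    have : ContDiff ℝ 1 (gradient (h c)) := contDiff_iff_contDiffAt.2 fun x => 
      ((hH c).smooth (x := x) trivial).of_le (by exact_mod_cast le_top)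
    exact this.contDiffOn.exists_lipschitzOnWith (by simp) (convex_closedBall _ _) (isCompact_closedBall _ _)
  choose K hK using hlip
  set A : ℝ := 1 + ∑ c ∈ t, (K c + ‖gradient (h c) 0‖) with hA
  have hsum0 : 0 ≤ ∑ c ∈ t, ((K c : ℝ) + ‖gradient (h c) 0‖) := Finset.sum_nonneg fun c _ => by positivity
  refine ⟨A, by linarith, ?_⟩
  intro f hf1 hf2
  refine ⟨_, _, Harm_sum t f fun c _ => hH c, ?_, ?_, ?_⟩
  · intro x hx
    have hs1 : ∑ c ∈ t, φ c x / D x = 1 := by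
      rw [← Finset.sum_div, ← hD1 x hx]; exact div_self (hD0 x).ne'
    have e1 : ∑ c ∈ t, f c * h c x - f x = ∑ c ∈ t, (f c * (h c x - φ c x / D x) + (f c - f x) * (φ c x / D x)) := by
      have : f x = ∑ c ∈ t, f x * (φ c x / D x) := by rw [← Finset.mul_sum, hs1, mul_one]
      rw [this, ← Finset.sum_sub_distrib, ← this]
      exact Finset.sum_congr rfl fun c _ => by ring
    rw [e1]
    refine (Finset.abs_sum_le_sum_abs _ _).trans ?_
    calc _ ≤ ∑ c ∈ t, (θ / (t.card + 1) + θ * (φ c x / D x)) := by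
          refine Finset.sum_le_sum fun c hc => ?_
          refine (abs_add_le _ _).trans (add_le_add ?_ ?_)
          · rw [abs_mul]
            calc _ ≤ 1 * (θ / (t.card + 1)) := by
                  gcongr
                  · exact hf1 c (htm c hc)
                  · exact happ c x hx
              _ = _ := one_mul _
          · have hq : 0 ≤ φ c x / D x := div_nonneg (hφ0 c x) (hD0 x).le
            rw [abs_mul, abs_of_nonneg hq]
            rcases le_or_gt ‖x - c‖ r1 with hxc | hxc
            · gcongr
              rw [abs_sub_comm]
              exact hf2 x c hx (htm c hc) hxc
            · have : φ c x = 0 := max_eq_left (by linarith)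
              rw [this]; simp
      _ = t.card * (θ / (t.card + 1)) + θ := by
          rw [Finset.sum_add_distrib, ← Finset.mul_sum, hs1]; simp
      _ ≤ 2 * θ := by
          have : (t.card : ℝ) * (θ / (t.card + 1)) ≤ θ := by
            rw [mul_div_assoc', div_le_iff₀ (by positivity)]; nlinarith
          linarith
  · intro x hx
    refine (norm_sum_le _ _).trans ?_
    have : ∑ c ∈ t, ‖f c • gradient (h c) x‖ ≤ ∑ c ∈ t, ((K c : ℝ) + ‖gradient (h c) 0‖) := by
      refine Finset.sum_le_sum fun c hc => ?_
      rw [norm_smul]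
      have h1 := (hK c).dist_le_mul x (by simpa using hx) 0 (by simp)
      rw [dist_eq_norm, dist_zero_right] at h1
      have h2 := norm_add_le (gradient (h c) x - gradient (h c) 0) (gradient (h c) 0)
      rw [sub_add_cancel] at h2
      have h3 : (K c : ℝ) * ‖x‖ ≤ K c * 1 := by gcongr
      have h4 := hf1 c (htm c hc)
      calc _ ≤ 1 * ‖gradient (h c) x‖ := by gcongr; exact h4
        _ ≤ _ := by linarith
    linarith
  · intro x y hx hy
    rw [← Finset.sum_sub_distrib]
    refine (norm_sum_le _ _).trans ?_
    have : ∑ c ∈ t, ‖f c • gradient (h c) x - f c • gradient (h c) y‖ ≤ ∑ c ∈ t, ((K c : ℝ) + ‖gradient (h c) 0‖) * ‖x - y‖ := by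
      refine Finset.sum_le_sum fun c hc => ?_
      rw [← smul_sub, norm_smul]
      have h1 := (hK c).dist_le_mul x (by simpa using hx) y (by simpa using hy)
      rw [dist_eq_norm, dist_eq_norm] at h1
      have h4 := hf1 c (htm c hc)
      calc _ ≤ 1 * ‖gradient (h c) x - gradient (h c) y‖ := by gcongr; exact h4
        _ ≤ K c * ‖x - y‖ := by linarith
        _ ≤ _ := by gcongr; linarith [norm_nonneg (gradient (h c) 0)]
    rw [← Finset.sum_mul] at this
    refine this.trans ?_
    gcongr
    linarith

end
end OP

namespace OP
open scoped RealInnerProductSpace Topology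
open Module

section
variable {E : Type*} [NormedAddCommGroup E] [InnerProductSpace ℝ E] [FiniteDimensional ℝ E]
  [MeasurableSpace E] [BorelSpace E]

variable {u : E → ℝ} {G : E → E} {U : Set E}

lemma D2_sq {e : E} (he : ‖e‖ = 1) (x : E) : ∃ B, D2 (fun y => ⟪e, y⟫ + ⟪e, y⟫ ^ 2) (fun y => (1 + 2 * ⟪e, y⟫) • e) B x ∧ tr B = 2 := by
  have h1 : ∀ y : E, HasFDerivAt (fun y => ⟪e, y⟫) (innerSL ℝ e) y := fun y => (innerSL ℝ e).hasFDerivAt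
  refine ⟨((2:ℝ) • innerSL ℝ e).smulRight e, ⟨Eventually.of_forall fun y => ?_, ?_⟩, ?_⟩
  · rw [hasGradientAt_iff]
    refine ((h1 y).add ((h1 y).pow 2)).congr_fderiv ?_
    ext w; simp [inner_smul_left]; ring
  · refine ((((h1 x).const_mul 2).const_add 1).smul_const e).congr_fderiv ?_
    ext w; simp
  · rw [tr_smulRight]; simp [real_inner_self_eq_norm_sq, he]

variable (E) in
lemma OSC4 [Nontrivial E] (θ : ℝ) (hθ : 0 < θ) : ∃ r1 > 0, ∃ ε0 > 0, ∀ (u : E → ℝ) (G : E → E) (e : E) (ε : ℝ),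
    0 < ε → ε ≤ ε0 → ‖e‖ = 1 → Sol u G (ball 0 4) → Flat u e (-ε) ε 0 4 →
    ∀ y ∈ ball (0:E) 2, y ∈ closure {x | 0 < u x} → ∀ x, ‖x - y‖ ≤ r1 →
      u y - ⟪e, y⟫ ≤ u x - ⟪e, x⟫ + θ * ε := by
  obtain ⟨r1, hr1, ε0, hε0, H⟩ := OSC E θ hθ
  refine ⟨r1, hr1, ε0, hε0, ?_⟩
  intro u G e ε hε hεε he S hf y hy hcl x hx
  have h4 : (0:ℝ) < 4 := by norm_num
  have hf1 := hf.scale h4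
  rw [div_self h4.ne', inner_zero_right, zero_add, zero_add] at hf1
  rw [mem_ball_zero_iff] at hy
  have h44 : ∀ y : E, (0:E) + (4:ℝ) • ((4:ℝ)⁻¹ • y) = y := fun y => by rw [smul_smul]; norm_num
  have := H _ _ e (4⁻¹ * ε) (by positivity) (by linarith) he (S.scale1 h4) (by
      have : (-(4⁻¹ * ε)) = 4⁻¹ * -ε := by ring
      rw [this]; exact hf1) ((4:ℝ)⁻¹ • y) (by
        rw [mem_ball_zero_iff, norm_smul]; norm_num; linarith) (by rw [scale_cl u h4, h44]; exact hcl)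
    ((4:ℝ)⁻¹ • x) (by rw [← smul_sub, norm_smul]; norm_num; linarith [norm_nonneg (x - y)])
  rw [h44, h44, inner_smul_right, inner_smul_right] at this
  linarith

set_option maxHeartbeats 1600000 in
variable (E) in
lemma IMP [Nontrivial E] : ∃ C ≥ 1, ∀ θ : ℝ, 0 < θ → θ ≤ 1 / 4 → ∃ ε0 > 0, ∀ (u : E → ℝ) (G : E → E) (e : E) (ε : ℝ),
    0 < ε → ε ≤ ε0 → ‖e‖ = 1 → Sol u G (ball 0 4) → Flat u e (-ε) ε 0 4 →
    ∃ (β : ℝ) (w : E), ⟪e, w⟫ = 0 ∧ ‖w‖ ≤ C ∧ ∀ x, ‖x‖ < 1 →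
      ⟪e, x⟫ + ε * (β + ⟪w, x⟫ - 6 * θ - C * ‖x‖ ^ 2) ≤ u x ∧
      (x ∈ closure {x | 0 < u x} → u x ≤ ⟪e, x⟫ + ε * (β + ⟪w, x⟫ + 6 * θ + C * ‖x‖ ^ 2)) := by
  obtain ⟨C, hC, hest⟩ := harm_est E
  refine ⟨2 * C, by linarith, ?_⟩
  intro θ hθ hθ1
  obtain ⟨r1, hr1, ε1, hε1, hosc⟩ := OSC4 E θ hθ
  obtain ⟨A, hA, hbas⟩ := BAS E (r1 / 3) θ (by positivity) hθ
  refine ⟨min (min ε1 (1/8)) (min (r1 / 4) (θ / (4 * ((A + 2) ^ 2 + A)))), by positivity, ?_⟩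
  intro u G e ε hε hεm he S hf
  have hεa : ε ≤ ε1 := hεm.trans ((min_le_left _ _).trans (min_le_left _ _))
  have hεb : ε ≤ 1/8 := hεm.trans ((min_le_left _ _).trans (min_le_right _ _))
  have hεc : ε ≤ r1 / 4 := hεm.trans ((min_le_right _ _).trans (min_le_left _ _))
  have hεd : ε ≤ θ / (4 * ((A + 2) ^ 2 + A)) := hεm.trans ((min_le_right _ _).trans (min_le_right _ _))
  rw [le_div_iff₀ (by positivity)] at hεd
  have hεA2 : ε * (A + 2) ^ 2 ≤ θ / 4 := by
    have : 0 ≤ ε * A := by positivity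
    linarith
  have hεA : ε * A ≤ θ / 4 := by
    have : 0 ≤ ε * (A + 2) ^ 2 := by positivity
    linarith
  have hcle : Continuous fun y : E => ⟪e, y⟫ := continuous_const.inner continuous_id
  have hein : ∀ y : E, |⟪e, y⟫| ≤ ‖y‖ := fun y => by
    have := abs_real_inner_le_norm e y
    rwa [he, one_mul] at this
  have hee : ⟪e, e⟫ = 1 := by rw [real_inner_self_eq_norm_sq, he]; norm_num
  have hlow : ∀ x, ‖x‖ ≤ 1 → x ∈ closure {x | 0 < u x} → -ε ≤ ⟪e, x⟫ := by
    intro x hx hcl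
    have hx4 : x ∈ ball (0:E) 4 := by rw [mem_ball_zero_iff]; linarith
    have := S.le_cl (v := fun y => ⟪e, y⟫ + ε) (by fun_prop) (fun z hz => (hf z hz).2) hx4 hcl
    have := S.nonneg x hx4
    linarith
  -- the folded point
  set Y : E → E := fun x => (x + (|⟪e, x⟫| - ⟪e, x⟫) • e) + (2 * ε) • e with hY
  have hYe : ∀ x, ⟪e, Y x⟫ = |⟪e, x⟫| + 2 * ε := by
    intro x
    simp only [hY, inner_add_right, inner_smul_right, hee]; ring
  have hYn : ∀ x, ‖x‖ ≤ 1 → ‖Y x‖ < 2 := by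
    intro x hx
    have h1 : ‖x + (|⟪e, x⟫| - ⟪e, x⟫) • e‖ = ‖x‖ := by
      rcases le_total 0 ⟪e, x⟫ with h | h
      · rw [abs_of_nonneg h]; simp
      · rw [abs_of_nonpos h, ← rf_norm he x, rf_apply]
        congr 1; module
    have h2 := norm_add_le (x + (|⟪e, x⟫| - ⟪e, x⟫) • e) ((2 * ε) • e)
    rw [h1, norm_smul, he, Real.norm_of_nonneg (by positivity)] at h2
    simp only [hY]; linarith
  have hYd : ∀ x y, ‖Y x - Y y‖ ≤ 3 * ‖x - y‖ := by
    intro x y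
    have h1 : Y x - Y y = (x - y) + ((|⟪e, x⟫| - |⟪e, y⟫|) - ⟪e, x - y⟫) • e := by
      simp only [hY, inner_sub_right]; module
    rw [h1]
    refine (norm_add_le _ _).trans ?_
    rw [norm_smul, he, mul_one, Real.norm_eq_abs]
    have h2 := abs_abs_sub_abs_le_abs_sub ⟪e, x⟫ ⟪e, y⟫
    rw [← inner_sub_right] at h2
    have h3 := abs_sub (|⟪e, x⟫| - |⟪e, y⟫|) ⟪e, x - y⟫
    linarith [hein (x - y)]
  have hYx : ∀ x, -ε ≤ ⟪e, x⟫ → ‖Y x - x‖ ≤ r1 := by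
    intro x hx
    have h1 : Y x - x = ((|⟪e, x⟫| - ⟪e, x⟫) + 2 * ε) • e := by simp only [hY]; module
    rw [h1, norm_smul, he, mul_one, Real.norm_eq_abs, abs_of_nonneg (by linarith [le_abs_self ⟪e, x⟫])]
    rcases abs_cases ⟪e, x⟫ with h | h <;> linarith
  have hYp : ∀ x, ‖x‖ ≤ 1 → 0 < u (Y x) ∧ |u (Y x) - ⟪e, Y x⟫| ≤ ε := by
    intro x hx
    have h1 := hf (Y x) (by rw [mem_ball_zero_iff]; linarith [hYn x hx])
    have h2 := hYe x
    have h3 := abs_nonneg ⟪e, x⟫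
    rw [max_eq_left (by linarith), max_eq_left (by linarith)] at h1
    exact ⟨by linarith, by rw [abs_le]; constructor <;> linarith⟩
  have hYr : ∀ x, Y (rf e x) = Y x := by
    intro x
    simp only [hY]
    rw [rf_inner he, rf_apply, abs_neg]; module
  set f : E → ℝ := fun x => (u (Y x) - ⟪e, Y x⟫) / ε with hfd
  have hfu : ∀ x, u (Y x) - ⟪e, Y x⟫ = ε * f x := fun x => by simp only [hfd]; field_simp
  obtain ⟨h0, g0, hH0, hh0, hg0, hgl0⟩ := hbas f (fun x hx => by
      simp only [hfd]; rw [abs_div, abs_of_pos hε, div_le_one hε]; exact (hYp x hx.le).2) (fun x y hx hy hxy => by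
      have h1 := hYd x y
      have h1' := hYd y x
      rw [norm_sub_rev y x] at h1'
      have h2 := hosc u G e ε hε hεa he S hf (Y x) (by rw [mem_ball_zero_iff]; exact hYn x hx.le) (subset_closure (hYp x hx.le).1) (Y y) (by linarith)
      have h3 := hosc u G e ε hε hεa he S hf (Y y) (by rw [mem_ball_zero_iff]; exact hYn y hy.le) (subset_closure (hYp y hy.le).1) (Y x) (by linarith)
      rw [hfu, hfu] at h2 h3
      rw [abs_le]
      constructor
      · by_contra hcon
        push Not at hcon
        have := mul_lt_mul_of_pos_left hcon hε
        linarith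
      · by_contra hcon
        push Not at hcon
        have := mul_lt_mul_of_pos_left hcon hε
        linarith)
  set h : E → ℝ := fun x => (1/2) * (h0 x + h0 (rf e x)) with hh
  set g : E → E := fun x => (1/2 : ℝ) • (g0 x + rf e (g0 (rf e x))) with hg
  have hH : Harm h g univ := (hH0.add (hH0.comp_rf he)).const_mul (1/2)
  have hhf : ∀ x, ‖x‖ = 1 → |h x - f x| ≤ 2 * θ := by
    intro x hx
    have h1 := abs_le.1 (hh0 x hx)
    have h2 := abs_le.1 (hh0 (rf e x) (by rw [rf_norm he]; exact hx))
    have h3 : f (rf e x) = f x := by simp only [hfd, hYr]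
    rw [h3] at h2
    simp only [hh]
    rw [abs_le]; constructor <;> linarith
  have hf1 : ∀ x, ‖x‖ ≤ 1 → |f x| ≤ 1 := fun x hx => by
      simp only [hfd]; rw [abs_div, abs_of_pos hε, div_le_one hε]; exact (hYp x hx).2
  have hhb : ∀ x, ‖x‖ ≤ 1 → |h x| ≤ 1 + 2 * θ := by
    intro x hx
    refine hH.max_ball (fun y hy => ?_) hx
    have h1 := abs_le.1 (hhf y hy)
    have h2 := abs_le.1 (hf1 y hy.le)
    rw [abs_le]; constructor <;> linarith
  have hge : ∀ x, ⟪e, g x⟫ = (1/2) * ⟪e, g0 x - g0 (rf e x)⟫ := by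
    intro x
    simp only [hg, inner_smul_right, inner_add_right, inner_sub_right]
    rw [rf_inner he]; ring
  have hgeb : ∀ x, ‖x‖ ≤ 1 → |⟪e, g x⟫| ≤ A * |⟪e, x⟫| := by
    intro x hx
    rw [hge, abs_mul]
    have h1 := hein (g0 x - g0 (rf e x))
    have h2 := hgl0 x (rf e x) hx (by rw [rf_norm he]; exact hx)
    have h3 : ‖x - rf e x‖ = 2 * |⟪e, x⟫| := by
      rw [rf_apply, _root_.sub_sub_cancel, norm_smul, he, mul_one, Real.norm_eq_abs, abs_mul]; norm_num
    rw [h3] at h2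
    rw [abs_of_pos (by norm_num : (0:ℝ) < 1/2)]
    linarith
  have hgb : ∀ x, ‖x‖ ≤ 1 → ‖g x‖ ≤ A := by
    intro x hx
    simp only [hg]
    rw [norm_smul]
    have h1 := norm_add_le (g0 x) (rf e (g0 (rf e x)))
    rw [rf_norm he] at h1
    have h2 := hg0 x hx
    have h3 := hg0 (rf e x) (by rw [rf_norm he]; exact hx)
    norm_num
    linarith
  set K : Set E := closedBall 0 1 with hK
  have hKU : K ⊆ ball (0:E) 4 := closedBall_subset_ball (by norm_num)
  have hKi : interior K = ball 0 1 := interior_closedBall _ (by norm_num)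
  have hbd : ∀ x ∈ K, x ∉ interior K → ‖x‖ = 1 := by
    intro x hx hxi
    rw [hKi, mem_ball_zero_iff] at hxi
    rw [hK, mem_closedBall_zero_iff] at hx
    linarith
  have hitg : ∀ x ∈ interior K, ‖x‖ ≤ 1 := by
    intro x hx
    rw [hKi, mem_ball_zero_iff] at hx
    exact hx.le
  set P : E → ℝ := fun y => ⟪e, y⟫ + ⟪e, y⟫ ^ 2 with hP
  have hPb : ∀ x, ‖x‖ ≤ 1 → -1/4 ≤ P x ∧ P x ≤ 2 := by
    intro x hx
    have := abs_le.1 ((hein x).trans hx)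
    simp only [hP]
    constructor
    · nlinarith [sq_nonneg (⟪e, x⟫ + 1/2)]
    · nlinarith
  have hhc : Continuous h := continuous_iff_continuousAt.2 fun x => (hH x trivial).1.continuousAt
  have hPc : Continuous P := by simp only [hP]; fun_prop
  have hFB : ∀ x ∈ interior K, x ∈ closure {x | 0 < u x} → u x = 0 → |⟪e, x⟫| ≤ ε := by
    intro x hx hcl h0
    have h1 := hlow x (hitg x hx) hcl
    have h2 := (le_max_left _ _).trans (hf x (hKU (interior_subset hx))).1
    rw [abs_le]; constructor <;> linarith
  have hlo := S.comp_below (isCompact_closedBall 0 1) hKU (v := fun y => (⟪e, y⟫ + ε * (-5 * θ)) + ε * (h y + θ * P y))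
    (g := fun y => e + ε • (g y + θ • ((1 + 2 * ⟪e, y⟫) • e))) (by fun_prop) (fun x hx => by
      obtain ⟨B, hB, ht⟩ := D2_sq he x
      obtain ⟨_, B', hB', ht'⟩ := hH x trivial
      refine ⟨_, (D2_inner e _ x).add ((hB'.add (hB.const_mul θ)).const_mul ε), ?_⟩
      rw [tr_add, tr_zero, tr_smul, tr_add, tr_smul, ht, ht']; positivity)
    (fun x hx hcl h0 => by
      right
      have h1 := hFB x hx hcl h0
      have h2 := abs_le.1 (hgeb x (hitg x hx))
      have h4 := abs_le.1 h1
      have h3 : A * |⟪e, x⟫| ≤ θ / 4 := by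
        calc _ ≤ A * ε := by gcongr
          _ ≤ _ := by linarith
      have h5 : ⟪e, e + ε • (g x + θ • ((1 + 2 * ⟪e, x⟫) • e))⟫ = 1 + ε * (⟪e, g x⟫ + θ * (1 + 2 * ⟪e, x⟫)) := by
        simp only [inner_add_right, inner_smul_right, hee]; ring
      have h6 := (le_abs_self _).trans (hein (e + ε • (g x + θ • ((1 + 2 * ⟪e, x⟫) • e))))
      rw [h5] at h6
      have h7 : θ * (3/4) ≤ θ * (1 + 2 * ⟪e, x⟫) := by gcongr; linarith
      have h8 : 0 < ε * (⟪e, g x⟫ + θ * (1 + 2 * ⟪e, x⟫)) := mul_pos hε (by linarith)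
      linarith)
    (fun x hx hxi => by
      have hx1 := hbd x hx hxi
      have h1 := hPb x hx1.le
      have h2 := abs_le.1 (hhf x hx1)
      have h3 := abs_le.1 (hhb x hx1.le)
      have hθP : θ * P x ≤ θ * 2 := by gcongr; exact h1.2
      have hu0 := S.nonneg x (hKU hx)
      rcases le_or_gt ⟪e, x⟫ (-ε) with ht | ht
      · have : ε * (h x + θ * P x) ≤ ε * (1 + 4 * θ) := mul_le_mul_of_nonneg_left (by linarith) hε.le
        have := mul_pos hε hθ
        linarith
      · have h4 := hosc u G e ε hε hεa he S hf (Y x) (by rw [mem_ball_zero_iff]; exact hYn x hx1.le) (subset_closure (hYp x hx1.le).1) x (by rw [norm_sub_rev]; exact hYx x ht.le)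
        rw [hfu] at h4
        have : ε * (h x + θ * P x) ≤ ε * (f x + 4 * θ) := mul_le_mul_of_nonneg_left (by linarith) hε.le
        linarith)
  have hhi := S.comp_above (isCompact_closedBall 0 1) hKU (v := fun y => (⟪e, y⟫ + ε * (5 * θ)) + ε * (h y + (-θ) * P y))
    (g := fun y => e + ε • (g y + (-θ) • ((1 + 2 * ⟪e, y⟫) • e))) (by fun_prop) (fun x hx => by
      obtain ⟨B, hB, ht⟩ := D2_sq he x
      obtain ⟨_, B', hB', ht'⟩ := hH x trivial
      refine ⟨_, (D2_inner e _ x).add ((hB'.add (hB.const_mul (-θ))).const_mul ε), ?_⟩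
      rw [tr_add, tr_zero, tr_smul, tr_add, tr_smul, ht, ht']
      have := mul_pos hε hθ
      linarith)
    (fun x hx hcl h0 => by
      have h1 := hFB x hx hcl h0
      have h2 := abs_le.1 (hgeb x (hitg x hx))
      have h4 := abs_le.1 h1
      have h3 : A * |⟪e, x⟫| ≤ θ / 4 := by
        calc _ ≤ A * ε := by gcongr
          _ ≤ _ := by linarith
      set z : E := g x + (-θ) • ((1 + 2 * ⟪e, x⟫) • e) with hz
      have h5 : ⟪e, z⟫ = ⟪e, g x⟫ - θ * (1 + 2 * ⟪e, x⟫) := by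
        simp only [hz, inner_add_right, inner_smul_right, hee]; ring
      have h7 : θ * (3/4) ≤ θ * (1 + 2 * ⟪e, x⟫) := by gcongr; linarith
      have h8 : ⟪e, z⟫ ≤ - (θ / 2) := by linarith
      have h9 : ‖z‖ ≤ A + 2 := by
        refine (norm_add_le _ _).trans (add_le_add (hgb x (hitg x hx)) ?_)
        rw [norm_smul, norm_smul, he, norm_neg, Real.norm_of_nonneg hθ.le, Real.norm_of_nonneg (by linarith)]
        nlinarith
      have h10 : ‖e + ε • z‖ ^ 2 = 1 + 2 * (ε * ⟪e, z⟫) + ε ^ 2 * ‖z‖ ^ 2 := by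
        rw [norm_add_sq_real, he, inner_smul_right, norm_smul, mul_pow, Real.norm_eq_abs, sq_abs]; ring
      have h11 : ε * ⟪e, z⟫ ≤ ε * (-(θ / 2)) := by gcongr
      have h12 : ε ^ 2 * ‖z‖ ^ 2 ≤ ε * (θ / 4) := by
        calc ε ^ 2 * ‖z‖ ^ 2 ≤ ε ^ 2 * (A + 2) ^ 2 := by gcongr
          _ = ε * (ε * (A + 2) ^ 2) := by ring
          _ ≤ _ := by gcongr
      have h13 := mul_pos hε hθ
      exact (sq_lt_one_iff₀ (norm_nonneg _)).1 (by rw [h10]; linarith))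
    (fun x hx hxi hcl => by
      have hx1 := hbd x hx hxi
      have h1 := hPb x hx1.le
      have h2 := abs_le.1 (hhf x hx1)
      have hθP : θ * P x ≤ θ * 2 := by gcongr; exact h1.2
      have ht := hlow x hx1.le hcl
      have h4 := hosc u G e ε hε hεa he S hf x (by rw [mem_ball_zero_iff]; linarith) hcl (Y x) (hYx x ht)
      rw [hfu] at h4
      have : ε * (f x - 4 * θ) ≤ ε * (h x + (-θ) * P x) := by gcongr; linarith
      linarith)
  -- Taylor expansion
  obtain ⟨-, k1, k2, -, -⟩ := hest h g 0 1 2 (by norm_num) (hH.mono (subset_univ _)) (fun y hy => (hhb y (by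
    rw [mem_ball_zero_iff] at hy; exact hy.le)).trans (by linarith))
  refine ⟨h 0, g 0, ?_, by linarith, ?_⟩
  · have := hgeb 0 (by simp)
    rw [inner_zero_right, abs_zero, mul_zero] at this
    exact abs_eq_zero.1 (le_antisymm this (abs_nonneg _))
  · intro x hx
    have h1 := k2 x (by rw [mem_ball_zero_iff]; exact hx)
    rw [sub_zero, div_one] at h1
    have h2 := abs_le.1 h1
    have hxK : x ∈ K := by rw [hK, mem_closedBall_zero_iff]; exact hx.le
    have h3 := hPb x hx.le
    have h4 : θ * (-1/4) ≤ θ * P x := by gcongr; exact h3.1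
    have hθP : θ * P x ≤ θ * 2 := by gcongr; exact h3.2
    constructor
    · refine le_trans ?_ (hlo x hxK)
      have : ε * (h 0 + ⟪g 0, x⟫ - 6 * θ - 2 * C * ‖x‖ ^ 2) ≤ ε * (-5 * θ + (h x + θ * P x)) := mul_le_mul_of_nonneg_left (by linarith) hε.le
      linarith
    · intro hcl
      refine (hhi x hxK hcl).trans ?_
      have : ε * (5 * θ + (h x + -θ * P x)) ≤ ε * (h 0 + ⟪g 0, x⟫ + 6 * θ + 2 * C * ‖x‖ ^ 2) := mul_le_mul_of_nonneg_left (by linarith) hε.le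
      linarith

end
end OP

namespace OP
open scoped RealInnerProductSpace Topology
open Module

section
variable {E : Type*} [NormedAddCommGroup E] [InnerProductSpace ℝ E] [FiniteDimensional ℝ E]
  [MeasurableSpace E] [BorelSpace E]

variable {u : E → ℝ} {G : E → E} {U : Set E}

/-- centred flatness -/
def Fl (u : E → ℝ) (e x0 : E) (δ r : ℝ) : Prop :=
  ∀ x ∈ ball x0 r, ⟪e, x - x0⟫ - δ ≤ u x ∧ (0 < u x → u x ≤ ⟪e, x - x0⟫ + δ)

lemma Fl.mono {e x0 : E} {δ δ' r r' : ℝ} (h : Fl u e x0 δ r) (hδ : δ ≤ δ') (hr : r' ≤ r) : Fl u e x0 δ' r' :=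
  fun x hx => ⟨by linarith [(h x (ball_subset_ball hr hx)).1], fun hp => by linarith [(h x (ball_subset_ball hr hx)).2 hp]⟩

lemma Fl.change {e e' x0 : E} {δ r d : ℝ} (h : Fl u e x0 δ r) (hd : ‖e' - e‖ ≤ d) (hr : 0 ≤ r) : Fl u e' x0 (δ + d * r) r := by
  intro x hx
  have h1 := h x hx
  rw [mem_ball, dist_eq_norm] at hx
  have h2 := abs_real_inner_le_norm (e' - e) (x - x0)
  have h3 : ‖e' - e‖ * ‖x - x0‖ ≤ d * r := mul_le_mul hd hx.le (norm_nonneg _) ((norm_nonneg _).trans hd)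
  have h4 := abs_le.1 (h2.trans h3)
  rw [inner_sub_left] at h4
  exact ⟨by linarith, fun hp => by linarith [h1.2 hp]⟩

lemma Fl.toFlat {e x0 : E} {δ r : ℝ} (h : Fl u e x0 δ r) (h0 : ∀ x ∈ ball x0 r, 0 ≤ u x) :
    Flat u e (-⟪e, x0⟫ - δ) (-⟪e, x0⟫ + δ) x0 r := by
  intro x hx
  have h1 := h x hx
  rw [inner_sub_right] at h1
  refine ⟨max_le (by linarith) (h0 x hx), ?_⟩
  rcases (h0 x hx).eq_or_lt with hz | hz
  · rw [← hz]; exact le_max_right _ _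
  · exact le_max_of_le_left (by linarith [h1.2 hz])

set_option maxHeartbeats 1600000 in
variable (E) in
lemma FI [Nontrivial E] : ∃ ρ ∈ Ioo (0:ℝ) (1/4), ∃ C ≥ 1, ∃ ε0 > 0, ∀ (u : E → ℝ) (G : E → E) (e x0 : E) (r ε : ℝ),
    0 < r → Sol u G (ball x0 r) → x0 ∈ closure {x | 0 < u x} → u x0 = 0 → 0 < ε → ε ≤ ε0 → ‖e‖ = 1 →
    Fl u e x0 (ε * r) r → ∃ e', ‖e'‖ = 1 ∧ ‖e' - e‖ ≤ C * ε ∧ Fl u e' x0 (ε / 2 * (ρ * r)) (ρ * r) := by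
  obtain ⟨C, hC, H⟩ := IMP E
  set q : ℝ := 1 / (2 * (49 + 4 * C)) with hq
  have hq0 : 0 < q := by positivity
  have hqe : q * (49 + 4 * C) = 1 / 2 := by rw [hq]; field_simp
  have hq1 : q ≤ 1 / 4 := by nlinarith
  obtain ⟨ε0, hε0, H⟩ := H (q ^ 2) (by positivity) (by nlinarith)
  refine ⟨q / 4, ⟨by positivity, by linarith⟩, 4 * C + 8 * C ^ 2, by nlinarith, min (min (ε0 / 4) 1) (q / (8 * C ^ 2)), by positivity, ?_⟩
  intro u G e x0 r ε hr S hcl h0 hε hεm he hf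
  have hεa : ε ≤ ε0 / 4 := hεm.trans ((min_le_left _ _).trans (min_le_left _ _))
  have hεb : ε ≤ 1 := hεm.trans ((min_le_left _ _).trans (min_le_right _ _))
  have hεc : ε ≤ q / (8 * C ^ 2) := hεm.trans (min_le_right _ _)
  rw [le_div_iff₀ (by positivity)] at hεc
  set s := r / 4 with hs
  have hs0 : 0 < s := by positivity
  have hrs : r / s = 4 := by rw [hs]; field_simp
  have hrs' : r = 4 * s := by rw [hs]; ring
  have hF := (hf.toFlat S.nonneg).scale hs0
  have e1 : s⁻¹ * (⟪e, x0⟫ + (-⟪e, x0⟫ - ε * r)) = -(4 * ε) := by rw [hrs']; field_simp; ring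
  have e2 : s⁻¹ * (⟪e, x0⟫ + (-⟪e, x0⟫ + ε * r)) = 4 * ε := by rw [hrs']; field_simp; ring
  rw [e1, e2, hrs] at hF
  have S' : Sol (fun z => s⁻¹ * u (x0 + s • z)) (fun z => G (x0 + s • z)) (ball 0 4) :=
    (S.scale hs0 x0).mono isOpen_ball (by have := scale_sub hs0 x0 r; rwa [hrs] at this)
  obtain ⟨β, w, hew, hw, hx⟩ := H _ _ e (4 * ε) (by positivity) (by linarith) he S' hF
  have hz := hx 0 (by simp)
  simp only [inner_zero_right, smul_zero, add_zero, h0, mul_zero, norm_zero, zero_add] at hz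
  have hz2 := hz.2 (by rw [scale_cl u hs0]; simpa using hcl)
  have hb1 : β ≤ 6 * q ^ 2 := by
    by_contra hcon
    push Not at hcon
    have := mul_pos (by positivity : 0 < 4 * ε) (sub_pos.2 hcon)
    linarith [hz.1]
  have hb2 : -(6 * q ^ 2) ≤ β := by
    by_contra hcon
    push Not at hcon
    have := mul_pos (by positivity : 0 < 4 * ε) (sub_pos.2 hcon)
    linarith
  set f : E := e + (4 * ε) • w with hfd
  have hfn : ‖f‖ ^ 2 = 1 + 16 * ε ^ 2 * ‖w‖ ^ 2 := by
    rw [hfd, norm_add_sq_real, he, inner_smul_right, hew, norm_smul, mul_pow, Real.norm_eq_abs, sq_abs]; ring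
  have hw2 : ‖w‖ ^ 2 ≤ C ^ 2 := by gcongr
  have hf1 : 1 ≤ ‖f‖ := by
    have : 1 ≤ ‖f‖ ^ 2 := by rw [hfn]; nlinarith [mul_nonneg (sq_nonneg ε) (sq_nonneg ‖w‖)]
    nlinarith [norm_nonneg f]
  have hf2 : ‖f‖ - 1 ≤ 8 * ε ^ 2 * C ^ 2 := by
    have : ‖f‖ ^ 2 ≤ 1 + 16 * ε ^ 2 * C ^ 2 := by rw [hfn]; gcongr
    nlinarith
  have hf0 : 0 < ‖f‖ := by linarith
  have hff : ‖‖f‖⁻¹ • f - f‖ = ‖f‖ - 1 := by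
    have : ‖f‖⁻¹ • f - f = (‖f‖⁻¹ - 1) • f := by module
    rw [this, norm_smul, Real.norm_eq_abs, abs_of_nonpos (by rw [sub_nonpos]; exact inv_le_one_of_one_le₀ hf1)]
    field_simp; ring
  have hε2 : 8 * ε ^ 2 * C ^ 2 ≤ ε * q := by
    have := mul_le_mul_of_nonneg_left hεc hε.le
    linarith
  refine ⟨‖f‖⁻¹ • f, ?_, ?_, ?_⟩
  · rw [norm_smul, norm_inv, norm_norm, inv_mul_cancel₀ hf0.ne']
  · have h1 : ‖f‖⁻¹ • f - e = (‖f‖⁻¹ • f - f) + (4 * ε) • w := by rw [hfd]; abel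
    rw [h1]
    refine (norm_add_le _ _).trans ?_
    rw [hff, norm_smul, Real.norm_of_nonneg (by positivity)]
    have h2 : 4 * ε * ‖w‖ ≤ 4 * ε * C := by gcongr
    have h3 : 8 * ε ^ 2 * C ^ 2 ≤ 8 * ε * C ^ 2 := by
      have : ε ^ 2 ≤ ε := by rw [sq]; exact mul_le_of_le_one_left hε.le hεb
      have h4 := mul_le_mul_of_nonneg_right this (sq_nonneg C)
      linarith
    linarith
  · intro x hxb
    have hρr : q / 4 * r = q * s := by rw [hs]; ring
    rw [hρr] at hxb ⊢
    rw [mem_ball, dist_eq_norm] at hxb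
    set z : E := s⁻¹ • (x - x0) with hzd
    have hsz : x - x0 = s • z := by rw [hzd, smul_smul, mul_inv_cancel₀ hs0.ne', one_smul]
    have hxz : x0 + s • z = x := by rw [← hsz]; abel
    have hzn : ‖z‖ < q := by
      rw [hsz, norm_smul, Real.norm_of_nonneg hs0.le, mul_comm] at hxb
      exact lt_of_mul_lt_mul_right hxb hs0.le
    have hk := hx z (by linarith)
    rw [hxz, scale_cl u hs0, hxz] at hk
    rw [hsz, inner_smul_right]
    have h5 := abs_real_inner_le_norm (‖f‖⁻¹ • f - f) z
    have h6 : ‖‖f‖⁻¹ • f - f‖ * ‖z‖ ≤ (ε * q) * q := by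
      gcongr
      rw [hff]; linarith
    have h7 := abs_le.1 (h5.trans h6)
    rw [inner_sub_left] at h7
    have h8 : ⟪f, z⟫ = ⟪e, z⟫ + 4 * ε * ⟪w, z⟫ := by rw [hfd, inner_add_left, inner_smul_left]; simp
    have h9 : C * ‖z‖ ^ 2 ≤ C * q ^ 2 := by gcongr
    have h10 : ε * q * (q * (49 + 4 * C)) = ε * q / 2 := by rw [hqe]; ring
    constructor
    · have h11 : 4 * ε * (β + ⟪w, z⟫ - 6 * q ^ 2 - C * ‖z‖ ^ 2) ≥ 4 * ε * (⟪w, z⟫ - 12 * q ^ 2 - C * q ^ 2) :=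
        mul_le_mul_of_nonneg_left (by linarith) (by positivity)
      have h12 : ⟪‖f‖⁻¹ • f, z⟫ - ε / 2 * q ≤ s⁻¹ * u x := by
        refine le_trans ?_ hk.1
        linarith
      rw [le_inv_mul_iff₀ hs0] at h12
      linarith
    · intro hp
      have h11 : 4 * ε * (β + ⟪w, z⟫ + 6 * q ^ 2 + C * ‖z‖ ^ 2) ≤ 4 * ε * (⟪w, z⟫ + 12 * q ^ 2 + C * q ^ 2) :=
        mul_le_mul_of_nonneg_left (by linarith) (by positivity)
      have h12 : s⁻¹ * u x ≤ ⟪‖f‖⁻¹ • f, z⟫ + ε / 2 * q := by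
        refine (hk.2 (subset_closure hp)).trans ?_
        linarith
      rw [inv_mul_le_iff₀ hs0] at h12
      linarith

variable (E) in
lemma EXP0 [Nontrivial E] : ∃ ρ ∈ Ioo (0:ℝ) (1/4), ∃ C ≥ 1, ∃ ε0 > 0, ∀ (u : E → ℝ) (G : E → E) (e x0 : E) (r ε : ℝ),
    0 < r → Sol u G (ball x0 r) → x0 ∈ closure {x | 0 < u x} → u x0 = 0 → 0 < ε → ε ≤ ε0 → ‖e‖ = 1 →
    Fl u e x0 (ε * r) r → ‖G x0 - e‖ ≤ C * ε ∧ ∀ k : ℕ, Fl u (G x0) x0 (C * ε / 2 ^ k * (ρ ^ k * r)) (ρ ^ k * r) := by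
  obtain ⟨ρ, hρ, C, hC, ε0, hε0, H⟩ := FI E
  refine ⟨ρ, hρ, 2 * C + 1, by linarith, ε0, hε0, ?_⟩
  intro u G e x0 r ε hr S hcl h0 hε hεε he hf
  have hρ0 := hρ.1
  have step : ∀ (k : ℕ) (a : E), ‖a‖ = 1 ∧ Fl u a x0 (ε / 2 ^ k * (ρ ^ k * r)) (ρ ^ k * r) →
      ∃ a', (‖a'‖ = 1 ∧ Fl u a' x0 (ε / 2 ^ (k+1) * (ρ ^ (k+1) * r)) (ρ ^ (k+1) * r)) ∧ ‖a' - a‖ ≤ C * (ε / 2 ^ k) := by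
    rintro k a ⟨ha, hfl⟩
    have hle : ρ ^ k * r ≤ r := by
      have : ρ ^ k ≤ 1 := pow_le_one₀ hρ0.le (by linarith [hρ.2])
      nlinarith
    obtain ⟨a', h1, h2, h3⟩ := H u G a x0 (ρ ^ k * r) (ε / 2 ^ k) (by positivity) (S.mono isOpen_ball (ball_subset_ball hle)) hcl h0
      (by positivity) ((div_le_self hε.le (one_le_pow₀ (by norm_num))).trans hεε) ha hfl
    refine ⟨a', ⟨h1, ?_⟩, h2⟩
    have e1 : ε / 2 ^ k / 2 = ε / 2 ^ (k+1) := by rw [pow_succ]; field_simp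
    have e2 : ρ * (ρ ^ k * r) = ρ ^ (k+1) * r := by rw [pow_succ]; ring
    rw [e1, e2] at h3
    exact h3
  choose! nx hnx1 hnx2 using step
  let sq : ℕ → E := fun k => Nat.rec e (fun k a => nx k a) k
  have hsq : ∀ k, ‖sq k‖ = 1 ∧ Fl u (sq k) x0 (ε / 2 ^ k * (ρ ^ k * r)) (ρ ^ k * r) := by
    intro k
    induction k with
    | zero =>
      refine ⟨he, ?_⟩
      change Fl u e x0 (ε / 2 ^ 0 * (ρ ^ 0 * r)) (ρ ^ 0 * r)
      simpa using hf
    | succ k ih => exact hnx1 k (sq k) ih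
  have hd : ∀ k, dist (sq k) (sq (k+1)) ≤ 2 * C * ε / 2 / 2 ^ k := by
    intro k
    rw [dist_comm, dist_eq_norm]
    refine (hnx2 k (sq k) (hsq k)).trans (le_of_eq ?_)
    ring
  obtain ⟨a, ha⟩ := cauchySeq_tendsto_of_complete (cauchySeq_of_le_geometric_two hd)
  have hda : ∀ k, dist (sq k) a ≤ 2 * C * ε / 2 ^ k := fun k => dist_le_of_le_geometric_two_of_tendsto hd ha k
  have hx0 : x0 ∈ ball x0 r := mem_ball_self hr
  have hG1 := S.norm1 x0 hx0 hcl h0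
  have han : ‖a‖ = 1 := tendsto_nhds_unique ha.norm (tendsto_const_nhds.congr fun k => ((hsq k).1).symm)
  have hρlim : Tendsto (fun k : ℕ => ρ ^ k * r / 2) atTop (𝓝[>] 0) := by
    rw [tendsto_nhdsWithin_iff]
    refine ⟨?_, Eventually.of_forall fun k => by rw [mem_Ioi]; positivity⟩
    have := ((_root_.tendsto_pow_atTop_nhds_zero_of_lt_one hρ0.le (by linarith [hρ.2])).mul_const r).div_const 2
    simpa using this
  have hinner : ∀ η : ℝ, 0 < η → η < 1 → 1 - η ≤ ⟪a, G x0⟫ := by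
    intro η hη hη1
    have hev := hρlim.eventually (S.nondeg hx0 hcl h0 hη hη1)
    have hlim2 : Tendsto (fun k : ℕ => ⟪sq k, G x0⟫ + 2 * (ε / 2 ^ k)) atTop (𝓝 (⟪a, G x0⟫ + 0)) := by
      refine (ha.inner tendsto_const_nhds).add ?_
      have : Tendsto (fun k : ℕ => 2 * (ε * ((1:ℝ)/2) ^ k)) atTop (𝓝 (2 * (ε * 0))) :=
        ((_root_.tendsto_pow_atTop_nhds_zero_of_lt_one (r := (1:ℝ)/2) (by norm_num) (by norm_num)).const_mul ε).const_mul 2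
      simp only [mul_zero] at this
      refine this.congr fun k => ?_
      rw [one_div, inv_pow]; ring
    rw [add_zero] at hlim2
    refine ge_of_tendsto hlim2 ?_
    filter_upwards [hev] with k hk
    have hpk : 0 < ρ ^ k * r := by positivity
    have hu : 0 < u (x0 + (ρ ^ k * r / 2) • G x0) := by
      refine lt_of_lt_of_le ?_ hk
      have : 0 < 1 - η := by linarith
      positivity
    have h1 := ((hsq k).2 (x0 + (ρ ^ k * r / 2) • G x0) (by
      rw [mem_ball, dist_eq_norm, add_sub_cancel_left, norm_smul, hG1, Real.norm_of_nonneg (by positivity)]; linarith)).2 hu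
    rw [add_sub_cancel_left, inner_smul_right] at h1
    have h2 := hk.trans h1
    have h3 : (ρ ^ k * r / 2) * (1 - η) ≤ (ρ ^ k * r / 2) * (⟪sq k, G x0⟫ + 2 * (ε / 2 ^ k)) := by linarith
    exact le_of_mul_le_mul_left h3 (by positivity)
  have h1 : 1 ≤ ⟪a, G x0⟫ := by
    by_contra hcon
    push Not at hcon
    rcases le_or_gt ⟪a, G x0⟫ 0 with h | h
    · linarith [hinner (1/2) (by norm_num) (by norm_num)]
    · linarith [hinner ((1 - ⟪a, G x0⟫) / 2) (by linarith) (by linarith)]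
  have haG : a = G x0 := by
    have h2 := real_inner_le_norm a (G x0)
    rw [han, hG1] at h2
    exact (inner_eq_one_iff_of_norm_eq_one (𝕜 := ℝ) han hG1).1 (le_antisymm (by linarith) h1)
  rw [haG] at hda
  constructor
  · have := hda 0
    rw [dist_comm, dist_eq_norm] at this
    simp only [pow_zero, div_one] at this
    change ‖G x0 - e‖ ≤ _ at this
    linarith
  · intro k
    have h2 := hda k
    rw [dist_comm, dist_eq_norm] at h2
    have := (hsq k).2.change h2 (by positivity)
    refine this.mono (le_of_eq ?_) le_rfl
    ring

variable (E) in
lemma EXPa [Nontrivial E] : ∃ γ ∈ Ioo (0:ℝ) 1, ∃ C ≥ 1, ∃ ε0 > 0, ∀ (u : E → ℝ) (G : E → E) (e : E) (ε : ℝ),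
    0 < ε → ε ≤ ε0 → ‖e‖ = 1 → Sol u G (ball 0 1) → Flat u e (-ε) ε 0 1 →
    ∀ x0 ∈ ball (0:E) (7/8), x0 ∈ closure {x | 0 < u x} → u x0 = 0 → ‖G x0 - e‖ ≤ C * ε ∧
    ∀ x ∈ ball x0 (1/8), ⟪G x0, x - x0⟫ - C * ε * ‖x - x0‖ ^ (1 + γ) ≤ u x ∧
      (0 < u x → u x ≤ ⟪G x0, x - x0⟫ + C * ε * ‖x - x0‖ ^ (1 + γ)) := by
  obtain ⟨ρ, hρ, C, hC, ε0, hε0, H⟩ := EXP0 E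
  have hρ0 := hρ.1
  have hρ1 : ρ < 1 := by linarith [hρ.2]
  have hlρ : Real.log ρ < 0 := Real.log_neg hρ0 hρ1
  have hl2 : 0 < Real.log 2 := Real.log_pos (by norm_num)
  set γ := Real.log 2 / (-Real.log ρ) with hγ
  have hγ0 : 0 < γ := div_pos hl2 (by linarith)
  have hγ1 : γ < 1 := by
    rw [hγ, div_lt_one (by linarith), ← Real.log_inv]
    refine Real.log_lt_log (by norm_num) ?_
    rw [lt_inv_comm₀ (by norm_num) hρ0]
    have := hρ.2; norm_num at this ⊢; linarith
  have hργ : ρ ^ γ = 1 / 2 := by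
    rw [Real.rpow_def_of_pos hρ0, hγ]
    have : Real.log ρ * (Real.log 2 / -Real.log ρ) = - Real.log 2 := by
      have := hlρ.ne; field_simp
    rw [this, Real.exp_neg, Real.exp_log (by norm_num)]; norm_num
  refine ⟨γ, ⟨hγ0, hγ1⟩, max (16 * C) (16 * C * (2 / ρ) * 8), le_max_of_le_left (by linarith), ε0 / 16, by positivity, ?_⟩
  intro u G e ε hε hεε he S hf x0 hx0 hcl h0
  rw [mem_ball_zero_iff] at hx0
  have hsub : ball x0 (1/8) ⊆ ball (0:E) 1 := by
    intro z hz
    rw [mem_ball, dist_eq_norm] at hz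
    rw [mem_ball_zero_iff]
    have := norm_add_le (z - x0) x0
    rw [sub_add_cancel] at this
    linarith
  have hx01 : x0 ∈ ball (0:E) 1 := by rw [mem_ball_zero_iff]; linarith
  have hcle : Continuous fun y : E => ⟪e, y⟫ := continuous_const.inner continuous_id
  have t1 := S.le_cl (v := fun y => ⟪e, y⟫ + ε) (by fun_prop) (fun z hz => (hf z hz).2) hx01 hcl
  have t2 := (le_max_left _ _).trans (hf x0 hx01).1
  rw [h0] at t1 t2
  have S' := S.mono isOpen_ball hsub
  obtain ⟨k1, k2⟩ := H u G e x0 (1/8) (16 * ε) (by norm_num) S' hcl h0 (by positivity) (by linarith) he (by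
    intro x hx
    have h1 := hf x (hsub hx)
    rw [inner_sub_right]
    refine ⟨by linarith [(le_max_left _ _).trans h1.1], fun hp => ?_⟩
    rcases le_max_iff.1 h1.2 with h | h
    · linarith
    · linarith)
  refine ⟨k1.trans ?_, ?_⟩
  · calc C * (16 * ε) = 16 * C * ε := by ring
      _ ≤ _ := by gcongr; exact le_max_left _ _
  · intro x hx
    rcases eq_or_ne x x0 with rfl | hne
    · simp only [sub_self, inner_zero_right, norm_zero, h0, lt_irrefl, false_implies, and_true]
      rw [Real.zero_rpow (by linarith)]; simp
    have hpos : 0 < ‖x - x0‖ := norm_pos_iff.2 (sub_ne_zero.2 hne)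
    rw [mem_ball, dist_eq_norm] at hx
    obtain ⟨k, hk1, hk2⟩ := exists_nat_pow_near_of_lt_one (x := 8 * ‖x - x0‖) (y := ρ) (by positivity) (by linarith) hρ0 hρ1
    obtain ⟨j, hj1, hj2⟩ : ∃ j : ℕ, ρ ^ (j + 1) ≤ 8 * ‖x - x0‖ ∧ 8 * ‖x - x0‖ < ρ ^ j := by
      rcases hk2.eq_or_lt with h | h
      · cases k with
        | zero => simp at h; linarith
        | succ k => exact ⟨k, h.ge, by rw [h]; exact pow_lt_pow_right_of_lt_one₀ hρ0 hρ1 (Nat.lt_succ_self k)⟩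
      · exact ⟨k, hk1.le, h⟩
    have hb := k2 j x (by rw [mem_ball, dist_eq_norm]; linarith)
    have hpw : (ρ ^ (j+1)) ^ γ = 1 / 2 ^ (j+1) := by
      rw [← Real.rpow_natCast, ← Real.rpow_mul hρ0.le, mul_comm, Real.rpow_mul hρ0.le, hργ, Real.rpow_natCast]
      simp
    have hle : 1 / 2 ^ (j+1) ≤ (8 * ‖x - x0‖) ^ γ := by rw [← hpw]; gcongr
    have h8 : (8 * ‖x - x0‖) ^ γ ≤ 8 * ‖x - x0‖ ^ γ := by
      rw [Real.mul_rpow (by norm_num) (norm_nonneg _)]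
      gcongr
      calc (8:ℝ) ^ γ ≤ 8 ^ (1:ℝ) := Real.rpow_le_rpow_of_exponent_le (by norm_num) hγ1.le
        _ = 8 := Real.rpow_one _
    have h9 : 1 / 2 ^ j ≤ 2 * (8 * ‖x - x0‖ ^ γ) := by
      have : (1:ℝ) / 2 ^ j = 2 * (1 / 2 ^ (j+1)) := by rw [pow_succ]; field_simp
      rw [this]; linarith
    have h10 : ρ ^ j * (1/8) ≤ ‖x - x0‖ / ρ := by
      rw [le_div_iff₀ hρ0]; rw [pow_succ] at hj1; linarith
    have h11 : C * (16 * ε) / 2 ^ j * (ρ ^ j * (1/8)) ≤ max (16 * C) (16 * C * (2 / ρ) * 8) * ε * ‖x - x0‖ ^ (1 + γ) := by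
      calc C * (16 * ε) / 2 ^ j * (ρ ^ j * (1/8)) = C * (16 * ε) * (1 / 2 ^ j) * (ρ ^ j * (1/8)) := by ring
        _ ≤ C * (16 * ε) * (2 * (8 * ‖x - x0‖ ^ γ)) * (‖x - x0‖ / ρ) := by gcongr
        _ = (16 * C * (2 / ρ) * 8) * ε * (‖x - x0‖ * ‖x - x0‖ ^ γ) := by field_simp
        _ = (16 * C * (2 / ρ) * 8) * ε * ‖x - x0‖ ^ (1 + γ) := by rw [Real.rpow_add hpos, Real.rpow_one]
        _ ≤ _ := by gcongr; exact le_max_right _ _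
    exact ⟨by linarith [hb.1], fun hp => by linarith [hb.2 hp]⟩

end
end OP

namespace OP
open scoped RealInnerProductSpace Topology
open Module

section
variable {E : Type*} [NormedAddCommGroup E] [InnerProductSpace ℝ E] [FiniteDimensional ℝ E]
  [MeasurableSpace E] [BorelSpace E]

variable {u : E → ℝ} {G : E → E} {U : Set E}

lemma rp_le {c r γ : ℝ} (hc : 1 ≤ c) (hr : 0 ≤ r) (hγ1 : γ ≤ 1) : (c * r) ^ γ ≤ c * r ^ γ := by
  rw [Real.mul_rpow (by linarith) hr]
  gcongr
  calc c ^ γ ≤ c ^ (1:ℝ) := Real.rpow_le_rpow_of_exponent_le hc hγ1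
    _ = c := Real.rpow_one _

lemma rp_one {c r γ : ℝ} (hc : 1 ≤ c) (hr : 0 ≤ r) (hγ0 : 0 ≤ γ) (hγ1 : γ ≤ 1) (h : 1 ≤ c * r) : 1 ≤ c * r ^ γ :=
  (Real.one_le_rpow h hγ0).trans (rp_le hc hr hγ1)

lemma rp_le1 {r γ : ℝ} (hr : 0 ≤ r) (hr1 : r ≤ 1) (hγ0 : 0 ≤ γ) : r ^ γ ≤ 1 := Real.rpow_le_one hr hr1 hγ0

lemma le_rp {s γ : ℝ} (hs : 0 ≤ s) (hs1 : s ≤ 1) (hγ0 : 0 < γ) (hγ1 : γ ≤ 1) : s ≤ s ^ γ := by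
  rcases hs.eq_or_lt with h | h
  · rw [← h, Real.zero_rpow hγ0.ne']
  · calc s = s ^ (1:ℝ) := (Real.rpow_one s).symm
      _ ≤ s ^ γ := Real.rpow_le_rpow_of_exponent_ge h hs1 hγ1

variable (E) in
lemma HolH [Nontrivial E] : ∃ C : ℝ, 1 ≤ C ∧ ∀ (u : E → ℝ) (G : E → E) (x a : E) (c d m γ : ℝ), 0 < d → 0 < γ → γ ≤ 1 → 0 ≤ m →
    Harm u G (ball x d) → (∀ z ∈ ball x d, |u z - (⟪a, z⟫ + c)| ≤ m * d ^ (1 + γ)) →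
    ‖G x - a‖ ≤ C * m * d ^ γ ∧ ∀ z, ‖z - x‖ < d / 2 → ‖G z - G x‖ ≤ C * m * ‖z - x‖ ^ γ := by
  obtain ⟨C, hC, H⟩ := harm_est (E := E)
  refine ⟨C, hC, ?_⟩
  intro u G x a c d m γ hd hγ hγ1 hm hH hb
  obtain ⟨-, h1, -, h2, -⟩ := H _ _ x d _ hd (hH.sub_affine a c) hb
  have hdd : d ^ (1 + γ) = d * d ^ γ := by rw [Real.rpow_add hd, Real.rpow_one]
  have he : C * (m * d ^ (1 + γ)) / d = C * m * d ^ γ := by rw [hdd]; field_simp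
  rw [he] at h1 h2
  refine ⟨h1, fun z hz => ?_⟩
  have h3 := h2 z (by rw [mem_ball, dist_eq_norm]; exact hz)
  rw [sub_sub_sub_cancel_right] at h3
  refine h3.trans ?_
  have h4 : ‖z - x‖ / d ≤ (‖z - x‖ / d) ^ γ := le_rp (by positivity) (by rw [div_le_one hd]; linarith) hγ hγ1
  calc C * m * d ^ γ * (‖z - x‖ / d) ≤ C * m * d ^ γ * (‖z - x‖ / d) ^ γ := by gcongr
    _ = C * m * ‖z - x‖ ^ γ := by
      rw [Real.div_rpow (norm_nonneg _) hd.le]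
      have : 0 < d ^ γ := Real.rpow_pos_of_pos hd γ
      field_simp

/-- comparison of the two expansions at free boundary points -/
lemma FBpair {e x0 y0 : E} {C ε γ : ℝ} (hγ : 0 < γ) (hγ1 : γ ≤ 1) (hC : 0 ≤ C) (hε : 0 ≤ ε) (hCε : C * ε ≤ 1 / 10) (he : ‖e‖ = 1)
    (ha : ‖G x0‖ = 1) (hae : ‖G x0 - e‖ ≤ C * ε) (hx : ∀ x ∈ ball x0 (1/8), ⟪G x0, x - x0⟫ - C * ε * ‖x - x0‖ ^ (1 + γ) ≤ u x ∧
      (0 < u x → u x ≤ ⟪G x0, x - x0⟫ + C * ε * ‖x - x0‖ ^ (1 + γ)))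
    (hy : ∀ x ∈ ball y0 (1/8), ⟪G y0, x - y0⟫ - C * ε * ‖x - y0‖ ^ (1 + γ) ≤ u x ∧
      (0 < u x → u x ≤ ⟪G y0, x - y0⟫ + C * ε * ‖x - y0‖ ^ (1 + γ))) (ht : ‖x0 - y0‖ < 1 / 32) :
    ‖G x0 - G y0‖ ≤ 100 * C * ε * ‖x0 - y0‖ ^ γ := by
  set t := ‖x0 - y0‖ with htd
  rcases (norm_nonneg (x0 - y0)).eq_or_lt with h | ht0
  · have : x0 = y0 := sub_eq_zero.1 (norm_eq_zero.1 h.symm)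
    rw [this, sub_self, norm_zero]
    positivity
  rw [← htd] at ht0
  have hCε0 : 0 ≤ C * ε := by positivity
  set P := C * ε * (4 * t) ^ (1 + γ) with hP
  have hP1 : P ≤ C * ε * (16 * t * t ^ γ) := by
    rw [hP]
    refine mul_le_mul_of_nonneg_left ?_ hCε0
    rw [Real.rpow_add (by positivity), Real.rpow_one]
    have := rp_le (by norm_num : (1:ℝ) ≤ 4) ht0.le hγ1
    calc 4 * t * (4 * t) ^ γ ≤ 4 * t * (4 * t ^ γ) := by gcongr
      _ = 16 * t * t ^ γ := by ring
  have key : ∀ w : E, ‖w‖ ≤ t / 2 → |⟪G x0, x0 + (2 * t) • e + w - x0⟫ - ⟪G y0, x0 + (2 * t) • e + w - y0⟫| ≤ 2 * P := by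
    intro w hw
    set z := x0 + (2 * t) • e + w with hz
    have hn1 : ‖z - x0‖ ≤ 5 / 2 * t := by
      have : z - x0 = (2 * t) • e + w := by rw [hz]; abel
      rw [this]
      refine (norm_add_le _ _).trans ?_
      rw [norm_smul, he, Real.norm_of_nonneg (by positivity)]; linarith
    have hn2 : ‖z - y0‖ ≤ 7 / 2 * t := by
      have : z - y0 = (z - x0) + (x0 - y0) := by abel
      rw [this]
      refine (norm_add_le _ _).trans ?_
      rw [← htd]; linarith
    have h1 := hx z (by rw [mem_ball, dist_eq_norm]; linarith)
    have h2 := hy z (by rw [mem_ball, dist_eq_norm]; linarith)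
    have h3 : C * ε * ‖z - x0‖ ^ (1 + γ) ≤ P := by
      rw [hP]; gcongr; linarith
    have h4 : C * ε * ‖z - y0‖ ^ (1 + γ) ≤ P := by
      rw [hP]; gcongr; linarith
    have h5 : C * ε * ‖z - x0‖ ^ (1 + γ) ≤ 1 / 10 * (5 / 2 * t) := by
      refine mul_le_mul hCε ?_ (by positivity) (by norm_num)
      calc ‖z - x0‖ ^ (1 + γ) ≤ (5 / 2 * t) ^ (1 + γ) := by gcongr
        _ = 5 / 2 * t * (5 / 2 * t) ^ γ := by rw [Real.rpow_add (by positivity), Real.rpow_one]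
        _ ≤ 5 / 2 * t * 1 := by
          gcongr
          exact rp_le1 (by positivity) (by linarith) hγ.le
        _ = _ := by ring
    have h6 : (3/2 - 2 / 10) * t ≤ ⟪G x0, z - x0⟫ := by
      have e1 : ⟪G x0, z - x0⟫ = 2 * t * (⟪e, e⟫ + ⟪G x0 - e, e⟫) + ⟪G x0, w⟫ := by
        have : z - x0 = (2 * t) • e + w := by rw [hz]; abel
        rw [this, inner_add_right, inner_smul_right, inner_sub_left]; ring
      have e2 := (abs_le.1 (abs_real_inner_le_norm (G x0 - e) e)).1
      have e3 := (abs_le.1 (abs_real_inner_le_norm (G x0) w)).1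
      rw [he, mul_one] at e2
      rw [ha, one_mul] at e3
      rw [e1, real_inner_self_eq_norm_sq, he]
      have e4 : 2 * t * (1 - 1 / 10) ≤ 2 * t * (1 ^ 2 + ⟪G x0 - e, e⟫) :=
        mul_le_mul_of_nonneg_left (by linarith) (by positivity)
      linarith
    have hpos : 0 < u z := by linarith [h1.1]
    have h7 := h1.2 hpos
    have h8 := h2.2 hpos
    rw [abs_le]
    exact ⟨by linarith [h1.1, h2.1], by linarith [h1.1, h2.1]⟩
  rcases eq_or_ne (G x0 - G y0) 0 with h0 | h0
  · rw [h0, norm_zero]; positivity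
  have hn : 0 < ‖G x0 - G y0‖ := norm_pos_iff.2 h0
  set w : E := (t / 2 * ‖G x0 - G y0‖⁻¹) • (G x0 - G y0) with hw
  have hwn : ‖w‖ = t / 2 := by
    rw [hw, norm_smul, Real.norm_of_nonneg (by positivity)]; field_simp
  have k1 := abs_le.1 (key w hwn.le)
  have k2 := abs_le.1 (key (-w) (by rw [norm_neg, hwn]))
  have hiw : ⟪G x0 - G y0, w⟫ = t / 2 * ‖G x0 - G y0‖ := by
    rw [hw, inner_smul_right, real_inner_self_eq_norm_sq]; field_simp
  rw [inner_sub_left] at hiw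
  simp only [inner_sub_right, inner_add_right, inner_neg_right] at k1 k2
  have h9 : t * ‖G x0 - G y0‖ ≤ t * (100 * C * ε * t ^ γ) := by
    have : 0 ≤ C * ε * (t * t ^ γ) := by positivity
    linarith
  exact le_of_mul_le_mul_left h9 ht0

variable (E) in
lemma HOL [Nontrivial E] : ∃ γ ∈ Ioo (0:ℝ) 1, ∃ C ≥ 1, ∃ ε0 > 0, ∀ (u : E → ℝ) (G : E → E) (e : E) (ε : ℝ),
    0 < ε → ε ≤ ε0 → ‖e‖ = 1 → Sol u G (ball 0 1) → Flat u e (-ε) ε 0 1 →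
    ∀ x ∈ ball (0:E) (3/4), x ∈ closure {x | 0 < u x} → ‖G x - e‖ ≤ C * ε ∧
    ∀ y ∈ ball (0:E) (3/4), y ∈ closure {x | 0 < u x} → ‖G x - G y‖ ≤ C * ε * ‖x - y‖ ^ γ := by
  obtain ⟨γ, hγ, C, hC, ε0, hε0, H⟩ := EXPa E
  obtain ⟨C1, hC1, H1⟩ := HolH E
  have hγ0 := hγ.1
  have hγ1 := hγ.2.le
  set K := C1 * (1024 * C) with hK
  have hK1 : 1 ≤ K := by
    have := mul_le_mul hC1 (by linarith : (1:ℝ) ≤ 1024 * C) (by norm_num) (by linarith)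
    linarith
  have hCK : C ≤ K := by
    have := mul_le_mul hC1 (by linarith : C ≤ 1024 * C) (by linarith) (by linarith)
    linarith
  refine ⟨γ, hγ, 1000 * K, by linarith, min ε0 (1 / (10 * C)), by positivity, ?_⟩
  intro u G e ε hε hεm he S hf
  have hεε : ε ≤ ε0 := hεm.trans (min_le_left _ _)
  have hCε : C * ε ≤ 1 / 10 := by
    have := hεm.trans (min_le_right _ _)
    rw [le_div_iff₀ (by positivity)] at this
    linarith
  have HE := H u G e ε hε hεε he S hf
  have hCεK : C * ε ≤ K * ε := by gcongr
  have hKε : 0 ≤ K * ε := by positivity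
  have PT : ∀ x ∈ ball (0:E) (3/4), x ∈ closure {x | 0 < u x} → ∃ (a : E) (d : ℝ), 0 ≤ d ∧ d ≤ 1 / 32 ∧ ‖G x - a‖ ≤ K * ε * d ^ γ ∧
      ‖a - e‖ ≤ K * ε ∧ (∀ z, ‖z - x‖ < d / 2 → ‖G z - G x‖ ≤ K * ε * ‖z - x‖ ^ γ) ∧
      (d = 1 / 32 ∨ ∃ x0 ∈ ball (0:E) (7/8), x0 ∈ closure {x | 0 < u x} ∧ u x0 = 0 ∧ ‖x - x0‖ = d ∧ a = G x0) := by
    intro x hx hcl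
    rw [mem_ball_zero_iff] at hx
    have hsub : ∀ z, ‖z - x‖ ≤ 1 / 32 → z ∈ ball (0:E) (7/8) := by
      intro z hz
      rw [mem_ball_zero_iff]
      have := norm_add_le (z - x) x
      rw [sub_add_cancel] at this
      linarith
    have h78 : ball (0:E) (7/8) ⊆ ball 0 1 := ball_subset_ball (by norm_num)
    by_cases hI : ∀ z ∈ ball x (1/32), 0 < u z
    · have hb : ball x (1/32) ⊆ ball (0:E) 1 ∩ {x | 0 < u x} := by
        intro z hz
        refine ⟨h78 (hsub z ?_), hI z hz⟩
        rw [mem_ball, dist_eq_norm] at hz; exact hz.le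
      have hH := S.harm.mono hb
      obtain ⟨k1, k2⟩ := H1 u G x e 0 (1/32) (1024 * C * ε) γ (by norm_num) hγ0 hγ1 (by positivity) hH (by
        intro z hz
        have h1 := hf z (hb hz).1
        have h2 := hI z hz
        have h3 : u z ≤ ⟪e, z⟫ + ε := by
          rcases le_max_iff.1 h1.2 with h | h
          · exact h
          · linarith
        have h4 := (le_max_left _ _).trans h1.1
        have h5 : 1 ≤ 1024 * (1/32:ℝ) ^ (1 + γ) := by
          rw [Real.rpow_add (by norm_num), Real.rpow_one]
          have := rp_one (c := 32) (r := 1/32) (by norm_num) (by norm_num) hγ0.le hγ1 (by norm_num)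
          linarith
        have h6 : ε ≤ 1024 * C * ε * (1/32:ℝ) ^ (1 + γ) := by
          calc ε = 1 * ε * 1 := by ring
            _ ≤ C * ε * (1024 * (1/32:ℝ) ^ (1 + γ)) := by gcongr
            _ = _ := by ring
        rw [abs_le]
        exact ⟨by linarith, by linarith⟩)
      have e1 : C1 * (1024 * C * ε) = K * ε := by rw [hK]; ring
      rw [e1] at k1 k2
      exact ⟨e, 1/32, by norm_num, le_rfl, k1, by rw [sub_self, norm_zero]; exact hKε, k2, Or.inl rfl⟩
    · push Not at hI
      obtain ⟨z1, hz1, hz1u⟩ := hI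
      have hcont : ContinuousOn u (closedBall x (1/32)) := fun z hz =>
        (S.cont z (h78 (hsub z (by rwa [mem_closedBall, dist_eq_norm] at hz)))).continuousWithinAt
      have hZ : IsCompact (closedBall x (1/32) ∩ u ⁻¹' (Iic 0)) :=
        (isCompact_closedBall x (1/32)).of_isClosed_subset (hcont.preimage_isClosed_of_isClosed isClosed_closedBall isClosed_Iic) inter_subset_left
      obtain ⟨x0, hx0, hmin⟩ := hZ.exists_isMinOn ⟨z1, ball_subset_closedBall hz1, hz1u⟩ (f := fun z => dist z x) (by fun_prop)
      have hx0d : dist x0 x < 1 / 32 := lt_of_le_of_lt (hmin ⟨ball_subset_closedBall hz1, hz1u⟩) hz1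
      have hx0b : x0 ∈ ball (0:E) (7/8) := hsub x0 (by rw [← dist_eq_norm]; exact hx0d.le)
      have hx00 : u x0 = 0 := le_antisymm hx0.2 (S.nonneg x0 (h78 hx0b))
      set d := dist x0 x with hd
      have hin : ∀ z ∈ ball x d, 0 < u z := by
        intro z hz
        by_contra hcon
        push Not at hcon
        have h1 : d ≤ dist z x := hmin ⟨by rw [mem_closedBall]; rw [mem_ball] at hz; linarith, hcon⟩
        rw [mem_ball] at hz
        linarith
      have hnx : ‖x - x0‖ = d := by rw [hd, dist_comm, dist_eq_norm]
      rcases (dist_nonneg (x := x0) (y := x)).eq_or_lt with hd0 | hd0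
      · have hxx : x0 = x := dist_eq_zero.1 hd0.symm
        rw [← hd] at hd0
        have h1 := HE x0 hx0b (by rw [hxx]; exact hcl) hx00
        refine ⟨G x0, d, hd0.le, by linarith, ?_, h1.1.trans hCεK, ?_, Or.inr ⟨x0, hx0b, by rw [hxx]; exact hcl, hx00, hnx, rfl⟩⟩
        · rw [hxx, sub_self, norm_zero]; positivity
        · intro z hz
          rw [← hd0] at hz
          linarith [norm_nonneg (z - x)]
      · rw [← hd] at hd0
        have hcl0 : x0 ∈ closure {x | 0 < u x} := by
          have h1 : x0 ∈ closure (ball x d) := by rw [closure_ball x hd0.ne']; rw [mem_closedBall]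
          exact closure_mono hin h1
        have h1 := HE x0 hx0b hcl0 hx00
        have hH : Harm u G (ball x d) := S.harm.mono fun z hz => ⟨h78 (hsub z (by
          rw [mem_ball, dist_eq_norm] at hz; linarith)), hin z hz⟩
        obtain ⟨k1, k2⟩ := H1 u G x (G x0) (-⟪G x0, x0⟫) d (1024 * C * ε) γ hd0 hγ0 hγ1 (by positivity) hH (by
          intro z hz
          have hz' := hz
          rw [mem_ball, dist_eq_norm] at hz'
          have h2 : ‖z - x0‖ ≤ 2 * d := by
            have := norm_add_le (z - x) (x - x0)
            rw [sub_add_sub_cancel] at this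
            linarith
          have h3 := h1.2 z (by rw [mem_ball, dist_eq_norm]; linarith)
          have h4 := h3.2 (hin z hz)
          have h5 : C * ε * ‖z - x0‖ ^ (1 + γ) ≤ 1024 * C * ε * d ^ (1 + γ) := by
            have : ‖z - x0‖ ^ (1 + γ) ≤ 4 * d ^ (1 + γ) := by
              calc ‖z - x0‖ ^ (1 + γ) ≤ (2 * d) ^ (1 + γ) := by gcongr
                _ = 2 * d * (2 * d) ^ γ := by rw [Real.rpow_add (by positivity), Real.rpow_one]
                _ ≤ 2 * d * (2 * d ^ γ) := by
                  gcongr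
                  exact rp_le (by norm_num) hd0.le hγ1
                _ = 4 * d ^ (1 + γ) := by rw [Real.rpow_add hd0, Real.rpow_one]; ring
            have hq : 0 ≤ C * ε * d ^ (1 + γ) := by positivity
            calc C * ε * ‖z - x0‖ ^ (1 + γ) ≤ C * ε * (4 * d ^ (1 + γ)) := by gcongr
              _ ≤ _ := by linarith
          rw [inner_sub_right] at h3 h4
          rw [abs_le]
          exact ⟨by linarith [h3.1], by linarith⟩)
        have e1 : C1 * (1024 * C * ε) = K * ε := by rw [hK]; ring
        rw [e1] at k1 k2
        exact ⟨G x0, d, hd0.le, hx0d.le, k1, h1.1.trans hCεK, k2, Or.inr ⟨x0, hx0b, hcl0, hx00, hnx, rfl⟩⟩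
  have R1 : ∀ x ∈ ball (0:E) (3/4), x ∈ closure {x | 0 < u x} → ‖G x - e‖ ≤ 2 * K * ε := by
    intro x hx hcl
    obtain ⟨a, d, hd0, hd1, h1, h2, -⟩ := PT x hx hcl
    have := norm_add_le (G x - a) (a - e)
    rw [sub_add_sub_cancel] at this
    have h3 : K * ε * d ^ γ ≤ K * ε * 1 := mul_le_mul_of_nonneg_left (rp_le1 hd0 (by linarith) hγ0.le) hKε
    linarith
  intro x hx hcl
  refine ⟨(R1 x hx hcl).trans (by linarith), fun y hy hcly => ?_⟩
  set r := ‖x - y‖ with hr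
  have hr0 : 0 ≤ r := norm_nonneg _
  have hKr : 0 ≤ K * ε * r ^ γ := by positivity
  have crude : 1 / 160 ≤ r → ‖G x - G y‖ ≤ 1000 * K * ε * r ^ γ := by
    intro h
    have h1 := rp_one (c := 160) (r := r) (by norm_num) hr0 hγ0.le hγ1 (by linarith)
    have h2 := norm_sub_le (G x - e) (G y - e)
    rw [sub_sub_sub_cancel_right] at h2
    have h3 := mul_le_mul_of_nonneg_left h1 hKε
    linarith [R1 x hx hcl, R1 y hy hcly]
  obtain ⟨a, d, hd0, hd1, h1, h2, h3, h4⟩ := PT x hx hcl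
  obtain ⟨b, d', hd0', hd1', h1', h2', h3', h4'⟩ := PT y hy hcly
  rcases lt_or_ge r (d / 2) with hA | hA
  · have := h3 y (by rw [norm_sub_rev]; exact hA)
    rw [norm_sub_rev, norm_sub_rev y x, ← hr] at this
    linarith
  rcases lt_or_ge r (d' / 2) with hB | hB
  · have := h3' x hB
    linarith
  rcases lt_or_ge r (1/160) with hR | hR
  swap
  · exact crude hR
  rcases h4 with h4 | ⟨x0, hx0, hx0c, hx00, hxd, rfl⟩
  · linarith
  rcases h4' with h4' | ⟨y0, hy0, hy0c, hy00, hyd, rfl⟩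
  · linarith
  have hE1 := HE x0 hx0 hx0c hx00
  have hE2 := HE y0 hy0 hy0c hy00
  have ht : ‖x0 - y0‖ ≤ 5 * r := by
    have e1 : x0 - y0 = -(x - x0) + ((x - y) + (y - y0)) := by abel
    rw [e1]
    refine (norm_add_le _ _).trans ?_
    rw [norm_neg]
    have := norm_add_le (x - y) (y - y0)
    linarith
  have hp := FBpair (u := u) hγ0 hγ1 (by linarith) hε.le hCε he (S.norm1 x0 (ball_subset_ball (by norm_num) hx0) hx0c hx00) hE1.1 hE1.2 hE2.2 (by linarith)
  have hp2 : ‖x0 - y0‖ ^ γ ≤ 5 * r ^ γ := by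
    calc ‖x0 - y0‖ ^ γ ≤ (5 * r) ^ γ := by gcongr
      _ ≤ _ := rp_le (by norm_num) hr0 hγ1
  have hp3 : 100 * C * ε * ‖x0 - y0‖ ^ γ ≤ 100 * K * ε * (5 * r ^ γ) := by gcongr
  have hdr : K * ε * d ^ γ ≤ K * ε * (2 * r ^ γ) := by
    refine mul_le_mul_of_nonneg_left ?_ hKε
    exact (Real.rpow_le_rpow hd0 (by linarith : d ≤ 2 * r) hγ0.le).trans (rp_le (by norm_num) hr0 hγ1)
  have hdr' : K * ε * d' ^ γ ≤ K * ε * (2 * r ^ γ) := by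
    refine mul_le_mul_of_nonneg_left ?_ hKε
    exact (Real.rpow_le_rpow hd0' (by linarith : d' ≤ 2 * r) hγ0.le).trans (rp_le (by norm_num) hr0 hγ1)
  have e1 : G x - G y = (G x - G x0) + ((G x0 - G y0) + -(G y - G y0)) := by abel
  rw [e1]
  refine (norm_add_le _ _).trans ?_
  have := norm_add_le (G x0 - G y0) (-(G y - G y0))
  rw [norm_neg] at this
  linarith

end
end OP

namespace OP
open scoped RealInnerProductSpace Topology
open Module

section
variable {E : Type*} [NormedAddCommGroup E] [InnerProductSpace ℝ E] [FiniteDimensional ℝ E]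
  [MeasurableSpace E] [BorelSpace E]

lemma strip_le {e : E} (he : ‖e‖ = 1) {R K : ℝ} (hK : 1 ≤ K) :
    volume.real {y : E | ‖y‖ ≤ R ∧ |⟪e, y⟫| ≤ 2 / K} ≤ volume.real (closedBall (0:E) (R + 2)) / K := by
  have hK0 : 0 < K := by linarith
  set f : E →ₗ[ℝ] E := LinearMap.transvection (innerSL ℝ e : E →ₗ[ℝ] ℝ) ((K - 1) • e) with hf
  have hfa : ∀ y, f y = y + ⟪e, y⟫ • ((K - 1) • e) := fun y => rfl
  have hdet : LinearMap.det f = K := by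
    rw [hf, LinearMap.transvection.det]
    simp [inner_smul_right, he]
  have hsub : f '' {y : E | ‖y‖ ≤ R ∧ |⟪e, y⟫| ≤ 2 / K} ⊆ closedBall 0 (R + 2) := by
    rintro _ ⟨y, ⟨h1, h2⟩, rfl⟩
    rw [mem_closedBall_zero_iff, hfa]
    refine (norm_add_le _ _).trans ?_
    rw [norm_smul, norm_smul, he, Real.norm_of_nonneg (by linarith : 0 ≤ K - 1), Real.norm_eq_abs]
    have : |⟪e, y⟫| * ((K - 1) * 1) ≤ 2 / K * K := by gcongr; linarith
    rw [div_mul_cancel₀ _ hK0.ne'] at this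
    linarith
  have h1 := measure_mono (μ := volume) hsub
  rw [Measure.addHaar_image_linearMap, hdet, abs_of_pos hK0] at h1
  rw [le_div_iff₀ hK0, mul_comm]
  have h2 := ENNReal.toReal_mono (measure_closedBall_lt_top (μ := volume) (x := (0:E)) (r := R + 2)).ne h1
  rw [ENNReal.toReal_mul, ENNReal.toReal_ofReal hK0.le] at h2
  exact h2

/-- even cutoff -/
noncomputable def ct (K s : ℝ) : ℝ := Real.smoothTransition (s ^ 2 * K ^ 2 - 1)

lemma ct_zero {K s : ℝ} (h : s ^ 2 * K ^ 2 ≤ 1) : ct K s = 0 := Real.smoothTransition.zero_of_nonpos (by linarith)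
lemma ct_one {K s : ℝ} (h : 2 ≤ s ^ 2 * K ^ 2) : ct K s = 1 := Real.smoothTransition.one_of_one_le (by linarith)
lemma ct_abs (K s : ℝ) : |ct K s| ≤ 1 := by
  rw [abs_of_nonneg (show 0 ≤ ct K s from Real.smoothTransition.nonneg _)]; exact Real.smoothTransition.le_one _
lemma ct_smooth (K : ℝ) : ContDiff ℝ 2 (ct K) :=
  Real.smoothTransition.contDiff.comp (by fun_prop)

lemma ct_even (K s : ℝ) : ct K (-s) = ct K s := by simp [ct]

lemma ct_deriv_neg (K s : ℝ) : deriv (ct K) (-s) = - deriv (ct K) s := by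
  have h : (fun s => ct K (-s)) = ct K := funext (ct_even K)
  have := deriv_comp_neg (ct K) s
  rw [h] at this
  linarith

lemma ct_deriv_zero {K s : ℝ} (hK : 0 < K) (h : 2 / K < |s|) : deriv (ct K) s = 0 := by
  have : ct K =ᶠ[𝓝 s] fun _ => 1 := by
    filter_upwards [(continuous_abs.tendsto s).eventually (lt_mem_nhds h)] with y hy
    refine ct_one ?_
    rw [div_lt_iff₀ hK] at hy
    have : (2:ℝ) ^ 2 ≤ (|y| * K) ^ 2 := by gcongr
    rw [mul_pow, sq_abs] at this
    linarith
  rw [this.deriv_eq, deriv_const]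

lemma ct_deriv_le : ∃ C > 0, ∀ K > 0, ∀ s, |deriv (ct K) s| ≤ C * K := by
  have hsm : ContDiff ℝ 1 Real.smoothTransition := Real.smoothTransition.contDiff
  obtain ⟨C, hC⟩ := (isCompact_Icc (a := (-1:ℝ)) (b := 3)).exists_bound_of_continuousOn (hsm.continuous_deriv le_rfl).continuousOn
  have hC0 : 0 ≤ C := (norm_nonneg _).trans (hC 0 (by norm_num))
  refine ⟨4 * C + 1, by positivity, fun K hK s => ?_⟩
  rcases lt_or_ge (2 / K) |s| with h | h
  · rw [ct_deriv_zero hK h]; simp; positivity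
  · have hd : HasDerivAt (ct K) (deriv Real.smoothTransition (s ^ 2 * K ^ 2 - 1) * (2 * s * K ^ 2)) s := by
      have h1 : HasDerivAt (fun s : ℝ => s ^ 2 * K ^ 2 - 1) (2 * s * K ^ 2) s := by
        have := (((hasDerivAt_id s).pow 2).mul_const (K ^ 2)).sub_const 1
        simpa using this
      exact ((hsm.differentiable one_ne_zero _).hasDerivAt).comp s h1
    rw [hd.deriv, abs_mul]
    rw [le_div_iff₀ hK] at h
    have h2 : s ^ 2 * K ^ 2 ≤ 4 := by
      have : (|s| * K) ^ 2 ≤ 2 ^ 2 := by gcongr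
      rw [mul_pow, sq_abs] at this
      linarith
    have h3 := hC (s ^ 2 * K ^ 2 - 1) ⟨by nlinarith [sq_nonneg (s * K)], by linarith⟩
    rw [Real.norm_eq_abs] at h3
    have h4 : |2 * s * K ^ 2| ≤ 4 * K := by
      rw [abs_mul, abs_mul, abs_of_pos (by norm_num : (0:ℝ) < 2), abs_of_pos (by positivity : 0 < K ^ 2)]
      have := mul_le_mul_of_nonneg_right h hK.le
      nlinarith
    calc _ ≤ C * (4 * K) := by gcongr
      _ ≤ _ := by linarith

/-- reflection as an isometric equivalence -/
noncomputable def rfE {e : E} (he : ‖e‖ = 1) : E ≃ₗᵢ[ℝ] E :=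
  { LinearEquiv.ofInvolutive (rf e : E →ₗ[ℝ] E) (rf_rf he) with norm_map' := rf_norm he }

lemma integral_rf {e : E} (he : ‖e‖ = 1) (h : E → ℝ) : ∫ y, h (rf e y) = ∫ y, h y :=
  (rfE he).measurePreserving.integral_comp (rfE he).toHomeomorph.measurableEmbedding h

lemma DIVH [Nontrivial E] {e : E} (he : ‖e‖ = 1) {Y : E → E} (hc : Continuous Y) (hs : HasCompactSupport Y) {D : E → ℝ}
    (hY : ∀ y, ⟪e, y⟫ ≠ 0 → ContDiffAt ℝ 1 Y y ∧ tr (fderiv ℝ Y y) = D y) : ∫ y, D y = 0 := by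
  by_cases hD : Integrable D
  swap
  · exact integral_undef hD
  have hcle : Continuous fun y : E => ⟪e, y⟫ := continuous_const.inner continuous_id
  obtain ⟨C, hC, hCt⟩ := ct_deriv_le
  obtain ⟨R, hR⟩ := hs.isCompact.isBounded.subset_closedBall (0:E)
  have hcd : ∀ K, Continuous (deriv (ct K)) := fun K => (ct_smooth K).continuous_deriv (by norm_num)
  have hYz : ∀ y, R < ‖y‖ → Y y = 0 := by
    intro y hy
    by_contra hcon
    have := hR (subset_tsupport _ hcon)
    rw [mem_closedBall_zero_iff] at this
    linarith
  have hitg : ∀ K, Integrable fun y => deriv (ct K) ⟪e, y⟫ * ⟪e, Y y⟫ := by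
    intro K
    refine Continuous.integrable_of_hasCompactSupport (((hcd K).comp hcle).mul (continuous_const.inner hc)) ?_
    refine hs.mono fun y hy hy' => hy ?_
    show _ * ⟪e, Y y⟫ = 0
    rw [hy']; simp
  have hgr : ∀ K y, HasGradientAt (fun y : E => ct K ⟪e, y⟫) (deriv (ct K) ⟪e, y⟫ • e) y := by
    intro K y
    rw [hasGradientAt_iff]
    have h1 := ((ct_smooth K).differentiable (by norm_num) ⟪e, y⟫).hasDerivAt.comp_hasFDerivAt y (innerSL ℝ e).hasFDerivAt
    have h2 : innerSL ℝ (deriv (ct K) ⟪e, y⟫ • e) = deriv (ct K) ⟪e, y⟫ • innerSL ℝ e := map_smul _ _ _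
    rw [h2]
    exact h1
  have step1 : ∀ K, 1 ≤ K → ∫ y, ct K ⟪e, y⟫ * D y = - ∫ y, deriv (ct K) ⟪e, y⟫ * ⟪e, Y y⟫ := by
    intro K hK
    have hev : ∀ y : E, ⟪e, y⟫ = 0 → ∀ᶠ z in 𝓝 y, ct K ⟪e, z⟫ = 0 := by
      intro y hy
      have : ∀ᶠ z in 𝓝 y, ⟪e, z⟫ ^ 2 * K ^ 2 < 1 := by
        have h1 : Continuous fun z : E => ⟪e, z⟫ ^ 2 * K ^ 2 := by fun_prop
        refine (h1.tendsto y).eventually (gt_mem_nhds ?_)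
        rw [hy]; norm_num
      filter_upwards [this] with z hz using ct_zero hz.le
    have hZ : ContDiff ℝ 1 (fun y => ct K ⟪e, y⟫ • Y y) := by
      rw [contDiff_iff_contDiffAt]
      intro y
      by_cases hy : ⟪e, y⟫ = 0
      · refine (contDiffAt_const (c := (0:E))).congr_of_eventuallyEq ?_
        filter_upwards [hev y hy] with z hz
        rw [hz, zero_smul]
      · refine ContDiffAt.smul ?_ (hY y hy).1
        exact (((ct_smooth K).of_le (by norm_num)).comp (innerSL ℝ e).contDiff).contDiffAt
    have hcs : HasCompactSupport (fun y => ct K ⟪e, y⟫ • Y y) := hs.mono fun y hy hy' => hy (by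
      show _ • Y y = 0
      rw [hy', smul_zero])
    have h0 := integral_div_eq_zero hZ hcs
    have hpt : ∀ y, LinearMap.trace ℝ E (fderiv ℝ (fun y => ct K ⟪e, y⟫ • Y y) y : E →ₗ[ℝ] E) =
        deriv (ct K) ⟪e, y⟫ * ⟪e, Y y⟫ + ct K ⟪e, y⟫ * D y := by
      intro y
      change tr _ = _
      by_cases hy : ⟪e, y⟫ = 0
      · have e1 : (fun y => ct K ⟪e, y⟫ • Y y) =ᶠ[𝓝 y] fun _ => 0 := by
          filter_upwards [hev y hy] with z hz
          rw [hz, zero_smul]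
        rw [e1.fderiv_eq, hy]
        have e2 : deriv (ct K) 0 = 0 := by
          have := ct_deriv_neg K 0
          rw [neg_zero] at this
          linarith
        rw [e2, ct_zero (by norm_num)]
        simp [tr]
      · rw [tr_fderiv_smul (hgr K y) ((hY y hy).1.differentiableAt one_ne_zero).hasFDerivAt, (hY y hy).2, inner_smul_left]
        simp
    simp_rw [hpt] at h0
    rw [integral_add (hitg K)] at h0
    · linarith
    · refine hD.bdd_mul (c := 1) ((ct_smooth K).continuous.comp hcle).aestronglyMeasurable ?_
      exact Eventually.of_forall fun y => ct_abs K _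
  have step2 : ∀ δ > 0, ∀ᶠ k : ℕ in atTop, |∫ y, ct (k + 1) ⟪e, y⟫ * D y| ≤ C * δ * volume.real (closedBall (0:E) (R + 2)) := by
    intro δ hδ
    obtain ⟨r, hr, hu⟩ := Metric.uniformContinuous_iff.1 (hs.uniformContinuous_of_continuous hc) δ hδ
    have hk : ∀ᶠ k : ℕ in atTop, 4 / ((k:ℝ) + 1) < r := by
      have : Tendsto (fun k : ℕ => 4 * (1 / ((k:ℝ) + 1))) atTop (𝓝 (4 * 0)) := tendsto_one_div_add_atTop_nhds_zero_nat.const_mul 4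
      rw [mul_zero] at this
      filter_upwards [this.eventually (gt_mem_nhds hr)] with k hk
      rwa [mul_one_div] at hk
    filter_upwards [hk] with k hk
    set K : ℝ := k + 1 with hKd
    have hK1 : 1 ≤ K := by rw [hKd]; linarith [Nat.cast_nonneg (α := ℝ) k]
    have hK0 : 0 < K := by linarith
    rw [step1 K hK1, abs_neg]
    have hrefl : ∫ y, deriv (ct K) ⟪e, y⟫ * ⟪e, Y y⟫ = ∫ y, -(deriv (ct K) ⟪e, y⟫ * ⟪e, Y (rf e y)⟫) := by
      rw [← integral_rf he]
      congr 1; ext y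
      rw [rf_inner he, ct_deriv_neg]; ring
    have hint2 : Integrable fun y => -(deriv (ct K) ⟪e, y⟫ * ⟪e, Y (rf e y)⟫) := by
      have h1 := (rfE he).measurePreserving.integrable_comp_of_integrable (hitg K)
      refine h1.congr (Eventually.of_forall fun y => ?_)
      show deriv (ct K) ⟪e, rf e y⟫ * ⟪e, Y (rf e y)⟫ = _
      rw [rf_inner he, ct_deriv_neg]; ring
    have h2J : 2 * ∫ y, deriv (ct K) ⟪e, y⟫ * ⟪e, Y y⟫ = ∫ y, deriv (ct K) ⟪e, y⟫ * ⟪e, Y y - Y (rf e y)⟫ := by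
      have h1 : 2 * ∫ y, deriv (ct K) ⟪e, y⟫ * ⟪e, Y y⟫ = (∫ y, deriv (ct K) ⟪e, y⟫ * ⟪e, Y y⟫) + ∫ y, -(deriv (ct K) ⟪e, y⟫ * ⟪e, Y (rf e y)⟫) := by
        rw [← hrefl]; ring
      rw [h1, ← integral_add (hitg K) hint2]
      congr 1; ext y
      rw [inner_sub_right]; ring
    set S : Set E := {y : E | ‖y‖ ≤ R ∧ |⟪e, y⟫| ≤ 2 / K} with hS
    have hSfin : volume S < ⊤ := lt_of_le_of_lt (measure_mono (fun y hy => mem_closedBall_zero_iff.2 hy.1)) (measure_closedBall_lt_top (x := (0:E)) (r := R))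
    have hzero : ∀ y, y ∉ S → deriv (ct K) ⟪e, y⟫ * ⟪e, Y y - Y (rf e y)⟫ = 0 := by
      intro y hy
      rw [hS, Set.mem_ofPred_eq, not_and_or, not_le, not_le] at hy
      rcases hy with hy | hy
      · rw [hYz y hy, hYz (rf e y) (by rwa [rf_norm he])]; simp
      · rw [ct_deriv_zero hK0 hy, zero_mul]
    have hb : ‖∫ y in S, deriv (ct K) ⟪e, y⟫ * ⟪e, Y y - Y (rf e y)⟫‖ ≤ (C * K * δ) * volume.real S := by
      refine norm_setIntegral_le_of_norm_le_const hSfin ?_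
      intro y hy
      rw [norm_mul, Real.norm_eq_abs, Real.norm_eq_abs]
      refine mul_le_mul (hCt K hK0 _) ?_ (abs_nonneg _) (by positivity)
      refine (abs_real_inner_le_norm _ _).trans ?_
      rw [he, one_mul, ← dist_eq_norm]
      refine (hu ?_).le
      rw [dist_eq_norm, rf_apply, _root_.sub_sub_cancel, norm_smul, he, Real.norm_eq_abs, abs_mul, abs_two]
      have := hy.2
      have e4 : 4 / K = 2 * (2 / K) := by ring
      linarith
    rw [setIntegral_eq_integral_of_forall_compl_eq_zero hzero, ← h2J, Real.norm_eq_abs, abs_mul, abs_two] at hb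
    have h3 := strip_le he (R := R) hK1
    have h4 : (C * K * δ) * volume.real S ≤ (C * K * δ) * (volume.real (closedBall (0:E) (R + 2)) / K) := by gcongr
    have h5 : (C * K * δ) * (volume.real (closedBall (0:E) (R + 2)) / K) = C * δ * volume.real (closedBall (0:E) (R + 2)) := by field_simp
    have h6 := abs_nonneg (∫ y, deriv (ct K) ⟪e, y⟫ * ⟪e, Y y⟫)
    linarith
  have hlim : Tendsto (fun k : ℕ => ∫ y, ct ((k:ℝ) + 1) ⟪e, y⟫ * D y) atTop (𝓝 (∫ y, D y)) := by
    refine tendsto_integral_of_dominated_convergence (fun y => ‖D y‖) ?_ hD.norm ?_ ?_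
    · intro k
      exact ((ct_smooth _).continuous.comp hcle).aestronglyMeasurable.mul hD.aestronglyMeasurable
    · intro k
      refine Eventually.of_forall fun y => ?_
      rw [norm_mul]
      have := ct_abs ((k:ℝ) + 1) ⟪e, y⟫
      rw [← Real.norm_eq_abs] at this
      exact mul_le_of_le_one_left (norm_nonneg _) this
    · have hnull : volume {y : E | ⟪e, y⟫ = 0} = 0 := by
        have h1 := Measure.addHaar_submodule (volume : Measure E) (LinearMap.ker (innerSL ℝ e : E →ₗ[ℝ] ℝ)) (by
          intro htop
          have : e ∈ (⊤ : Submodule ℝ E) := trivial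
          rw [← htop, LinearMap.mem_ker] at this
          simp [he] at this)
        exact h1
      have hae : ∀ᵐ y : E, ⟪e, y⟫ ≠ 0 := by rw [ae_iff]; simpa using hnull
      filter_upwards [hae] with y hy
      refine tendsto_const_nhds.congr' ?_
      have h1 : Tendsto (fun k : ℕ => ((k:ℝ) + 1) * |⟪e, y⟫|) atTop atTop :=
        (tendsto_atTop_add_const_right _ 1 tendsto_natCast_atTop_atTop).atTop_mul_const (abs_pos.2 hy)
      filter_upwards [h1.eventually_ge_atTop 2] with k hk
      rw [ct_one, one_mul]
      have : (2:ℝ) ^ 2 ≤ (((k:ℝ) + 1) * |⟪e, y⟫|) ^ 2 := by gcongr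
      rw [mul_pow, sq_abs] at this
      linarith
  have hfin : ∀ δ > 0, |∫ y, D y| ≤ C * δ * volume.real (closedBall (0:E) (R + 2)) := fun δ hδ =>
    le_of_tendsto hlim.abs (step2 δ hδ)
  by_contra hne
  have hp := abs_pos.2 hne
  set A := C * volume.real (closedBall (0:E) (R + 2)) with hA
  have hA0 : 0 ≤ A := by positivity
  have h1 := hfin (|∫ y, D y| / (2 * (A + 1))) (by positivity)
  have h2 : C * (|∫ y, D y| / (2 * (A + 1))) * volume.real (closedBall (0:E) (R + 2)) = |∫ y, D y| * (A / (2 * (A + 1))) := by rw [hA]; ring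
  have h3 : A / (2 * (A + 1)) < 1 := by rw [div_lt_one (by positivity)]; linarith
  rw [h2] at h1
  nlinarith

end
end OP

namespace OP
open scoped RealInnerProductSpace Topology
open Module

section
variable {E : Type*} [NormedAddCommGroup E] [InnerProductSpace ℝ E] [FiniteDimensional ℝ E]
  [MeasurableSpace E] [BorelSpace E]

/-- gradient of `bump` -/
noncomputable def bv (z : E) : E := -(rho z) • z
noncomputable def kH (z : E) : E →L[ℝ] E := fderiv ℝ bv z
noncomputable def kt (z : E) : ℝ := tr (kH z)
noncomputable def Za (a z : E) : E := kt z • a - kH z a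

lemma bv_smooth : ContDiff ℝ 3 (bv : E → E) := rho_contDiff.neg.smul contDiff_id
lemma kH_smooth : ContDiff ℝ 2 (kH : E → E →L[ℝ] E) := bv_smooth.fderiv_right (by norm_num)
lemma kt_eq0 : (kt : E → ℝ) = fun z => trL E (kH z) := by ext z; rw [trL_apply]; rfl
lemma kt_smooth : ContDiff ℝ 2 (kt : E → ℝ) := by
  rw [kt_eq0]; exact (trL E).contDiff.comp kH_smooth
lemma Za_smooth (a : E) : ContDiff ℝ 2 (Za a) :=
  (kt_smooth.smul contDiff_const).sub (kH_smooth.clm_apply contDiff_const)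

lemma bv_zero {z : E} (h : 1 ≤ ‖z‖) : bv z = 0 := by simp [bv, rho_zero h]
lemma kH_zero {z : E} (h : 1 < ‖z‖) : kH z = 0 := by
  have : (bv : E → E) =ᶠ[𝓝 z] fun _ => 0 := by
    filter_upwards [(continuous_norm.tendsto z).eventually (lt_mem_nhds h)] with y hy using bv_zero hy.le
  rw [kH, this.fderiv_eq]; simp
lemma kt_zero {z : E} (h : 1 < ‖z‖) : kt z = 0 := by rw [kt, kH_zero h, tr_zero]
lemma Za_zero (a : E) {z : E} (h : 1 < ‖z‖) : Za a z = 0 := by simp [Za, kt_zero h, kH_zero h]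

lemma rho_hasFDerivAt (z : E) : HasFDerivAt rho (fderiv ℝ rho z) z :=
  (rho_contDiff.differentiable (by norm_num) z).hasFDerivAt

lemma rho_radial (z : E) : ∃ κ : ℝ, ∀ w, fderiv ℝ rho z w = κ * ⟪z, w⟫ := by
  have h1 : HasFDerivAt (fun z : E => 1 - ‖z‖ ^ 2) (-(2 • (innerSL ℝ z))) z := by
    have := (hasStrictFDerivAt_norm_sq z).hasFDerivAt
    simpa using this.const_sub 1
  have h0 : ContDiff ℝ 1 (deriv expNegInvGlue) := by
    have := (contDiff_succ_iff_deriv (n := 1) (f := expNegInvGlue) (𝕜 := ℝ)).1 expNegInvGlue.contDiff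
    exact this.2.2
  have h2 := (h0.differentiable one_ne_zero (1 - ‖z‖ ^ 2)).hasDerivAt
  have h3 := (h2.comp_hasFDerivAt z h1).const_mul 2
  refine ⟨- (4 * deriv (deriv expNegInvGlue) (1 - ‖z‖ ^ 2)), fun w => ?_⟩
  have h4 : fderiv ℝ rho z = _ := HasFDerivAt.fderiv h3
  rw [h4]
  simp
  ring

lemma kH_eq (z : E) : kH z = -(rho z • ContinuousLinearMap.id ℝ E + (fderiv ℝ rho z).smulRight z) := by
  have h := ((rho_hasFDerivAt z).smul (hasFDerivAt_id z)).neg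
  have e : (bv : E → E) = -((rho : E → ℝ) • (id : E → E)) := by ext z; simp [bv]
  rw [kH, e, h.fderiv]; rfl

lemma kt_eq (z : E) : kt z = -(finrank ℝ E * rho z + fderiv ℝ rho z z) := by
  rw [kt, kH_eq, tr_neg, tr_add, tr_smul, tr_id, tr_smulRight]; ring

lemma bv_grad (a z : E) : HasGradientAt (fun z => ⟪bv z, a⟫) (kH z a) z := by
  rw [hasGradientAt_iff]
  have h1 : HasFDerivAt bv (kH z) z := (bv_smooth.differentiable (by norm_num) z).hasFDerivAt
  refine (h1.inner ℝ (hasFDerivAt_const a z)).congr_fderiv ?_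
  ext w
  obtain ⟨κ, hκ⟩ := rho_radial z
  simp [kH_eq, hκ, inner_add_left, inner_smul_left, inner_neg_left]
  rw [real_inner_comm w a]; ring

lemma Za_div (a z : E) : tr (fderiv ℝ (Za a) z) = 0 := by
  have h1 : HasFDerivAt (kH : E → E →L[ℝ] E) (fderiv ℝ kH z) z := (kH_smooth.differentiable (by norm_num) z).hasFDerivAt
  have hs := bv_smooth.contDiffAt (x := z) |>.isSymmSndFDerivAt (by norm_num)
  have h2 : HasFDerivAt (Za a) (((trL E).comp (fderiv ℝ kH z)).smulRight a - (fderiv ℝ kH z a)) z := by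
    have h3 : HasFDerivAt (kt : E → ℝ) ((trL E).comp (fderiv ℝ kH z)) z := by
      rw [kt_eq0]; exact (trL E).hasFDerivAt.comp z h1
    refine ((h3.smul_const a).sub (h1.clm_apply (hasFDerivAt_const a z))).congr_fderiv ?_
    ext w
    have := hs w a
    simp
    exact this
  rw [h2.fderiv, tr_sub, tr_smulRight]
  simp [trL_apply]

lemma kt_cs : HasCompactSupport (kt : E → ℝ) :=
  HasCompactSupport.intro (isCompact_closedBall 0 1) fun z hz => kt_zero (by simpa using hz)
lemma Za_cs (a : E) : HasCompactSupport (Za a) :=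
  HasCompactSupport.intro (isCompact_closedBall 0 1) fun z hz => Za_zero a (by simpa using hz)

lemma integral_resc (g : E → ℝ) {t : ℝ} (ht : 0 < t) (x : E) :
    ∫ z, g (x + t • z) = (t⁻¹) ^ finrank ℝ E * ∫ y, g y := by
  have h := Measure.integral_comp_smul (volume : Measure E) (fun y => g (x + y)) t
  rw [h, integral_add_left_eq_self, abs_of_pos (by positivity), smul_eq_mul, inv_pow]

lemma AD [Nontrivial E] {S : E → ℝ} (hS : Continuous S) (x : E) {t : ℝ} (ht : 0 < t) :
    HasDerivAt (fun t => avg S t x) (t⁻¹ * ∫ z, S (x + t • z) * kt z) t := by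
  obtain ⟨m, hm⟩ : ∃ m, finrank ℝ E = m + 1 := ⟨finrank ℝ E - 1, by have := finrank_pos (R := ℝ) (M := E); omega⟩
  obtain ⟨K, hK⟩ := kt_cs.exists_bound_of_continuous (kt_smooth (E := E)).continuous
  obtain ⟨M, hM⟩ := (isCompact_closedBall (0:E) (2 * t)).exists_bound_of_continuousOn
    (f := fun y => S (x + y)) (by fun_prop)
  have hK0 : 0 ≤ K := (norm_nonneg _).trans (hK 0)
  have hM0 : 0 ≤ M := (norm_nonneg _).trans (hM 0 (by simp; positivity))
  set Fk : ℝ → E → ℝ := fun τ y => S (x + y) * (τ⁻¹ ^ (m + 1) * rho (τ⁻¹ • y)) with hFk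
  set Fd : ℝ → E → ℝ := fun τ y => S (x + y) * (τ⁻¹ ^ (m + 2) * kt (τ⁻¹ • y)) with hFd
  have hav : ∀ τ, 0 < τ → avg S τ x = ∫ y, Fk τ y := by
    intro τ hτ
    have := integral_resc (fun y => S y * rho (τ⁻¹ • (y - x))) hτ x
    have h2 := integral_add_left_eq_self (μ := (volume : Measure E)) (fun y => S y * rho (τ⁻¹ • (y - x))) x
    rw [← h2, hm, ← integral_const_mul] at this
    simp only [add_sub_cancel_left, inv_smul_smul₀ hτ.ne'] at this
    unfold avg
    rw [this]
    congr 1; ext y; simp only [hFk]; ring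
  have hdr : ∀ τ, 0 < τ → ∀ y, HasDerivAt (Fk · y) (Fd τ y) τ := by
    intro τ hτ y
    have h1 := (hasDerivAt_inv hτ.ne').pow (m + 1)
    have h2 := (rho_hasFDerivAt (τ⁻¹ • y)).comp_hasDerivAt τ ((hasDerivAt_inv hτ.ne').smul_const y)
    have h3 := (h1.mul h2).const_mul (S (x + y))
    refine HasDerivAt.congr_deriv h3 ?_
    have e1 : fderiv ℝ rho (τ⁻¹ • y) (τ⁻¹ • y) = τ⁻¹ * fderiv ℝ rho (τ⁻¹ • y) y := by rw [map_smul]; rfl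
    simp only [hFd, kt_eq, hm, e1, map_smul, smul_eq_mul, Nat.add_sub_cancel, Pi.inv_apply, Pi.pow_apply]
    push_cast
    simp only [Function.comp_apply, map_smul, smul_eq_mul]
    ring
  have hs : Ioo (t / 2) (2 * t) ∈ 𝓝 t := Ioo_mem_nhds (by linarith) (by linarith)
  have hcont : ∀ τ, Continuous (Fk τ) := fun τ => by
    have := rho_cont (E := E); simp only [hFk]; fun_prop
  have hcontd : ∀ τ, Continuous (Fd τ) := fun τ => by
    have := (kt_smooth (E := E)).continuous; simp only [hFd]; fun_prop
  have hitg : Integrable (Fk t) := by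
    refine (hcont t).integrable_of_hasCompactSupport (HasCompactSupport.intro (isCompact_closedBall 0 t) fun y hy => ?_)
    have : rho (t⁻¹ • y) = 0 := rho_zero (by
      rw [norm_smul, Real.norm_of_nonneg (by positivity), inv_mul_eq_div, le_div_iff₀ ht]
      simp at hy; linarith)
    simp [hFk, this]
  have key := hasDerivAt_integral_of_dominated_loc_of_deriv_le (μ := (volume : Measure E)) (F := Fk) (F' := Fd) (x₀ := t) (s := Ioo (t / 2) (2 * t))
    (bound := (closedBall (0:E) (2 * t)).indicator fun _ => M * ((2 / t) ^ (m + 2) * K)) hs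
    (Eventually.of_forall fun τ => (hcont τ).aestronglyMeasurable) hitg (hcontd t).aestronglyMeasurable ?_ ?_ ?_
  · have h1 : (fun τ => avg S τ x) =ᶠ[𝓝 t] fun τ => ∫ y, Fk τ y := by
      filter_upwards [lt_mem_nhds ht] with τ hτ using hav τ hτ
    refine (key.2.congr_of_eventuallyEq h1).congr_deriv ?_
    have := integral_resc (fun y => S y * kt (t⁻¹ • (y - x))) ht x
    have h2 := integral_add_left_eq_self (μ := (volume : Measure E)) (fun y => S y * kt (t⁻¹ • (y - x))) x
    rw [← h2, hm, ← integral_const_mul] at this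
    simp only [add_sub_cancel_left, inv_smul_smul₀ ht.ne'] at this
    rw [this, ← integral_const_mul]
    congr 1; ext y; simp only [hFd]; ring
  · refine Eventually.of_forall fun y τ hτ => ?_
    have hτ0 : 0 < τ := by linarith [hτ.1]
    by_cases hy : y ∈ closedBall (0:E) (2 * t)
    · rw [indicator_of_mem hy]
      have h1 : |τ⁻¹| ≤ 2 / t := by
        rw [abs_of_pos (by positivity), inv_eq_one_div, div_le_div_iff₀ hτ0 ht]; linarith [hτ.1]
      simp only [hFd, norm_mul, norm_pow]
      have := hM y hy
      have := hK (τ⁻¹ • y)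
      rw [Real.norm_eq_abs τ⁻¹]
      gcongr
    · rw [indicator_of_notMem hy]
      have : kt (τ⁻¹ • y) = 0 := kt_zero (by
        rw [norm_smul, Real.norm_of_nonneg (by positivity), inv_mul_eq_div, lt_div_iff₀ hτ0]
        simp at hy; linarith [hτ.2])
      simp [hFd, this]
  · rw [integrable_indicator_iff measurableSet_closedBall]
    exact integrableOn_const measure_closedBall_lt_top.ne
  · exact Eventually.of_forall fun y τ hτ => hdr τ (by linarith [hτ.1]) y

lemma avg_cont {S : E → ℝ} (hS : Continuous S) (x : E) : Continuous fun t => avg S t x := by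
  have h := continuous_parametric_integral_of_continuous (μ := (volume : Measure E)) (f := fun (t : ℝ) (z : E) => S (x + t • z) * rho z)
    (by have := rho_cont (E := E); simp only [Function.uncurry_def]; fun_prop) (isCompact_closedBall (0:E) 1)
  refine h.congr fun t => ?_
  refine setIntegral_eq_integral_of_forall_compl_eq_zero fun z hz => ?_
  rw [rho_zero (by simp at hz; exact hz.le), mul_zero]

lemma AVGe [Nontrivial E] {S : E → ℝ} (hS : Continuous S) (x : E) {t B γ : ℝ} (ht : 0 < t) (hγ : 0 < γ)
    (hb : ∀ τ ∈ Ioo 0 t, |∫ z, S (x + τ • z) * kt z| ≤ B * τ ^ γ) :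
    |avg S t x - c0 E * S x| ≤ B / γ * t ^ γ := by
  have key : ∀ s : ℝ, |s| ≤ 1 → s * (avg S t x - c0 E * S x) ≤ B / γ * t ^ γ := by
    intro s hs
    set g : ℝ → ℝ := fun τ => B / γ * τ ^ γ - s * avg S τ x with hg
    have hd : ∀ τ ∈ Ioo 0 t, HasDerivAt g (B / γ * (γ * τ ^ (γ - 1)) - s * (τ⁻¹ * ∫ z, S (x + τ • z) * kt z)) τ := fun τ hτ =>
      ((Real.hasDerivAt_rpow_const (Or.inl hτ.1.ne')).const_mul _).sub ((AD hS x hτ.1).const_mul s)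
    have hmono : MonotoneOn g (Icc 0 t) := by
      refine monotoneOn_of_deriv_nonneg (convex_Icc 0 t) ?_ ?_ ?_
      · exact ((continuous_const.mul (Real.continuous_rpow_const hγ.le)).sub (continuous_const.mul (avg_cont hS x))).continuousOn
      · rw [interior_Icc]; exact fun τ hτ => (hd τ hτ).differentiableAt.differentiableWithinAt
      · rw [interior_Icc]
        intro τ hτ
        rw [(hd τ hτ).deriv]
        have h1 := hb τ hτ
        have h2 : s * ∫ z, S (x + τ • z) * kt z ≤ B * τ ^ γ := by
          refine (le_abs_self _).trans ?_
          rw [abs_mul]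
          exact (mul_le_of_le_one_left (abs_nonneg _) hs).trans h1
        have h3 : τ ^ γ = τ ^ (γ - 1) * τ := by
          rw [Real.rpow_sub hτ.1, Real.rpow_one, div_mul_cancel₀ _ hτ.1.ne']
        have h4 := mul_le_mul_of_nonneg_left h2 (inv_pos.2 hτ.1).le
        have h5 : τ⁻¹ * (B * τ ^ γ) = B / γ * (γ * τ ^ (γ - 1)) := by
          rw [h3]; have := hτ.1.ne'; field_simp
        linarith
    have := hmono (left_mem_Icc.2 ht.le) (right_mem_Icc.2 ht.le) ht.le
    simp only [hg, avg_zero, Real.zero_rpow hγ.ne'] at this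
    linarith
  rw [abs_le]
  constructor
  · have := key (-1) (by simp); linarith
  · have := key 1 (by simp); linarith

end
end OP

namespace OP
open scoped RealInnerProductSpace Topology
open Module

section
variable {E : Type*} [NormedAddCommGroup E] [InnerProductSpace ℝ E] [FiniteDimensional ℝ E]
  [MeasurableSpace E] [BorelSpace E]

noncomputable def fd (e y : E) : E := y + (|⟪e, y⟫| - ⟪e, y⟫) • e

lemma fd_pos {e y : E} (h : 0 ≤ ⟪e, y⟫) : fd e y = y := by simp [fd, abs_of_nonneg h]
lemma fd_neg {e y : E} (h : ⟪e, y⟫ ≤ 0) : fd e y = rf e y := by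
  rw [fd, abs_of_nonpos h, rf_apply, sub_eq_add_neg y, ← neg_smul]; congr 2; ring
lemma fd_inner {e : E} (he : ‖e‖ = 1) (y : E) : ⟪e, fd e y⟫ = |⟪e, y⟫| := by
  rw [fd, inner_add_right, inner_smul_right, real_inner_self_eq_norm_sq, he]; ring
lemma fd_norm {e : E} (he : ‖e‖ = 1) (y : E) : ‖fd e y‖ = ‖y‖ := by
  rcases le_total 0 ⟪e, y⟫ with h | h
  · rw [fd_pos h]
  · rw [fd_neg h, rf_norm he]
lemma fd_cont (e : E) : Continuous (fd e) := by
  have hcle : Continuous fun y : E => ⟪e, y⟫ := continuous_const.inner continuous_id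
  unfold fd; fun_prop
lemma fd_lip0 {e : E} (he : ‖e‖ = 1) {x y : E} (hx : 0 ≤ ⟪e, x⟫) (hy : ⟪e, y⟫ ≤ 0) : ‖rf e y - x‖ ≤ ‖y - x‖ := by
  rw [← abs_of_nonneg (norm_nonneg (rf e y - x)), ← abs_of_nonneg (norm_nonneg (y - x)), ← sq_le_sq]
  have h1 : rf e y - x = (y - x) - (2 * ⟪e, y⟫) • e := by rw [rf_apply]; abel
  rw [h1, norm_sub_sq_real, inner_smul_right, norm_smul, he, real_inner_comm e (y - x), inner_sub_right, mul_one,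
    Real.norm_eq_abs, sq_abs]
  nlinarith [mul_nonneg hx (neg_nonneg.2 hy)]
lemma fd_lip {e : E} (he : ‖e‖ = 1) (x y : E) : ‖fd e y - fd e x‖ ≤ ‖y - x‖ := by
  rcases le_total 0 ⟪e, y⟫ with h | h <;> rcases le_total 0 ⟪e, x⟫ with h' | h'
  · rw [fd_pos h, fd_pos h']
  · rw [fd_pos h, fd_neg h', norm_sub_rev, norm_sub_rev y]; exact fd_lip0 he h h'
  · rw [fd_neg h, fd_pos h']; exact fd_lip0 he h' h
  · rw [fd_neg h, fd_neg h', ← map_sub, rf_norm he]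

open Classical in
noncomputable def hat (e : E) (F : E → E) (y : E) : E := if 0 ≤ ⟪e, y⟫ then F (fd e y) else rf e (F (fd e y))

lemma hat_pos {e : E} {F : E → E} {y : E} (h : 0 ≤ ⟪e, y⟫) : hat e F y = F y := by rw [hat, if_pos h, fd_pos h]

lemma hat_norm {e : E} (he : ‖e‖ = 1) (F : E → E) (y : E) : ‖hat e F y‖ = ‖F (fd e y)‖ := by
  unfold hat; split_ifs
  · rfl
  · exact rf_norm he _

lemma hat_cont {e : E} {F : E → E} (hF : Continuous F) (hb : ∀ y, ⟪e, y⟫ = 0 → ⟪e, F y⟫ = 0) : Continuous (hat e F) := by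
  unfold hat
  refine Continuous.if_le (hF.comp (fd_cont e)) ((rf e).continuous.comp (hF.comp (fd_cont e))) continuous_const
    (continuous_const.inner continuous_id) fun y hy => ?_
  have hy : 0 = ⟪e, y⟫ := hy
  show F (fd e y) = rf e (F (fd e y))
  rw [fd_pos hy.le, rf_apply, hb y hy.symm]; simp

lemma ev_pos {e y : E} (h : 0 < ⟪e, y⟫) : ∀ᶠ z in 𝓝 y, 0 < ⟪e, z⟫ :=
  ((continuous_const.inner continuous_id).tendsto y).eventually (lt_mem_nhds h)
lemma ev_neg {e y : E} (h : ⟪e, y⟫ < 0) : ∀ᶠ z in 𝓝 y, ⟪e, z⟫ < 0 :=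
  ((continuous_const.inner continuous_id).tendsto y).eventually (gt_mem_nhds h)

lemma hat_at {e : E} (he : ‖e‖ = 1) {F : E → E} {y : E} (hy : ⟪e, y⟫ ≠ 0)
    (hF : ContDiffAt ℝ 1 F (fd e y) ∧ tr (fderiv ℝ F (fd e y)) = 0) :
    ContDiffAt ℝ 1 (hat e F) y ∧ tr (fderiv ℝ (hat e F) y) = 0 := by
  rcases lt_or_gt_of_ne hy with h | h
  · have h1 : hat e F =ᶠ[𝓝 y] fun z => rf e (F (rf e z)) := by
      filter_upwards [ev_neg h] with z hz
      rw [hat, if_neg (not_le.2 hz), fd_neg hz.le]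
    rw [fd_neg h.le] at hF
    refine ⟨ContDiffAt.congr_of_eventuallyEq ((rf e).contDiff.contDiffAt.comp y (hF.1.comp y (rf e).contDiff.contDiffAt)) h1, ?_⟩
    have h2 : HasFDerivAt (fun z => rf e (F (rf e z))) ((rf e) ∘L (fderiv ℝ F (rf e y)) ∘L (rf e)) y :=
      (rf e).hasFDerivAt.comp y ((hF.1.differentiableAt one_ne_zero).hasFDerivAt.comp y (rf e).hasFDerivAt)
    rw [h1.fderiv_eq, h2.fderiv, ← hF.2]
    have h3 : ((rf e : E →L[ℝ] E) : E →ₗ[ℝ] E) * (rf e : E →L[ℝ] E) = 1 := by ext z; exact rf_rf he z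
    unfold tr
    have h4 := LinearMap.trace_mul_comm ℝ ((rf e : E →L[ℝ] E) : E →ₗ[ℝ] E) ((fderiv ℝ F (rf e y) : E →ₗ[ℝ] E) * (rf e : E →L[ℝ] E))
    rw [mul_assoc, h3, mul_one] at h4
    exact h4
  · have h1 : hat e F =ᶠ[𝓝 y] F := by
      filter_upwards [ev_pos h] with z hz using hat_pos hz.le
    rw [fd_pos h.le] at hF
    exact ⟨hF.1.congr_of_eventuallyEq h1, by rw [h1.fderiv_eq]; exact hF.2⟩

lemma C1_of_grad {V : E → ℝ} {X : E → E} (hX : Continuous X) {y : E} (h : ∀ᶠ z in 𝓝 y, HasGradientAt V (X z) z) :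
    ContDiffAt ℝ 1 V y :=
  contDiffAt_one_iff.2 ⟨fun z => innerSL ℝ (X z), _, h, ((innerSL ℝ).continuous.comp hX).continuousOn, fun z hz => hasGradientAt_iff.1 hz⟩

lemma Vh_at {e : E} (he : ‖e‖ = 1) {V : E → ℝ} {X : E → E} (hX : Continuous X) {y : E} (hy : ⟪e, y⟫ ≠ 0)
    (h : ∀ᶠ z in 𝓝 (fd e y), HasGradientAt V (X z) z) :
    HasGradientAt (fun y => V (fd e y)) (hat e X y) y ∧ ContDiffAt ℝ 1 (fun y => V (fd e y)) y := by
  have hV := C1_of_grad hX h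
  rcases lt_or_gt_of_ne hy with h0 | h0
  · have h1 : (fun y => V (fd e y)) =ᶠ[𝓝 y] fun z => V (rf e z) := by
      filter_upwards [ev_neg h0] with z hz
      rw [fd_neg hz.le]
    rw [fd_neg h0.le] at h hV
    refine ⟨?_, (hV.comp y (rf e).contDiff.contDiffAt).congr_of_eventuallyEq h1⟩
    rw [hat, if_neg (not_le.2 h0), fd_neg h0.le]
    refine HasGradientAt.congr_of_eventuallyEq ?_ h1
    rw [hasGradientAt_iff]
    refine ((hasGradientAt_iff.1 h.self_of_nhds).comp y (rf e).hasFDerivAt).congr_fderiv ?_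
    ext w
    simp [rf_symm]
  · have h1 : (fun y => V (fd e y)) =ᶠ[𝓝 y] V := by
      filter_upwards [ev_pos h0] with z hz
      rw [fd_pos hz.le]
    rw [fd_pos h0.le] at h hV
    rw [hat_pos h0.le]
    exact ⟨h.self_of_nhds.congr_of_eventuallyEq h1, hV.congr_of_eventuallyEq h1⟩

/-- linear system in a half ball -/
structure LS (e : E) (R : ℝ) (V : E → ℝ) (X F : E → E) : Prop where
  vc : Continuous V
  xc : Continuous X
  fc : Continuous F
  grad : ∀ y, ‖y‖ < R → 0 < ⟪e, y⟫ → HasGradientAt V (X y) y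
  div : ∀ y, ‖y‖ < R → 0 < ⟪e, y⟫ → ContDiffAt ℝ 1 F y ∧ tr (fderiv ℝ F y) = 0
  bd : ∀ y, ⟪e, y⟫ = 0 → ⟪e, F y⟫ = 0

lemma hat_lin (e : E) (F X : E → E) (c y : E) :
    hat e (fun y => F y - (2:ℝ) • X y - c) y = hat e F y - (2:ℝ) • hat e X y - hat e (fun _ => c) y := by
  unfold hat; split_ifs
  · rfl
  · simp [map_sub]

lemma IDENT [Nontrivial E] {e : E} (he : ‖e‖ = 1) {R : ℝ} {V : E → ℝ} {X F : E → E} (H : LS e R V X F) {x : E} {t : ℝ}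
    (ht : 0 < t) (hx : ‖x‖ + t < R) (a c : E) :
    ∫ z, ⟪hat e F (x + t • z), a⟫ * kt z = ∫ z, ⟪hat e (fun y => F y - (2:ℝ) • X y - c) (x + t • z), Za a z⟫ := by
  have hcle : Continuous fun y : E => ⟪e, y⟫ := continuous_const.inner continuous_id
  have hFc := hat_cont H.fc H.bd
  set w : E → E := fun y => t⁻¹ • (y - x) with hw
  have hwc : ContDiff ℝ 2 w := contDiff_const.smul (contDiff_id.sub contDiff_const)
  have hwd : ∀ y, HasFDerivAt w (t⁻¹ • ContinuousLinearMap.id ℝ E) y := fun y =>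
    ((hasFDerivAt_id y).sub_const x).const_smul t⁻¹
  have hw1 : ∀ y, R ≤ ‖y‖ → 1 < ‖w y‖ := by
    intro y hy
    simp only [hw]
    rw [norm_smul, Real.norm_of_nonneg (by positivity), inv_mul_eq_div, lt_div_iff₀ ht]
    have := norm_sub_norm_le y x
    linarith
  set D : E → ℝ := fun y => ⟪kH (w y) a, hat e F y⟫ + ⟪(2:ℝ) • hat e X y + hat e (fun _ => c) y, Za a (w y)⟫ with hD
  set Y1 : E → E := fun y => (t * ⟪bv (w y), a⟫) • hat e F y with hY1
  set Y2 : E → E := fun y => (2 * V (fd e y) + ⟪c, fd e y⟫) • Za a (w y) with hY2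
  have hD0 : ∫ y, D y = 0 := by
    refine DIVH he (Y := fun y => Y1 y + Y2 y) ?_ ?_ ?_
    · have h1 : Continuous (bv : E → E) := bv_smooth.continuous
      have h2 := (Za_smooth a).continuous
      have h3 := hwc.continuous
      have h4 := fd_cont e
      have h5 := H.vc
      simp only [hY1, hY2]
      refine Continuous.add ?_ ?_
      · exact (continuous_const.mul ((h1.comp h3).inner continuous_const)).smul hFc
      · exact ((continuous_const.mul (h5.comp h4)).add (continuous_const.inner h4)).smul (h2.comp h3)
    · refine HasCompactSupport.intro (isCompact_closedBall 0 R) fun y hy => ?_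
      have hy := hw1 y (by simp at hy; exact hy.le)
      simp [hY1, hY2, bv_zero hy.le, Za_zero a hy]
    · intro y hy
      by_cases hyR : ‖y‖ < R
      · have hfn : ‖fd e y‖ < R := by rwa [fd_norm he]
        have hfp : 0 < ⟪e, fd e y⟫ := by rw [fd_inner he]; exact abs_pos.2 hy
        obtain ⟨f1, f2⟩ := hat_at he hy (H.div _ hfn hfp)
        have hev : ∀ᶠ z in 𝓝 (fd e y), HasGradientAt V (X z) z := by
          filter_upwards [ev_pos hfp, (continuous_norm.tendsto _).eventually (gt_mem_nhds hfn)] with z h1 h2 using H.grad z h2 h1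
        obtain ⟨v1, v2⟩ := Vh_at he H.xc hy hev
        obtain ⟨c1, c2⟩ := Vh_at he (V := fun z => ⟪c, z⟫) (X := fun _ => c) continuous_const hy
          (Eventually.of_forall fun z => hasGradientAt_iff.2 (innerSL ℝ c).hasFDerivAt)
        have hg2 : HasGradientAt (fun y => 2 * V (fd e y) + ⟪c, fd e y⟫) ((2:ℝ) • hat e X y + hat e (fun _ => c) y) y := by
          rw [hasGradientAt_iff] at v1 c1 ⊢
          refine ((v1.const_mul 2).add c1).congr_fderiv ?_
          rw [map_add, map_smul]
        have hg1 : HasGradientAt (fun y => t * ⟪bv (w y), a⟫) (kH (w y) a) y := by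
          rw [hasGradientAt_iff]
          refine (((hasGradientAt_iff.1 (bv_grad a (w y))).comp y (hwd y)).const_mul t).congr_fderiv ?_
          ext z
          simp [inner_smul_right, ht.ne']
        have hbw : ContDiffAt ℝ 1 (fun y => t * ⟪bv (w y), a⟫) y :=
          (contDiff_const.mul ((bv_smooth.of_le (by norm_num)).comp (hwc.of_le (by norm_num)) |>.inner ℝ contDiff_const)).contDiffAt
        have hzw : ContDiffAt ℝ 1 (fun y => Za a (w y)) y :=
          (((Za_smooth a).of_le (by norm_num)).comp (hwc.of_le (by norm_num))).contDiffAt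
        have s1 : ContDiffAt ℝ 1 Y1 y := hbw.smul f1
        have s2 : ContDiffAt ℝ 1 Y2 y := ((contDiffAt_const.mul v2).add c2).smul hzw
        refine ⟨s1.add s2, ?_⟩
        have hza : HasFDerivAt (fun y => Za a (w y)) ((fderiv ℝ (Za a) (w y)).comp (t⁻¹ • ContinuousLinearMap.id ℝ E)) y :=
          (((Za_smooth a).differentiable (by norm_num) _).hasFDerivAt).comp y (hwd y)
        have h0 : tr ((fderiv ℝ (Za a) (w y)).comp (t⁻¹ • ContinuousLinearMap.id ℝ E)) = 0 := by
          rw [ContinuousLinearMap.comp_smul, ContinuousLinearMap.comp_id, tr_smul, Za_div, mul_zero]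
        rw [fderiv_fun_add (s1.differentiableAt one_ne_zero) (s2.differentiableAt one_ne_zero), tr_add]
        rw [tr_fderiv_smul hg1 (f1.differentiableAt one_ne_zero).hasFDerivAt, tr_fderiv_smul hg2 hza, f2, h0]
        simp [hD]
      · have hy1 := hw1 y (not_lt.1 hyR)
        have hev : (fun y => Y1 y + Y2 y) =ᶠ[𝓝 y] fun _ => 0 := by
          filter_upwards [((continuous_norm.comp hwc.continuous).tendsto y).eventually (lt_mem_nhds hy1)] with z hz
          have hz : 1 < ‖w z‖ := hz
          simp [hY1, hY2, bv_zero hz.le, Za_zero a hz]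
        refine ⟨contDiffAt_const.congr_of_eventuallyEq hev, ?_⟩
        rw [hev.fderiv_eq]
        simp [hD, kH_zero hy1, Za_zero a hy1, tr_zero]
  have hr := integral_resc D ht x
  rw [hD0, mul_zero] at hr
  have hwz : ∀ z, w (x + t • z) = z := fun z => by simp [hw, ht.ne']
  have hA : Integrable fun z => ⟪hat e F (x + t • z), a⟫ * kt z := by
    refine Continuous.integrable_of_hasCompactSupport ?_ kt_cs.mul_left
    have := (kt_smooth (E := E)).continuous
    exact ((hFc.comp (by fun_prop)).inner continuous_const).mul this
  have hB : Integrable fun z => ⟪hat e (fun y => F y - (2:ℝ) • X y - c) (x + t • z), Za a z⟫ := by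
    classical
    have hfc : Continuous fun z : E => F (fd e (x + t • z)) - (2:ℝ) • X (fd e (x + t • z)) - c := by
      have h4 : Continuous fun z : E => fd e (x + t • z) := (fd_cont e).comp (by fun_prop)
      exact ((H.fc.comp h4).sub ((H.xc.comp h4).const_smul _)).sub continuous_const
    have h1 : (fun z => ⟪hat e (fun y => F y - (2:ℝ) • X y - c) (x + t • z), Za a z⟫) =
        {z : E | 0 ≤ ⟪e, x + t • z⟫}.piecewise (fun z => ⟪F (fd e (x + t • z)) - (2:ℝ) • X (fd e (x + t • z)) - c, Za a z⟫)
          (fun z => ⟪rf e (F (fd e (x + t • z)) - (2:ℝ) • X (fd e (x + t • z)) - c), Za a z⟫) := by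
      ext z
      simp only [hat, piecewise, Set.mem_ofPred_eq]
      split_ifs <;> rfl
    rw [h1]
    have hcs : ∀ g : E → E, HasCompactSupport fun z => ⟪g z, Za a z⟫ := fun g =>
      (Za_cs a).mono fun y hy hy' => hy (by
        show ⟪g y, Za a y⟫ = 0
        rw [show Za a y = 0 from hy', inner_zero_right])
    refine Integrable.piecewise ?_ ?_ ?_
    · exact measurableSet_le measurable_const (hcle.comp (by fun_prop)).measurable
    · exact (Continuous.integrable_of_hasCompactSupport (hfc.inner (Za_smooth a).continuous) (hcs _)).integrableOn
    · exact (Continuous.integrable_of_hasCompactSupport (((rf e).continuous.comp hfc).inner (Za_smooth a).continuous) (hcs _)).integrableOn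
  have hsub : ∀ z, D (x + t • z) = ⟪hat e F (x + t • z), a⟫ * kt z - ⟪hat e (fun y => F y - (2:ℝ) • X y - c) (x + t • z), Za a z⟫ := by
    intro z
    rw [hat_lin]
    simp only [hD, hwz, Za, inner_sub_left, inner_add_left, inner_sub_right, inner_smul_left, inner_smul_right]
    rw [real_inner_comm (kH z a) (hat e F (x + t • z))]
    simp
    ring
  simp only [hsub] at hr
  rw [integral_sub hA hB] at hr
  linarith

/-- half ball and Hoelder condition -/
def HB (e : E) (r : ℝ) : Set E := {y | ‖y‖ < r ∧ 0 ≤ ⟪e, y⟫}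
def Ho {W : Type*} [NormedAddCommGroup W] (γ : ℝ) (f : E → W) (S : Set E) (N : ℝ) : Prop :=
  ∀ x ∈ S, ∀ y ∈ S, ‖f x - f y‖ ≤ N * ‖x - y‖ ^ γ

lemma ex_dual (d : E) : ∃ a : E, ‖a‖ ≤ 1 ∧ ⟪d, a⟫ = ‖d‖ := by
  refine ⟨‖d‖⁻¹ • d, ?_, ?_⟩
  · rw [norm_smul, norm_inv, norm_norm]; exact inv_mul_le_one
  · rw [inner_smul_right, real_inner_self_eq_norm_sq, pow_two, ← mul_assoc]
    rcases eq_or_ne ‖d‖ 0 with h | h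
    · simp [h]
    · rw [inv_mul_cancel₀ h, one_mul]

lemma hat_hol {e : E} (he : ‖e‖ = 1) {F : E → E} (hb : ∀ y, ⟪e, y⟫ = 0 → ⟪e, F y⟫ = 0) {R N γ : ℝ} (hγ : 0 < γ) (hN : 0 ≤ N)
    (hF : Ho γ F (HB e R) N) {x y : E} (hx : x ∈ HB e R) (hy : ‖y‖ < R) : ‖hat e F y - F x‖ ≤ 3 * N * ‖y - x‖ ^ γ := by
  have hfy : fd e y ∈ HB e R := ⟨by rw [fd_norm he]; exact hy, by rw [fd_inner he]; exact abs_nonneg _⟩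
  have h1 : ‖F (fd e y) - F x‖ ≤ N * ‖y - x‖ ^ γ := by
    refine (hF _ hfy _ hx).trans ?_
    have := fd_lip he x y
    rw [fd_pos hx.2] at this
    gcongr
  have h2 : 0 ≤ N * ‖y - x‖ ^ γ := by positivity
  rcases le_or_gt 0 ⟪e, y⟫ with h | h
  · rw [hat, if_pos h]; linarith
  · rw [hat, if_neg (not_le.2 h)]
    have h3 : rf e (F (fd e y)) - F x = rf e (F (fd e y) - F x) - (2 * ⟪e, F x⟫) • e := by
      rw [map_sub, rf_apply e (F x)]; abel
    set x0 := x - ⟪e, x⟫ • e with hx0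
    have hx0n : ⟪e, x0⟫ = 0 := by
      rw [hx0, inner_sub_right, inner_smul_right, real_inner_self_eq_norm_sq, he]; ring
    have hx0m : ‖x0‖ ≤ ‖x‖ := by
      rw [← abs_of_nonneg (norm_nonneg x0), ← abs_of_nonneg (norm_nonneg x), ← sq_le_sq, hx0, norm_sub_sq_real, inner_smul_right,
        norm_smul, he, real_inner_comm, Real.norm_eq_abs, mul_one, sq_abs]
      nlinarith [sq_nonneg ⟪e, x⟫]
    have h4 := hF x hx x0 ⟨lt_of_le_of_lt hx0m hx.1, hx0n.ge⟩
    have h5 : ‖x - x0‖ ≤ ‖y - x‖ := by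
      rw [hx0, _root_.sub_sub_cancel, norm_smul, he, mul_one, Real.norm_of_nonneg hx.2, norm_sub_rev]
      have := real_inner_le_norm e (x - y)
      rw [inner_sub_right, he] at this
      linarith
    have h6 : |⟪e, F x⟫| ≤ N * ‖y - x‖ ^ γ := by
      have h7 : ⟪e, F x⟫ = ⟪e, F x - F x0⟫ := by rw [inner_sub_right, hb x0 hx0n, sub_zero]
      rw [h7]
      have := abs_real_inner_le_norm e (F x - F x0)
      rw [he, one_mul] at this
      refine this.trans (h4.trans ?_)
      gcongr
    rw [h3]
    refine (norm_sub_le _ _).trans ?_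
    rw [rf_norm he, norm_smul, he, mul_one, Real.norm_eq_abs, abs_mul, abs_two]
    linarith

variable (E) in
lemma STEP [Nontrivial E] {γ : ℝ} (hγ : 0 < γ) (hγ1 : γ ≤ 1) : ∃ C : ℝ, 1 ≤ C ∧ ∀ (e : E) (R : ℝ) (V : E → ℝ) (X F : E → E) (L N : ℝ), ‖e‖ = 1 →
    LS e R V X F → 0 ≤ L → 0 ≤ N → Ho γ (fun y => F y - (2:ℝ) • X y) (HB e R) L → Ho γ F (HB e R) N →
    ∀ x ∈ HB e R, ∀ x' ∈ HB e R, ∀ t, 0 < t → ‖x‖ + 2 * t < R → ‖x - x'‖ ≤ t →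
      ‖F x - F x'‖ ≤ C * (t ^ γ * (L + N * (‖x - x'‖ / t))) := by
  obtain ⟨C1, hC1, hreg⟩ := avg_reg E
  set Kz : ℝ := ∫ z : E, (|kt z| + ‖kH z‖) with hKz
  have hKi : Integrable fun z : E => (|kt z| + ‖kH z‖) := by
    refine Continuous.integrable_of_hasCompactSupport ((kt_smooth.continuous.abs).add kH_smooth.continuous.norm) ?_
    refine HasCompactSupport.intro (isCompact_closedBall 0 1) fun z hz => ?_
    have hz : 1 < ‖z‖ := by simpa using hz
    simp [kt_zero hz, kH_zero hz]
  have hK0 : 0 ≤ Kz := integral_nonneg fun z => by positivity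
  have hc0 := c0_pos (E := E)
  refine ⟨1 + (2 * Kz / γ + 6 * C1) / c0 E, le_add_of_nonneg_right (by positivity), ?_⟩
  intro e R V X F L N he H hL hN hf hF x hx x' hx' t ht hxt hxx
  obtain ⟨a, ha, had⟩ := ex_dual (F x - F x')
  set S : E → ℝ := fun y => ⟪hat e F y, a⟫ with hS
  have hSc : Continuous S := (hat_cont H.fc H.bd).inner continuous_const
  have hkey : ∀ y ∈ HB e R, ‖y‖ + t < R → |avg S t y - c0 E * S y| ≤ (L * Kz) / γ * t ^ γ := by
    intro y hy hyt
    refine AVGe hSc y ht hγ fun τ hτ => ?_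
    simp only [hS]
    rw [IDENT he H hτ.1 (by linarith [hτ.2]) a (F y - (2:ℝ) • X y), hKz, mul_assoc, mul_comm (∫ z : E, _), ← mul_assoc, ← integral_const_mul, ← Real.norm_eq_abs]
    refine norm_integral_le_of_norm_le (hKi.const_mul _) (Eventually.of_forall fun z => ?_)
    rcases lt_or_ge 1 ‖z‖ with hz | hz
    · rw [Za_zero a hz]; simp; have := hτ.1.le; positivity
    · refine (norm_inner_le_norm _ _).trans ?_
      have hty : ‖τ • z‖ ≤ τ := by
        rw [norm_smul, Real.norm_of_nonneg hτ.1.le]; exact mul_le_of_le_one_right hτ.1.le hz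
      have h1 : ‖hat e (fun y' => F y' - (2:ℝ) • X y' - (F y - (2:ℝ) • X y)) (y + τ • z)‖ ≤ L * τ ^ γ := by
        rw [hat_norm he]
        have h2 : fd e (y + τ • z) ∈ HB e R := by
          refine ⟨?_, by rw [fd_inner he]; exact abs_nonneg _⟩
          rw [fd_norm he]
          have := norm_add_le y (τ • z)
          linarith [hτ.2]
        refine (hf _ h2 _ hy).trans ?_
        have h3 := fd_lip he y (y + τ • z)
        rw [fd_pos hy.2, add_sub_cancel_left] at h3
        have h4 := h3.trans hty
        gcongr
      have h2 : ‖Za a z‖ ≤ |kt z| + ‖kH z‖ := by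
        unfold Za
        refine (norm_sub_le _ _).trans (add_le_add ?_ ?_)
        · rw [norm_smul, Real.norm_eq_abs]; exact mul_le_of_le_one_right (abs_nonneg _) ha
        · exact ((kH z).le_opNorm a).trans (mul_le_of_le_one_right (norm_nonneg _) ha)
      have := hτ.1.le
      gcongr
  have hx't : ‖x'‖ + t < R := by
    have := norm_sub_norm_le x' x
    rw [norm_sub_rev] at this
    linarith
  have k1 := hkey x hx (by linarith)
  have k2 := hkey x' hx' hx't
  have hcst : ∀ y, avg (fun z => S z - S x) t y = avg S t y - c0 E * S x := by
    intro y
    unfold avg c0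
    rw [mul_comm, ← integral_const_mul, ← integral_sub (avg_int hSc t y) (rho_int.const_mul _)]
    congr 1; ext z; ring
  have h2t : (2 * t) ^ γ ≤ 2 * t ^ γ := rp_le (by norm_num) ht.le hγ1
  have hr := (hreg (fun z => S z - S x) t (6 * N * t ^ γ) x (by fun_prop) ht ?_).2.1 (x' - x) (by rw [norm_sub_rev]; exact hxx)
  · rw [hcst, hcst, add_sub_cancel, norm_sub_rev] at hr
    have hd : c0 E * ‖F x - F x'‖ = c0 E * S x - c0 E * S x' := by
      rw [← had, inner_sub_left]
      simp only [hS]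
      rw [hat_pos hx.2, hat_pos hx'.2]; ring
    have hfin : c0 E * ‖F x - F x'‖ ≤ (2 * Kz / γ + 6 * C1) * (t ^ γ * (L + N * (‖x - x'‖ / t))) := by
      rw [hd]
      have e1 := abs_le.1 k1
      have e2 := abs_le.1 k2
      have e3 := abs_le.1 hr
      have e4 : 0 ≤ 2 * Kz / γ * (t ^ γ * (N * (‖x - x'‖ / t))) := by positivity
      have e5 : 0 ≤ 6 * C1 * (t ^ γ * L) := by positivity
      have e6 : L * Kz / γ * t ^ γ = (Kz / γ) * (t ^ γ * L) := by ring
      have e7 : 2 * Kz / γ = 2 * (Kz / γ) := by ring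
      rw [e7] at e4 ⊢
      rw [e6] at e1 e2
      linarith [e1.1, e1.2, e2.1, e2.2, e3.1, e3.2]
    rw [mul_comm, ← le_div_iff₀ hc0] at hfin
    have h0 : 0 ≤ t ^ γ * (L + N * (‖x - x'‖ / t)) := by positivity
    refine hfin.trans ?_
    rw [mul_div_right_comm, add_mul, one_mul]
    linarith
  · intro y hy
    rw [mem_closedBall, dist_eq_norm] at hy
    have hyR : ‖y‖ < R := by
      have := norm_sub_norm_le y x
      linarith
    have h1 := hat_hol he H.bd hγ hN hF hx hyR
    simp only [hS]
    rw [hat_pos hx.2, ← inner_sub_left]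
    refine (abs_real_inner_le_norm _ _).trans ((mul_le_of_le_one_right (norm_nonneg _) ha).trans (h1.trans ?_))
    have h3 : ‖y - x‖ ^ γ ≤ 2 * t ^ γ := le_trans (by gcongr) h2t
    have := mul_le_mul_of_nonneg_left h3 (by positivity : 0 ≤ 3 * N)
    linarith

end
end OP

namespace OP
open scoped RealInnerProductSpace Topology
open Module

section
variable {E : Type*} [NormedAddCommGroup E] [InnerProductSpace ℝ E] [FiniteDimensional ℝ E]
  [MeasurableSpace E] [BorelSpace E]

lemma HB_mono {e : E} {r r' : ℝ} (h : r ≤ r') : HB e r ⊆ HB e r' := fun y hy => ⟨lt_of_lt_of_le hy.1 h, hy.2⟩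
lemma Ho.mono {W : Type*} [NormedAddCommGroup W] {γ : ℝ} {f : E → W} {S T : Set E} {N M : ℝ} (h : Ho γ f S N) (hT : T ⊆ S) (hN : N ≤ M) : Ho γ f T M :=
  fun x hx y hy => (h x (hT hx) y (hT hy)).trans (by gcongr)

lemma INT {e : E} (he : ‖e‖ = 1) {V : E → ℝ} {X : E → E} {R γ v N s : ℝ} (hγ : 0 < γ) (hN : 0 ≤ N) (hs : 0 < s) (hX : Continuous X)
    (hg : ∀ y, ‖y‖ < R → 0 < ⟪e, y⟫ → HasGradientAt V (X y) y) (hV : ∀ y ∈ HB e R, |V y| ≤ v) (hH : Ho γ X (HB e R) N)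
    {x : E} (hx : x ∈ HB e R) (hxs : ‖x‖ + s < R) : ‖X x‖ ≤ 2 * v / s + N * s ^ γ := by
  have key : ∀ x : E, 0 < ⟪e, x⟫ → ‖x‖ + s < R → ‖X x‖ ≤ 2 * v / s + N * s ^ γ := by
    intro x hxp hxs
    obtain ⟨w, hw1, hw2, hw3⟩ : ∃ w : E, ‖w‖ ≤ 1 ∧ |⟪X x, w⟫| = ‖X x‖ ∧ 0 ≤ ⟪e, w⟫ := by
      obtain ⟨a, ha, hb⟩ := ex_dual (X x)
      rcases le_total 0 ⟪e, a⟫ with h | h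
      · exact ⟨a, ha, by rw [hb, abs_norm], h⟩
      · exact ⟨-a, by rwa [norm_neg], by rw [inner_neg_right, abs_neg, hb, abs_norm], by rw [inner_neg_right]; linarith⟩
    have hin : ∀ τ ∈ Icc 0 s, ‖x + τ • w‖ < R ∧ 0 < ⟪e, x + τ • w⟫ := by
      intro τ hτ
      constructor
      · refine (norm_add_le _ _).trans_lt ?_
        rw [norm_smul, Real.norm_of_nonneg hτ.1]
        have := mul_le_of_le_one_right hτ.1 hw1
        linarith [hτ.2]
      · rw [inner_add_right, inner_smul_right]
        have := mul_nonneg hτ.1 hw3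
        linarith
    have hd : ∀ τ ∈ Icc 0 s, HasDerivAt (fun τ : ℝ => V (x + τ • w)) ⟪X (x + τ • w), w⟫ τ := by
      intro τ hτ
      have h1 := hasGradientAt_iff.1 (hg _ (hin τ hτ).1 (hin τ hτ).2)
      have h2 : HasDerivAt (fun τ : ℝ => x + τ • w) w τ := by
        simpa using ((hasDerivAt_id τ).smul_const w).const_add x
      exact h1.comp_hasDerivAt τ h2
    obtain ⟨ξ, hξ, hξe⟩ := exists_hasDerivAt_eq_slope (fun τ : ℝ => V (x + τ • w)) (fun τ => ⟪X (x + τ • w), w⟫) hs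
      (fun τ hτ => (hd τ hτ).continuousAt.continuousWithinAt) (fun τ hτ => hd τ (Ioo_subset_Icc_self hτ))
    have hξ' := Ioo_subset_Icc_self hξ
    have hb := hH _ ⟨(hin ξ hξ').1, (hin ξ hξ').2.le⟩ x ⟨by linarith, hxp.le⟩
    rw [add_sub_cancel_left] at hb
    have h3 : ‖ξ • w‖ ≤ s := by
      rw [norm_smul, Real.norm_of_nonneg hξ.1.le]
      exact (mul_le_of_le_one_right hξ.1.le hw1).trans hξ.2.le
    have h4 : ‖X (x + ξ • w) - X x‖ ≤ N * s ^ γ := hb.trans (by gcongr)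
    have h5 : |⟪X (x + ξ • w), w⟫| ≤ 2 * v / s := by
      rw [hξe, abs_div, sub_zero, abs_of_pos hs]
      have v1 := hV _ ⟨(hin s ⟨hs.le, le_rfl⟩).1, (hin s ⟨hs.le, le_rfl⟩).2.le⟩
      have v2 := hV _ ⟨(hin 0 ⟨le_rfl, hs.le⟩).1, (hin 0 ⟨le_rfl, hs.le⟩).2.le⟩
      have := abs_sub (V (x + s • w)) (V (x + (0:ℝ) • w))
      gcongr
      linarith
    have h6 : |⟪X (x + ξ • w), w⟫ - ⟪X x, w⟫| ≤ N * s ^ γ := by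
      rw [← inner_sub_left]
      exact (abs_real_inner_le_norm _ _).trans ((mul_le_of_le_one_right (norm_nonneg _) hw1).trans h4)
    rw [← hw2]
    have := abs_sub_abs_le_abs_sub ⟪X x, w⟫ ⟪X (x + ξ • w), w⟫
    rw [abs_sub_comm] at this
    linarith
  have hlim : Tendsto (fun δ : ℝ => ‖X (x + δ • e)‖) (𝓝[>] 0) (𝓝 ‖X x‖) := by
    have h1 : Continuous fun δ : ℝ => ‖X (x + δ • e)‖ := (hX.comp (by fun_prop)).norm
    have := h1.tendsto 0
    simp only [zero_smul, add_zero] at this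
    exact this.mono_left nhdsWithin_le_nhds
  refine le_of_tendsto hlim ?_
  have hev : ∀ᶠ δ : ℝ in 𝓝[>] 0, δ < R - s - ‖x‖ := nhdsWithin_le_nhds (gt_mem_nhds (by linarith))
  filter_upwards [hev, self_mem_nhdsWithin] with δ h1 h2
  have h2 : 0 < δ := h2
  refine key _ ?_ ?_
  · rw [inner_add_right, inner_smul_right, real_inner_self_eq_norm_sq, he]; linarith [hx.2]
  · have := norm_add_le x (δ • e)
    rw [norm_smul, he, Real.norm_of_nonneg h2.le] at this
    linarith

set_option maxHeartbeats 2000000 in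
variable (E) in
lemma LIN [Nontrivial E] {γ R0 R1 : ℝ} (hγ : 0 < γ) (hγ1 : γ < 1) (hR0 : 0 < R0) (hR : R0 < R1) (hR1 : R1 ≤ 1) :
    ∃ c > 0, ∃ C ≥ 1, ∀ (e : E) (V : E → ℝ) (X F : E → E) (v K N1 : ℝ), ‖e‖ = 1 → LS e R1 V X F → 0 ≤ v → 0 ≤ K → 0 ≤ N1 →
      (∀ y ∈ HB e R1, |V y| ≤ v) → Ho γ X (HB e R1) N1 →
      (∀ r ∈ Icc R0 R1, ∀ N m : ℝ, 0 ≤ N → 0 ≤ m → Ho γ X (HB e r) N → (∀ y ∈ HB e r, ‖X y‖ ≤ m) →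
        Ho γ (fun y => F y - (2:ℝ) • X y) (HB e r) (c * (N + m) + K)) →
      Ho γ X (HB e R0) (C * (v + K)) ∧ ∀ y ∈ HB e R0, ‖X y‖ ≤ C * (v + K) := by
  obtain ⟨C, hC, hstep⟩ := STEP E hγ hγ1.le
  obtain ⟨Λ, hΛ1, hΛ⟩ : ∃ Λ : ℝ, 1 ≤ Λ ∧ C * Λ ^ (γ - 1) ≤ 1 / 16 := by
    have hg1 : 0 < 1 - γ := by linarith
    refine ⟨(16 * C) ^ (1 / (1 - γ)), Real.one_le_rpow (by linarith) (by positivity), ?_⟩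
    have hgm : 1 / (1 - γ) * (γ - 1) = -1 := by
      rw [div_mul_eq_mul_div, div_eq_iff hg1.ne']; ring
    rw [← Real.rpow_mul (by linarith), hgm, Real.rpow_neg_one]
    have : C ≠ 0 := by linarith
    field_simp; norm_num
  have hΛ0 : 0 < Λ := by linarith
  have hC0 : 0 < C := by linarith
  obtain ⟨κ, hκ0, hκ4, hκ⟩ : ∃ κ : ℝ, 0 < κ ∧ κ ≤ 1 / 4 ∧ (4 * Λ * κ) ^ γ ≤ 1 / 16 := by
    refine ⟨(1 / 16) ^ (1 / γ) / (4 * Λ), by positivity, ?_, ?_⟩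
    · rw [div_le_div_iff₀ (by positivity) (by norm_num)]
      have : (1 / 16 : ℝ) ^ (1 / γ) ≤ 1 := Real.rpow_le_one (by norm_num) (by norm_num) (by positivity)
      linarith
    · rw [mul_div_cancel₀ _ (by positivity), ← Real.rpow_mul (by norm_num), one_div_mul_cancel hγ.ne', Real.rpow_one]
  set c : ℝ := 1 / (48 * C * Λ) with hc
  have hc0 : 0 < c := by positivity
  have hCΛ : 1 ≤ C * Λ := one_le_mul_of_one_le_of_one_le hC hΛ1
  have hc1 : c ≤ 1 := by rw [hc, div_le_one (by positivity)]; linarith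
  have hcC : C * Λ * c = 1 / 48 := by rw [hc]; field_simp
  set A0 : ℝ := 16 * C * Λ / κ with hA0
  have hA0p : 0 < A0 := by positivity
  set Δ : ℝ := R1 - R0 with hΔ
  have hΔ0 : 0 < Δ := by linarith
  set B0 : ℝ := 8 * A0 / Δ ^ 2 with hB0
  have hB0p : 0 < B0 := by positivity
  have hBΔ : 0 ≤ 4 * B0 + 8 / Δ := by positivity
  refine ⟨c, hc0, 1 + 4 * B0 + 8 / Δ, by linarith, ?_⟩
  intro e V X F v K N1 he H hv hK hN1 hV hX1 hper
  have hstp : ∀ r r', R0 ≤ r → r < r' → r' ≤ R1 → ∀ N, 0 ≤ N → Ho γ X (HB e r') N → Ho γ X (HB e r) (1 / 8 * N + A0 * (v + K) / (r' - r) ^ 2) := by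
    intro r r' hr hrr hr' N hN hHo
    set d := r' - r with hd
    have hd0 : 0 < d := by linarith
    have hd1 : d ≤ 1 := by linarith
    have hκd : 0 < κ * d := by positivity
    have hκd1 : κ * d ≤ d / 4 := by linarith [mul_le_mul_of_nonneg_right hκ4 hd0.le]
    have hm : ∀ y ∈ HB e (r + d / 2), ‖X y‖ ≤ 2 * v / (κ * d) + N * (κ * d) ^ γ := fun y hy =>
      INT he hγ hN hκd H.xc (fun y h1 h2 => H.grad y (by linarith) h2) (fun y hy => hV y (HB_mono hr' hy)) hHo
        (HB_mono (by linarith) hy) (by have := hy.1; linarith)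
    have hs1 : (κ * d) ^ γ ≤ 1 := rp_le1 hκd.le (by linarith) hγ.le
    have hvκ : 0 ≤ 2 * v / (κ * d) := by positivity
    have hNs : N * (κ * d) ^ γ ≤ N := mul_le_of_le_one_right hN hs1
    set L := c * (N + (2 * v / (κ * d) + N)) + K with hL
    have hL0 : 0 ≤ L := by positivity
    have hHr : Ho γ X (HB e (r + d / 2)) N := hHo.mono (HB_mono (by linarith)) le_rfl
    have hf := hper (r + d / 2) ⟨by linarith, by linarith⟩ N (2 * v / (κ * d) + N) hN (by positivity) hHr
      (fun y hy => (hm y hy).trans (by linarith))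
    have hF : Ho γ F (HB e (r + d / 2)) (2 * N + L) := by
      intro x hx y hy
      have h1 := hf x hx y hy
      have h2 := hHr x hx y hy
      have h3 : F x - F y = (F x - (2:ℝ) • X x - (F y - (2:ℝ) • X y)) + (2:ℝ) • (X x - X y) := by rw [smul_sub]; abel
      rw [h3]
      refine (norm_add_le _ _).trans ?_
      rw [norm_smul, Real.norm_of_nonneg zero_le_two]
      linarith
    have hLS : LS e (r + d / 2) V X F := ⟨H.vc, H.xc, H.fc, fun y h1 h2 => H.grad y (by linarith) h2, fun y h1 h2 => H.div y (by linarith) h2, H.bd⟩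
    have hd2 : d ^ 2 ≤ d := by rw [sq]; exact mul_le_of_le_one_right hd0.le hd1
    have hvd : v / d ≤ v / d ^ 2 := by gcongr
    have hKd : K ≤ K / d ^ 2 := by rw [le_div_iff₀ (by positivity)]; exact mul_le_of_le_one_right hK (hd2.trans hd1)
    have hAe : A0 * (v + K) / d ^ 2 = 16 * (C * Λ) / κ * (v / d ^ 2) + 16 * (C * Λ) / κ * (K / d ^ 2) := by rw [hA0]; ring
    have hvd0 : 0 ≤ v / d ^ 2 := by positivity
    have hKd0 : 0 ≤ K / d ^ 2 := by positivity
    intro x hx y hy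
    have hx2 : x ∈ HB e (r + d / 2) := HB_mono (by linarith) hx
    have hy2 : y ∈ HB e (r + d / 2) := HB_mono (by linarith) hy
    set ρ := ‖x - y‖ with hρ
    rcases eq_or_lt_of_le (norm_nonneg (x - y)) with h0 | h0
    · have : x = y := by rw [← sub_eq_zero, ← norm_eq_zero]; exact h0.symm
      rw [this, sub_self, norm_zero]; positivity
    have hρ0 : 0 < ρ := h0
    have hρg : 0 < ρ ^ γ := by positivity
    rcases lt_or_ge (4 * Λ * ρ) d with hcase | hcase
    · have h1 := hstep e (r + d / 2) V X F L (2 * N + L) he hLS hL0 (by positivity) hf hF x hx2 y hy2 (Λ * ρ) (by positivity)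
        (by have := hx.1; linarith) (le_mul_of_one_le_left hρ0.le hΛ1)
      have h2 := hf x hx2 y hy2
      have e1 : (Λ * ρ) ^ γ = Λ ^ (γ - 1) * Λ * ρ ^ γ := by
        rw [Real.mul_rpow hΛ0.le hρ0.le, Real.rpow_sub hΛ0, Real.rpow_one]; field_simp
      have e2 : ‖x - y‖ / (Λ * ρ) = Λ⁻¹ := by rw [← hρ]; field_simp
      rw [e1, e2] at h1
      have h3 : (2:ℝ) * ‖X x - X y‖ ≤ ‖F x - F y‖ + ‖F x - (2:ℝ) • X x - (F y - (2:ℝ) • X y)‖ := by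
        rw [← Real.norm_of_nonneg (zero_le_two : (0:ℝ) ≤ 2), ← norm_smul, Real.norm_of_nonneg zero_le_two]
        have : (2:ℝ) • (X x - X y) = (F x - F y) - (F x - (2:ℝ) • X x - (F y - (2:ℝ) • X y)) := by rw [smul_sub]; abel
        rw [this]; exact norm_sub_le _ _
      -- coefficients
      have f1 : C * (Λ ^ (γ - 1) * Λ * ρ ^ γ * (L + (2 * N + L) * Λ⁻¹)) = (C * Λ ^ (γ - 1)) * (Λ * L + 2 * N + L) * ρ ^ γ := by
        field_simp; ring
      rw [f1] at h1
      have f2 : (C * Λ ^ (γ - 1)) * (Λ * L + 2 * N + L) ≤ 1 / 16 * (Λ * L + 2 * N + L) := by gcongr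
      have f3 : 1 / 16 * (Λ * L + 2 * N + L) + L ≤ 2 * (1 / 8 * N + A0 * (v + K) / d ^ 2) := by
        have g1 : L = 2 * (c * N) + 2 * c * (v / d) / κ + K := by rw [hL]; field_simp; ring
        have g0 : L ≤ C * Λ * L := le_mul_of_one_le_left hL0 hCΛ
        have g0' : Λ * L ≤ C * Λ * L := mul_le_mul_of_nonneg_right (le_mul_of_one_le_left hΛ0.le hC) hL0
        have g2 : C * Λ * L = 2 * (C * Λ * c) * N + 2 * (C * Λ * c) * (v / d) / κ + C * Λ * K := by rw [g1]; ring
        rw [hcC] at g2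
        have hκi : 1 ≤ 1 / κ := by rw [le_div_iff₀ hκ0]; linarith
        have g3 : 2 * (1 / 48) * (v / d) / κ ≤ 16 * (C * Λ) / κ * (v / d ^ 2) / 2 := by
          have a1 : 2 * (1 / 48) * (v / d) / κ = 2 * (1 / 48) * ((1 / κ) * (v / d)) := by ring
          have a2 : 16 * (C * Λ) / κ * (v / d ^ 2) = 16 * ((C * Λ) * ((1 / κ) * (v / d ^ 2))) := by ring
          rw [a1, a2]
          have a3 : (1 / κ) * (v / d) ≤ (1 / κ) * (v / d ^ 2) := by gcongr
          have a4 : (1 / κ) * (v / d ^ 2) ≤ (C * Λ) * ((1 / κ) * (v / d ^ 2)) := le_mul_of_one_le_left (by positivity) hCΛ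
          have : 0 ≤ (1 / κ) * (v / d) := by positivity
          linarith
        have g4 : C * Λ * K ≤ 16 * (C * Λ) / κ * (K / d ^ 2) / 2 := by
          have a2 : 16 * (C * Λ) / κ * (K / d ^ 2) = 16 * ((1 / κ) * (C * Λ * (K / d ^ 2))) := by ring
          rw [a2]
          have a3 : C * Λ * K ≤ C * Λ * (K / d ^ 2) := by gcongr
          have a4 : C * Λ * (K / d ^ 2) ≤ (1 / κ) * (C * Λ * (K / d ^ 2)) := le_mul_of_one_le_left (by positivity) hκi
          have : 0 ≤ C * Λ * (K / d ^ 2) := by positivity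
          linarith
        rw [hAe]
        have p1 : 0 ≤ 16 * (C * Λ) / κ * (v / d ^ 2) := by positivity
        have p2 : 0 ≤ 16 * (C * Λ) / κ * (K / d ^ 2) := by positivity
        linarith
      have f4 := mul_le_mul_of_nonneg_right (add_le_add_left f2 L |>.trans f3) hρg.le
      have hcc : (c * (N + (2 * v / (κ * d) + N)) + K) = L := rfl
      rw [hcc] at h2
      have h5 : L * ρ ^ γ = L * ‖x - y‖ ^ γ := rfl
      linarith
    · have h1 := hm x hx2
      have h2 := hm y hy2
      have h3 := norm_sub_le (X x) (X y)
      have f1 : (κ * d) ^ γ ≤ 1 / 16 * ρ ^ γ := by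
        calc (κ * d) ^ γ ≤ (4 * Λ * κ * ρ) ^ γ := by
              refine Real.rpow_le_rpow hκd.le ?_ hγ.le
              have := mul_le_mul_of_nonneg_left hcase hκ0.le
              linarith
          _ = (4 * Λ * κ) ^ γ * ρ ^ γ := Real.mul_rpow (by positivity) hρ0.le
          _ ≤ _ := by gcongr
      have f2 : 1 ≤ 4 * Λ / d * ρ ^ γ := by
        refine rp_one ?_ hρ0.le hγ.le hγ1.le ?_
        · rw [le_div_iff₀ hd0]; linarith
        · rw [div_mul_eq_mul_div, le_div_iff₀ hd0]; linarith
      have f3 : 2 * (2 * v / (κ * d)) ≤ A0 * (v + K) / d ^ 2 * ρ ^ γ := by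
        have a1 : 2 * (2 * v / (κ * d)) = 4 / κ * (v / d) * 1 := by field_simp; ring
        have a2 : 4 / κ * (v / d) * (4 * Λ / d * ρ ^ γ) = 16 * Λ / κ * (v / d ^ 2) * ρ ^ γ := by field_simp; ring
        have a3 : 16 * Λ / κ * (v / d ^ 2) ≤ A0 * (v + K) / d ^ 2 := by
          rw [hAe]
          have b1 : 16 * Λ / κ * (v / d ^ 2) ≤ C * (16 * Λ / κ * (v / d ^ 2)) := le_mul_of_one_le_left (by positivity) hC
          have b2 : C * (16 * Λ / κ * (v / d ^ 2)) = 16 * (C * Λ) / κ * (v / d ^ 2) := by ring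
          have p2 : 0 ≤ 16 * (C * Λ) / κ * (K / d ^ 2) := by positivity
          linarith
        rw [a1]
        refine (mul_le_mul_of_nonneg_left f2 (by positivity)).trans ?_
        rw [a2]
        exact mul_le_mul_of_nonneg_right a3 hρg.le
      have f4 := mul_le_mul_of_nonneg_left f1 hN
      have : (1 / 8 * N + A0 * (v + K) / d ^ 2) * ρ ^ γ = 1 / 8 * (N * ρ ^ γ) + A0 * (v + K) / d ^ 2 * ρ ^ γ := by ring
      rw [this]
      linarith
  -- iteration
  set rr : ℕ → ℝ := fun i => R1 - Δ * (1 / 2) ^ i with hrr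
  have hQ : ∀ k i : ℕ, Ho γ X (HB e (rr i)) (N1 * (1 / 8) ^ k + B0 * (v + K) * 4 ^ i) := by
    intro k
    induction k with
    | zero =>
      intro i
      refine hX1.mono (HB_mono ?_) ?_
      · simp only [hrr]; have : 0 ≤ Δ * (1 / 2) ^ i := by positivity
        linarith
      · have : 0 ≤ B0 * (v + K) * 4 ^ i := by positivity
        rw [pow_zero, mul_one]; linarith
    | succ k ih =>
      intro i
      have hp : (0:ℝ) < (1 / 2) ^ i := by positivity
      have hp1 : ((1:ℝ) / 2) ^ i ≤ 1 := pow_le_one₀ (by norm_num) (by norm_num)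
      have hdd : rr (i + 1) - rr i = Δ * (1 / 2) ^ i / 2 := by simp only [hrr]; ring
      have := hstp (rr i) (rr (i + 1)) ?_ ?_ ?_ _ (by positivity) (ih (i + 1))
      · refine this.mono subset_rfl ?_
        rw [hdd]
        have e1 : (Δ * (1 / 2) ^ i / 2) ^ 2 = Δ ^ 2 * (1 / 4) / 4 ^ i := by
          have h4 : ((1:ℝ) / 2) ^ i * (1 / 2) ^ i * 4 ^ i = 1 := by rw [← _root_.mul_pow, ← _root_.mul_pow]; norm_num
          rw [_root_.eq_div_iff (by positivity)]; linear_combination Δ ^ 2 / 4 * h4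
        have e2 : A0 * (v + K) / (Δ ^ 2 * (1 / 4) / 4 ^ i) = B0 * (v + K) * 4 ^ i / 2 := by
          rw [hB0]; field_simp; ring
        rw [e1, e2, pow_succ, pow_succ]
        exact le_of_eq (by ring)
      · simp only [hrr]; have := mul_le_mul_of_nonneg_left hp1 hΔ0.le; linarith
      · have : 0 < Δ * (1 / 2) ^ i / 2 := by positivity
        linarith
      · simp only [hrr]; have : 0 ≤ Δ * (1 / 2) ^ (i + 1) := by positivity
        linarith
  have hlim : ∀ i, Ho γ X (HB e (rr i)) (B0 * (v + K) * 4 ^ i) := by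
    intro i x hx y hy
    have h1 : Tendsto (fun k : ℕ => (N1 * (1 / 8) ^ k + B0 * (v + K) * 4 ^ i) * ‖x - y‖ ^ γ) atTop (𝓝 ((N1 * 0 + B0 * (v + K) * 4 ^ i) * ‖x - y‖ ^ γ)) :=
      (((_root_.tendsto_pow_atTop_nhds_zero_of_lt_one (by norm_num) (by norm_num)).const_mul N1).add_const _).mul_const _
    rw [mul_zero, zero_add] at h1
    exact ge_of_tendsto' h1 fun k => hQ k i x hx y hy
  have hr1 : rr 1 = R0 + Δ / 2 := by simp only [hrr, hΔ]; ring
  have h1 := hlim 1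
  rw [hr1, pow_one] at h1
  have hB0v : 0 ≤ B0 * (v + K) := by positivity
  have h8 : 0 ≤ 8 / Δ * (v + K) := by positivity
  constructor
  · exact h1.mono (HB_mono (by linarith)) (by rw [add_mul, add_mul]; linarith)
  · intro y hy
    have h2 := INT he hγ (by positivity) (by positivity : 0 < Δ / 4) H.xc (fun y h1 h2 => H.grad y (by linarith) h2)
      (fun y hy => hV y (HB_mono (by linarith) hy)) h1 (HB_mono (by linarith) hy) (by have := hy.1; linarith)
    have h3 : (Δ / 4) ^ γ ≤ 1 := rp_le1 (by positivity) (by linarith) hγ.le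
    have h4 := mul_le_of_le_one_right (by positivity : 0 ≤ B0 * (v + K) * 4) h3
    have h5 : 2 * v / (Δ / 4) ≤ 8 / Δ * (v + K) := by
      rw [show 2 * v / (Δ / 4) = 8 / Δ * v by rw [div_div_eq_mul_div]; ring]; gcongr; linarith
    linarith
end
end OP

namespace OP
open scoped RealInnerProductSpace Topology
open Module

section
variable {E : Type*} [NormedAddCommGroup E] [InnerProductSpace ℝ E] [FiniteDimensional ℝ E]
  [MeasurableSpace E] [BorelSpace E]

/-- Hölder norm bound on a set. -/
def Nb {W : Type*} [NormedAddCommGroup W] (γ : ℝ) (f : E → W) (S : Set E) (m : ℝ) : Prop :=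
  (∀ y ∈ S, ‖f y‖ ≤ m) ∧ Ho γ f S m

/-- hodograph solutions -/
structure Hod (e : E) (R δ γ : ℝ) (k : E → ℝ) (X Z : E → E) : Prop where
  lip : ∀ y ∈ HB e R, ∀ z ∈ HB e R, |k y - k z| ≤ δ * ‖y - z‖
  eq : ∀ y ∈ HB e R, X y = Z y + ⟪e, Z y⟫ • X y
  xb : Nb γ X (HB e R) δ
  zb : Nb γ Z (HB e R) δ
  grad : ∀ y, ‖y‖ < R → 0 < ⟪e, y⟫ → HasGradientAt k (X y) y
  sm : ∀ y, ‖y‖ < R → 0 < ⟪e, y⟫ → ContDiffAt ℝ 2 X y ∧ ContDiffAt ℝ 2 Z y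
  div : ∀ y, ‖y‖ < R → 0 < ⟪e, y⟫ → tr (fderiv ℝ (fun y => (2:ℝ) • Z y - ⟪Z y, Z y⟫ • e) y) = 0
  bd : ∀ y, ‖y‖ < R → ⟪e, y⟫ = 0 → 2 * ⟪e, Z y⟫ = ⟪Z y, Z y⟫

lemma cone {u : E → ℝ} {G : E → E} {e : E} {δ : ℝ} (S : Sol u G (ball 0 1))
    (hG : ∀ x ∈ ball (0:E) (3/4), x ∈ closure {x | 0 < u x} → ‖G x - e‖ ≤ δ) {x w : E} (hx : x ∈ ball (0:E) (3/4))
    (hw : x + w ∈ ball (0:E) (3/4)) (hcl : x ∈ closure {x | 0 < u x}) (hp : 0 < u x + (⟪e, w⟫ - δ * ‖w‖)) :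
    u x + (⟪e, w⟫ - δ * ‖w‖) ≤ u (x + w) := by
  have h34 : ball (0:E) (3/4) ⊆ ball 0 1 := ball_subset_ball (by norm_num)
  have key : ∀ z : E, 0 < u z → z ∈ ball (0:E) (3/4) → z + w ∈ ball (0:E) (3/4) → 0 < u z + (⟪e, w⟫ - δ * ‖w‖) →
      u z + (⟪e, w⟫ - δ * ‖w‖) ≤ u (z + w) := by
    intro z hz hzb hzw hzp
    have hseg : ∀ t ∈ Icc (0:ℝ) 1, z + t • w ∈ ball (0:E) (3/4) := by
      intro t ht
      have := (convex_ball (0:E) (3/4)).add_smul_sub_mem hzb hzw ht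
      rwa [add_sub_cancel_left] at this
    have := ray (f := fun t : ℝ => u (z + t • w)) (T := 1) (c := ⟪e, w⟫ - δ * ‖w‖)
      (S.cont_line fun t ht => h34 (hseg t ht)) (by simpa using hz) ?_ (s := 1) ⟨zero_le_one, le_rfl⟩ (by simpa using hzp)
    · simpa using this
    · intro t ht hpt
      have hb := hseg t ⟨ht.1, ht.2.le⟩
      refine ⟨_, ?_, S.deriv_line (h34 hb) hpt⟩
      have h1 := hG _ hb (subset_closure hpt)
      have h2 : ⟪G (z + t • w), w⟫ = ⟪e, w⟫ + ⟪G (z + t • w) - e, w⟫ := by rw [inner_sub_left]; ring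
      have h3 := neg_le_of_abs_le (abs_real_inner_le_norm (G (z + t • w) - e) w)
      have h4 := mul_le_mul_of_nonneg_right h1 (norm_nonneg w)
      linarith
  have hne : (𝓝[{x | 0 < u x}] x).NeBot := mem_closure_iff_nhdsWithin_neBot.1 hcl
  have c1 : ContinuousAt u x := S.cont x (h34 hx)
  have c2 : ContinuousAt (fun z => u (z + w)) x :=
    ContinuousAt.comp (f := fun z => z + w) (S.cont _ (h34 hw)) (by fun_prop)
  have c1' : Tendsto (fun z => u z + (⟪e, w⟫ - δ * ‖w‖)) (𝓝 x) (𝓝 (u x + (⟪e, w⟫ - δ * ‖w‖))) := c1.tendsto.add_const _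
  refine le_of_tendsto_of_tendsto (b := 𝓝[{x | 0 < u x}] x) (c1'.mono_left nhdsWithin_le_nhds) (c2.tendsto.mono_left nhdsWithin_le_nhds) ?_
  have b1 : ∀ᶠ z in 𝓝 x, z ∈ ball (0:E) (3/4) := isOpen_ball.mem_nhds hx
  have b2 : ∀ᶠ z in 𝓝 x, z + w ∈ ball (0:E) (3/4) :=
    (show ContinuousAt (fun z => z + w) x by fun_prop).eventually (isOpen_ball.mem_nhds hw)
  filter_upwards [nhdsWithin_le_nhds b1, nhdsWithin_le_nhds b2, nhdsWithin_le_nhds (c1'.eventually (lt_mem_nhds hp)), self_mem_nhdsWithin] with z h1 h2 h3 h4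
  exact key z h4 h1 h2 h3

lemma kex {u : E → ℝ} {G : E → E} {e : E} {ε : ℝ} (he : ‖e‖ = 1) (hε : 0 < ε) (hε1 : ε ≤ 1 / 100) (S : Sol u G (ball 0 1))
    (hF : Flat u e (-ε) ε 0 1) {y : E} (hy : y ∈ HB e (7/10)) :
    ∃ t : ℝ, |t| ≤ 2 * ε ∧ y + t • e ∈ ball (0:E) (3/4) ∧ y + t • e ∈ closure {x | 0 < u x} ∧ u (y + t • e) = ⟪e, y⟫ := by
  have hyn : 0 ≤ ⟪e, y⟫ := hy.2
  have hb : ∀ t : ℝ, |t| ≤ 2 * ε → y + t • e ∈ ball (0:E) (3/4) := by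
    intro t ht
    rw [mem_ball_zero_iff]
    have := norm_add_le y (t • e)
    rw [norm_smul, he, mul_one, Real.norm_eq_abs] at this
    linarith [hy.1]
  have hb1 : ∀ t : ℝ, |t| ≤ 2 * ε → y + t • e ∈ ball (0:E) 1 := fun t ht => ball_subset_ball (by norm_num) (hb t ht)
  have habs : ∀ t ∈ Icc (-ε) (2 * ε), |t| ≤ 2 * ε := fun t ht => abs_le.2 ⟨by linarith [ht.1], ht.2⟩
  have hcon : ContinuousOn (fun t : ℝ => u (y + t • e)) (Icc (-ε) (2 * ε)) := S.cont_line fun t ht => hb1 t (habs t ht)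
  have hin : ∀ t : ℝ, ⟪e, y + t • e⟫ = ⟪e, y⟫ + t := by
    intro t; rw [inner_add_right, inner_smul_right, real_inner_self_eq_norm_sq, he]; ring
  have hK : IsCompact {t | t ∈ Icc (-ε) (2 * ε) ∧ u (y + t • e) ≤ ⟪e, y⟫} := by
    have h1 := hcon.preimage_isClosed_of_isClosed isClosed_Icc (isClosed_Iic (a := ⟪e, y⟫))
    exact isCompact_Icc.of_isClosed_subset h1 inter_subset_left
  have hm : -ε ∈ Icc (-ε) (2 * ε) := ⟨le_rfl, by linarith⟩
  obtain ⟨t, ⟨ht1, ht2⟩, htm⟩ := hK.exists_isGreatest ⟨-ε, hm, by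
    have := (hF _ (hb1 _ (habs _ hm))).2
    rw [hin] at this
    refine this.trans (max_le (by linarith) hyn)⟩
  have hlt : t < 2 * ε := by
    refine lt_of_le_of_ne ht1.2 fun h => ?_
    have := (hF _ (hb1 _ (habs _ ht1))).1
    rw [hin, h] at this
    rw [h] at ht2
    have := le_trans (le_max_left _ _) this
    linarith
  have hgt : ∀ᶠ s in 𝓝[>] t, s ∈ Icc (-ε) (2 * ε) ∧ ⟪e, y⟫ < u (y + s • e) := by
    filter_upwards [self_mem_nhdsWithin, nhdsWithin_le_nhds (gt_mem_nhds hlt)] with s h1 h2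
    have h1 : t < s := h1
    have h3 : s ∈ Icc (-ε) (2 * ε) := ⟨by linarith [ht1.1], h2.le⟩
    refine ⟨h3, not_le.1 fun h => ?_⟩
    exact absurd (htm ⟨h3, h⟩) (not_le.2 h1)
  have hcts : Continuous fun s : ℝ => y + s • e := by fun_prop
  have htt := habs t ht1
  refine ⟨t, htt, hb t htt, ?_, le_antisymm ht2 ?_⟩
  · refine mem_closure_of_tendsto (f := fun s : ℝ => y + s • e) ((hcts.tendsto t).mono_left nhdsWithin_le_nhds) (b := 𝓝[>] t) ?_
    filter_upwards [hgt] with s hs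
    exact lt_of_le_of_lt hyn hs.2
  · have hc : ContinuousAt (fun s : ℝ => u (y + s • e)) t :=
      ContinuousAt.comp (f := fun s : ℝ => y + s • e) (S.cont _ (hb1 t htt)) hcts.continuousAt
    refine ge_of_tendsto (hc.tendsto.mono_left nhdsWithin_le_nhds : Tendsto _ (𝓝[>] t) _) ?_
    filter_upwards [hgt] with s hs using hs.2.le

lemma klip {u : E → ℝ} {G : E → E} {e : E} {δ : ℝ} (he : ‖e‖ = 1) (hδ : 0 ≤ δ) (hδ1 : δ ≤ 1 / 100) (S : Sol u G (ball 0 1))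
    (hG : ∀ x ∈ ball (0:E) (3/4), x ∈ closure {x | 0 < u x} → ‖G x - e‖ ≤ δ) {y y' : E} {t t' : ℝ}
    (h1 : y + t • e ∈ ball (0:E) (3/4)) (h2 : y + t • e ∈ closure {x | 0 < u x}) (h3 : u (y + t • e) = ⟪e, y⟫)
    (h1' : y' + t' • e ∈ ball (0:E) (3/4)) (h3' : u (y' + t' • e) = ⟪e, y'⟫) (hy' : 0 ≤ ⟪e, y'⟫) :
    t' - t ≤ 2 * δ * ‖y' - y‖ := by
  by_contra hcon
  push Not at hcon
  have hn := norm_nonneg (y' - y)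
  have hδn : 0 ≤ δ * ‖y' - y‖ := by positivity
  have htt : 0 < t' - t := by linarith
  set w := (y' - y) + (t' - t) • e with hw
  have hxw : y + t • e + w = y' + t' • e := by rw [hw, sub_smul]; abel
  have hwn : ‖w‖ ≤ ‖y' - y‖ + (t' - t) := by
    refine (norm_add_le _ _).trans ?_
    rw [norm_smul, he, mul_one, Real.norm_of_nonneg htt.le]
  have hwe : ⟪e, w⟫ = ⟪e, y'⟫ - ⟪e, y⟫ + (t' - t) := by
    rw [hw, inner_add_right, inner_smul_right, inner_sub_right, real_inner_self_eq_norm_sq, he]; ring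
  have hδw := mul_le_mul_of_nonneg_left hwn hδ
  have hδt : δ * (t' - t) ≤ 1 / 100 * (t' - t) := mul_le_mul_of_nonneg_right hδ1 htt.le
  have hpos : 0 < (t' - t) - δ * ‖w‖ := by linarith
  have := cone S hG h1 (by rw [hxw]; exact h1') h2 (w := w) (by rw [h3, hwe]; linarith)
  rw [hxw, h3, h3', hwe] at this
  linarith

lemma Cn_of_grad {V : E → ℝ} {X : E → E} {y : E} (n : ℕ) (h : ∀ᶠ z in 𝓝 y, HasGradientAt V (X z) z) (hX : ContDiffAt ℝ n X y) :
    ContDiffAt ℝ (n + 1 : ℕ) V y := by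
  have := (contDiffAt_succ_iff_hasFDerivAt (𝕜 := ℝ) (n := n) (f := V) (x := y)).2
    ⟨fun z => innerSL ℝ (X z), ⟨_, h, fun z hz => hasGradientAt_iff.1 hz⟩, (innerSL ℝ).contDiff.contDiffAt.comp y hX⟩
  exact_mod_cast this

lemma xz_facts {e X Z : E} (he : ‖e‖ = 1) (hZ : ‖Z‖ ≤ 1 / 2) (hX : X = (1 - ⟪e, Z⟫)⁻¹ • Z) :
    1 / 2 ≤ 1 - ⟪e, Z⟫ ∧ X = Z + ⟪e, Z⟫ • X ∧ ‖X‖ ≤ 2 * ‖Z‖ ∧ (1 + ⟪e, X⟫) • Z = X := by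
  have h1 := (le_abs_self _).trans (abs_real_inner_le_norm e Z)
  rw [he, one_mul] at h1
  have h2 : 1 / 2 ≤ 1 - ⟪e, Z⟫ := by linarith
  have h3 : (1 - ⟪e, Z⟫) • X = Z := by rw [hX, smul_smul, mul_inv_cancel₀ (by linarith), one_smul]
  refine ⟨h2, ?_, ?_, ?_⟩
  · rw [sub_smul, one_smul] at h3
    rw [← h3]
    nth_rewrite 1 [h3]
    have : X = Z + ⟪e, Z⟫ • X := by rw [← h3]; simp only [h3]; rw [← sub_eq_iff_eq_add]; exact h3
    rw [h3]; exact this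
  · have h4 : ‖(1 - ⟪e, Z⟫) • X‖ = ‖Z‖ := by rw [h3]
    rw [norm_smul, Real.norm_of_nonneg (by linarith)] at h4
    have := mul_le_mul_of_nonneg_right h2 (norm_nonneg X)
    linarith
  · have : 1 + ⟪e, X⟫ = (1 - ⟪e, Z⟫)⁻¹ := by
      rw [hX, inner_smul_right]; have : 1 - ⟪e, Z⟫ ≠ 0 := by linarith
      field_simp; ring
    rw [this, hX]
end
end OP

namespace OP
open scoped RealInnerProductSpace Topology
open Module

section
variable {E : Type*} [NormedAddCommGroup E] [InnerProductSpace ℝ E] [FiniteDimensional ℝ E]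
  [MeasurableSpace E] [BorelSpace E]

lemma dXZ (e X Z X' Z' : E) (a : X = Z + ⟪e, Z⟫ • X) (b : X' = Z' + ⟪e, Z'⟫ • X') :
    X - X' = (Z - Z') + (⟪e, Z⟫ • (X - X') + ⟪e, Z - Z'⟫ • X') := by
  rw [inner_sub_right, sub_smul, smul_sub]
  have : X - X' = (Z + ⟪e, Z⟫ • X) - (Z' + ⟪e, Z'⟫ • X') := by rw [← a, ← b]
  rw [this]; module

lemma bdz {e Z : E} (he : ‖e‖ = 1) (h : ‖e - Z‖ = 1) : 2 * ⟪e, Z⟫ = ⟪Z, Z⟫ := by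
  have h3 := norm_sub_sq_real e Z
  rw [he, h] at h3
  rw [real_inner_self_eq_norm_sq]; linarith

lemma HodAux {u : E → ℝ} {G : E → E} {e : E} {ε δ γ : ℝ} (he : ‖e‖ = 1) (hγ : 0 < γ) (hγ1 : γ ≤ 1) (hε : 0 < ε) (hεδ : ε ≤ δ)
    (hδ1 : δ ≤ 1 / 100) (S : Sol u G (ball 0 1)) (hF : Flat u e (-ε) ε 0 1)
    (hG : ∀ x ∈ ball (0:E) (3/4), x ∈ closure {x | 0 < u x} → ‖G x - e‖ ≤ δ)
    (hG2 : ∀ x ∈ ball (0:E) (3/4), x ∈ closure {x | 0 < u x} → ∀ y ∈ ball (0:E) (3/4), y ∈ closure {x | 0 < u x} → ‖G x - G y‖ ≤ δ * ‖x - y‖ ^ γ) :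
    ∃ (k : E → ℝ) (X Z : E → E), Hod e (7/10) (4 * δ) γ k X Z ∧ (∀ y, Z y = e - G (y + k y • e)) ∧
      (∀ y ∈ HB e (7/10), y + k y • e ∈ ball (0:E) (3/4) ∧ y + k y • e ∈ closure {x | 0 < u x} ∧ u (y + k y • e) = ⟪e, y⟫) ∧
      ∀ x, ‖x‖ < 7/10 - ε → 0 < u x → x + (u x - ⟪e, x⟫) • e ∈ HB e (7/10) ∧ k (x + (u x - ⟪e, x⟫) • e) = ⟪e, x⟫ - u x := by
  have hδ : 0 < δ := by linarith
  have hee : ⟪e, e⟫ = 1 := by rw [real_inner_self_eq_norm_sq, he]; norm_num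
  have hex : ∀ y, ∃ t : ℝ, y ∈ HB e (7/10) → |t| ≤ 2 * ε ∧ y + t • e ∈ ball (0:E) (3/4) ∧ y + t • e ∈ closure {x | 0 < u x} ∧ u (y + t • e) = ⟪e, y⟫ := by
    intro y
    by_cases hy : y ∈ HB e (7/10)
    · obtain ⟨t, ht⟩ := kex he hε (by linarith) S hF hy
      exact ⟨t, fun _ => ht⟩
    · exact ⟨0, fun h => absurd h hy⟩
  choose k hk using hex
  have hlip1 : ∀ y ∈ HB e (7/10), ∀ z ∈ HB e (7/10), k y - k z ≤ 2 * δ * ‖y - z‖ := by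
    intro y hy z hz
    obtain ⟨-, a1, a2, a3⟩ := hk y hy
    obtain ⟨-, b1, b2, b3⟩ := hk z hz
    exact klip he hδ.le hδ1 S hG b1 b2 b3 a1 a3 hy.2
  have hlip : ∀ y ∈ HB e (7/10), ∀ z ∈ HB e (7/10), |k y - k z| ≤ 2 * δ * ‖y - z‖ := by
    intro y hy z hz
    have := hlip1 z hz y hy
    rw [norm_sub_rev] at this
    exact abs_le.2 ⟨by linarith, hlip1 y hy z hz⟩
  set Sy : E → E := fun y => y + k y • e with hSy
  set Z : E → E := fun y => e - G (Sy y) with hZ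
  set X : E → E := fun y => (1 - ⟪e, Z y⟫)⁻¹ • Z y with hX
  have hSl : ∀ y ∈ HB e (7/10), ∀ z ∈ HB e (7/10), ‖Sy y - Sy z‖ ≤ 2 * ‖y - z‖ := by
    intro y hy z hz
    have h1 : Sy y - Sy z = (y - z) + (k y - k z) • e := by simp only [hSy, sub_smul]; abel
    rw [h1]
    refine (norm_add_le _ _).trans ?_
    rw [norm_smul, he, mul_one, Real.norm_eq_abs]
    have h2 := hlip y hy z hz
    have h3 : 2 * δ * ‖y - z‖ ≤ 1 * ‖y - z‖ := mul_le_mul_of_nonneg_right (by linarith) (norm_nonneg _)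
    linarith
  have hZb : ∀ y ∈ HB e (7/10), ‖Z y‖ ≤ δ := by
    intro y hy
    obtain ⟨-, a1, a2, a3⟩ := hk y hy
    simp only [hZ]; rw [norm_sub_rev]; exact hG _ a1 a2
  have hZh : ∀ y ∈ HB e (7/10), ∀ z ∈ HB e (7/10), ‖Z y - Z z‖ ≤ 2 * δ * ‖y - z‖ ^ γ := by
    intro y hy z hz
    obtain ⟨-, a1, a2, a3⟩ := hk y hy
    obtain ⟨-, b1, b2, b3⟩ := hk z hz
    have h1 : Z y - Z z = G (Sy z) - G (Sy y) := by simp only [hZ]; abel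
    rw [h1]
    refine (hG2 _ b1 b2 _ a1 a2).trans ?_
    have h2 : ‖Sy z - Sy y‖ ^ γ ≤ 2 * ‖y - z‖ ^ γ := by
      rw [norm_sub_rev]
      exact (Real.rpow_le_rpow (norm_nonneg _) (hSl y hy z hz) hγ.le).trans (rp_le one_le_two (norm_nonneg _) hγ1)
    have := mul_le_mul_of_nonneg_left h2 hδ.le
    linarith
  have hfac : ∀ y ∈ HB e (7/10), _ := fun y hy => xz_facts (X := X y) he ((hZb y hy).trans (by linarith)) rfl
  have hXh : ∀ y ∈ HB e (7/10), ∀ z ∈ HB e (7/10), ‖X y - X z‖ ≤ 4 * δ * ‖y - z‖ ^ γ := by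
    intro y hy z hz
    obtain ⟨-, a1, a2, -⟩ := hfac y hy
    obtain ⟨-, b1, b2, -⟩ := hfac z hz
    have h1 : X y - X z = (Z y - Z z) + (⟪e, Z y⟫ • (X y - X z) + ⟪e, Z y - Z z⟫ • X z) := by
      exact dXZ e _ _ _ _ a1 b1
    have h2 : |⟪e, Z y⟫| ≤ δ := (abs_real_inner_le_norm _ _).trans (by rw [he, one_mul]; exact hZb y hy)
    have h3 : |⟪e, Z y - Z z⟫| ≤ ‖Z y - Z z‖ := (abs_real_inner_le_norm _ _).trans (by rw [he, one_mul])
    have h4 : ‖X y - X z‖ ≤ ‖Z y - Z z‖ + (δ * ‖X y - X z‖ + ‖Z y - Z z‖ * (2 * δ)) := by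
      nth_rewrite 1 [h1]
      refine (norm_add_le _ _).trans (add_le_add le_rfl ((norm_add_le _ _).trans (add_le_add ?_ ?_)))
      · rw [norm_smul, Real.norm_eq_abs]; gcongr
      · rw [norm_smul, Real.norm_eq_abs]; gcongr; linarith [hZb z hz]
    have h5 := hZh y hy z hz
    have h6 := mul_le_mul_of_nonneg_right hδ1 (norm_nonneg (X y - X z))
    have h7 := mul_le_mul_of_nonneg_left hδ1 (norm_nonneg (Z y - Z z))
    have h8 : 0 ≤ δ * ‖y - z‖ ^ γ := by positivity
    linarith
  have hnb : ∀ y, ‖y‖ < 7/10 → 0 < ⟪e, y⟫ → ∀ᶠ z in 𝓝 y, ‖z‖ < 7/10 ∧ 0 < ⟪e, z⟫ := fun y h1 h2 =>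
    (continuous_norm.continuousAt.eventually (gt_mem_nhds h1)).and (ev_pos h2)
  have hcX : ∀ y, ‖y‖ < 7/10 → 0 < ⟪e, y⟫ → ContinuousAt X y := by
    intro y h1 h2
    have : Tendsto (fun z => 4 * δ * ‖z - y‖ ^ γ) (𝓝 y) (𝓝 0) := by
      have hc : Continuous fun z : E => 4 * δ * ‖z - y‖ ^ γ :=
        continuous_const.mul ((continuous_id.sub continuous_const).norm.rpow_const fun _ => Or.inr hγ.le)
      have := hc.tendsto y
      simpa [Real.zero_rpow hγ.ne'] using this
    refine tendsto_iff_norm_sub_tendsto_zero.2 (squeeze_zero' (Eventually.of_forall fun _ => norm_nonneg _) ?_ this)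
    filter_upwards [hnb y h1 h2] with z hz
    exact hXh z ⟨hz.1, hz.2.le⟩ y ⟨h1, h2.le⟩
  have hcS : ∀ y, ‖y‖ < 7/10 → 0 < ⟪e, y⟫ → ContinuousAt Sy y := by
    intro y h1 h2
    have : Tendsto (fun z => 2 * ‖z - y‖) (𝓝 y) (𝓝 0) := by
      have hc : Continuous fun z : E => 2 * ‖z - y‖ := by fun_prop
      have := hc.tendsto y
      simpa using this
    refine tendsto_iff_norm_sub_tendsto_zero.2 (squeeze_zero' (Eventually.of_forall fun _ => norm_nonneg _) ?_ this)
    filter_upwards [hnb y h1 h2] with z hz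
    exact hSl z ⟨hz.1, hz.2.le⟩ y ⟨h1, h2.le⟩
  have h34 : ball (0:E) (3/4) ⊆ ball 0 1 := ball_subset_ball (by norm_num)
  have hSpos : ∀ y, ‖y‖ < 7/10 → 0 < ⟪e, y⟫ → Sy y ∈ ball (0:E) 1 ∧ 0 < u (Sy y) := by
    intro y h1 h2
    obtain ⟨-, a1, a2, a3⟩ := hk y ⟨h1, h2.le⟩
    exact ⟨h34 a1, by simp only [hSy]; rw [a3]; exact h2⟩
  have hgrad : ∀ y, ‖y‖ < 7/10 → 0 < ⟪e, y⟫ → HasGradientAt k (X y) y := by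
    intro y h1 h2
    have hyB : y ∈ HB e (7/10) := ⟨h1, h2.le⟩
    obtain ⟨c1, c2, c3, c4⟩ := hfac y hyB
    obtain ⟨p1, p2⟩ := hSpos y h1 h2
    have hu := hasGradientAt_iff.1 (S.grad p1 p2)
    have hT : HasFDerivAt (fun x => x + (u x - ⟪e, x⟫) • e)
        (ContinuousLinearMap.id ℝ E + (innerSL ℝ (G (Sy y)) - innerSL ℝ e).smulRight e) (Sy y) :=
      (hasFDerivAt_id _).add ((hu.sub (innerSL ℝ e).hasFDerivAt).smul_const e)
    have hZG : G (Sy y) = e - Z y := by simp only [hZ]; abel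
    have hXZ : (1 - ⟪e, Z y⟫) • X y = Z y := by
      simp only [hX]; rw [smul_smul, mul_inv_cancel₀ (by linarith), one_smul]
    have hXw : ∀ w, (1 - ⟪e, Z y⟫) * ⟪X y, w⟫ = ⟪Z y, w⟫ := by
      intro w; rw [← real_inner_smul_left, hXZ]
    have hz := real_inner_comm e (Z y)
    let f' : E ≃L[ℝ] E := ContinuousLinearEquiv.equivOfInverse
      (ContinuousLinearMap.id ℝ E + (innerSL ℝ (G (Sy y)) - innerSL ℝ e).smulRight e)
      (ContinuousLinearMap.id ℝ E + (innerSL ℝ (X y)).smulRight e)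
      (by
        intro w
        simp only [hZG, ContinuousLinearMap.add_apply, ContinuousLinearMap.id_apply, ContinuousLinearMap.smulRight_apply,
          ContinuousLinearMap.sub_apply, innerSL_apply_apply, inner_sub_left, inner_add_right, inner_smul_right]
        have hXe := hXw e
        rw [add_assoc, ← add_smul, add_eq_left]
        have : ⟪e, w⟫ - ⟪Z y, w⟫ - ⟪e, w⟫ + (⟪X y, w⟫ + (⟪e, w⟫ - ⟪Z y, w⟫ - ⟪e, w⟫) * ⟪X y, e⟫) = 0 := by
          have h1w := hXw w
          have h3w : (1 - ⟪e, Z y⟫) * (1 + ⟪X y, e⟫) = 1 := by rw [mul_add, hXe, hz]; ring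
          rw [← h1w]
          linear_combination (-⟪X y, w⟫) * h3w
        rw [this, zero_smul])
      (by
        intro w
        simp only [hZG, ContinuousLinearMap.add_apply, ContinuousLinearMap.id_apply, ContinuousLinearMap.smulRight_apply,
          ContinuousLinearMap.sub_apply, innerSL_apply_apply, inner_sub_left, inner_add_right, inner_smul_right, hee]
        rw [add_assoc, ← add_smul, add_eq_left]
        have : ⟪X y, w⟫ + (⟪e, w⟫ - ⟪Z y, w⟫ + ⟪X y, w⟫ * (1 - ⟪Z y, e⟫) - (⟪e, w⟫ + ⟪X y, w⟫ * 1)) = 0 := by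
          rw [← hXw w, ← hz]; ring
        rw [this, zero_smul])
    have hT' : HasFDerivAt (fun x => x + (u x - ⟪e, x⟫) • e) (f' : E →L[ℝ] E) (Sy y) := hT
    have hinv := HasFDerivAt.of_local_left_inverse (hcS y h1 h2) hT' (by
      filter_upwards [hnb y h1 h2] with z hz
      obtain ⟨-, -, -, a3⟩ := hk z ⟨hz.1, hz.2.le⟩
      simp only [hSy]
      rw [a3, inner_add_right, inner_smul_right, hee, add_assoc, ← add_smul]
      simp)
    have hk' : k = fun z => ⟪e, Sy z - z⟫ := by
      funext z; simp only [hSy]; rw [add_sub_cancel_left, inner_smul_right, hee, mul_one]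
    rw [hasGradientAt_iff, hk']
    refine ((innerSL ℝ e).hasFDerivAt.comp y (hinv.sub (hasFDerivAt_id y))).congr_fderiv ?_
    ext w
    have : f'.symm w = w + ⟪X y, w⟫ • e := rfl
    simp only [ContinuousLinearMap.comp_apply, ContinuousLinearMap.sub_apply, ContinuousLinearEquiv.coe_coe, this,
      ContinuousLinearMap.id_apply, add_sub_cancel_left, innerSL_apply_apply, inner_smul_right, hee, mul_one]
  have hGs : ∀ y, ‖y‖ < 7/10 → 0 < ⟪e, y⟫ → ContDiffAt ℝ (⊤ : ℕ∞) G (Sy y) := fun y h1 h2 =>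
    S.harm.smooth (hSpos y h1 h2)
  have hstep : ∀ (n : ℕ) y, n ≤ 1 → ‖y‖ < 7/10 → 0 < ⟪e, y⟫ → ContDiffAt ℝ n X y →
      ContDiffAt ℝ (n + 1 : ℕ) X y ∧ ContDiffAt ℝ (n + 1 : ℕ) Z y := by
    intro n y hn h1 h2 hXn
    have hkn : ContDiffAt ℝ (n + 1 : ℕ) k y := Cn_of_grad n ((hnb y h1 h2).mono fun z hz => hgrad z hz.1 hz.2) hXn
    have hSn : ContDiffAt ℝ (n + 1 : ℕ) Sy y := contDiffAt_id.add (hkn.smul contDiffAt_const)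
    have hGn : ContDiffAt ℝ (n + 1 : ℕ) G (Sy y) := (hGs y h1 h2).of_le (by exact_mod_cast le_top)
    have hZn : ContDiffAt ℝ (n + 1 : ℕ) Z y := contDiffAt_const.sub (hGn.comp y hSn)
    refine ⟨?_, hZn⟩
    have := (hfac y ⟨h1, h2.le⟩).1
    exact ((contDiffAt_const.sub (contDiffAt_const.inner ℝ hZn)).inv (by linarith)).smul hZn
  have hX0 : ∀ y, ‖y‖ < 7/10 → 0 < ⟪e, y⟫ → ContDiffAt ℝ (0 : ℕ) X y := by
    intro y h1 h2
    exact contDiffAt_zero.2 ⟨_, hnb y h1 h2, fun z hz => (hcX z hz.1 hz.2).continuousWithinAt⟩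
  refine ⟨k, X, Z, ⟨?_, ?_, ?_, ?_, hgrad, ?_, ?_, ?_⟩, fun y => rfl, fun y hy => (hk y hy).2, ?_⟩
  · intro y hy z hz
    refine (hlip y hy z hz).trans ?_
    gcongr; linarith
  · exact fun y hy => (hfac y hy).2.1
  · refine ⟨fun y hy => ?_, hXh⟩
    have := (hfac y hy).2.2.1
    linarith [hZb y hy]
  · refine ⟨fun y hy => by linarith [hZb y hy], fun y hy z hz => (hZh y hy z hz).trans ?_⟩
    gcongr; linarith
  · intro y h1 h2
    exact_mod_cast hstep 1 y le_rfl h1 h2 (by exact_mod_cast (hstep 0 y zero_le_one h1 h2 (hX0 y h1 h2)).1)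
  · intro y h1 h2
    obtain ⟨c1, c2, c3, c4⟩ := hfac y ⟨h1, h2.le⟩
    have hAd : HasFDerivAt G (fderiv ℝ G (Sy y)) (Sy y) := ((hGs y h1 h2).differentiableAt (by simp)).hasFDerivAt
    set A := fderiv ℝ G (Sy y) with hA
    have hSd : HasFDerivAt Sy (ContinuousLinearMap.id ℝ E + (innerSL ℝ (X y)).smulRight e) y :=
      (hasFDerivAt_id _).add ((hasGradientAt_iff.1 (hgrad y h1 h2)).smul_const e)
    have hZd : HasFDerivAt Z (-(A.comp (ContinuousLinearMap.id ℝ E + (innerSL ℝ (X y)).smulRight e))) y :=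
      (hAd.comp y hSd).const_sub e
    set L := -(A.comp (ContinuousLinearMap.id ℝ E + (innerSL ℝ (X y)).smulRight e)) with hL
    have hFd : HasFDerivAt (fun y => (2:ℝ) • Z y - ⟪Z y, Z y⟫ • e)
        ((2:ℝ) • L - ((2:ℝ) • (innerSL ℝ (Z y)).comp L).smulRight e) y := by
      refine (hZd.const_smul (2:ℝ)).sub (HasFDerivAt.smul_const ?_ e)
      refine (hZd.inner ℝ hZd).congr_fderiv ?_
      ext w
      simp [real_inner_comm, two_mul]
    rw [hFd.fderiv, tr_sub, tr_smul, tr_smulRight]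
    have e1 : L = -(A + (innerSL ℝ (X y)).smulRight (A e)) := by
      rw [hL]; ext w; simp
    have e2 : L e = -((1 + ⟪e, X y⟫) • A e) := by
      rw [e1]
      simp [add_smul, real_inner_comm]
    have trA : tr A = 0 := S.harm.tr_eq (hSpos y h1 h2)
    rw [ContinuousLinearMap.smul_apply, ContinuousLinearMap.comp_apply, innerSL_apply_apply, e2, e1, tr_neg, tr_add, tr_smulRight,
      trA, inner_neg_right, inner_smul_right, ← real_inner_smul_left, c4, innerSL_apply_apply]
    simp
  · intro y h1 h2
    have hyB : y ∈ HB e (7/10) := ⟨h1, h2.ge⟩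
    obtain ⟨-, a1, a2, a3⟩ := hk y hyB
    have hn := S.norm1 (Sy y) (h34 a1) a2 (by simp only [hSy]; rw [a3, h2])
    exact bdz he (by rw [show e - Z y = G (Sy y) by simp only [hZ]; abel, hn])
  · intro x hx hux
    have hx1 : x ∈ ball (0:E) 1 := by rw [mem_ball_zero_iff]; linarith
    obtain ⟨f1, f2⟩ := hF x hx1
    have g1 := (le_max_left _ _).trans f1
    have g2 : u x ≤ ⟪e, x⟫ + ε := by
      rcases le_max_iff.1 f2 with h | h
      · exact h
      · linarith
    have hab : |u x - ⟪e, x⟫| ≤ ε := abs_le.2 ⟨by linarith, by linarith⟩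
    have hinn : ⟪e, x + (u x - ⟪e, x⟫) • e⟫ = u x := by rw [inner_add_right, inner_smul_right, hee]; ring
    have hB : x + (u x - ⟪e, x⟫) • e ∈ HB e (7/10) := by
      refine ⟨?_, by rw [hinn]; exact hux.le⟩
      have := norm_add_le x ((u x - ⟪e, x⟫) • e)
      rw [norm_smul, he, mul_one, Real.norm_eq_abs] at this
      linarith
    refine ⟨hB, ?_⟩
    set y := x + (u x - ⟪e, x⟫) • e with hy
    obtain ⟨-, a1, a2, a3⟩ := hk y hB
    have hyx : y + (⟪e, x⟫ - u x) • e = x := by rw [hy, add_assoc, ← add_smul]; simp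
    have hx34 : y + (⟪e, x⟫ - u x) • e ∈ ball (0:E) (3/4) := by rw [hyx, mem_ball_zero_iff]; linarith
    have hxc : y + (⟪e, x⟫ - u x) • e ∈ closure {x | 0 < u x} := by rw [hyx]; exact subset_closure hux
    have hxu : u (y + (⟪e, x⟫ - u x) • e) = ⟪e, y⟫ := by rw [hyx, hinn]
    have q1 := klip he hδ.le hδ1 S hG a1 a2 a3 hx34 hxu hB.2
    have q2 := klip he hδ.le hδ1 S hG hx34 hxc hxu a1 a3 hB.2
    rw [sub_self, norm_zero, mul_zero] at q1 q2
    linarith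
end
end OP

namespace OP
open scoped RealInnerProductSpace Topology
open Module

section
variable {E : Type*} [NormedAddCommGroup E] [InnerProductSpace ℝ E] [FiniteDimensional ℝ E]
  [MeasurableSpace E] [BorelSpace E]

section
variable {W W₁ W₂ : Type*} [NormedAddCommGroup W] [NormedAddCommGroup W₁] [NormedAddCommGroup W₂]

lemma Nb.mono {γ m m' : ℝ} {f : E → W} {S T : Set E} (h : Nb γ f S m) (hT : T ⊆ S) (hm : m ≤ m') : Nb γ f T m' :=
  ⟨fun y hy => (h.1 y (hT hy)).trans hm, h.2.mono hT hm⟩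
lemma Nb.congr {γ m : ℝ} {f g : E → W} {S : Set E} (h : Nb γ f S m) (hfg : ∀ y ∈ S, g y = f y) : Nb γ g S m :=
  ⟨fun y hy => by rw [hfg y hy]; exact h.1 y hy, fun x hx y hy => by rw [hfg x hx, hfg y hy]; exact h.2 x hx y hy⟩
lemma Nb.add {γ m m' : ℝ} {f g : E → W} {S : Set E} (h : Nb γ f S m) (h' : Nb γ g S m') : Nb γ (fun y => f y + g y) S (m + m') := by
  refine ⟨fun y hy => (norm_add_le _ _).trans (add_le_add (h.1 y hy) (h'.1 y hy)), fun x hx y hy => ?_⟩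
  rw [add_sub_add_comm, add_mul]
  exact (norm_add_le _ _).trans (add_le_add (h.2 x hx y hy) (h'.2 x hx y hy))
lemma Nb.sub {γ m m' : ℝ} {f g : E → W} {S : Set E} (h : Nb γ f S m) (h' : Nb γ g S m') : Nb γ (fun y => f y - g y) S (m + m') := by
  refine ⟨fun y hy => (norm_sub_le _ _).trans (add_le_add (h.1 y hy) (h'.1 y hy)), fun x hx y hy => ?_⟩
  rw [sub_sub_sub_comm, add_mul]
  exact (norm_sub_le _ _).trans (add_le_add (h.2 x hx y hy) (h'.2 x hx y hy))
lemma Nb.zero {γ : ℝ} {S : Set E} {m : ℝ} (hm : 0 ≤ m) : Nb γ (fun _ : E => (0 : W)) S m :=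
  ⟨fun y _ => by rw [norm_zero]; exact hm, fun x _ y _ => by rw [sub_self, norm_zero]; positivity⟩

/-- bounded biadditive maps -/
def Bil (β : W₁ → W₂ → W) : Prop := (∀ a a' b, β (a - a') b = β a b - β a' b) ∧ (∀ a b b', β a (b - b') = β a b - β a b') ∧
  ∀ a b, ‖β a b‖ ≤ ‖a‖ * ‖b‖

lemma Nb.bil {β : W₁ → W₂ → W} (hβ : Bil β) {γ m m' : ℝ} {f : E → W₁} {g : E → W₂} {S : Set E} (hm : 0 ≤ m) (hm' : 0 ≤ m')
    (h : Nb γ f S m) (h' : Nb γ g S m') : Nb γ (fun y => β (f y) (g y)) S (2 * (m * m')) := by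
  have h0 : 0 ≤ m * m' := by positivity
  refine ⟨fun y hy => ?_, fun x hx y hy => ?_⟩
  · have := (hβ.2.2 (f y) (g y)).trans (mul_le_mul (h.1 y hy) (h'.1 y hy) (norm_nonneg _) hm)
    linarith
  · have e1 : β (f x) (g x) - β (f y) (g y) = β (f x - f y) (g x) + β (f y) (g x - g y) := by
      rw [hβ.1, hβ.2.1]; abel
    rw [e1]
    have t0 : 0 ≤ ‖x - y‖ ^ γ := by positivity
    have a1 := (hβ.2.2 (f x - f y) (g x)).trans (mul_le_mul (h.2 x hx y hy) (h'.1 x hx) (norm_nonneg _) (by positivity))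
    have a2 := (hβ.2.2 (f y) (g x - g y)).trans (mul_le_mul (h.1 y hy) (h'.2 x hx y hy) (norm_nonneg _) hm)
    refine (norm_add_le _ _).trans ((add_le_add a1 a2).trans (le_of_eq (by ring)))

lemma Nb.absorb {γ c m0 : ℝ} {f : E → W} {S : Set E} (hc : 0 ≤ c) (hm : 0 ≤ m0) (h0 : Nb γ f S m0)
    (h : ∀ m, 0 ≤ m → Nb γ f S m → Nb γ f S (c + m / 2)) : Nb γ f S (2 * c) := by
  have hk : ∀ k : ℕ, Nb γ f S (2 * c + m0 * (1 / 2) ^ k) := by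
    intro k
    induction k with
    | zero => exact h0.mono subset_rfl (by rw [pow_zero]; linarith)
    | succ k ih =>
      refine (h _ (by positivity) ih).mono subset_rfl (le_of_eq ?_)
      rw [pow_succ]; ring
  have hl : Tendsto (fun k : ℕ => 2 * c + m0 * (1 / 2 : ℝ) ^ k) atTop (𝓝 (2 * c + m0 * 0)) :=
    ((_root_.tendsto_pow_atTop_nhds_zero_of_lt_one (by norm_num) (by norm_num)).const_mul m0).const_add _
  rw [mul_zero, add_zero] at hl
  exact ⟨fun y hy => ge_of_tendsto' hl fun k => (hk k).1 y hy,
    fun x hx y hy => ge_of_tendsto' (hl.mul_const _) fun k => (hk k).2 x hx y hy⟩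

/-- second difference -/
def sd (a b c d : W) : W := a - b - c + d

lemma sd_bil {β : W₁ → W₂ → W} (hβ : Bil β) (a b c d : W₁) (a' b' c' d' : W₂) : sd (β a a') (β b b') (β c c') (β d d') =
    (β (sd a b c d) a' + β (b - d) (a' - b')) + (β (c - d) (a' - c') + β d (sd a' b' c' d')) := by
  have e1 : sd a b c d = (a - b) - (c - d) := by simp only [sd]; abel
  have e2 : sd a' b' c' d' = (a' - b') - (c' - d') := by simp only [sd]; abel
  rw [e1, e2]
  simp only [hβ.1, hβ.2.1, sd]; abel

lemma Nb.sd_bil {β : W₁ → W₂ → W} (hβ : Bil β) {γ : ℝ} {S : Set E} {f11 f10 f01 f00 : E → W₁} {g11 g10 g01 g00 : E → W₂} {y m a b y' m' a' b' : ℝ}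
    (hy : 0 ≤ y) (hm : 0 ≤ m) (ha : 0 ≤ a) (hb : 0 ≤ b) (hy' : 0 ≤ y') (hm' : 0 ≤ m') (ha' : 0 ≤ a') (hb' : 0 ≤ b')
    (h1 : Nb γ (fun z => sd (f11 z) (f10 z) (f01 z) (f00 z)) S y) (h2 : Nb γ f00 S m) (h3 : Nb γ (fun z => f10 z - f00 z) S a)
    (h4 : Nb γ (fun z => f01 z - f00 z) S b) (h1' : Nb γ (fun z => sd (g11 z) (g10 z) (g01 z) (g00 z)) S y') (h2' : Nb γ g11 S m')
    (h3' : Nb γ (fun z => g11 z - g01 z) S a') (h4' : Nb γ (fun z => g11 z - g10 z) S b') :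
    Nb γ (fun z => sd (β (f11 z) (g11 z)) (β (f10 z) (g10 z)) (β (f01 z) (g01 z)) (β (f00 z) (g00 z))) S
      (2 * (y * m') + 2 * (a * b') + (2 * (b * a') + 2 * (m * y'))) :=
  (((h1.bil hβ hy hm' h2').add (h3.bil hβ ha hb' h4')).add ((h4.bil hβ hb ha' h3').add (h2.bil hβ hm hy' h1'))).congr
    fun z _ => OP.sd_bil hβ _ _ _ _ _ _ _ _
end

lemma bil1 {e : E} (he : ‖e‖ = 1) : Bil (fun a b : E => ⟪e, a⟫ • b) := by
  refine ⟨fun a a' b => ?_, fun a b b' => smul_sub _ _ _, fun a b => ?_⟩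
  · simp only [inner_sub_right, sub_smul]
  · rw [norm_smul, Real.norm_eq_abs]
    gcongr
    have := abs_real_inner_le_norm e a
    rwa [he, one_mul] at this

lemma bil2 {e : E} (he : ‖e‖ = 1) : Bil (fun a b : E => ⟪a, b⟫ • e) := by
  refine ⟨fun a a' b => ?_, fun a b b' => ?_, fun a b => ?_⟩
  · simp only [inner_sub_left, sub_smul]
  · simp only [inner_sub_right, sub_smul]
  · rw [norm_smul, Real.norm_eq_abs, he, mul_one]; exact abs_real_inner_le_norm a b

lemma dZ {e : E} (he : ‖e‖ = 1) {γ δ a : ℝ} (hδ : 0 ≤ δ) (hδ1 : δ ≤ 1 / 100) (ha : 0 ≤ a) {S : Set E} {X Z X' Z' : E → E}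
    (h : ∀ y ∈ S, X y = Z y + ⟪e, Z y⟫ • X y) (h' : ∀ y ∈ S, X' y = Z' y + ⟪e, Z' y⟫ • X' y)
    (hX : Nb γ X S δ) (hZ : Nb γ Z S δ) (hZ' : Nb γ Z' S δ) (hd : Nb γ (fun y => X y - X' y) S a) :
    Nb γ (fun y => Z y - Z' y) S (3 * a) := by
  refine (Nb.absorb (c := 3 / 2 * a) (by positivity) (by linarith : 0 ≤ δ + δ) (hZ.sub hZ') fun m hm hN => ?_).mono subset_rfl (by linarith)
  refine (((hd.sub (hN.bil (bil1 he) hm hδ hX)).sub (hZ'.bil (bil1 he) hδ ha hd)).mono subset_rfl ?_).congr fun y hy => ?_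
  · have := mul_le_mul_of_nonneg_left hδ1 hm
    have := mul_le_mul_of_nonneg_right hδ1 ha
    linarith
  · simp only [inner_sub_right, sub_smul, smul_sub]
    have e1 : Z y = X y - ⟪e, Z y⟫ • X y := eq_sub_of_add_eq (h y hy).symm
    have e2 : Z' y = X' y - ⟪e, Z' y⟫ • X' y := eq_sub_of_add_eq (h' y hy).symm
    have : Z y - Z' y = (X y - ⟪e, Z y⟫ • X y) - (X' y - ⟪e, Z' y⟫ • X' y) := by rw [← e1, ← e2]
    rw [this]; abel

lemma pert {e : E} (he : ‖e‖ = 1) {γ δ A B Y : ℝ} (hδ : 0 ≤ δ) (hδ1 : δ ≤ 1 / 100) (hA : 0 ≤ A) (hB : 0 ≤ B) (hY : 0 ≤ Y) {S : Set E}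
    {X11 X10 X01 X00 Z11 Z10 Z01 Z00 : E → E}
    (h11 : ∀ y ∈ S, X11 y = Z11 y + ⟪e, Z11 y⟫ • X11 y) (h10 : ∀ y ∈ S, X10 y = Z10 y + ⟪e, Z10 y⟫ • X10 y)
    (h01 : ∀ y ∈ S, X01 y = Z01 y + ⟪e, Z01 y⟫ • X01 y) (h00 : ∀ y ∈ S, X00 y = Z00 y + ⟪e, Z00 y⟫ • X00 y)
    (hX11 : Nb γ X11 S δ) (hX10 : Nb γ X10 S δ) (hX01 : Nb γ X01 S δ)
    (hZ11 : Nb γ Z11 S δ) (hZ10 : Nb γ Z10 S δ) (hZ01 : Nb γ Z01 S δ) (hZ00 : Nb γ Z00 S δ)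
    (hA0 : Nb γ (fun y => X10 y - X00 y) S A) (hA1 : Nb γ (fun y => X11 y - X01 y) S A)
    (hB0 : Nb γ (fun y => X01 y - X00 y) S B) (hB1 : Nb γ (fun y => X11 y - X10 y) S B)
    (hYY : Nb γ (fun y => sd (X11 y) (X10 y) (X01 y) (X00 y)) S Y) :
    Nb γ (fun y => sd ((2:ℝ) • Z11 y - ⟪Z11 y, Z11 y⟫ • e) ((2:ℝ) • Z10 y - ⟪Z10 y, Z10 y⟫ • e) ((2:ℝ) • Z01 y - ⟪Z01 y, Z01 y⟫ • e)
      ((2:ℝ) • Z00 y - ⟪Z00 y, Z00 y⟫ • e) - (2:ℝ) • sd (X11 y) (X10 y) (X01 y) (X00 y)) S (30 * (δ * Y) + 70 * (A * B)) ∧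
    Nb γ (fun y => sd (Z11 y) (Z10 y) (Z01 y) (Z00 y)) S (3 * Y + 25 * (A * B)) := by
  have hAB : 0 ≤ A * B := by positivity
  have hδY : 0 ≤ δ * Y := by positivity
  have s1 := mul_le_mul_of_nonneg_right hδ1 hAB
  have s2 := mul_le_mul_of_nonneg_right hδ1 hY
  have zA0 := dZ he hδ hδ1 hA h10 h00 hX10 hZ10 hZ00 hA0
  have zA1 := dZ he hδ hδ1 hA h11 h01 hX11 hZ11 hZ01 hA1
  have zB0 := dZ he hδ hδ1 hB h01 h00 hX01 hZ01 hZ00 hB0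
  have zB1 := dZ he hδ hδ1 hB h11 h10 hX11 hZ11 hZ10 hB1
  have e3 : ∀ X Z : E → E, (∀ y ∈ S, X y = Z y + ⟪e, Z y⟫ • X y) → ∀ y ∈ S, Z y = X y - ⟪e, Z y⟫ • X y := fun X Z h y hy => eq_sub_of_add_eq (h y hy).symm
  have zY : Nb γ (fun y => sd (Z11 y) (Z10 y) (Z01 y) (Z00 y)) S (3 * Y + 25 * (A * B)) := by
    refine (Nb.absorb (c := 3 / 2 * Y + 12.5 * (A * B)) (by positivity) (by positivity : 0 ≤ (δ + δ) + δ + δ)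
      (((hZ11.sub hZ10).sub hZ01).add hZ00) fun m hm hN => ?_).mono subset_rfl (by linarith)
    have hq := Nb.sd_bil (bil1 he) hm hδ (by positivity) (by positivity) hY hδ hA hB hN hZ00 zA0 zB0 hYY hX11 hA1 hB1
    refine ((hYY.sub hq).mono subset_rfl ?_).congr fun y hy => ?_
    · have := mul_le_mul_of_nonneg_left hδ1 hm
      linarith
    · have a1 := e3 _ _ h11 y hy
      have a2 := e3 _ _ h10 y hy
      have a3 := e3 _ _ h01 y hy
      have a4 := e3 _ _ h00 y hy
      have : sd (Z11 y) (Z10 y) (Z01 y) (Z00 y) = sd (X11 y - ⟪e, Z11 y⟫ • X11 y) (X10 y - ⟪e, Z10 y⟫ • X10 y) (X01 y - ⟪e, Z01 y⟫ • X01 y) (X00 y - ⟪e, Z00 y⟫ • X00 y) := by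
        rw [← a1, ← a2, ← a3, ← a4]
      refine this.trans ?_
      simp only [sd]; abel
  refine ⟨?_, zY⟩
  have hy0 : 0 ≤ 3 * Y + 25 * (A * B) := by positivity
  have q1 := Nb.sd_bil (bil1 he) hy0 hδ (by positivity) (by positivity) hY hδ hA hB zY hZ00 zA0 zB0 hYY hX11 hA1 hB1
  have q2 := Nb.sd_bil (bil2 he) hy0 hδ (by positivity) (by positivity) hy0 hδ (by positivity) (by positivity) zY hZ00 zA0 zB0 zY hZ11 zA1 zB1
  refine (((Nb.zero le_rfl).sub ((q1.add q1).add q2)).mono subset_rfl ?_).congr fun y hy => ?_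
  · linarith
  · have a1 := e3 _ _ h11 y hy
    have a2 := e3 _ _ h10 y hy
    have a3 := e3 _ _ h01 y hy
    have a4 := e3 _ _ h00 y hy
    have : sd ((2:ℝ) • Z11 y - ⟪Z11 y, Z11 y⟫ • e) ((2:ℝ) • Z10 y - ⟪Z10 y, Z10 y⟫ • e) ((2:ℝ) • Z01 y - ⟪Z01 y, Z01 y⟫ • e)
        ((2:ℝ) • Z00 y - ⟪Z00 y, Z00 y⟫ • e) = sd ((2:ℝ) • (X11 y - ⟪e, Z11 y⟫ • X11 y) - ⟪Z11 y, Z11 y⟫ • e) ((2:ℝ) • (X10 y - ⟪e, Z10 y⟫ • X10 y) - ⟪Z10 y, Z10 y⟫ • e)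
        ((2:ℝ) • (X01 y - ⟪e, Z01 y⟫ • X01 y) - ⟪Z01 y, Z01 y⟫ • e) ((2:ℝ) • (X00 y - ⟪e, Z00 y⟫ • X00 y) - ⟪Z00 y, Z00 y⟫ • e) := by
      rw [← a1, ← a2, ← a3, ← a4]
    refine (congrArg (· - _) this).trans ?_
    simp only [sd]; module

lemma toLS {e : E} (he : ‖e‖ = 1) {r R : ℝ} (hr : 0 < r) (hrR : r < R) {V : E → ℝ} {X F : E → E} (hV : ContinuousOn V (HB e R))
    (hX : ContinuousOn X (HB e R)) (hF : ContinuousOn F (HB e R)) (hg : ∀ y, ‖y‖ < R → 0 < ⟪e, y⟫ → HasGradientAt V (X y) y)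
    (hd : ∀ y, ‖y‖ < R → 0 < ⟪e, y⟫ → ContDiffAt ℝ 1 F y ∧ tr (fderiv ℝ F y) = 0) (hb : ∀ y, ‖y‖ < R → ⟪e, y⟫ = 0 → ⟪e, F y⟫ = 0) :
    ∃ ρ : E → E, (∀ y ∈ HB e r, ρ y = y) ∧ LS e r (fun y => V (ρ y)) (fun y => X (ρ y)) (fun y => F (ρ y)) := by
  set pj : E → E := fun y => (r / max r ‖y‖) • y with hpj
  have hmx : ∀ y : E, 0 < max r ‖y‖ := fun y => lt_max_of_lt_left hr
  have hpc : Continuous pj := (continuous_const.div (continuous_const.max continuous_norm) fun y => (hmx y).ne').smul continuous_id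
  have hpn : ∀ y, ‖pj y‖ ≤ r := by
    intro y
    simp only [hpj]
    rw [norm_smul, Real.norm_of_nonneg (div_nonneg hr.le (hmx y).le), div_mul_eq_mul_div, div_le_iff₀ (hmx y)]
    gcongr; exact le_max_right _ _
  have hρc : Continuous fun y => fd e (pj y) := (fd_cont e).comp hpc
  have hρm : ∀ y, fd e (pj y) ∈ HB e R := fun y => ⟨by rw [fd_norm he]; exact (hpn y).trans_lt hrR, by rw [fd_inner he]; exact abs_nonneg _⟩
  have hid : ∀ y ∈ HB e r, fd e (pj y) = y := by
    intro y hy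
    have : pj y = y := by simp only [hpj]; rw [max_eq_left hy.1.le, div_self hr.ne', one_smul]
    rw [this, fd_pos hy.2]
  have hev : ∀ y, ‖y‖ < r → 0 < ⟪e, y⟫ → ∀ᶠ z in 𝓝 y, fd e (pj z) = z := fun y h1 h2 => by
    filter_upwards [continuous_norm.continuousAt.eventually (gt_mem_nhds h1), ev_pos h2] with z a b
    exact hid z ⟨a, b.le⟩
  refine ⟨fun y => fd e (pj y), hid, hV.comp_continuous hρc hρm, hX.comp_continuous hρc hρm, hF.comp_continuous hρc hρm, ?_, ?_, ?_⟩
  · intro y h1 h2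
    have h3 := (hev y h1 h2)
    show HasGradientAt (fun y => V (fd e (pj y))) (X (fd e (pj y))) y
    rw [h3.self_of_nhds]
    exact (hg y (by linarith) h2).congr_of_eventuallyEq (h3.mono fun z hz => by simp only [hz])
  · intro y h1 h2
    have h3 : (fun y => F (fd e (pj y))) =ᶠ[𝓝 y] F := (hev y h1 h2).mono fun z hz => by simp only [hz]
    obtain ⟨d1, d2⟩ := hd y (by linarith) h2
    exact ⟨d1.congr_of_eventuallyEq h3, by rw [h3.fderiv_eq]; exact d2⟩
  · intro y h1
    refine hb _ (by rw [fd_norm he]; exact (hpn y).trans_lt hrR) ?_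
    rw [fd_inner he]; simp only [hpj]; rw [inner_smul_right, h1, mul_zero, abs_zero]

lemma Ho.cont {W : Type*} [NormedAddCommGroup W] {γ N : ℝ} (hγ : 0 < γ) {f : E → W} {S : Set E} (h : Ho γ f S N) : ContinuousOn f S := by
  intro x hx
  have hl : Tendsto (fun z => N * ‖z - x‖ ^ γ) (𝓝[S] x) (𝓝 0) := by
    have hc : Continuous fun z : E => N * ‖z - x‖ ^ γ :=
      continuous_const.mul ((continuous_id.sub continuous_const).norm.rpow_const fun _ => Or.inr hγ.le)
    have := (hc.tendsto x).mono_left (nhdsWithin_le_nhds (s := S))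
    simpa [Real.zero_rpow hγ.ne'] using this
  refine tendsto_iff_norm_sub_tendsto_zero.2 (squeeze_zero' (Eventually.of_forall fun _ => norm_nonneg _) ?_ hl)
  filter_upwards [self_mem_nhdsWithin] with z hz using h z hz x hx

lemma Hod.kcont {e : E} {R δ γ : ℝ} {k : E → ℝ} {X Z : E → E} (H : Hod e R δ γ k X Z) : ContinuousOn k (HB e R) := by
  intro x hx
  have hl : Tendsto (fun z => δ * ‖z - x‖) (𝓝[HB e R] x) (𝓝 0) := by
    have hc : Continuous fun z : E => δ * ‖z - x‖ := by fun_prop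
    have := (hc.tendsto x).mono_left (nhdsWithin_le_nhds (s := HB e R))
    simpa using this
  refine tendsto_iff_norm_sub_tendsto_zero.2 (squeeze_zero' (Eventually.of_forall fun _ => norm_nonneg _) ?_ hl)
  filter_upwards [self_mem_nhdsWithin] with z hz using H.lip z hz x hx
end
end OP

namespace OP
open scoped RealInnerProductSpace Topology
open Module

section
variable {E : Type*} [NormedAddCommGroup E] [InnerProductSpace ℝ E] [FiniteDimensional ℝ E]
  [MeasurableSpace E] [BorelSpace E]

/-- nonlinear flux -/
def fl (e z : E) : E := (2:ℝ) • z - ⟪z, z⟫ • e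

lemma fl_cd {e : E} {Z : E → E} {y : E} (h : ContDiffAt ℝ 2 Z y) : ContDiffAt ℝ 1 (fun y => fl e (Z y)) y := by
  have h1 : ContDiffAt ℝ 1 Z y := h.of_le (by norm_num)
  exact (h1.const_smul (2:ℝ)).sub ((h1.inner ℝ h1).smul contDiffAt_const)

lemma Hod.mono {e : E} {R R' δ γ : ℝ} {k : E → ℝ} {X Z : E → E} (H : Hod e R δ γ k X Z) (h : R' ≤ R) : Hod e R' δ γ k X Z :=
  ⟨fun y hy z hz => H.lip y (HB_mono h hy) z (HB_mono h hz), fun y hy => H.eq y (HB_mono h hy), H.xb.mono (HB_mono h) le_rfl,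
    H.zb.mono (HB_mono h) le_rfl, fun y hy => H.grad y (hy.trans_le h), fun y hy => H.sm y (hy.trans_le h),
    fun y hy => H.div y (hy.trans_le h), fun y hy => H.bd y (hy.trans_le h)⟩

lemma Hod.zero (e : E) (R γ : ℝ) {δ : ℝ} (hδ : 0 ≤ δ) : Hod e R δ γ (fun _ => 0) (fun _ => 0) (fun _ => 0) := by
  refine ⟨fun y _ z _ => ?_, fun y _ => ?_, Nb.zero hδ, Nb.zero hδ, fun y _ _ => ?_, fun y _ _ => ⟨contDiffAt_const, contDiffAt_const⟩,
    fun y _ _ => ?_, fun y _ _ => ?_⟩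
  · rw [sub_self, abs_zero]; positivity
  · simp
  · rw [hasGradientAt_iff, map_zero]; exact hasFDerivAt_const _ _
  · simp [tr_zero]
  · simp

lemma HB_shift {e h y : E} (hh : ⟪e, h⟫ = 0) {R R' : ℝ} (hR : R' + ‖h‖ ≤ R) (hy : y ∈ HB e R') : y + h ∈ HB e R :=
  ⟨by have := norm_add_le y h; have := hy.1; linarith, by rw [inner_add_right, hh, add_zero]; exact hy.2⟩

lemma Nb.shift {W : Type*} [NormedAddCommGroup W] {e h : E} (hh : ⟪e, h⟫ = 0) {γ m R R' : ℝ} (hR : R' + ‖h‖ ≤ R) {f : E → W}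
    (H : Nb γ f (HB e R) m) : Nb γ (fun y => f (y + h)) (HB e R') m :=
  ⟨fun y hy => H.1 _ (HB_shift hh hR hy), fun y hy z hz => by
    have := H.2 _ (HB_shift hh hR hy) _ (HB_shift hh hR hz); rwa [add_sub_add_right_eq_sub] at this⟩

lemma Hod.shift {e h : E} (hh : ⟪e, h⟫ = 0) {R R' δ γ : ℝ} (hR : R' + ‖h‖ ≤ R) {k : E → ℝ} {X Z : E → E} (H : Hod e R δ γ k X Z) :
    Hod e R' δ γ (fun y => k (y + h)) (fun y => X (y + h)) (fun y => Z (y + h)) := by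
  have hi : ∀ y, ⟪e, y + h⟫ = ⟪e, y⟫ := fun y => by rw [inner_add_right, hh, add_zero]
  have hn : ∀ y, ‖y‖ < R' → ‖y + h‖ < R := fun y hy => by have := norm_add_le y h; linarith
  refine ⟨fun y hy z hz => ?_, fun y hy => H.eq _ (HB_shift hh hR hy), H.xb.shift hh hR, H.zb.shift hh hR, fun y h1 h2 => ?_,
    fun y h1 h2 => ?_, fun y h1 h2 => ?_, fun y h1 h2 => H.bd _ (hn y h1) (by rw [hi, h2])⟩
  · have := H.lip _ (HB_shift hh hR hy) _ (HB_shift hh hR hz); rwa [add_sub_add_right_eq_sub] at this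
  · have := H.grad (y + h) (hn y h1) (by rw [hi]; exact h2)
    rw [hasGradientAt_iff] at this ⊢
    exact (hasFDerivAt_comp_add_right h).2 this
  · have := H.sm (y + h) (hn y h1) (by rw [hi]; exact h2)
    have ha : ContDiffAt ℝ 2 (fun y => y + h) y := contDiffAt_id.add contDiffAt_const
    exact ⟨this.1.comp y ha, this.2.comp y ha⟩
  · have := H.div (y + h) (hn y h1) (by rw [hi]; exact h2)
    rw [← fderiv_comp_add_right] at this
    exact this

lemma fl_sd {e : E} {Z11 Z10 Z01 Z00 : E → E} {y : E} (h11 : ContDiffAt ℝ 2 Z11 y) (h10 : ContDiffAt ℝ 2 Z10 y) (h01 : ContDiffAt ℝ 2 Z01 y)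
    (h00 : ContDiffAt ℝ 2 Z00 y) (t11 : tr (fderiv ℝ (fun y => fl e (Z11 y)) y) = 0) (t10 : tr (fderiv ℝ (fun y => fl e (Z10 y)) y) = 0)
    (t01 : tr (fderiv ℝ (fun y => fl e (Z01 y)) y) = 0) (t00 : tr (fderiv ℝ (fun y => fl e (Z00 y)) y) = 0) :
    ContDiffAt ℝ 1 (fun y => sd (fl e (Z11 y)) (fl e (Z10 y)) (fl e (Z01 y)) (fl e (Z00 y))) y ∧
    tr (fderiv ℝ (fun y => sd (fl e (Z11 y)) (fl e (Z10 y)) (fl e (Z01 y)) (fl e (Z00 y))) y) = 0 := by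
  have d11 := fl_cd (e := e) h11
  have d10 := fl_cd (e := e) h10
  have d01 := fl_cd (e := e) h01
  have d00 := fl_cd (e := e) h00
  refine ⟨((d11.sub d10).sub d01).add d00, ?_⟩
  have f := (((d11.differentiableAt one_ne_zero).hasFDerivAt.sub (d10.differentiableAt one_ne_zero).hasFDerivAt).sub
    (d01.differentiableAt one_ne_zero).hasFDerivAt).add (d00.differentiableAt one_ne_zero).hasFDerivAt
  have : fderiv ℝ (fun y => sd (fl e (Z11 y)) (fl e (Z10 y)) (fl e (Z01 y)) (fl e (Z00 y))) y = _ := f.fderiv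
  rw [this, tr_add, tr_sub, tr_sub, t11, t10, t01, t00]; simp

theorem QEST (E : Type*) [NormedAddCommGroup E] [InnerProductSpace ℝ E] [FiniteDimensional ℝ E] [Nontrivial E] [MeasurableSpace E] [BorelSpace E]
    {γ R0 R1 : ℝ} (hγ : 0 < γ) (hγ1 : γ < 1) (hR0 : 0 < R0) (hR : R0 < R1) (hR1 : R1 ≤ 1) :
    ∃ c > 0, c ≤ 1 / 100 ∧ ∃ C ≥ 1, ∀ (e : E) (δ : ℝ) (k11 k10 k01 k00 : E → ℝ) (X11 X10 X01 X00 Z11 Z10 Z01 Z00 : E → E) (v K A : ℝ),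
      ‖e‖ = 1 → 0 ≤ δ → δ ≤ c → Hod e R1 δ γ k11 X11 Z11 → Hod e R1 δ γ k10 X10 Z10 → Hod e R1 δ γ k01 X01 Z01 →
      Hod e R1 δ γ k00 X00 Z00 → 0 ≤ v → 0 ≤ K → 0 ≤ A → (∀ y ∈ HB e R1, |sd (k11 y) (k10 y) (k01 y) (k00 y)| ≤ v) →
      Nb γ (fun y => X10 y - X00 y) (HB e R1) A → Nb γ (fun y => X11 y - X01 y) (HB e R1) A →
      (∀ r ≤ R1, ∀ m ≥ 0, Nb γ (fun y => sd (X11 y) (X10 y) (X01 y) (X00 y)) (HB e r) m →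
        ∃ B ≥ 0, Nb γ (fun y => X01 y - X00 y) (HB e r) B ∧ Nb γ (fun y => X11 y - X10 y) (HB e r) B ∧ A * B ≤ δ * m + K) →
      Nb γ (fun y => sd (X11 y) (X10 y) (X01 y) (X00 y)) (HB e R0) (C * (v + K)) := by
  set r1 := (R0 + R1) / 2 with hr1
  obtain ⟨c, hc, C, hC, L⟩ := LIN E hγ hγ1 hR0 (show R0 < r1 by linarith) (show r1 ≤ 1 by linarith)
  refine ⟨min (c / 100) (1 / 100), by positivity, min_le_right _ _, C * 70, by linarith, ?_⟩
  intro e δ k11 k10 k01 k00 X11 X10 X01 X00 Z11 Z10 Z01 Z00 v K A he hδ hδc H11 H10 H01 H00 hv hK hA hk hA0 hA1 hB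
  have hδ1 : δ ≤ 1 / 100 := hδc.trans (min_le_right _ _)
  have hδ2 : 100 * δ ≤ c := by have := hδc.trans (min_le_left _ _); linarith
  have hr : r1 < R1 := by linarith
  have flc : ∀ {Z : E → E}, ContinuousOn Z (HB e R1) → ContinuousOn (fun y => fl e (Z y)) (HB e R1) := fun hZ =>
    (hZ.const_smul (2:ℝ)).sub ((hZ.inner hZ).smul continuousOn_const)
  obtain ⟨ρ, hρ, hLS⟩ := toLS he (show 0 < r1 by linarith) hr (V := fun y => sd (k11 y) (k10 y) (k01 y) (k00 y))
    (X := fun y => sd (X11 y) (X10 y) (X01 y) (X00 y)) (F := fun y => sd (fl e (Z11 y)) (fl e (Z10 y)) (fl e (Z01 y)) (fl e (Z00 y)))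
    (((H11.kcont.sub H10.kcont).sub H01.kcont).add H00.kcont)
    ((((H11.xb.2.cont hγ).sub (H10.xb.2.cont hγ)).sub (H01.xb.2.cont hγ)).add (H00.xb.2.cont hγ))
    ((((flc (H11.zb.2.cont hγ)).sub (flc (H10.zb.2.cont hγ))).sub (flc (H01.zb.2.cont hγ))).add (flc (H00.zb.2.cont hγ)))
    (fun y h1 h2 => by
      have a1 := H11.grad y h1 h2
      have a2 := H10.grad y h1 h2
      have a3 := H01.grad y h1 h2
      have a4 := H00.grad y h1 h2
      rw [hasGradientAt_iff] at *
      have := ((a1.sub a2).sub a3).add a4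
      simp only [sd, map_add, map_sub]
      exact this)
    (fun y h1 h2 => fl_sd (H11.sm y h1 h2).2 (H10.sm y h1 h2).2 (H01.sm y h1 h2).2 (H00.sm y h1 h2).2
      (H11.div y h1 h2) (H10.div y h1 h2) (H01.div y h1 h2) (H00.div y h1 h2))
    (fun y h1 h2 => by
      have a1 := H11.bd y h1 h2
      have a2 := H10.bd y h1 h2
      have a3 := H01.bd y h1 h2
      have a4 := H00.bd y h1 h2
      have hee : ⟪e, e⟫ = 1 := by rw [real_inner_self_eq_norm_sq, he, one_pow]
      simp only [sd, fl, inner_add_right, inner_sub_right, inner_smul_right, hee]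
      linarith)
  have hS : HB e R0 ⊆ HB e r1 := HB_mono (by linarith)
  have q := L e _ _ _ v (70 * K) (δ + δ + δ + δ) he hLS hv (by positivity) (by positivity)
    (fun y hy => by rw [hρ y hy]; exact hk y (HB_mono hr.le hy))
    ((((((H11.xb.sub H10.xb).sub H01.xb).add H00.xb).mono (HB_mono hr.le) le_rfl).congr (g := fun y => sd (X11 (ρ y)) (X10 (ρ y)) (X01 (ρ y)) (X00 (ρ y)))
      fun y hy => by rw [hρ y hy]; rfl).2)
    (fun r hr' N m hN hm h1 h2 => by
      have hSr : HB e r ⊆ HB e r1 := HB_mono hr'.2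
      have hY : Nb γ (fun y => sd (X11 y) (X10 y) (X01 y) (X00 y)) (HB e r) (N + m) := by
        refine Nb.congr (f := fun y => sd (X11 (ρ y)) (X10 (ρ y)) (X01 (ρ y)) (X00 (ρ y))) ⟨fun y hy => (h2 y hy).trans (by linarith), h1.mono subset_rfl (by linarith)⟩ fun y hy => ?_
        rw [hρ y (hSr hy)]
      have hrR : r ≤ R1 := hr'.2.trans hr.le
      have hs : HB e r ⊆ HB e R1 := HB_mono hrR
      obtain ⟨B, hB0, b0, b1, hAB⟩ := hB r hrR (N + m) (by positivity) hY
      have := (pert he hδ hδ1 hA hB0 (by positivity) (fun y hy => H11.eq y (hs hy)) (fun y hy => H10.eq y (hs hy))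
        (fun y hy => H01.eq y (hs hy)) (fun y hy => H00.eq y (hs hy)) (H11.xb.mono hs le_rfl) (H10.xb.mono hs le_rfl) (H01.xb.mono hs le_rfl)
        (H11.zb.mono hs le_rfl) (H10.zb.mono hs le_rfl) (H01.zb.mono hs le_rfl) (H00.zb.mono hs le_rfl) (hA0.mono hs le_rfl) (hA1.mono hs le_rfl)
        b0 b1 hY).1
      have h3 := mul_le_mul_of_nonneg_right hδ2 (by positivity : 0 ≤ N + m)
      refine (this.congr (g := fun y => sd (fl e (Z11 (ρ y))) (fl e (Z10 (ρ y))) (fl e (Z01 (ρ y))) (fl e (Z00 (ρ y))) -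
        (2:ℝ) • sd (X11 (ρ y)) (X10 (ρ y)) (X01 (ρ y)) (X00 (ρ y))) fun y hy => ?_).2.mono subset_rfl (by linarith)
      rw [hρ y (hSr hy)]; rfl)
  have hle : C * (v + 70 * K) ≤ C * 70 * (v + K) := by
    rw [mul_assoc]; exact mul_le_mul_of_nonneg_left (by linarith) (by linarith)
  refine (Nb.congr (f := fun y => sd (X11 (ρ y)) (X10 (ρ y)) (X01 (ρ y)) (X00 (ρ y))) ⟨q.2, q.1⟩ fun y hy => ?_).mono subset_rfl hle
  rw [hρ y (hS hy)]
end
end OP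

namespace OP
open scoped RealInnerProductSpace Topology
open Module

section
variable {E : Type*} [NormedAddCommGroup E] [InnerProductSpace ℝ E] [FiniteDimensional ℝ E]
  [MeasurableSpace E] [BorelSpace E]

/-- open half ball -/
def OB (e : E) (r : ℝ) : Set E := {y | ‖y‖ < r ∧ 0 < ⟪e, y⟫}

lemma OB_HB {e : E} {r : ℝ} : OB e r ⊆ HB e r := fun _ h => ⟨h.1, h.2.le⟩
lemma OB_mono {e : E} {r r' : ℝ} (h : r ≤ r') : OB e r ⊆ OB e r' := fun _ hy => ⟨lt_of_lt_of_le hy.1 h, hy.2⟩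
lemma OB_open (e : E) (r : ℝ) : IsOpen (OB e r) :=
  (isOpen_lt continuous_norm continuous_const).inter (isOpen_lt (f := fun _ => (0:ℝ)) (g := fun y : E => ⟪e, y⟫) continuous_const (continuous_const.inner continuous_id))
lemma OB_conv (e : E) (r : ℝ) : Convex ℝ (OB e r) := by
  have h1 : OB e r = ball 0 r ∩ {y | 0 < innerSL ℝ e y} := by ext y; simp [OB]
  rw [h1]
  exact (convex_ball _ _).inter (convex_halfSpace_gt (innerSL ℝ e).isLinear 0)

lemma tend_up {W : Type*} [TopologicalSpace W] {e : E} (he : ‖e‖ = 1) {R : ℝ} {f : E → W} (hf : ContinuousOn f (HB e R)) {a : E} (ha : a ∈ HB e R) :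
    Tendsto (fun t : ℝ => f (a + t • e)) (𝓝[>] 0) (𝓝 (f a)) ∧ ∀ᶠ t : ℝ in 𝓝[>] 0, a + t • e ∈ OB e R := by
  have hl : Tendsto (fun t : ℝ => a + t • e) (𝓝[>] 0) (𝓝 a) := by
    have : Continuous fun t : ℝ => a + t • e := by fun_prop
    have := (this.tendsto 0).mono_left (nhdsWithin_le_nhds (s := Ioi 0))
    simpa using this
  have hev : ∀ᶠ t : ℝ in 𝓝[>] 0, a + t • e ∈ OB e R := by
    filter_upwards [hl.eventually (continuous_norm.continuousAt.eventually (gt_mem_nhds ha.1)), self_mem_nhdsWithin] with t h1 h2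
    refine ⟨h1, ?_⟩
    rw [inner_add_right, inner_smul_right, real_inner_self_eq_norm_sq, he]
    have := ha.2
    have : 0 < t := h2
    simp only [one_pow, mul_one]; linarith
  exact ⟨(hf a ha).tendsto.comp (tendsto_nhdsWithin_iff.2 ⟨hl, hev.mono fun t h => OB_HB h⟩), hev⟩

lemma lipOB {e : E} {R m : ℝ} {W : E → ℝ} {Y : E → E} (hg : ∀ y ∈ OB e R, HasGradientAt W (Y y) y) (hY : ∀ y ∈ OB e R, ‖Y y‖ ≤ m)
    {a b : E} (ha : a ∈ OB e R) (hb : b ∈ OB e R) : |W a - W b| ≤ m * ‖a - b‖ :=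
  (OB_conv e R).norm_image_sub_le_of_norm_hasFDerivWithin_le (f := W) (f' := fun y => innerSL ℝ (Y y))
    (fun y hy => (hasGradientAt_iff.1 (hg y hy)).hasFDerivWithinAt) (fun y hy => by rw [innerSL_apply_norm]; exact hY y hy) hb ha

lemma lipHB {e : E} (he : ‖e‖ = 1) {R m : ℝ} {W : E → ℝ} {Y : E → E} (hc : ContinuousOn W (HB e R)) (hg : ∀ y ∈ OB e R, HasGradientAt W (Y y) y)
    (hY : ∀ y ∈ OB e R, ‖Y y‖ ≤ m) {a b : E} (ha : a ∈ HB e R) (hb : b ∈ HB e R) : |W a - W b| ≤ m * ‖a - b‖ := by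
  obtain ⟨t1, e1⟩ := tend_up he hc ha
  obtain ⟨t2, e2⟩ := tend_up he hc hb
  refine le_of_tendsto ((t1.sub t2).abs) ?_
  filter_upwards [e1, e2] with t h1 h2
  have := lipOB hg hY h1 h2
  rwa [add_sub_add_right_eq_sub] at this

lemma Nb.deriv {W : Type*} [NormedAddCommGroup W] [NormedSpace ℝ W] {f : E → W} {S : Set E} {τ : E} {γ m d : ℝ} (hd : 0 < d)
    (hf : ∀ y ∈ S, DifferentiableAt ℝ f y) (h : ∀ t : ℝ, 0 < t → ‖t • τ‖ ≤ d → Nb γ (fun y => f (y + t • τ) - f y) S (m * ‖t • τ‖)) :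
    Nb γ (fun y => fderiv ℝ f y τ) S (m * ‖τ‖) := by
  have hl : ∀ y ∈ S, Tendsto (fun t : ℝ => t⁻¹ • (f (y + t • τ) - f y)) (𝓝[>] 0) (𝓝 (fderiv ℝ f y τ)) := fun y hy =>
    ((hf y hy).hasFDerivAt.hasLineDerivAt τ).tendsto_slope_zero_right
  have hev : ∀ᶠ t : ℝ in 𝓝[>] 0, 0 < t ∧ ‖t • τ‖ ≤ d := by
    have hc : Continuous fun t : ℝ => ‖t • τ‖ := by fun_prop
    have h0 : ‖(0:ℝ) • τ‖ < d := by simpa using hd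
    filter_upwards [self_mem_nhdsWithin, mem_nhdsWithin_of_mem_nhds ((hc.tendsto 0).eventually (gt_mem_nhds h0))] with t a b
    exact ⟨a, b.le⟩
  refine ⟨fun y hy => le_of_tendsto (hl y hy).norm ?_, fun x hx y hy => le_of_tendsto ((hl x hx).sub (hl y hy)).norm ?_⟩
  · filter_upwards [hev] with t ht
    have := (h t ht.1 ht.2).1 y hy
    rw [norm_smul, Real.norm_of_nonneg ht.1.le] at this
    rw [norm_smul, norm_inv, Real.norm_of_nonneg ht.1.le, inv_mul_le_iff₀ ht.1]
    linarith
  · filter_upwards [hev] with t ht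
    have := (h t ht.1 ht.2).2 x hx y hy
    rw [norm_smul, Real.norm_of_nonneg ht.1.le] at this
    rw [← smul_sub, norm_smul, norm_inv, Real.norm_of_nonneg ht.1.le, inv_mul_le_iff₀ ht.1]
    linarith

lemma sd_zero {V : Type*} [NormedAddCommGroup V] (a b : V) : sd a b 0 0 = a - b := by simp [sd]

theorem P4 (E : Type*) [NormedAddCommGroup E] [InnerProductSpace ℝ E] [FiniteDimensional ℝ E] [Nontrivial E] [MeasurableSpace E] [BorelSpace E]
    {γ R0 R1 : ℝ} (hγ : 0 < γ) (hγ1 : γ < 1) (hR0 : 0 < R0) (hR : R0 < R1) (hR1 : R1 ≤ 1) :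
    ∃ c > 0, c ≤ 1 / 100 ∧ ∃ C ≥ 1, ∀ (e : E) (δ : ℝ) (k2 k1 : E → ℝ) (X2 X1 Z2 Z1 : E → E) (w : ℝ),
      ‖e‖ = 1 → 0 ≤ δ → δ ≤ c → Hod e R1 δ γ k2 X2 Z2 → Hod e R1 δ γ k1 X1 Z1 → 0 ≤ w → (∀ y ∈ HB e R1, |k2 y - k1 y| ≤ w) →
      Nb γ (fun y => X2 y - X1 y) (HB e R0) (C * w) ∧ Nb γ (fun y => Z2 y - Z1 y) (HB e R0) (C * w) := by
  obtain ⟨c, hc, hc1, C, hC, Q⟩ := QEST E hγ hγ1 hR0 hR hR1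
  refine ⟨c, hc, hc1, 3 * C, by linarith, ?_⟩
  intro e δ k2 k1 X2 X1 Z2 Z1 w he hδ hδc H2 H1 hw hk
  have hz := Hod.zero e R1 γ hδ
  have hX : Nb γ (fun y => X2 y - X1 y) (HB e R0) (C * w) := by
    have q := Q e δ k2 k1 _ _ X2 X1 _ _ Z2 Z1 _ _ w 0 δ he hδ hδc H2 H1 hz hz hw le_rfl hδ
      (fun y hy => by rw [sd_zero]; exact hk y hy) (by simpa using H1.xb) (by simpa using H2.xb)
      (fun r hr m hm hN => ⟨m, hm, by simpa using Nb.zero hm, by simpa only [sd_zero] using hN, by linarith⟩)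
    simpa only [sd_zero, add_zero] using q
  have hm : HB e R0 ⊆ HB e R1 := HB_mono hR.le
  have h0 : 0 ≤ C * w := by positivity
  refine ⟨hX.mono subset_rfl (by linarith), (dZ he hδ (hδc.trans hc1) h0 (fun y hy => H2.eq y (hm hy)) (fun y hy => H1.eq y (hm hy))
    (H2.xb.mono hm le_rfl) (H2.zb.mono hm le_rfl) (H1.zb.mono hm le_rfl) hX).mono subset_rfl (by linarith)⟩

theorem P5 (E : Type*) [NormedAddCommGroup E] [InnerProductSpace ℝ E] [FiniteDimensional ℝ E] [Nontrivial E] [MeasurableSpace E] [BorelSpace E]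
    {γ R0 R1 : ℝ} (hγ : 0 < γ) (hγ1 : γ < 1) (hR0 : 0 < R0) (hR : R0 < R1) (hR1 : R1 ≤ 1) :
    ∃ c > 0, c ≤ 1 / 100 ∧ ∃ C ≥ 1, ∃ d > 0, ∀ (e : E) (δ : ℝ) (k2 k1 : E → ℝ) (X2 X1 Z2 Z1 : E → E) (w : ℝ) (h : E),
      ‖e‖ = 1 → 0 ≤ δ → δ ≤ c → Hod e R1 δ γ k2 X2 Z2 → Hod e R1 δ γ k1 X1 Z1 → 0 ≤ w → (∀ y ∈ HB e R1, |k2 y - k1 y| ≤ w) →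
      ⟪e, h⟫ = 0 → ‖h‖ ≤ d →
      Nb γ (fun y => sd (X2 (y + h)) (X2 y) (X1 (y + h)) (X1 y)) (HB e R0) (C * w * ‖h‖) ∧
      Nb γ (fun y => sd (Z2 (y + h)) (Z2 y) (Z1 (y + h)) (Z1 y)) (HB e R0) (C * w * ‖h‖) := by
  set d := (R1 - R0) / 4 with hd
  have hd0 : 0 < d := by rw [hd]; linarith
  obtain ⟨c, hc, hc1, C, hC, P⟩ := P4 E hγ hγ1 (show 0 < R0 + 2 * d by linarith) (show R0 + 2 * d < R0 + 3 * d by linarith) (by linarith)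
  obtain ⟨c', hc', hc1', C', hC', Q⟩ := QEST E hγ hγ1 hR0 (show R0 < R0 + d by linarith) (by linarith)
  refine ⟨min c c', by positivity, (min_le_left _ _).trans hc1, 3 * (C' * (C + C * C)) + 25 * (C * C), ?_, d, hd0, ?_⟩
  · have h1 : 1 ≤ C * C := one_le_mul_of_one_le_of_one_le hC hC
    have : 0 ≤ C' * (C + C * C) := by positivity
    linarith
  intro e δ k2 k1 X2 X1 Z2 Z1 w h he hδ hδc H2 H1 hw hk hh hhd
  have hδ1 := hδc.trans (min_le_left _ _)
  have hδ2 := hδc.trans (min_le_right _ _)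
  have hδ3 : δ ≤ 1 := by linarith
  have hn := norm_nonneg h
  have h3 : R0 + 3 * d ≤ R1 := by linarith
  have a := P e δ k2 k1 X2 X1 Z2 Z1 w he hδ hδ1 (H2.mono h3) (H1.mono h3) hw (fun y hy => hk y (HB_mono h3 hy))
  have hs : ∀ {k : E → ℝ} {X Z : E → E}, Hod e R1 δ γ k X Z → Nb γ (fun y => X (y + h) - X y) (HB e (R0 + 2 * d)) (C * ‖h‖ * δ) := by
    intro k X Z H
    refine (P e δ _ k _ X _ Z (δ * ‖h‖) he hδ hδ1 (H.shift hh (by linarith)) (H.mono h3) (by positivity) fun y hy => ?_).1.mono subset_rfl (le_of_eq (by ring))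
    have := H.lip (y + h) (HB_shift hh (by linarith) hy) y (HB_mono h3 hy)
    rwa [add_sub_cancel_left] at this
  have s1 : HB e (R0 + d) ⊆ HB e (R0 + 2 * d) := HB_mono (by linarith)
  have s0 : HB e (R0 + d) ⊆ HB e R1 := HB_mono (by linarith)
  have S2 := H2.shift (R' := R0 + d) hh (by linarith)
  have S1 := H1.shift (R' := R0 + d) hh (by linarith)
  have M2 := H2.mono (R' := R0 + d) (by linarith)
  have M1 := H1.mono (R' := R0 + d) (by linarith)
  have hA0 : Nb γ (fun y => X2 y - X1 y) (HB e (R0 + d)) (C * w) := a.1.mono s1 le_rfl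
  have hA1 : Nb γ (fun y => X2 (y + h) - X1 (y + h)) (HB e (R0 + d)) (C * w) := a.1.shift (f := fun y => X2 y - X1 y) hh (by linarith)
  have hB0 : Nb γ (fun y => X1 (y + h) - X1 y) (HB e (R0 + d)) (C * ‖h‖ * δ) := (hs H1).mono s1 le_rfl
  have hB1 : Nb γ (fun y => X2 (y + h) - X2 y) (HB e (R0 + d)) (C * ‖h‖ * δ) := (hs H2).mono s1 le_rfl
  have hAB : C * w * (C * ‖h‖ * δ) ≤ C * C * (w * ‖h‖) := by
    have : C * w * (C * ‖h‖ * δ) = C * C * (w * ‖h‖) * δ := by ring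
    rw [this]; exact mul_le_of_le_one_right (by positivity) hδ3
  have hq := Q e δ _ k2 _ k1 _ X2 _ X1 _ Z2 _ Z1 (C * (w * ‖h‖)) (C * C * (w * ‖h‖)) (C * w) he hδ hδ2 S2 M2 S1 M1 (by positivity) (by positivity) (by positivity)
    (fun y hy => by
      have := lipHB he (W := fun y => k2 y - k1 y) (Y := fun y => X2 y - X1 y) (R := R0 + 2 * d) (m := C * w)
        ((H2.kcont.sub H1.kcont).mono (HB_mono (by linarith))) (fun y hy => by
          have h1 := H2.grad y (by linarith [hy.1]) hy.2
          have h2 := H1.grad y (by linarith [hy.1]) hy.2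
          rw [hasGradientAt_iff] at *
          rw [map_sub]; exact h1.sub h2) (fun y hy => a.1.1 y (OB_HB hy)) (HB_shift hh (by linarith) hy) (s1 hy)
      rw [add_sub_cancel_left] at this
      refine (le_of_eq ?_).trans (this.trans (le_of_eq (by ring)))
      congr 1; simp only [sd]; ring)
    hA0 hA1 (fun r hr m hm _ => ⟨C * ‖h‖ * δ, by positivity, hB0.mono (HB_mono hr) le_rfl, hB1.mono (HB_mono hr) le_rfl,
      hAB.trans (by have : 0 ≤ δ * m := by positivity
                    linarith)⟩)
  have hm : HB e R0 ⊆ HB e (R0 + d) := HB_mono (by linarith)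
  have hY0 : 0 ≤ C' * (C * (w * ‖h‖) + C * C * (w * ‖h‖)) := by positivity
  have hCC : 0 ≤ C * C * (w * ‖h‖) := by positivity
  have hfin : 3 * (C' * (C * (w * ‖h‖) + C * C * (w * ‖h‖))) + 25 * (C * C * (w * ‖h‖)) = (3 * (C' * (C + C * C)) + 25 * (C * C)) * w * ‖h‖ := by ring
  refine ⟨hq.mono subset_rfl (by linarith), ?_⟩
  refine (pert he hδ (by linarith) (by positivity : 0 ≤ C * w) (by positivity : 0 ≤ C * ‖h‖ * δ) hY0 (fun y hy => S2.eq y (hm hy)) (fun y hy => M2.eq y (hm hy))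
    (fun y hy => S1.eq y (hm hy)) (fun y hy => M1.eq y (hm hy)) (S2.xb.mono hm le_rfl) (M2.xb.mono hm le_rfl) (S1.xb.mono hm le_rfl) (S2.zb.mono hm le_rfl)
    (M2.zb.mono hm le_rfl) (S1.zb.mono hm le_rfl) (M1.zb.mono hm le_rfl) (hA0.mono hm le_rfl) (hA1.mono hm le_rfl) (hB0.mono hm le_rfl) (hB1.mono hm le_rfl) hq).2.mono subset_rfl ?_
  linarith
end
end OP

namespace OP
open scoped RealInnerProductSpace Topology
open Module

section
variable {E : Type*} [NormedAddCommGroup E] [InnerProductSpace ℝ E] [FiniteDimensional ℝ E]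
  [MeasurableSpace E] [BorelSpace E]

lemma fderiv_shift {W : Type*} [NormedAddCommGroup W] [NormedSpace ℝ W] (f : E → W) (h y : E) : fderiv ℝ (fun y => f (y + h)) y = fderiv ℝ f (y + h) :=
  fderiv_comp_add_right h

theorem T1 (E : Type*) [NormedAddCommGroup E] [InnerProductSpace ℝ E] [FiniteDimensional ℝ E] [Nontrivial E] [MeasurableSpace E] [BorelSpace E]
    {γ R0 R1 : ℝ} (hγ : 0 < γ) (hγ1 : γ < 1) (hR0 : 0 < R0) (hR : R0 < R1) (hR1 : R1 ≤ 1) :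
    ∃ c > 0, c ≤ 1 / 100 ∧ ∃ C ≥ 1, ∀ (e : E) (δ : ℝ) (k2 k1 : E → ℝ) (X2 X1 Z2 Z1 : E → E) (w : ℝ),
      ‖e‖ = 1 → 0 ≤ δ → δ ≤ c → Hod e R1 δ γ k2 X2 Z2 → Hod e R1 δ γ k1 X1 Z1 → 0 ≤ w → (∀ y ∈ HB e R1, |k2 y - k1 y| ≤ w) →
      Nb γ (fun y => X2 y - X1 y) (HB e R0) (C * w) ∧ Nb γ (fun y => Z2 y - Z1 y) (HB e R0) (C * w) ∧
      ∀ τ, ⟪e, τ⟫ = 0 → Nb γ (fun y => fderiv ℝ Z2 y τ - fderiv ℝ Z1 y τ) (OB e R0) (C * w * ‖τ‖) := by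
  obtain ⟨c, hc, hc1, C, hC, P⟩ := P4 E hγ hγ1 hR0 hR hR1
  obtain ⟨c', hc', hc1', C', hC', d, hd, Q⟩ := P5 E hγ hγ1 hR0 hR hR1
  refine ⟨min c c', by positivity, (min_le_left _ _).trans hc1, C + C', by linarith, ?_⟩
  intro e δ k2 k1 X2 X1 Z2 Z1 w he hδ hδc H2 H1 hw hk
  have hδ1 := hδc.trans (min_le_left _ _)
  have hδ2 := hδc.trans (min_le_right _ _)
  have p := P e δ k2 k1 X2 X1 Z2 Z1 w he hδ hδ1 H2 H1 hw hk
  have l1 : C * w ≤ (C + C') * w := mul_le_mul_of_nonneg_right (by linarith) hw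
  have l2 : C' * w ≤ (C + C') * w := mul_le_mul_of_nonneg_right (by linarith) hw
  refine ⟨p.1.mono subset_rfl l1, p.2.mono subset_rfl l1, fun τ hτ => ?_⟩
  have df : ∀ {k : E → ℝ} {X Z : E → E}, Hod e R1 δ γ k X Z → ∀ y ∈ OB e R0, DifferentiableAt ℝ Z y := fun H y hy =>
    (H.sm y (hy.1.trans hR) hy.2).2.differentiableAt two_ne_zero
  have := Nb.deriv (f := fun y => Z2 y - Z1 y) (S := OB e R0) (τ := τ) (γ := γ) (m := C' * w) hd
    (fun y hy => (df H2 y hy).sub (df H1 y hy)) (fun t ht htd => by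
      have q := (Q e δ k2 k1 X2 X1 Z2 Z1 w (t • τ) he hδ hδ2 H2 H1 hw hk (by rw [inner_smul_right, hτ, mul_zero]) htd).2
      refine (q.mono OB_HB le_rfl).congr fun y hy => ?_
      simp only [sd]; abel)
  refine (this.mono subset_rfl (mul_le_mul_of_nonneg_right l2 (norm_nonneg _))).congr fun y hy => ?_
  have e1 : fderiv ℝ (fun y => Z2 y - Z1 y) y = _ := fderiv_sub (df H2 y hy) (df H1 y hy)
  rw [e1]; rfl

theorem T2 (E : Type*) [NormedAddCommGroup E] [InnerProductSpace ℝ E] [FiniteDimensional ℝ E] [Nontrivial E] [MeasurableSpace E] [BorelSpace E]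
    {γ R0 R1 : ℝ} (hγ : 0 < γ) (hγ1 : γ < 1) (hR0 : 0 < R0) (hR : R0 < R1) (hR1 : R1 ≤ 1) :
    ∃ c > 0, c ≤ 1 / 100 ∧ ∃ C ≥ 1, ∀ (e : E) (δ : ℝ) (k : E → ℝ) (X Z : E → E),
      ‖e‖ = 1 → 0 ≤ δ → δ ≤ c → Hod e R1 δ γ k X Z → ∀ τ, ⟪e, τ⟫ = 0 →
      Nb γ (fun y => fderiv ℝ X y τ) (OB e R0) (C * ‖τ‖) ∧ Nb γ (fun y => fderiv ℝ Z y τ) (OB e R0) (C * ‖τ‖) ∧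
      ∀ σ, ⟪e, σ⟫ = 0 → Nb γ (fun y => fderiv ℝ (fun z => fderiv ℝ Z z τ) y σ) (OB e R0) (C * ‖τ‖ * ‖σ‖) := by
  set Rm := (R0 + R1) / 2 with hRm
  obtain ⟨c, hc, hc1, C, hC, T⟩ := T1 E hγ hγ1 hR0 (show R0 < Rm by linarith) (show Rm ≤ 1 by linarith)
  refine ⟨c, hc, hc1, C, hC, ?_⟩
  intro e δ k X Z he hδ hδc H τ hτ
  have hd : 0 < R1 - Rm := by linarith
  have key : ∀ h, ⟪e, h⟫ = 0 → ‖h‖ ≤ R1 - Rm → _ := fun h hh hn =>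
    T e δ (fun y => k (y + h)) k (fun y => X (y + h)) X (fun y => Z (y + h)) Z ‖h‖ he hδ hδc (H.shift hh (by linarith)) (H.mono (by linarith)) (norm_nonneg _)
      (fun y hy => by
        have := H.lip (y + h) (HB_shift hh (by linarith) hy) y (HB_mono (by linarith) hy)
        rw [add_sub_cancel_left] at this
        exact this.trans (mul_le_of_le_one_left (norm_nonneg _) (by linarith)))
  have hin : ∀ σ, ⟪e, σ⟫ = 0 → ∀ t : ℝ, ⟪e, t • σ⟫ = 0 := fun σ hσ t => by rw [inner_smul_right, hσ, mul_zero]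
  have sm : ∀ y ∈ OB e R0, _ := fun y hy => H.sm y (show ‖y‖ < R1 by linarith [hy.1]) hy.2
  refine ⟨?_, ?_, fun σ hσ => ?_⟩
  · exact Nb.deriv hd (fun y hy => (sm y hy).1.differentiableAt two_ne_zero) fun t ht htd => (key _ (hin τ hτ t) htd).1.mono OB_HB le_rfl
  · exact Nb.deriv hd (fun y hy => (sm y hy).2.differentiableAt two_ne_zero) fun t ht htd => (key _ (hin τ hτ t) htd).2.1.mono OB_HB le_rfl
  · refine Nb.deriv hd (fun y hy => ?_) fun t ht htd => ?_
    · have : ContDiffAt ℝ 1 (fderiv ℝ Z) y := (sm y hy).2.fderiv_right (by norm_num)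
      exact (this.differentiableAt one_ne_zero).clm_apply (differentiableAt_const _)
    · refine (((key _ (hin σ hσ t) htd).2.2 τ hτ).mono subset_rfl (le_of_eq (by ring))).congr fun y hy => ?_
      rw [fderiv_shift]

section
variable {W : Type*} [NormedAddCommGroup W]

lemma Nb.pair (γ : ℝ) (f : E → W) (y z : E) : ∃ m, 0 ≤ m ∧ Nb γ f {y, z} m := by
  have h0 : 0 ≤ ‖f y - f z‖ / ‖y - z‖ ^ γ := by positivity
  have hyz : ‖f y - f z‖ ≤ (‖f y‖ + ‖f z‖ + ‖f y - f z‖ / ‖y - z‖ ^ γ) * ‖y - z‖ ^ γ := by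
    rcases eq_or_ne y z with rfl | h
    · rw [sub_self, norm_zero]; positivity
    · have hp : 0 < ‖y - z‖ ^ γ := Real.rpow_pos_of_pos (norm_sub_pos_iff.2 h) _
      rw [add_mul _ (_ / _), div_mul_cancel₀ _ hp.ne']
      have : 0 ≤ (‖f y‖ + ‖f z‖) * ‖y - z‖ ^ γ := by positivity
      linarith
  have hs : ∀ x : E, ‖f x - f x‖ ≤ (‖f y‖ + ‖f z‖ + ‖f y - f z‖ / ‖y - z‖ ^ γ) * ‖x - x‖ ^ γ := fun x => by
    rw [sub_self, norm_zero]; positivity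
  refine ⟨‖f y‖ + ‖f z‖ + ‖f y - f z‖ / ‖y - z‖ ^ γ, by positivity, ?_, ?_⟩
  · rintro x (rfl | rfl)
    · linarith [norm_nonneg (f z)]
    · linarith [norm_nonneg (f y)]
  · rintro x (rfl | rfl) x' (rfl | rfl)
    · exact hs _
    · exact hyz
    · rw [norm_sub_rev (f x), norm_sub_rev x]; exact hyz
    · exact hs _

lemma Nb.absorb2 {γ c : ℝ} {f : E → W} {S : Set E} (hc : 0 ≤ c)
    (h : ∀ T ⊆ S, ∀ m, 0 ≤ m → Nb γ f T m → Nb γ f T (c + m / 2)) : Nb γ f S (2 * c) := by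
  have key : ∀ y ∈ S, ∀ z ∈ S, Nb γ f {y, z} (2 * c) := fun y hy z hz => by
    obtain ⟨m, hm, hN⟩ := Nb.pair γ f y z
    exact Nb.absorb hc hm hN (h _ (by rintro x (rfl | rfl) <;> assumption))
  exact ⟨fun y hy => (key y hy y hy).1 y (by simp), fun y hy z hz => (key y hy z hz).2 y (by simp) z (by simp)⟩
end

/-- symmetric and trace free -/
def ST (B : E →L[ℝ] E) : Prop := (∀ a b, ⟪B a, b⟫ = ⟪a, B b⟫) ∧ tr B = 0
lemma ST.sub {B B' : E →L[ℝ] E} (h : ST B) (h' : ST B') : ST (B - B') :=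
  ⟨fun a b => by simp only [ContinuousLinearMap.sub_apply, inner_sub_left, inner_sub_right, h.1, h'.1], by rw [tr_sub, h.2, h'.2, sub_zero]⟩

lemma ST.rec' {e : E} (he : ‖e‖ = 1) {B : E →L[ℝ] E} (h : ST B) {a : ℝ} (ha : 0 ≤ a) (hB : ∀ τ, ⟪e, τ⟫ = 0 → ‖B τ‖ ≤ a * ‖τ‖) :
    ‖B‖ ≤ (3 * (finrank ℝ E : ℝ) + 2) * a := by
  have hee : ⟪e, e⟫ = 1 := by rw [real_inner_self_eq_norm_sq, he, one_pow]
  set P : E → E := fun w => w - ⟪e, w⟫ • e with hP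
  have hPe : ∀ w, ⟪e, P w⟫ = 0 := fun w => by simp only [hP]; rw [inner_sub_right, inner_smul_right, hee]; ring
  have hdec : ∀ w, w = ⟪e, w⟫ • e + P w := fun w => by simp only [hP]; abel
  have habs : ∀ w, |⟪e, w⟫| ≤ ‖w‖ := fun w => by simpa [he] using abs_real_inner_le_norm e w
  have hPn : ∀ w, ‖P w‖ ≤ ‖w‖ := fun w => by
    have h1 : ‖w‖ ^ 2 = ⟪e, w⟫ ^ 2 + ‖P w‖ ^ 2 := by
      simp only [hP]
      rw [norm_sub_sq_real, norm_smul, Real.norm_eq_abs, he, inner_smul_right, real_inner_comm, mul_one, sq_abs, real_inner_comm]; ring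
    exact abs_le_of_sq_le_sq' (by linarith [sq_nonneg ⟪e, w⟫]) (norm_nonneg _) |>.2
  have hBP : ∀ w, ‖B (P w)‖ ≤ a * ‖w‖ := fun w => (hB _ (hPe w)).trans (mul_le_mul_of_nonneg_left (hPn w) ha)
  have hcr : ∀ w, |⟪B e, P w⟫| ≤ a * ‖w‖ := fun w => by
    rw [h.1]
    have := abs_real_inner_le_norm e (B (P w))
    rw [he, one_mul] at this
    exact this.trans (hBP w)
  -- normal component of B e
  have hn : |⟪e, B e⟫| ≤ 3 * (finrank ℝ E : ℝ) * a := by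
    set b := stdOrthonormalBasis ℝ E
    have hq : ∀ i, |⟪b i, B (b i)⟫ - ⟪e, b i⟫ ^ 2 * ⟪e, B e⟫| ≤ 3 * a := by
      intro i
      have hb1 : ‖b i‖ = 1 := b.orthonormal.1 i
      have e1 : ⟪b i, B (b i)⟫ - ⟪e, b i⟫ ^ 2 * ⟪e, B e⟫ = ⟪e, b i⟫ * (2 * ⟪B e, P (b i)⟫) + ⟪P (b i), B (P (b i))⟫ := by
        conv_lhs => rw [hdec (b i)]
        simp only [map_add, map_smul, inner_add_left, inner_add_right, inner_smul_left, inner_smul_right, hPe, hee, RCLike.conj_to_real]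
        rw [← h.1 (P (b i)) e, real_inner_comm (B (P (b i))) e]
        have : ⟪B (P (b i)), e⟫ = ⟪B e, P (b i)⟫ := by rw [h.1, real_inner_comm]
        rw [this]; ring
      rw [e1]
      have a1 := habs (b i)
      have a2 := hcr (b i)
      have a3 := (abs_real_inner_le_norm (P (b i)) (B (P (b i)))).trans (mul_le_mul (hPn _) (hBP _) (norm_nonneg _) (norm_nonneg _))
      rw [hb1] at a1 a2 a3
      refine (abs_add_le _ _).trans ?_
      rw [abs_mul, abs_mul, abs_two]
      have := mul_le_mul a1 a2 (abs_nonneg _) zero_le_one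
      linarith
    have hsum : ∑ i, (⟪b i, B (b i)⟫ - ⟪e, b i⟫ ^ 2 * ⟪e, B e⟫) = - ⟪e, B e⟫ := by
      rw [Finset.sum_sub_distrib, ← tr_eq_sum, h.2, ← Finset.sum_mul]
      have : ∑ i, ⟪e, b i⟫ ^ 2 = 1 := by
        have := b.sum_sq_norm_inner_left e
        simp only [Real.norm_eq_abs, sq_abs, he, one_pow] at this
        exact this
      rw [this]; ring
    rw [← abs_neg, ← hsum]
    refine (Finset.abs_sum_le_sum_abs _ _).trans ((Finset.sum_le_sum fun i _ => hq i).trans (le_of_eq ?_))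
    simp; ring
  have hBe : ‖B e‖ ≤ (3 * (finrank ℝ E : ℝ) + 1) * a := by
    have e2 : ‖P (B e)‖ ≤ a := by
      rcases (norm_nonneg (P (B e))).eq_or_lt with h0 | h0
      · rw [← h0]; exact ha
      have h1 : ⟪B e, P (P (B e))⟫ = ‖P (B e)‖ ^ 2 := by
        have : P (P (B e)) = P (B e) := by conv_lhs => simp only [hP]
                                           have := hPe (B e)
                                           simp only [hP] at this ⊢
                                           rw [this]; simp
        rw [this]
        conv_lhs => rw [hdec (B e)]
        rw [inner_add_left, inner_smul_left, hPe]
        have : P (⟪e, B e⟫ • e + P (B e)) = P (B e) := by rw [← hdec]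
        simp [real_inner_self_eq_norm_sq, this, hPe]
      have := hcr (P (B e))
      rw [h1, abs_of_nonneg (sq_nonneg _), sq] at this
      exact le_of_mul_le_mul_right this h0
    rw [hdec (B e)]
    refine (norm_add_le _ _).trans ?_
    rw [norm_smul, he, mul_one, Real.norm_eq_abs]
    linarith
  refine B.opNorm_le_bound (by positivity) fun w => ?_
  rw [hdec w, map_add, map_smul, ← hdec w]
  refine (norm_add_le _ _).trans ?_
  rw [norm_smul, Real.norm_eq_abs]
  have := mul_le_mul (habs w) hBe (norm_nonneg _) (norm_nonneg _)
  have := hBP w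
  linarith

lemma Nb.rec {e : E} (he : ‖e‖ = 1) {γ a : ℝ} (ha : 0 ≤ a) {S : Set E} {B : E → E →L[ℝ] E} (hB : ∀ y ∈ S, ST (B y))
    (h : ∀ τ, ⟪e, τ⟫ = 0 → Nb γ (fun y => B y τ) S (a * ‖τ‖)) : Nb γ B S ((3 * (finrank ℝ E : ℝ) + 2) * a) := by
  refine ⟨fun y hy => (hB y hy).rec' he ha fun τ hτ => (h τ hτ).1 y hy, fun x hx y hy => ?_⟩
  rw [mul_assoc]
  refine ((hB x hx).sub (hB y hy)).rec' he (by positivity) fun τ hτ => ?_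
  have := (h τ hτ).2 x hx y hy
  rw [ContinuousLinearMap.sub_apply]
  linarith
end
end OP

namespace OP
open scoped RealInnerProductSpace Topology
open Module

section
variable {E : Type*} [NormedAddCommGroup E] [InnerProductSpace ℝ E] [FiniteDimensional ℝ E]
  [MeasurableSpace E] [BorelSpace E]

lemma Nb.app {V W : Type*} [NormedAddCommGroup V] [NormedSpace ℝ V] [NormedAddCommGroup W] [NormedSpace ℝ W] {γ m : ℝ} {B : E → V →L[ℝ] W} {S : Set E}
    (h : Nb γ B S m) (w : V) : Nb γ (fun y => B y w) S (m * ‖w‖) :=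
  ⟨fun y hy => (B y).le_of_opNorm_le (h.1 y hy) w, fun x hx y hy => by
    have := (B x - B y).le_of_opNorm_le (h.2 x hx y hy) w
    rw [ContinuousLinearMap.sub_apply] at this
    linarith⟩
lemma Nb.inn {γ m : ℝ} {X : E → E} {S : Set E} (h : Nb γ X S m) (w : E) : Nb γ (fun y => ⟪X y, w⟫) S (m * ‖w‖) :=
  ⟨fun y hy => (abs_real_inner_le_norm _ _).trans (mul_le_mul_of_nonneg_right (h.1 y hy) (norm_nonneg _)), fun x hx y hy => by
    have := (abs_real_inner_le_norm (X x - X y) w).trans (mul_le_mul_of_nonneg_right (h.2 x hx y hy) (norm_nonneg _))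
    rw [inner_sub_left] at this
    rw [Real.norm_eq_abs]; linarith⟩
lemma bilS (W : Type*) [NormedAddCommGroup W] [NormedSpace ℝ W] : Bil (fun (r : ℝ) (b : W) => r • b) :=
  ⟨fun a a' b => sub_smul _ _ _, fun a b b' => smul_sub _ _ _, fun a b => (norm_smul a b).le⟩

lemma solve {e : E} (he : ‖e‖ = 1) {γ δ a : ℝ} (hδ : 0 ≤ δ) (hδD : 4 * (3 * (finrank ℝ E : ℝ) + 2) * δ ≤ 1) (ha : 0 ≤ a) {S : Set E} {X : E → E}
    {B : E → E →L[ℝ] E} {q : E → E → E} (hX : Nb γ X S δ) (hB : ∀ y ∈ S, ST (B y)) (hq : ∀ τ, ⟪e, τ⟫ = 0 → Nb γ (fun y => q τ y) S (a * ‖τ‖))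
    (h : ∀ τ, ⟪e, τ⟫ = 0 → ∀ y ∈ S, B y τ = q τ y - ⟪X y, τ⟫ • B y e) : Nb γ B S (2 * ((3 * (finrank ℝ E : ℝ) + 2) * a)) := by
  refine Nb.absorb2 (by positivity) fun T hT m hm hN => ?_
  refine (Nb.rec he (a := a + 2 * (δ * m)) (by positivity) (fun y hy => hB y (hT hy)) fun τ hτ => ?_).mono subset_rfl ?_
  · have h1 := ((hX.mono hT le_rfl).inn τ).bil (bilS E) (by positivity) (by positivity) (hN.app e)
    rw [he, mul_one] at h1
    refine ((((hq τ hτ).mono hT le_rfl).sub h1).mono subset_rfl (le_of_eq (by ring))).congr fun y hy => h τ hτ y (hT hy)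
  · have := mul_le_mul_of_nonneg_right hδD hm
    linarith

structure Geo (e : E) (R : ℝ) (X Z : E → E) (B : E → E →L[ℝ] E) (T : E → E →L[ℝ] E →L[ℝ] E) : Prop where
  st : ∀ y ∈ OB e R, ST (B y)
  dz : ∀ y ∈ OB e R, ∀ w, fderiv ℝ Z y w = -(B y (w + ⟪X y, w⟫ • e))
  db : ∀ y ∈ OB e R, DifferentiableAt ℝ B y ∧ ∀ w, fderiv ℝ B y w = T y (w + ⟪X y, w⟫ • e)
  ts : ∀ y ∈ OB e R, (∀ a b, T y a b = T y b a) ∧ ∀ w, ST (T y w)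

lemma ddz {e : E} {R : ℝ} {X Z : E → E} {B : E → E →L[ℝ] E} {T : E → E →L[ℝ] E →L[ℝ] E} (G : Geo e R X Z B T) {y : E} (hy : y ∈ OB e R)
    (hX : DifferentiableAt ℝ X y) (τ ρ : E) : fderiv ℝ (fun z => fderiv ℝ Z z τ) y ρ =
      -(fderiv ℝ B y ρ (τ + ⟪X y, τ⟫ • e) + ⟪fderiv ℝ X y ρ, τ⟫ • B y e) := by
  have hev : (fun z => fderiv ℝ Z z τ) =ᶠ[𝓝 y] fun z => -(B z (τ + ⟪X z, τ⟫ • e)) := by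
    filter_upwards [(OB_open e R).mem_nhds hy] with z hz using G.dz z hz τ
  rw [hev.fderiv_eq]
  have h1 : HasFDerivAt (fun z => ⟪X z, τ⟫) _ y := hX.hasFDerivAt.inner ℝ (hasFDerivAt_const τ y)
  have h2 := ((G.db y hy).1.hasFDerivAt.clm_apply ((hasFDerivAt_const τ y).add (h1.smul_const e))).neg
  have h3 : fderiv ℝ (fun z => -(B z (τ + ⟪X z, τ⟫ • e))) y = _ := h2.fderiv
  rw [h3]
  simp [add_comm]

theorem T3 (E : Type*) [NormedAddCommGroup E] [InnerProductSpace ℝ E] [FiniteDimensional ℝ E] [Nontrivial E] [MeasurableSpace E] [BorelSpace E]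
    {γ R0 R1 : ℝ} (hγ : 0 < γ) (hγ1 : γ < 1) (hR0 : 0 < R0) (hR : R0 < R1) (hR1 : R1 ≤ 1) :
    ∃ c > 0, c ≤ 1 / 100 ∧ ∃ C ≥ 1, ∀ (e : E) (δ : ℝ) (k2 k1 : E → ℝ) (X2 X1 Z2 Z1 : E → E) (B2 B1 : E → E →L[ℝ] E)
      (S2 S1 : E → E →L[ℝ] E →L[ℝ] E) (w : ℝ),
      ‖e‖ = 1 → 0 ≤ δ → δ ≤ c → Hod e R1 δ γ k2 X2 Z2 → Hod e R1 δ γ k1 X1 Z1 → Geo e R1 X2 Z2 B2 S2 → Geo e R1 X1 Z1 B1 S1 →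
      0 ≤ w → (∀ y ∈ HB e R1, |k2 y - k1 y| ≤ w) →
      Nb γ (fun y => X2 y - X1 y) (OB e R0) (C * w) ∧ Nb γ (fun y => Z2 y - Z1 y) (OB e R0) (C * w) ∧
      Nb γ (fun y => B2 y - B1 y) (OB e R0) (C * w) ∧ Nb γ B2 (OB e R0) C ∧ Nb γ (fun y => fderiv ℝ B2 y e) (OB e R0) C := by
  obtain ⟨c, hc, hc1, C, hC, P⟩ := T1 E hγ hγ1 hR0 hR hR1
  obtain ⟨c', hc', hc1', C', hC', Q⟩ := T2 E hγ hγ1 hR0 hR hR1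
  set D : ℝ := 3 * (finrank ℝ E : ℝ) + 2 with hD
  have hD0 : 2 ≤ D := by rw [hD]; have : (0:ℝ) ≤ finrank ℝ E := by positivity
                         linarith
  set b := 2 * (D * C') with hb
  have hb0 : 0 ≤ b := by positivity
  set b2 := 2 * (D * (C + 2 * (C * b))) with hb2
  have hb20 : 0 ≤ b2 := by positivity
  set b3 := 2 * (D * (C' + 2 * (C' * b))) with hb3
  have hb30 : 0 ≤ b3 := by positivity
  set b4 := 2 * (D * b3) with hb4
  have hb40 : 0 ≤ b4 := by positivity
  refine ⟨min (min c c') (1 / (4 * D)), by positivity, ((min_le_left _ _).trans (min_le_left _ _)).trans hc1, C + b + b2 + (b4 + 2 * b4), by linarith, ?_⟩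
  intro e δ k2 k1 X2 X1 Z2 Z1 B2 B1 S2 S1 w he hδ hδc H2 H1 G2 G1 hw hk
  have hδ1 : δ ≤ c := hδc.trans ((min_le_left _ _).trans (min_le_left _ _))
  have hδ2 : δ ≤ c' := hδc.trans ((min_le_left _ _).trans (min_le_right _ _))
  have hδD : 4 * D * δ ≤ 1 := by
    have := hδc.trans (min_le_right _ _)
    rwa [le_div_iff₀ (by positivity), mul_comm] at this
  have p := P e δ k2 k1 X2 X1 Z2 Z1 w he hδ hδ1 H2 H1 hw hk
  have q2 := Q e δ k2 X2 Z2 he hδ hδ2 H2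
  have q1 := Q e δ k1 X1 Z1 he hδ hδ2 H1
  have hs : OB e R0 ⊆ OB e R1 := OB_mono hR.le
  have x2 : Nb γ X2 (OB e R0) δ := H2.xb.mono (OB_HB.trans (HB_mono hR.le)) le_rfl
  have x1 : Nb γ X1 (OB e R0) δ := H1.xb.mono (OB_HB.trans (HB_mono hR.le)) le_rfl
  have xd : Nb γ (fun y => X2 y - X1 y) (OB e R0) (C * w) := p.1.mono OB_HB le_rfl
  have E1 : ∀ {X Z : E → E} {B : E → E →L[ℝ] E} {T : E → E →L[ℝ] E →L[ℝ] E}, Geo e R1 X Z B T → Nb γ X (OB e R0) δ →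
      (∀ τ, ⟪e, τ⟫ = 0 → Nb γ (fun y => fderiv ℝ Z y τ) (OB e R0) (C' * ‖τ‖)) → Nb γ B (OB e R0) b := by
    intro X Z B T G hX hZ
    refine solve he hδ hδD (by linarith) hX (fun y hy => G.st y (hs hy)) (q := fun τ y => 0 - fderiv ℝ Z y τ)
      (fun τ hτ => (((Nb.zero le_rfl).sub (hZ τ hτ)).mono subset_rfl (by linarith))) fun τ hτ y hy => ?_
    rw [G.dz y (hs hy), map_add, map_smul]; abel
  have hB2 := E1 G2 x2 fun τ hτ => (q2 τ hτ).2.1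
  have hB1 := E1 G1 x1 fun τ hτ => (q1 τ hτ).2.1
  have hBd : Nb γ (fun y => B2 y - B1 y) (OB e R0) (b2 * w) := by
    refine (solve he hδ hδD (a := (C + 2 * (C * b)) * w) (by positivity) x2 (fun y hy => (G2.st y (hs hy)).sub (G1.st y (hs hy)))
      (q := fun τ y => 0 - (fderiv ℝ Z2 y τ - fderiv ℝ Z1 y τ) - ⟪X2 y - X1 y, τ⟫ • B1 y e) (fun τ hτ => ?_) fun τ hτ y hy => ?_).mono subset_rfl (le_of_eq (by rw [hb2]; ring))
    · have h1 := (xd.inn τ).bil (bilS E) (by positivity) (by positivity) (hB1.app e)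
      rw [he, mul_one] at h1
      exact (((Nb.zero le_rfl).sub (p.2.2 τ hτ)).sub h1).mono subset_rfl (le_of_eq (by ring))
    · rw [G2.dz y (hs hy), G1.dz y (hs hy)]
      simp only [map_add, map_smul, ContinuousLinearMap.sub_apply, inner_sub_left]
      module
  have sm : ∀ y ∈ OB e R0, DifferentiableAt ℝ X2 y := fun y hy => (H2.sm y (hy.1.trans hR) hy.2).1.differentiableAt two_ne_zero
  have hDB : ∀ ρ, ⟪e, ρ⟫ = 0 → Nb γ (fun y => fderiv ℝ B2 y ρ) (OB e R0) (b3 * ‖ρ‖) := by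
    intro ρ hρ
    refine (solve he hδ hδD (a := (C' + 2 * (C' * b)) * ‖ρ‖) (by positivity) x2 (fun y hy => ?_)
      (q := fun τ y => 0 - fderiv ℝ (fun z => fderiv ℝ Z2 z τ) y ρ - ⟪fderiv ℝ X2 y ρ, τ⟫ • B2 y e) (fun τ hτ => ?_) fun τ hτ y hy => ?_).mono subset_rfl (le_of_eq (by rw [hb3]; ring))
    · show ST (fderiv ℝ B2 y ρ)
      rw [(G2.db y (hs hy)).2]; exact (G2.ts y (hs hy)).2 _
    · have h1 := ((q2 ρ hρ).1.inn τ).bil (bilS E) (by positivity) (by positivity) (hB2.app e)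
      rw [he, mul_one] at h1
      exact (((Nb.zero le_rfl).sub ((q2 τ hτ).2.2 ρ hρ)).sub h1).mono subset_rfl (le_of_eq (by ring))
    · rw [ddz G2 (hs hy) (sm y hy)]
      simp only [map_add, map_smul]
      abel
  have hTe : Nb γ (fun y => S2 y e) (OB e R0) b4 := by
    refine solve he hδ hδD hb30 x2 (fun y hy => (G2.ts y (hs hy)).2 _) (q := fun τ y => fderiv ℝ B2 y τ e) (fun τ hτ => ?_) fun τ hτ y hy => ?_
    · have := (hDB τ hτ).app e
      rwa [he, mul_one] at this
    · rw [(G2.db y (hs hy)).2, map_add, map_smul, (G2.ts y (hs hy)).1 e τ]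
      simp only [ContinuousLinearMap.add_apply, ContinuousLinearMap.smul_apply]
      abel
  have hDn : Nb γ (fun y => fderiv ℝ B2 y e) (OB e R0) (b4 + 2 * b4) := by
    have h1 := (x2.inn e).bil (bilS _) (by positivity) hb40 hTe
    rw [he, mul_one] at h1
    have : δ * b4 ≤ b4 := mul_le_of_le_one_left hb40 (by linarith)
    refine ((hTe.add h1).mono subset_rfl (by linarith)).congr fun y hy => ?_
    rw [(G2.db y (hs hy)).2, map_add, map_smul]
  have l : ∀ s, 0 ≤ s → s ≤ C + b + b2 + (b4 + 2 * b4) → s * w ≤ (C + b + b2 + (b4 + 2 * b4)) * w := fun s h0 h1 => mul_le_mul_of_nonneg_right h1 hw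
  exact ⟨xd.mono subset_rfl (l _ (by linarith) (by linarith)), p.2.1.mono OB_HB (l _ (by linarith) (by linarith)), hBd.mono subset_rfl (l _ hb20 (by linarith)),
    hB2.mono subset_rfl (by linarith), hDn.mono subset_rfl (by linarith)⟩
end
end OP

namespace OP
open scoped RealInnerProductSpace Topology
open Module

section
variable {E : Type*} [NormedAddCommGroup E] [InnerProductSpace ℝ E] [FiniteDimensional ℝ E]
  [MeasurableSpace E] [BorelSpace E]


lemma Geo.mono {e : E} {R R' : ℝ} {X Z : E → E} {B : E → E →L[ℝ] E} {T : E → E →L[ℝ] E →L[ℝ] E} (G : Geo e R X Z B T) (h : R' ≤ R) : Geo e R' X Z B T :=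
  ⟨fun y hy => G.st y (OB_mono h hy), fun y hy => G.dz y (OB_mono h hy), fun y hy => G.db y (OB_mono h hy), fun y hy => G.ts y (OB_mono h hy)⟩

lemma Harm.st {h : E → ℝ} {g : E → E} {U : Set E} (hU : IsOpen U) (H : Harm h g U) {x : E} (hx : x ∈ U) : ST (fderiv ℝ g x) := by
  refine ⟨fun a b => ?_, H.tr_eq hx⟩
  have h1 := hasGradientAt_iff.1 ((H.dir hU b).grad hx)
  have hd : DifferentiableAt ℝ g x := (H.smooth hx).differentiableAt (by simp)
  have h2 : HasFDerivAt (fun z => ⟪g z, b⟫) _ x := hd.hasFDerivAt.inner ℝ (hasFDerivAt_const b x)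
  have h3 := congrArg (fun L => L a) (h1.unique h2)
  simp at h3
  rw [← h3, real_inner_comm]

lemma Harm.st2 {h : E → ℝ} {g : E → E} {U : Set E} (hU : IsOpen U) (H : Harm h g U) {x : E} (hx : x ∈ U) :
    DifferentiableAt ℝ (fderiv ℝ g) x ∧ (∀ a b, fderiv ℝ (fderiv ℝ g) x a b = fderiv ℝ (fderiv ℝ g) x b a) ∧ ∀ w, ST (fderiv ℝ (fderiv ℝ g) x w) := by
  have hs := H.smooth hx
  have hd : DifferentiableAt ℝ (fderiv ℝ g) x :=
    (hs.fderiv_right (m := 1) (by rw [one_add_one_eq_two]; exact two_le_top)).differentiableAt (by simp)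
  have hsy : ∀ a b, fderiv ℝ (fderiv ℝ g) x a b = fderiv ℝ (fderiv ℝ g) x b a := fun a b =>
    (hs.isSymmSndFDerivAt (by simpa using two_le_top)).eq a b
  refine ⟨hd, hsy, fun w => ?_⟩
  have h1 := (H.dir hU w).st hU hx
  have h2 : HasFDerivAt (fun z => fderiv ℝ g z w) _ x := hd.hasFDerivAt.clm_apply (hasFDerivAt_const w x)
  convert h1
  rw [h2.fderiv]
  ext a
  simp [hsy w a]

lemma geo {u k : E → ℝ} {G X Z : E → E} {e : E} {δ γ : ℝ} (S : Sol u G (ball 0 1)) (H : Hod e (7/10) δ γ k X Z) (hZ : ∀ y, Z y = e - G (y + k y • e))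
    (hl : ∀ y ∈ HB e (7/10), y + k y • e ∈ ball (0:E) (3/4) ∧ y + k y • e ∈ closure {x | 0 < u x} ∧ u (y + k y • e) = ⟪e, y⟫) :
    Geo e (7/10) X Z (fun y => fderiv ℝ G (y + k y • e)) (fun y => fderiv ℝ (fderiv ℝ G) (y + k y • e)) := by
  have hU : IsOpen (ball (0:E) 1 ∩ {x | 0 < u x}) := by
    refine isOpen_iff_mem_nhds.2 fun x hx => inter_mem (isOpen_ball.mem_nhds hx.1) ?_
    exact (S.cont x hx.1).eventually (lt_mem_nhds hx.2)
  have hm : ∀ y ∈ OB e (7/10), y + k y • e ∈ ball (0:E) 1 ∩ {x | 0 < u x} := fun y hy => by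
    obtain ⟨a, -, b⟩ := hl y (OB_HB hy)
    exact ⟨ball_subset_ball (by norm_num) a, show 0 < u _ by rw [b]; exact hy.2⟩
  have hS : ∀ y ∈ OB e (7/10), HasFDerivAt (fun y => y + k y • e) (ContinuousLinearMap.id ℝ E + (innerSL ℝ (X y)).smulRight e) y := fun y hy =>
    (hasFDerivAt_id y).add ((hasGradientAt_iff.1 (H.grad y hy.1 hy.2)).smul_const e)
  refine ⟨fun y hy => S.harm.st hU (hm y hy), fun y hy w => ?_, fun y hy => ?_, fun y hy => (S.harm.st2 hU (hm y hy)).2⟩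
  · have hd : DifferentiableAt ℝ G (y + k y • e) := (S.harm.smooth (hm y hy)).differentiableAt (by simp)
    have h1 := (HasFDerivAt.comp (g := G) y hd.hasFDerivAt (hS y hy)).const_sub e
    have h2 : Z = fun y => e - (G ∘ fun y => y + k y • e) y := by ext1 y; exact hZ y
    rw [h2, h1.fderiv]
    simp
  · have h1 := HasFDerivAt.comp (g := fderiv ℝ G) y (S.harm.st2 hU (hm y hy)).1.hasFDerivAt (hS y hy)
    refine ⟨h1.differentiableAt, fun w => ?_⟩
    have h2 : fderiv ℝ (fun y => fderiv ℝ G (y + k y • e)) y = _ := h1.fderiv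
    rw [h2]
    simp

/-- increments along the direction `e` -/
lemma line2 {W : Type*} [NormedAddCommGroup W] [NormedSpace ℝ W] {e : E} {R γ m r M t t' : ℝ} {f : E → W} (hm : 0 ≤ m) (hγ : 0 ≤ γ) (he : ‖e‖ = 1)
    (hf : ∀ y ∈ OB e R, DifferentiableAt ℝ f y) (hN : Nb γ (fun y => fderiv ℝ f y e) (OB e R) m) {y y' : E} (hy : y ∈ OB e R)
    (hy' : y' ∈ OB e R) (h2 : y + t • e ∈ OB e R) (h2' : y' + t' • e ∈ OB e R) (hr : ‖y - y'‖ ≤ r) (hr2 : ‖(y + t • e) - (y' + t' • e)‖ ≤ r)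
    (ht : |t'| ≤ M) : ‖f (y + t • e) - f y‖ ≤ m * |t| ∧ ‖(f (y + t • e) - f y) - (f (y' + t' • e) - f y')‖ ≤ m * |t - t'| + M * (m * r ^ γ) := by
  have seg : ∀ (y : E) (t s : ℝ), y ∈ OB e R → y + t • e ∈ OB e R → s ∈ Icc (0:ℝ) 1 → y + (s * t) • e ∈ OB e R := fun y t s h h' hs => by
    have := (OB_conv e R) h h' (sub_nonneg.2 hs.2) hs.1 (by ring)
    convert this using 1
    module
  have hd : ∀ (y : E) (t s : ℝ), y ∈ OB e R → y + t • e ∈ OB e R → s ∈ Icc (0:ℝ) 1 → HasDerivAt (fun s : ℝ => f (y + (s * t) • e)) (t • fderiv ℝ f (y + (s * t) • e) e) s := fun y t s h h' hs => by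
    have h1 : HasDerivAt (fun s : ℝ => y + (s * t) • e) (t • e) s := by
      have := (((hasDerivAt_id s).mul_const t).smul_const e).const_add y
      simpa using this
    have h3 := (hf _ (seg y t s h h' hs)).hasFDerivAt.comp_hasDerivAt s h1
    rw [map_smul] at h3
    exact h3
  constructor
  · have := norm_image_sub_le_of_norm_deriv_le_segment_01' (f := fun s : ℝ => f (y + (s * t) • e)) (C := m * |t|)
      (fun s hs => (hd y t s hy h2 hs).hasDerivWithinAt) (fun s hs => by
        rw [norm_smul, Real.norm_eq_abs, mul_comm]
        exact mul_le_mul_of_nonneg_right (hN.1 _ (seg y t s hy h2 (Ico_subset_Icc_self hs))) (abs_nonneg _))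
    simpa using this
  · have := norm_image_sub_le_of_norm_deriv_le_segment_01' (f := fun s : ℝ => f (y + (s * t) • e) - f (y' + (s * t') • e)) (C := m * |t - t'| + M * (m * r ^ γ))
      (fun s hs => ((hd y t s hy h2 hs).sub (hd y' t' s hy' h2' hs)).hasDerivWithinAt) (fun s hs => by
        have hs' := Ico_subset_Icc_self hs
        have m1 := seg y t s hy h2 hs'
        have m2 := seg y' t' s hy' h2' hs'
        have hdist : ‖(y + (s * t) • e) - (y' + (s * t') • e)‖ ≤ r := by
          have : (y + (s * t) • e) - (y' + (s * t') • e) = (1 - s) • (y - y') + s • ((y + t • e) - (y' + t' • e)) := by module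
          rw [this]
          refine (norm_add_le _ _).trans ?_
          rw [norm_smul, norm_smul, Real.norm_of_nonneg hs'.1, Real.norm_of_nonneg (sub_nonneg.2 hs'.2)]
          have a1 := mul_le_mul_of_nonneg_left hr (sub_nonneg.2 hs'.2)
          have a2 := mul_le_mul_of_nonneg_left hr2 hs'.1
          linarith
        have e1 : t • fderiv ℝ f (y + (s * t) • e) e - t' • fderiv ℝ f (y' + (s * t') • e) e =
          (t - t') • fderiv ℝ f (y + (s * t) • e) e + t' • (fderiv ℝ f (y + (s * t) • e) e - fderiv ℝ f (y' + (s * t') • e) e) := by module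
        rw [e1]
        refine (norm_add_le _ _).trans (add_le_add ?_ ?_)
        · rw [norm_smul, Real.norm_eq_abs, mul_comm]
          exact mul_le_mul_of_nonneg_right (hN.1 _ m1) (abs_nonneg _)
        · rw [norm_smul, Real.norm_eq_abs]
          refine mul_le_mul ht ((hN.2 _ m1 _ m2).trans ?_) (norm_nonneg _) ((abs_nonneg _).trans ht)
          exact mul_le_mul_of_nonneg_left (Real.rpow_le_rpow (norm_nonneg _) hdist hγ) hm)
    have e2 : ∀ a b c d : W, a - b - (c - d) = (a - c) - (b - d) := fun a b c d => by abel
    rw [e2]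
    simpa using this

end
end OP

namespace OP
open scoped RealInnerProductSpace Topology
open Module

section
variable {E : Type*} [NormedAddCommGroup E] [InnerProductSpace ℝ E] [FiniteDimensional ℝ E]
  [MeasurableSpace E] [BorelSpace E]


lemma PT {u : E → ℝ} {e : E} {ε r : ℝ} (he : ‖e‖ = 1) (hF : Flat u e (-ε) ε 0 1) (hr : r ≤ 1) {x : E} (hx : x ∈ ball (0:E) r) (hu : 0 < u x) :
    |u x - ⟪e, x⟫| ≤ ε ∧ x + (u x - ⟪e, x⟫) • e ∈ OB e (r + ε) := by
  obtain ⟨h1, h2⟩ := hF x (ball_subset_ball hr hx)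
  have h3 := (le_max_left _ _).trans h1
  have h4 : u x ≤ ⟪e, x⟫ + ε := by
    rcases le_max_iff.1 h2 with h | h
    · exact h
    · linarith
  have h5 : |u x - ⟪e, x⟫| ≤ ε := abs_le.2 ⟨by linarith, by linarith⟩
  refine ⟨h5, ?_, ?_⟩
  · rw [mem_ball_zero_iff] at hx
    refine (norm_add_le _ _).trans_lt ?_
    rw [norm_smul, he, mul_one, Real.norm_eq_abs]
    linarith
  · rw [inner_add_right, real_inner_smul_right, real_inner_self_eq_norm_sq, he]
    linarith

/-- data extracted from a flat solution by the hodograph transform -/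
structure HD (e : E) (ε δ γ : ℝ) (u : E → ℝ) (G : E → E) (k : E → ℝ) (X Z : E → E) : Prop where
  hod : Hod e (7/10) δ γ k X Z
  hz : ∀ y, Z y = e - G (y + k y • e)
  loc : ∀ y ∈ HB e (7/10), y + k y • e ∈ ball (0:E) (3/4) ∧ y + k y • e ∈ closure {x | 0 < u x} ∧ u (y + k y • e) = ⟪e, y⟫
  inv : ∀ x, ‖x‖ < 7/10 - ε → 0 < u x → x + (u x - ⟪e, x⟫) • e ∈ HB e (7/10) ∧ k (x + (u x - ⟪e, x⟫) • e) = ⟪e, x⟫ - u x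

lemma KD {e : E} {ε δ γ M : ℝ} {u1 u2 k1 k2 : E → ℝ} {G1 G2 X1 X2 Z1 Z2 : E → E} (he : ‖e‖ = 1) (hε : ε ≤ 1 / 1000) (hδ : δ ≤ 1)
    (hF : Flat u1 e (-ε) ε 0 1) (H1 : HD e ε δ γ u1 G1 k1 X1 Z1) (H2 : HD e ε δ γ u2 G2 k2 X2 Z2) (hle : ∀ x ∈ ball (0:E) 1, u1 x ≤ u2 x)
    (hM : ∀ x ∈ ball (0:E) 1, |u2 x - u1 x| ≤ M) : ∀ y ∈ HB e (69/100), |k2 y - k1 y| ≤ 2 * M := by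
  have hO : ∀ y ∈ OB e (69/100), |k2 y - k1 y| ≤ 2 * M := fun y hy => by
    have hy7 : y ∈ HB e (7/10) := OB_HB (OB_mono (by norm_num) hy)
    obtain ⟨a1, -, a3⟩ := H1.loc y hy7
    have hx1 : y + k1 y • e ∈ ball (0:E) 1 := ball_subset_ball (by norm_num) a1
    have hin : ⟪e, y + k1 y • e⟫ = ⟪e, y⟫ + k1 y := by
      rw [inner_add_right, real_inner_smul_right, real_inner_self_eq_norm_sq, he]; ring
    have hp : 0 < u1 (y + k1 y • e) := by rw [a3]; exact hy.2
    obtain ⟨b1, -⟩ := PT he hF le_rfl hx1 hp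
    rw [a3, hin] at b1
    have hn : ‖y + k1 y • e‖ < 7/10 - ε := by
      refine (norm_add_le _ _).trans_lt ?_
      rw [norm_smul, he, mul_one, Real.norm_eq_abs]
      have h1 := hy.1
      have : |k1 y| ≤ ε := by rw [← abs_neg]; convert b1 using 2; ring
      linarith
    obtain ⟨c1, c2⟩ := H2.inv _ hn (hp.trans_le (hle _ hx1))
    have hv := hM _ hx1
    rw [a3] at hv
    rw [hin] at c1 c2
    set v := u2 (y + k1 y • e) with hvd
    have e1 : y + k1 y • e + (v - (⟪e, y⟫ + k1 y)) • e = y + (v - ⟪e, y⟫) • e := by module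
    rw [e1] at c1 c2
    have l1 := H2.hod.lip y hy7 _ c1
    have e2 : ‖y - (y + (v - ⟪e, y⟫) • e)‖ = |v - ⟪e, y⟫| := by
      rw [sub_add_cancel_left, norm_neg, norm_smul, he, mul_one, Real.norm_eq_abs]
    rw [e2, c2] at l1
    have l2 : δ * |v - ⟪e, y⟫| ≤ 1 * |v - ⟪e, y⟫| := mul_le_mul_of_nonneg_right hδ (abs_nonneg _)
    have e3 : k2 y - k1 y = (k2 y - (⟪e, y⟫ + k1 y - v)) + -(v - ⟪e, y⟫) := by ring
    rw [e3]
    refine (abs_add_le _ _).trans ?_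
    rw [abs_neg]
    linarith
  intro y hy
  have hc : ContinuousOn (fun y => |k2 y - k1 y|) (HB e (69/100)) :=
    ((H2.hod.mono (by norm_num)).kcont.sub (H1.hod.mono (by norm_num)).kcont).abs
  obtain ⟨t1, t2⟩ := tend_up he hc hy
  refine le_of_tendsto t1 ?_
  filter_upwards [t2] with t ht using hO _ ht

lemma lip2 {e : E} (he : ‖e‖ = 1) {δ a a' : ℝ} (hδ : δ ≤ 1 / 2) {x x' y y' : E} (h : y = x + a • e) (h' : y' = x' + a' • e) (hl : |a - a'| ≤ δ * ‖y - y'‖) : ‖y - y'‖ ≤ 2 * ‖x - x'‖ := by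
  have e1 : y - y' = (x - x') + (a - a') • e := by rw [h, h']; module
  have h1 : ‖y - y'‖ ≤ ‖x - x'‖ + |a - a'| := by
    conv_lhs => rw [e1]
    refine (norm_add_le _ _).trans ?_
    rw [norm_smul, he, mul_one, Real.norm_eq_abs]
  have := mul_le_mul_of_nonneg_right hδ (norm_nonneg (y - y'))
  linarith

theorem FIN (E : Type*) [NormedAddCommGroup E] [InnerProductSpace ℝ E] [FiniteDimensional ℝ E] [MeasurableSpace E] [BorelSpace E] [Nontrivial E] :
    ∃ ε ∈ Ioo (0:ℝ) 1, ∃ γ ∈ Ioo (0:ℝ) 1, ∃ C ≥ 1, ∀ (u1 u2 : E → ℝ) (G1 G2 : E → E) (e : E) (M : ℝ), ‖e‖ = 1 → Sol u1 G1 (ball 0 1) → Sol u2 G2 (ball 0 1) →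
      Flat u1 e (-ε) ε 0 1 → Flat u2 e (-ε) ε 0 1 → (∀ x ∈ ball (0:E) 1, u1 x ≤ u2 x) → (∀ x ∈ ball (0:E) 1, |u2 x - u1 x| ≤ M) →
      ∀ x ∈ ball (0:E) (1/2), 0 < u1 x → ‖G2 x - G1 x‖ ≤ C * M ∧ ‖fderiv ℝ G2 x - fderiv ℝ G1 x‖ ≤ C * M ∧
        ∀ x' ∈ ball (0:E) (1/2), 0 < u1 x' → ‖(fderiv ℝ G2 x - fderiv ℝ G1 x) - (fderiv ℝ G2 x' - fderiv ℝ G1 x')‖ ≤ C * M * ‖x - x'‖ ^ γ := by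
  obtain ⟨γ, hγ, CH, hCH, ε0, hε0, HH⟩ := HOL (E := E)
  obtain ⟨c, hc, hc1, C, hC, HT⟩ := T3 E hγ.1 hγ.2 (R0 := 6/10) (R1 := 69/100) (by norm_num) (by norm_num) (by norm_num)
  set ε := min ε0 (min (1/1000) (c / (4 * CH))) with hεd
  have hCH0 : 0 < CH := by linarith
  have hε : 0 < ε := by positivity
  have hεa : ε ≤ ε0 := min_le_left _ _
  have hεb : ε ≤ 1 / 1000 := (min_le_right _ _).trans (min_le_left _ _)
  have hεc : ε ≤ c / (4 * CH) := (min_le_right _ _).trans (min_le_right _ _)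
  rw [le_div_iff₀ (by positivity)] at hεc
  have hδc : 4 * (CH * ε) ≤ c := by linarith
  have hεδ : ε ≤ CH * ε := le_mul_of_one_le_left hε.le hCH
  have key : ∀ (u : E → ℝ) (G : E → E) (e : E), ‖e‖ = 1 → Sol u G (ball 0 1) → Flat u e (-ε) ε 0 1 → ∃ (k : E → ℝ) (X Z : E → E), HD e ε (4 * (CH * ε)) γ u G k X Z := by
    intro u G e he S hF
    have h := HH u G e ε hε hεa he S hF
    obtain ⟨k, X, Z, a, b, c', d⟩ := HodAux he hγ.1 hγ.2.le hε hεδ (by linarith) S hF (fun x hx hx' => (h x hx hx').1) (fun x hx hx' y hy hy' => (h x hx hx').2 y hy hy')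
    exact ⟨k, X, Z, a, b, c', d⟩
  set δ := 4 * (CH * ε) with hδd
  have hδ0 : 0 ≤ δ := by positivity
  refine ⟨ε, ⟨hε, by linarith⟩, γ, hγ, 16 * C ^ 2, by nlinarith, ?_⟩
  clear_value δ ε
  intro u1 u2 G1 G2 e M he S1 S2 F1 F2 hle hM
  obtain ⟨k1, X1, Z1, H1⟩ := key u1 G1 e he S1 F1
  obtain ⟨k2, X2, Z2, H2⟩ := key u2 G2 e he S2 F2
  have hM0 : 0 ≤ M := (abs_nonneg _).trans (hM 0 (by simp))
  have hkd := KD he hεb (by linarith) F1 H1 H2 hle hM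
  have A2 := (geo S2 H2.hod H2.hz H2.loc).mono (R' := 69/100) (by norm_num)
  have A1 := (geo S1 H1.hod H1.hz H1.loc).mono (R' := 69/100) (by norm_num)
  obtain ⟨nX, nZ, nB, nB2, nD⟩ := HT e δ k2 k1 X2 X1 Z2 Z1 _ _ _ _ (2 * M) he hδ0 hδc (H2.hod.mono (by norm_num)) (H1.hod.mono (by norm_num)) A2 A1 (by positivity) hkd
  set B2 := fun y => fderiv ℝ G2 (y + k2 y • e) with hB2
  set B1 := fun y => fderiv ℝ G1 (y + k1 y • e) with hB1
  have hO : OB e (6/10) ⊆ OB e (69/100) := OB_mono (by norm_num)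
  have hO7 : OB e (6/10) ⊆ OB e (7/10) := OB_mono (by norm_num)
  have pts : ∀ x ∈ ball (0:E) (1/2), 0 < u1 x → ∃ (y : E) (t : ℝ), y = x + (-k1 y) • e ∧ y + t • e = x + (-k2 (y + t • e)) • e ∧ y ∈ OB e (6/10) ∧ y + t • e ∈ OB e (6/10) ∧
      |t| ≤ M ∧ t = k1 y - k2 (y + t • e) ∧ G2 x = e - Z2 (y + t • e) ∧ G1 x = e - Z1 y ∧ fderiv ℝ G2 x = B2 (y + t • e) ∧ fderiv ℝ G1 x = B1 y := by
    intro x hx hu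
    have hx1 : x ∈ ball (0:E) 1 := ball_subset_ball (by norm_num) hx
    have hu2 := hu.trans_le (hle x hx1)
    have hxn : ‖x‖ < 7/10 - ε := by rw [mem_ball_zero_iff] at hx; linarith
    have p1 := (PT he F1 (by norm_num) hx hu).2
    have p2 := (PT he F2 (by norm_num) hx hu2).2
    have i1 := (H1.inv x hxn hu).2
    have i2 := (H2.inv x hxn hu2).2
    have ey : x + (u1 x - ⟪e, x⟫) • e + (u2 x - u1 x) • e = x + (u2 x - ⟪e, x⟫) • e := by module
    have s1 : x + (u1 x - ⟪e, x⟫) • e + (⟪e, x⟫ - u1 x) • e = x := by module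
    have s2 : x + (u2 x - ⟪e, x⟫) • e + (⟪e, x⟫ - u2 x) • e = x := by module
    refine ⟨x + (u1 x - ⟪e, x⟫) • e, u2 x - u1 x, ?_⟩
    simp only [ey, i1, i2, H1.hz, H2.hz, hB1, hB2, s1, s2, neg_sub, sub_sub_cancel, true_and, and_true]
    refine ⟨OB_mono (by linarith) p1, OB_mono (by linarith) p2, hM x hx1, by ring, (_root_.sub_sub_cancel _ _).symm, (_root_.sub_sub_cancel _ _).symm⟩
  have hZl : ∀ y ∈ OB e (6/10), ∀ y2 ∈ OB e (6/10), ‖Z2 y2 - Z2 y‖ ≤ 2 * C * ‖y2 - y‖ := by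
    intro y hy y2 hy2
    refine (OB_conv e (6/10)).norm_image_sub_le_of_norm_fderiv_le (𝕜 := ℝ) (fun z hz => (H2.hod.sm z (hO7 hz).1 hz.2).2.differentiableAt (by simp)) (fun z hz => ?_) hy hy2
    refine ContinuousLinearMap.opNorm_le_bound _ (by positivity) fun w => ?_
    rw [A2.dz z (hO hz) w, norm_neg]
    refine ((B2 z).le_of_opNorm_le (nB2.1 z hz) _).trans ?_
    rw [mul_comm 2 C, mul_assoc]
    refine mul_le_mul_of_nonneg_left ((norm_add_le _ _).trans ?_) (by linarith)
    rw [norm_smul, he, mul_one]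
    have h1 := (norm_inner_le_norm (𝕜 := ℝ) (X2 z) w).trans (mul_le_mul_of_nonneg_right (H2.hod.xb.1 z (OB_HB (hO7 hz))) (norm_nonneg w))
    have h2 := mul_le_mul_of_nonneg_right (show δ ≤ 1 by linarith) (norm_nonneg w)
    linarith
  intro x hx hu
  obtain ⟨y, t, q1, q2, q3, q4, q5, q6, q7, q8, q9, q10⟩ := pts x hx hu
  have hB2d : ∀ y ∈ OB e (6/10), DifferentiableAt ℝ B2 y := fun z hz => (A2.db z (hO hz)).1
  have hγ0 := hγ.1.le
  have hCM : C * M ≤ C ^ 2 * M := by rw [pow_two]; exact mul_le_mul_of_nonneg_right (le_mul_of_one_le_left (by linarith) hC) hM0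
  have hCM0 : 0 ≤ C * M := by positivity
  refine ⟨?_, ?_, fun x' hx' hu' => ?_⟩
  · have e1 : G2 x - G1 x = -(Z2 y - Z1 y) - (Z2 (y + t • e) - Z2 y) := by rw [q7, q8]; abel
    rw [e1]
    have h1 := hZl y q3 _ q4
    rw [add_sub_cancel_left, norm_smul, he, mul_one, Real.norm_eq_abs] at h1
    have h2 := nZ.1 y q3
    have h3 := mul_le_mul_of_nonneg_left q5 (show 0 ≤ 2 * C by linarith)
    refine (norm_sub_le _ _).trans ?_
    rw [norm_neg]
    linarith
  · have e1 : fderiv ℝ G2 x - fderiv ℝ G1 x = (B2 y - B1 y) + (B2 (y + t • e) - B2 y) := by rw [q9, q10]; abel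
    rw [e1]
    have h1 := (line2 (by linarith) hγ0 he hB2d nD q3 q3 q4 q4 (r := 0) (by simp) (by simp) q5).1
    have h2 := nB.1 y q3
    have h3 := mul_le_mul_of_nonneg_left q5 (show 0 ≤ C by linarith)
    refine (norm_add_le _ _).trans ?_
    linarith
  · obtain ⟨y', t', q1', q2', q3', q4', q5', q6', q7', q8', q9', q10'⟩ := pts x' hx' hu'
    have hr1 : ‖y - y'‖ ≤ 2 * ‖x - x'‖ := by
      refine lip2 he (by linarith) q1 q1' (δ := δ) ?_
      have := H1.hod.lip y (OB_HB (hO7 q3)) y' (OB_HB (hO7 q3'))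
      rwa [← neg_sub', abs_neg]
    have hr2 : ‖(y + t • e) - (y' + t' • e)‖ ≤ 2 * ‖x - x'‖ := by
      refine lip2 he (by linarith) q2 q2' (δ := δ) ?_
      have := H2.hod.lip _ (OB_HB (hO7 q4)) _ (OB_HB (hO7 q4'))
      rwa [← neg_sub', abs_neg]
    set s := ‖x - x'‖ with hs
    have hs0 : 0 ≤ s := norm_nonneg _
    have hs1 : s ≤ 1 := by
      rw [mem_ball_zero_iff] at hx hx'
      have := norm_sub_le x x'
      linarith
    have hsγ := le_rp hs0 hs1 hγ.1 hγ.2.le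
    have hrγ : (2 * s) ^ γ ≤ 2 * s ^ γ := rp_le (by norm_num) hs0 hγ.2.le
    have hp0 : 0 ≤ s ^ γ := Real.rpow_nonneg hs0 _
    set p := s ^ γ with hp
    have L1 := (line2 (by linarith) hγ0 he hB2d nD q3 q3' q4 q4' hr1 hr2 q5').2
    have hgk : ∀ z ∈ OB e (6/10), HasGradientAt k2 (X2 z) z := fun z hz => H2.hod.grad z (hO7 hz).1 hz.2
    have nK : Nb γ (fun y => fderiv ℝ k2 y e) (OB e (6/10)) δ := by
      have := (H2.hod.xb.mono (OB_HB.trans (HB_mono (r' := 7/10) (by norm_num)) : OB e (6/10) ⊆ _) le_rfl).inn e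
      rw [he, mul_one] at this
      refine this.congr fun z hz => ?_
      rw [(hasGradientAt_iff.1 (hgk z hz)).fderiv, innerSL_apply_apply]
    have L2 := (line2 hδ0 hγ0 he (fun z hz => (hgk z hz).differentiableAt) nK q3 q3' q4 q4' hr1 hr2 q5').2
    have L3 := lipOB (W := fun z => k2 z - k1 z) (Y := fun z => X2 z - X1 z) (R := 6/10) (e := e) (fun z hz => by
      have := (hasGradientAt_iff.1 (hgk z hz)).sub (hasGradientAt_iff.1 (H1.hod.grad z (hO7 hz).1 hz.2))
      rw [hasGradientAt_iff, map_sub]; exact this) nX.1 q3 q3'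
    have ett : t - t' = -((k2 y - k1 y) - (k2 y' - k1 y')) - ((k2 (y + t • e) - k2 y) - (k2 (y' + t' • e) - k2 y')) := by
      linear_combination q6 - q6'
    have hδ2 : δ ≤ 1 / 2 := by linarith
    have htt : |t - t'| ≤ 10 * (C * M) * p := by
      have a1 : |t - t'| ≤ C * (2 * M) * ‖y - y'‖ + (δ * |t - t'| + M * (δ * (2 * s) ^ γ)) := by
        conv_lhs => rw [ett]
        refine (abs_sub _ _).trans (add_le_add ?_ L2)
        rw [abs_neg]; exact L3
      have a2 : C * (2 * M) * ‖y - y'‖ ≤ C * (2 * M) * (2 * p) := mul_le_mul_of_nonneg_left (by linarith) (by positivity)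
      have a3 : δ * |t - t'| ≤ 1 / 2 * |t - t'| := mul_le_mul_of_nonneg_right hδ2 (abs_nonneg _)
      have a4 : M * (δ * (2 * s) ^ γ) ≤ M * (1 / 2 * (2 * p)) := by gcongr
      have a5 : M * p ≤ C * M * p := mul_le_mul_of_nonneg_right (le_mul_of_one_le_left hM0 hC) hp0
      linarith
    have e1 : (fderiv ℝ G2 x - fderiv ℝ G1 x) - (fderiv ℝ G2 x' - fderiv ℝ G1 x') =
      ((B2 y - B1 y) - (B2 y' - B1 y')) + ((B2 (y + t • e) - B2 y) - (B2 (y' + t' • e) - B2 y')) := by rw [q9, q10, q9', q10']; abel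
    rw [e1]
    have b1 : ‖(B2 y - B1 y) - (B2 y' - B1 y')‖ ≤ C * (2 * M) * (2 * p) :=
      (nB.2 y q3 y' q3').trans (mul_le_mul_of_nonneg_left ((Real.rpow_le_rpow (norm_nonneg _) hr1 hγ0).trans hrγ) (by positivity))
    have b2 : C * |t - t'| ≤ C * (10 * (C * M) * p) := mul_le_mul_of_nonneg_left htt (by linarith)
    have b3 : M * (C * (2 * s) ^ γ) ≤ M * (C * (2 * p)) := by gcongr
    have b4 := mul_le_mul_of_nonneg_right hCM hp0
    refine (norm_add_le _ _).trans ?_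
    have b5 : 16 * C ^ 2 * M * p = 16 * (C ^ 2 * M * p) := by ring
    have b6 : C * (10 * (C * M) * p) = 10 * (C ^ 2 * M * p) := by ring
    have b7 : C * (2 * M) * (2 * p) = 4 * (C * M * p) := by ring
    have b8 : M * (C * (2 * p)) = 2 * (C * M * p) := by ring
    linarith

end
end OP

namespace OP
open scoped RealInnerProductSpace Topology
open Module

section
variable {E : Type*} [NormedAddCommGroup E] [InnerProductSpace ℝ E] [FiniteDimensional ℝ E]
  [MeasurableSpace E] [BorelSpace E]


lemma toSol {n : ℕ} {u : EuclideanSpace ℝ (Fin n) → ℝ} (h : OnePhaseSolution u) : ∃ G, Sol u G (ball 0 1) := by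
  obtain ⟨h1, h2, h3, h4, G, g1, g2, g3⟩ := h
  have hc : ∀ x ∈ ball (0 : EuclideanSpace ℝ (Fin n)) 1, ContinuousAt u x := fun x hx => h1.continuousAt (isOpen_ball.mem_nhds hx)
  have hU : IsOpen (ball (0 : EuclideanSpace ℝ (Fin n)) 1 ∩ {x | 0 < u x}) :=
    isOpen_iff_mem_nhds.2 fun x hx => inter_mem (isOpen_ball.mem_nhds hx.1) ((hc x hx.1).eventually (lt_mem_nhds hx.2))
  refine ⟨G, isOpen_ball, hc, h2, fun x hx => ?_, fun x hx hx' => ?_, fun x hx hx' h0 => g3 x ⟨hx, hx', fun hi => ?_⟩⟩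
  · have hs : ∀ y ∈ ball (0 : EuclideanSpace ℝ (Fin n)) 1 ∩ {x | 0 < u x}, ContDiffAt ℝ (⊤ : ℕ∞) u y := fun y hy => h3.contDiffAt (hU.mem_nhds hy)
    have hgr : ∀ y ∈ ball (0 : EuclideanSpace ℝ (Fin n)) 1 ∩ {x | 0 < u x}, HasGradientAt u (G y) y := fun y hy => by
      rw [g2 y hy]
      exact ((hs y hy).differentiableAt (by simp)).hasGradientAt
    have hev : ∀ᶠ y in 𝓝 x, HasGradientAt u (G y) y := by filter_upwards [hU.mem_nhds hx] with y hy using hgr y hy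
    have hd : DifferentiableAt ℝ G x := (contDiffAt_gradient (hs x hx) hev).differentiableAt (by simp)
    refine ⟨hs x hx, fderiv ℝ G x, ⟨hev, hd.hasFDerivAt⟩, ?_⟩
    rw [tr_eq_sum (EuclideanSpace.basisFun (Fin n) ℝ), ← h4 x hx, lap]
    refine Finset.sum_congr rfl fun i _ => ?_
    rw [EuclideanSpace.basisFun_apply]
    have e1 : (fun y => fderiv ℝ u y (EuclideanSpace.single i 1)) =ᶠ[𝓝 x] fun y => ⟪G y, EuclideanSpace.single i 1⟫ := by
      filter_upwards [hev] with y hy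
      rw [(hasGradientAt_iff.1 hy).fderiv, innerSL_apply_apply]
    have e2 : HasFDerivAt (fun y => ⟪G y, EuclideanSpace.single i (1:ℝ)⟫) _ x := hd.hasFDerivAt.inner ℝ (hasFDerivAt_const (EuclideanSpace.single i (1:ℝ)) x)
    rw [e1.fderiv_eq, e2.fderiv]
    simp only [ContinuousLinearMap.comp_apply, ContinuousLinearMap.prod_apply, ContinuousLinearMap.zero_apply, fderivInnerCLM_apply, inner_zero_right, zero_add]
    exact real_inner_comm _ _
  · have := g1 x ⟨hx, hx'⟩
    rw [inter_comm] at this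
    exact (continuousWithinAt_inter (isOpen_ball.mem_nhds hx)).1 this
  · have := interior_subset hi
    exact absurd this (by simp [h0])

end
end OP

/-- `C^{2,α}` bound for the difference of nearby solutions
(part of Proposition 5.1), with `M = sup_{B₁} |u₂ - u₁|`. -/
theorem stmt18 (n : ℕ) (hn : 2 ≤ n) :
    ∃ ε₁ ∈ Set.Ioo (0 : ℝ) 1, ∃ α ∈ Set.Ioo (0 : ℝ) 1, ∃ C : ℝ, 0 < C ∧
      ∀ u₁ u₂ : EuclideanSpace ℝ (Fin n) → ℝ,
        OnePhaseSolution u₁ → OnePhaseSolution u₂ →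
        (∀ x ∈ Metric.ball (0 : EuclideanSpace ℝ (Fin n)) 1,
          max (x ⟨n - 1, by omega⟩ - ε₁) 0 ≤ u₁ x ∧ u₁ x ≤ u₂ x ∧
            u₂ x ≤ max (x ⟨n - 1, by omega⟩ + ε₁) 0) →
        ContDiffOn ℝ 2 (fun x => u₂ x - u₁ x)
          (Metric.ball (0 : EuclideanSpace ℝ (Fin n)) (1 / 2) ∩ {x | 0 < u₁ x}) ∧
        ∀ x ∈ Metric.ball (0 : EuclideanSpace ℝ (Fin n)) (1 / 2) ∩ {x | 0 < u₁ x},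
          ∀ y ∈ Metric.ball (0 : EuclideanSpace ℝ (Fin n)) (1 / 2) ∩ {x | 0 < u₁ x},
            x ≠ y →
            |u₂ x - u₁ x| ≤
                C * sSup ((fun z => |u₂ z - u₁ z|) ''
                  Metric.ball (0 : EuclideanSpace ℝ (Fin n)) 1) ∧
            ‖fderiv ℝ (fun z => u₂ z - u₁ z) x‖ ≤
                C * sSup ((fun z => |u₂ z - u₁ z|) ''
                  Metric.ball (0 : EuclideanSpace ℝ (Fin n)) 1) ∧
            ‖fderiv ℝ (fderiv ℝ (fun z => u₂ z - u₁ z)) x‖ ≤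
                C * sSup ((fun z => |u₂ z - u₁ z|) ''
                  Metric.ball (0 : EuclideanSpace ℝ (Fin n)) 1) ∧
            ‖fderiv ℝ (fderiv ℝ (fun z => u₂ z - u₁ z)) x -
                fderiv ℝ (fderiv ℝ (fun z => u₂ z - u₁ z)) y‖ ≤
                C * sSup ((fun z => |u₂ z - u₁ z|) ''
                  Metric.ball (0 : EuclideanSpace ℝ (Fin n)) 1) * ‖x - y‖ ^ α := by
  haveI : Nonempty (Fin n) := ⟨⟨n - 1, by omega⟩⟩
  obtain ⟨ε, hε, γ, hγ, C, hC, H⟩ := OP.FIN (EuclideanSpace ℝ (Fin n))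
  refine ⟨ε, hε, γ, hγ, C, by linarith, fun u₁ u₂ h₁ h₂ hF => ?_⟩
  obtain ⟨G₁, S₁⟩ := OP.toSol h₁
  obtain ⟨G₂, S₂⟩ := OP.toSol h₂
  set e : EuclideanSpace ℝ (Fin n) := EuclideanSpace.single ⟨n - 1, by omega⟩ 1 with hedef
  have he : ‖e‖ = 1 := by rw [hedef, EuclideanSpace.norm_single]; simp
  have hex : ∀ x : EuclideanSpace ℝ (Fin n), inner ℝ e x = x ⟨n - 1, by omega⟩ := fun x => by
    rw [hedef, EuclideanSpace.inner_single_left]; simp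
  set M := sSup ((fun z => |u₂ z - u₁ z|) '' Metric.ball (0 : EuclideanSpace ℝ (Fin n)) 1) with hMdef
  have hM : ∀ x ∈ Metric.ball (0 : EuclideanSpace ℝ (Fin n)) 1, |u₂ x - u₁ x| ≤ M := by
    intro x hx
    refine le_csSup ⟨2, ?_⟩ (mem_image_of_mem _ hx)
    rintro _ ⟨z, hz, rfl⟩
    obtain ⟨a, b, c⟩ := hF z hz
    have h0 := S₁.nonneg z hz
    have h3 : z ⟨n - 1, by omega⟩ ≤ 1 := by
      rw [← hex]
      refine (real_inner_le_norm _ _).trans ?_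
      rw [mem_ball_zero_iff] at hz
      rw [he]; linarith
    have h4 : u₂ z ≤ 2 := c.trans (max_le (by linarith [hε.2]) (by norm_num))
    show |u₂ z - u₁ z| ≤ 2
    rw [abs_of_nonneg (by linarith)]
    linarith
  have hle : ∀ x ∈ Metric.ball (0 : EuclideanSpace ℝ (Fin n)) 1, u₁ x ≤ u₂ x := fun x hx => (hF x hx).2.1
  have hsub : Metric.ball (0 : EuclideanSpace ℝ (Fin n)) (1/2) ⊆ Metric.ball 0 1 := Metric.ball_subset_ball (by norm_num)
  have K := H u₁ u₂ G₁ G₂ e M he S₁ S₂ (fun x hx => by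
      obtain ⟨a, b, c⟩ := hF x hx
      rw [hex, ← sub_eq_add_neg]; exact ⟨a, b.trans c⟩) (fun x hx => by
      obtain ⟨a, b, c⟩ := hF x hx
      rw [hex, ← sub_eq_add_neg]; exact ⟨a.trans b, c⟩) hle hM
  have hm₁ : ∀ x ∈ Metric.ball (0 : EuclideanSpace ℝ (Fin n)) (1/2) ∩ {x | 0 < u₁ x}, x ∈ Metric.ball (0 : EuclideanSpace ℝ (Fin n)) 1 ∩ {x | 0 < u₁ x} :=
    fun x hx => ⟨hsub hx.1, hx.2⟩
  have hm₂ : ∀ x ∈ Metric.ball (0 : EuclideanSpace ℝ (Fin n)) (1/2) ∩ {x | 0 < u₁ x}, x ∈ Metric.ball (0 : EuclideanSpace ℝ (Fin n)) 1 ∩ {x | 0 < u₂ x} :=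
    fun x hx => ⟨hsub hx.1, lt_of_lt_of_le hx.2 (hle x (hsub hx.1))⟩
  have hU : IsOpen (Metric.ball (0 : EuclideanSpace ℝ (Fin n)) (1/2) ∩ {x | 0 < u₁ x}) :=
    isOpen_iff_mem_nhds.2 fun x hx => inter_mem (isOpen_ball.mem_nhds hx.1) ((S₁.cont x (hsub hx.1)).eventually (lt_mem_nhds hx.2))
  have d1 : ∀ x ∈ Metric.ball (0 : EuclideanSpace ℝ (Fin n)) (1/2) ∩ {x | 0 < u₁ x}, fderiv ℝ (fun z => u₂ z - u₁ z) x = innerSL ℝ (G₂ x - G₁ x) := by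
    intro x hx
    have h := (OP.hasGradientAt_iff.1 (S₂.harm.grad (hm₂ x hx))).sub (OP.hasGradientAt_iff.1 (S₁.harm.grad (hm₁ x hx)))
    rw [map_sub]
    exact h.fderiv
  have d2 : ∀ x ∈ Metric.ball (0 : EuclideanSpace ℝ (Fin n)) (1/2) ∩ {x | 0 < u₁ x}, fderiv ℝ (fderiv ℝ (fun z => u₂ z - u₁ z)) x =
      (innerSL ℝ).comp (fderiv ℝ G₂ x - fderiv ℝ G₁ x) := by
    intro x hx
    have e1 : fderiv ℝ (fun z => u₂ z - u₁ z) =ᶠ[nhds x] fun z => innerSL ℝ (G₂ z - G₁ z) := by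
      filter_upwards [hU.mem_nhds hx] with z hz using d1 z hz
    rw [e1.fderiv_eq]
    have g₂ : DifferentiableAt ℝ G₂ x := (S₂.harm.smooth (hm₂ x hx)).differentiableAt (by simp)
    have g₁ : DifferentiableAt ℝ G₁ x := (S₁.harm.smooth (hm₁ x hx)).differentiableAt (by simp)
    exact ((innerSL ℝ (E := EuclideanSpace ℝ (Fin n))).hasFDerivAt.comp x (g₂.hasFDerivAt.sub g₁.hasFDerivAt)).fderiv
  have nrm : ∀ B : EuclideanSpace ℝ (Fin n) →L[ℝ] EuclideanSpace ℝ (Fin n), ‖(innerSL ℝ (E := EuclideanSpace ℝ (Fin n))).comp B‖ ≤ ‖B‖ := fun B =>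
    ContinuousLinearMap.opNorm_le_bound _ (norm_nonneg _) fun w => by
      rw [ContinuousLinearMap.comp_apply, innerSL_apply_norm]; exact B.le_opNorm w
  refine ⟨fun x hx => ?_, fun x hx y hy _ => ?_⟩
  · exact (((S₂.harm x (hm₂ x hx)).1.of_le OP.two_le_top).sub ((S₁.harm x (hm₁ x hx)).1.of_le OP.two_le_top)).contDiffWithinAt
  · obtain ⟨k1, k2, k3⟩ := K x hx.1 hx.2
    have hx1 := hM x (hsub hx.1)
    refine ⟨hx1.trans (le_mul_of_one_le_left ((abs_nonneg _).trans hx1) hC), ?_, ?_, ?_⟩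
    · rw [d1 x hx, innerSL_apply_norm]; exact k1
    · rw [d2 x hx]; exact (nrm _).trans k2
    · rw [d2 x hx, d2 y hy, ← ContinuousLinearMap.comp_sub]
      exact (nrm _).trans (k3 y hy.1 hy.2)
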